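/- Main technical estimate, the boundary-strip gradient bound (estimate (3.10)/(4.17) of the paper): Let Ω ⊂ ℝ³ be a convex polyhedron, c > 0, and r ≥ 1 an integer. There exist constants C > 0 and h₀ > 0 (depending only on Ω, c and r) such that for every h ∈ (0, h₀], every tetrahedral partition 𝔗 of Ω with mesh size h and quasi-uniformity constant c, every x₀ ∈ closure(Ω), every ρ with h ≤ ρ ≤ diam(Ω), and every φ, v, v_h as in the context, one has ∫_{Λ_h} |∇(v − v_h)| dx ≤ C ρ^{3/2} h, where Λ_h = {x ∈ Ω : dist(x, ∂Ω) ≤ h}. -/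

import Mathlib

open MeasureTheory Metric Set
open scoped RealInnerProductSpace ENNReal NNReal

noncomputable section

/-- Three-dimensional Euclidean space. -/
abbrev E3 : Type := EuclideanSpace ℝ (Fin 3)

/-- A convex polyhedron: a bounded convex open set which is the interior of the
convex hull of a finite set of points. -/
def IsConvexPolyhedron (Ω : Set E3) : Prop :=
  IsOpen Ω ∧ Bornology.IsBounded Ω ∧ Convex ℝ Ω ∧
    ∃ S : Finset E3, Ω = interior (convexHull ℝ (S : Set E3))

/-- The closed tetrahedron with vertices `v 0, v 1, v 2, v 3`. -/
def tet (v : Fin 4 → E3) : Set E3 := convexHull ℝ (Set.range v)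

/-- A quasi-uniform conforming tetrahedral partition of `Ω` with mesh size `h`
and quasi-uniformity constant `c`, recorded by the vertex tuples of its tetrahedra. -/
def IsTetPartition (Ω : Set E3) (T : Finset (Fin 4 → E3)) (h c : ℝ) : Prop :=
  (∀ v ∈ T, AffineIndependent ℝ v) ∧
  (⋃ v ∈ T, tet v) = closure Ω ∧
  (∀ v ∈ T, ∀ w ∈ T, tet v ≠ tet w → interior (tet v) ∩ interior (tet w) = ∅) ∧
  (∀ v ∈ T, ∀ w ∈ T, tet v ≠ tet w →
    tet v ∩ tet w = ∅ ∨ tet v ∩ tet w = convexHull ℝ (Set.range v ∩ Set.range w)) ∧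
  (∀ v ∈ T, Metric.diam (tet v) ≤ h) ∧
  (∀ v ∈ T, ∃ x : E3, Metric.closedBall x (c * h) ⊆ tet v)

/-- The finite element space `S_h` of continuous piecewise polynomials of degree `≤ r`. -/
def MemSh (Ω : Set E3) (T : Finset (Fin 4 → E3)) (r : ℕ) (u : E3 → ℝ) : Prop :=
  ContinuousOn u (closure Ω) ∧
  ∀ v ∈ T, ∃ p : MvPolynomial (Fin 3) ℝ,
    p.totalDegree ≤ r ∧ ∀ x ∈ tet v, u x = MvPolynomial.eval (fun i => x i) p

/-- The subspace `S̊_h` of finite element functions vanishing on the boundary. -/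
def MemSh0 (Ω : Set E3) (T : Finset (Fin 4 → E3)) (r : ℕ) (u : E3 → ℝ) : Prop :=
  MemSh Ω T r u ∧ ∀ x ∈ frontier Ω, u x = 0

/-- The Laplacian, as the trace of the Hessian. -/
def lap (v : E3 → ℝ) (x : E3) : ℝ :=
  ∑ i : Fin 3,
    fderiv ℝ (fun y => fderiv ℝ v y (EuclideanSpace.single i 1)) x (EuclideanSpace.single i 1)

/-- The `L^p(A)` norm. -/
def LpN (A : Set E3) (p : ℝ) (w : E3 → ℝ) : ℝ := (∫ x in A, |w x| ^ p) ^ (1 / p)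

/-- The `W^{1,p}(A)` norm. -/
def W1pN (A : Set E3) (p : ℝ) (w : E3 → ℝ) : ℝ :=
  (∫ x in A, (|w x| ^ p + ‖gradient w x‖ ^ p)) ^ (1 / p)

/-- The `W^{2,p}(A)` norm. -/
def W2pN (A : Set E3) (p : ℝ) (w : E3 → ℝ) : ℝ :=
  (∫ x in A, (|w x| ^ p + ‖gradient w x‖ ^ p + ‖iteratedFDeriv ℝ 2 w x‖ ^ p)) ^ (1 / p)

/-- Standing assumptions on the domain. -/
structure Dom (Ω : Set E3) : Prop where
  op : IsOpen Ω
  bd : Bornology.IsBounded Ω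
  cv : Convex ℝ Ω

/-- Bounded (on `Ω`) measurable functions. -/
def BM {V : Type*} [NormedAddCommGroup V] [MeasurableSpace V] (Ω : Set E3) (F : E3 → V) : Prop :=
  Measurable F ∧ ∃ C, ∀ x ∈ Ω, ‖F x‖ ≤ C

/-- Lipschitz functions vanishing outside `Ω`. -/
def LO (Ω : Set E3) (f : E3 → ℝ) : Prop := (∃ K, LipschitzWith K f) ∧ ∀ x, x ∉ Ω → f x = 0

section basics
variable {Ω : Set E3}

theorem Dom.fin (hD : Dom Ω) : volume Ω < ⊤ := hD.bd.measure_lt_top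
theorem Dom.meas (hD : Dom Ω) : MeasurableSet Ω := hD.op.measurableSet

theorem BM.integrableOn {V : Type*} [NormedAddCommGroup V] [MeasurableSpace V] [BorelSpace V]
    [SecondCountableTopology V] (hD : Dom Ω) {F : E3 → V} (hF : BM Ω F) : IntegrableOn F Ω := by
  obtain ⟨hm, C, hC⟩ := hF
  exact IntegrableOn.of_bound hD.fin hm.aestronglyMeasurable C
    ((ae_restrict_iff' hD.meas).2 (Filter.Eventually.of_forall hC))

theorem BM.mono {V : Type*} [NormedAddCommGroup V] [MeasurableSpace V] {A : Set E3} {F : E3 → V}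
    (h : BM Ω F) (hA : A ⊆ Ω) : BM A F := ⟨h.1, h.2.imp fun _ hC x hx => hC x (hA hx)⟩

theorem BM.add {V : Type*} [NormedAddCommGroup V] [MeasurableSpace V] [BorelSpace V]
    [SecondCountableTopology V] {F G : E3 → V} (hF : BM Ω F)
    (hG : BM Ω G) : BM Ω (fun x => F x + G x) := by
  obtain ⟨h1, C, hC⟩ := hF
  obtain ⟨h2, D, hD⟩ := hG
  exact ⟨h1.add h2, C + D, fun x hx => (norm_add_le _ _).trans (add_le_add (hC x hx) (hD x hx))⟩

theorem BM.sub {V : Type*} [NormedAddCommGroup V] [MeasurableSpace V] [BorelSpace V]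
    [SecondCountableTopology V] {F G : E3 → V} (hF : BM Ω F)
    (hG : BM Ω G) : BM Ω (fun x => F x - G x) := by
  obtain ⟨h1, C, hC⟩ := hF
  obtain ⟨h2, D, hD⟩ := hG
  exact ⟨h1.sub h2, C + D, fun x hx => (norm_sub_le _ _).trans (add_le_add (hC x hx) (hD x hx))⟩

theorem BM.smul {V : Type*} [NormedAddCommGroup V] [NormedSpace ℝ V] [MeasurableSpace V]
    [BorelSpace V] [SecondCountableTopology V] {F : E3 → ℝ} {G : E3 → V} (hF : BM Ω F)
    (hG : BM Ω G) : BM Ω (fun x => F x • G x) := by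
  obtain ⟨h1, C, hC⟩ := hF
  obtain ⟨h2, D, hD⟩ := hG
  refine ⟨h1.smul h2, C * D, fun x hx => ?_⟩
  rw [norm_smul]
  have := hC x hx
  have := hD x hx
  have := norm_nonneg (F x)
  gcongr
  linarith

theorem BM.mul {F G : E3 → ℝ} (hF : BM Ω F) (hG : BM Ω G) : BM Ω (fun x => F x * G x) :=
  hF.smul hG

theorem BM.const {V : Type*} [NormedAddCommGroup V] [MeasurableSpace V] (c : V) :
    BM Ω (fun _ => c) := ⟨measurable_const, ‖c‖, fun _ _ => le_rfl⟩

theorem BM.cmul {F : E3 → ℝ} (c : ℝ) (hF : BM Ω F) : BM Ω (fun x => c * F x) :=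
  (BM.const c).mul hF

theorem BM.sq {F : E3 → ℝ} (hF : BM Ω F) : BM Ω (fun x => F x ^ 2) := by
  simpa only [_root_.sq] using hF.mul hF

theorem BM.norm {V : Type*} [NormedAddCommGroup V] [MeasurableSpace V] [BorelSpace V]
    {F : E3 → V} (hF : BM Ω F) : BM Ω (fun x => ‖F x‖) :=
  ⟨hF.1.norm, hF.2.imp fun C h x hx => by simpa using h x hx⟩

theorem BM.inner {F G : E3 → E3} (hF : BM Ω F) (hG : BM Ω G) : BM Ω (fun x => ⟪F x, G x⟫) := by
  obtain ⟨h1, C, hC⟩ := hF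
  obtain ⟨h2, D, hD⟩ := hG
  refine ⟨h1.inner h2, C * D, fun x hx => (norm_inner_le_norm _ _).trans ?_⟩
  have := hC x hx
  have := hD x hx
  have := norm_nonneg (F x)
  gcongr
  linarith

theorem BM.nsq {F : E3 → E3} (hF : BM Ω F) : BM Ω (fun x => ‖F x‖ ^ 2) := hF.norm.sq

theorem measurable_gradient (f : E3 → ℝ) : Measurable (gradient f) :=
  (LinearIsometryEquiv.continuous _).measurable.comp (measurable_fderiv ℝ f)

theorem norm_gradient_eq (f : E3 → ℝ) (x : E3) : ‖gradient f x‖ = ‖fderiv ℝ f x‖ := by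
  simp [gradient]

theorem norm_gradient_le {f : E3 → ℝ} {K : ℝ≥0} (hf : LipschitzWith K f) (x : E3) :
    ‖gradient f x‖ ≤ K := by
  rw [norm_gradient_eq]; exact norm_fderiv_le_of_lipschitz ℝ hf

theorem HasGradientAt.mul' {f g : E3 → ℝ} {a b x : E3} (hf : HasGradientAt f a x)
    (hg : HasGradientAt g b x) : HasGradientAt (fun y => f y * g y) (f x • b + g x • a) x := by
  rw [hasGradientAt_iff_hasFDerivAt] at *
  rw [map_add, map_smul, map_smul]; exact hf.mul hg

theorem HasGradientAt.add' {f g : E3 → ℝ} {a b x : E3} (hf : HasGradientAt f a x)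
    (hg : HasGradientAt g b x) : HasGradientAt (fun y => f y + g y) (a + b) x := by
  rw [hasGradientAt_iff_hasFDerivAt] at *
  rw [map_add]; exact hf.add hg

theorem HasGradientAt.sub' {f g : E3 → ℝ} {a b x : E3} (hf : HasGradientAt f a x)
    (hg : HasGradientAt g b x) : HasGradientAt (fun y => f y - g y) (a - b) x := by
  rw [hasGradientAt_iff_hasFDerivAt] at *
  rw [map_sub]; exact hf.sub hg

theorem HasGradientAt.cmul {f : E3 → ℝ} {a x : E3} (c : ℝ) (hf : HasGradientAt f a x) :
    HasGradientAt (fun y => c * f y) (c • a) x := by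
  simpa using (hasGradientAt_const x c).mul' hf

theorem HasGradientAt.comp_real {f : E3 → ℝ} {a x : E3} {φ : ℝ → ℝ} {φ' : ℝ}
    (hφ : HasDerivAt φ φ' (f x)) (hf : HasGradientAt f a x) :
    HasGradientAt (fun y => φ (f y)) (φ' • a) x := by
  rw [hasGradientAt_iff_hasFDerivAt] at *
  rw [map_smul]; exact hφ.comp_hasFDerivAt x hf

theorem gradient_mul' {f g : E3 → ℝ} {x : E3} (hf : DifferentiableAt ℝ f x)
    (hg : DifferentiableAt ℝ g x) :
    gradient (fun y => f y * g y) x = f x • gradient g x + g x • gradient f x :=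
  (hf.hasGradientAt.mul' hg.hasGradientAt).gradient

theorem gradient_add' {f g : E3 → ℝ} {x : E3} (hf : DifferentiableAt ℝ f x)
    (hg : DifferentiableAt ℝ g x) :
    gradient (fun y => f y + g y) x = gradient f x + gradient g x :=
  (hf.hasGradientAt.add' hg.hasGradientAt).gradient

theorem gradient_sub' {f g : E3 → ℝ} {x : E3} (hf : DifferentiableAt ℝ f x)
    (hg : DifferentiableAt ℝ g x) :
    gradient (fun y => f y - g y) x = gradient f x - gradient g x :=
  (hf.hasGradientAt.sub' hg.hasGradientAt).gradient

theorem gradient_congr {A : Set E3} (hA : IsOpen A) {f g : E3 → ℝ} (h : ∀ x ∈ A, f x = g x)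
    {x : E3} (hx : x ∈ A) : gradient f x = gradient g x :=
  Filter.EventuallyEq.gradient_eq (Filter.mem_of_superset (hA.mem_nhds hx) h)

theorem LO.meas {f : E3 → ℝ} (hf : LO Ω f) : Measurable f :=
  let ⟨⟨_, h⟩, _⟩ := hf
  h.continuous.measurable

theorem LO.cont {f : E3 → ℝ} (hf : LO Ω f) : Continuous f :=
  let ⟨⟨_, h⟩, _⟩ := hf
  h.continuous

theorem LO.cs (hD : Dom Ω) {f : E3 → ℝ} (hf : LO Ω f) : HasCompactSupport f :=
  HasCompactSupport.intro' hD.bd.isCompact_closure isClosed_closure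
    fun x hx => hf.2 x fun h => hx (subset_closure h)

theorem LO.bdd (hD : Dom Ω) {f : E3 → ℝ} (hf : LO Ω f) : ∃ C, ∀ x, ‖f x‖ ≤ C := by
  obtain ⟨C, hC⟩ := (hf.cs hD).exists_bound_of_continuous hf.cont
  exact ⟨C, hC⟩

theorem LO.bm (hD : Dom Ω) {f : E3 → ℝ} (hf : LO Ω f) : BM Ω f :=
  ⟨hf.meas, (hf.bdd hD).imp fun _ h x _ => h x⟩

theorem LO.gbm {f : E3 → ℝ} (hf : LO Ω f) : BM Ω (gradient f) :=
  let ⟨⟨K, h⟩, _⟩ := hf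
  ⟨measurable_gradient f, K, fun x _ => norm_gradient_le h x⟩

theorem LO.ae {f : E3 → ℝ} (hf : LO Ω f) : ∀ᵐ x, DifferentiableAt ℝ f x :=
  let ⟨⟨_, h⟩, _⟩ := hf
  h.ae_differentiableAt

theorem LO.add {f g : E3 → ℝ} (hf : LO Ω f) (hg : LO Ω g) : LO Ω (fun x => f x + g x) := by
  obtain ⟨⟨K, hK⟩, h⟩ := hf
  obtain ⟨⟨L, hL⟩, h'⟩ := hg
  exact ⟨⟨_, hK.add hL⟩, fun x hx => by simp [h x hx, h' x hx]⟩

theorem LO.sub {f g : E3 → ℝ} (hf : LO Ω f) (hg : LO Ω g) : LO Ω (fun x => f x - g x) := by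
  obtain ⟨⟨K, hK⟩, h⟩ := hf
  obtain ⟨⟨L, hL⟩, h'⟩ := hg
  exact ⟨⟨_, hK.sub hL⟩, fun x hx => by simp [h x hx, h' x hx]⟩

/-- A segment from an open set to its complement meets the frontier. -/
theorem exists_frontier_segment {A : Set E3} {x y : E3} (hx : x ∈ A) (hy : y ∉ A) :
    ∃ z ∈ segment ℝ x y, z ∈ frontier A := by
  have hc : IsPreconnected (segment ℝ x y) := (convex_segment x y).isPreconnected
  by_contra! hcon
  have h1 : segment ℝ x y ⊆ interior A ∪ interior Aᶜ := by
    intro z hz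
    have := hcon z hz
    rw [frontier, mem_sdiff, not_and, not_not] at this
    by_cases hzc : z ∈ closure A
    · exact Or.inl (this hzc)
    · right; rw [interior_compl]; exact hzc
  have := hc.subset_left_of_subset_union isOpen_interior isOpen_interior
    (disjoint_compl_right.mono interior_subset interior_subset) h1
    ⟨x, left_mem_segment ℝ x y, ?_⟩
  · exact hy (interior_subset (this (right_mem_segment ℝ x y)))
  · rcases h1 (left_mem_segment ℝ x y) with h | h
    · exact h
    · exact absurd hx (interior_subset h)

theorem dist_segment_le {x y z : E3} (hz : z ∈ segment ℝ x y) : dist x z ≤ dist x y := by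
  rw [← dist_add_dist_of_mem_segment hz]
  linarith [dist_nonneg (x := z) (y := y)]

/-- Zero extension of a Lipschitz function vanishing on the frontier. -/
theorem LO.of_lipOn {f : E3 → ℝ} {K : ℝ≥0} (hf : LipschitzOnWith K f (closure Ω))
    (h0 : ∀ x ∈ frontier Ω, f x = 0) : LO Ω (Ω.indicator f) := by
  have hin : ∀ x ∈ closure Ω, Ω.indicator f x = f x := by
    intro x hx
    by_cases h : x ∈ Ω
    · simp [h]
    · rw [indicator_of_notMem h, h0 x ⟨hx, fun h' => h (interior_subset h')⟩]
  have key : ∀ x y, x ∈ Ω → y ∉ Ω → dist (Ω.indicator f x) (Ω.indicator f y) ≤ K * dist x y := by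
    intro x y hx hy
    obtain ⟨z, hz, hzf⟩ := exists_frontier_segment hx hy
    rw [indicator_of_notMem hy, hin x (subset_closure hx), ← h0 z hzf]
    exact (hf.dist_le_mul x (subset_closure hx) z hzf.1).trans
      (mul_le_mul_of_nonneg_left (dist_segment_le hz) K.2)
  refine ⟨⟨K, LipschitzWith.of_dist_le_mul fun x y => ?_⟩, fun x hx => indicator_of_notMem hx f⟩
  by_cases hx : x ∈ Ω <;> by_cases hy : y ∈ Ω
  · rw [hin x (subset_closure hx), hin y (subset_closure hy)]
    exact hf.dist_le_mul x (subset_closure hx) y (subset_closure hy)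
  · exact key x y hx hy
  · rw [dist_comm, dist_comm x]; exact key y x hy hx
  · simp [indicator_of_notMem hx, indicator_of_notMem hy]; positivity

/-- Multiplication by a function that is bounded and Lipschitz on `Ω`. -/
theorem LO.mulOn (hD : Dom Ω) {f m : E3 → ℝ} (hf : LO Ω f) {K : ℝ≥0}
    (hm : LipschitzOnWith K m Ω) : LO Ω (fun x => m x * f x) := by
  obtain ⟨M', hM'⟩ : ∃ M', ∀ x ∈ Ω, |m x| ≤ M' := by
    rcases Ω.eq_empty_or_nonempty with h | ⟨z, hz⟩
    · exact ⟨0, by simp [h]⟩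
    refine ⟨|m z| + K * diam Ω, fun x hx => ?_⟩
    have h1 := hm.dist_le_mul x hx z hz
    have h2 := dist_le_diam_of_mem hD.bd hx hz
    have h3 : |m x| ≤ |m z| + |m x - m z| := by
      have := abs_add_le (m z) (m x - m z); simpa using this
    rw [Real.dist_eq] at h1
    nlinarith [K.2]
  obtain ⟨C, hC⟩ := hf.bdd hD
  obtain ⟨⟨L, hL⟩, h0⟩ := hf
  have hM0 : ∀ x ∈ Ω, |m x| ≤ (Real.toNNReal M' : ℝ) := fun x hx =>
    (hM' x hx).trans (Real.le_coe_toNNReal _)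
  have hC0 : ∀ x, |f x| ≤ (Real.toNNReal C : ℝ) := fun x => (hC x).trans (Real.le_coe_toNNReal _)
  set M := Real.toNNReal M'
  set D := Real.toNNReal C
  have key : ∀ x y, x ∈ Ω → dist (m x * f x) (m y * f y) ≤ (M * L + K * D : ℝ≥0) * dist x y := by
    intro x y hx
    have h1 := hL.dist_le_mul x y
    rw [Real.dist_eq] at h1 ⊢
    push_cast
    have h4 : |m x * (f x - f y)| ≤ M * (L * dist x y) := by
      rw [abs_mul]; exact mul_le_mul (hM0 x hx) h1 (abs_nonneg _) M.2
    by_cases hy : y ∈ Ω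
    · have h2 := hm.dist_le_mul x hx y hy
      rw [Real.dist_eq] at h2
      have h5 : |(m x - m y) * f y| ≤ K * dist x y * D := by
        rw [abs_mul]; exact mul_le_mul h2 (hC0 y) (abs_nonneg _) (by positivity)
      calc |m x * f x - m y * f y| = |m x * (f x - f y) + (m x - m y) * f y| := by ring_nf
        _ ≤ _ := abs_add_le _ _
        _ ≤ _ := by linarith
    · rw [h0 y hy] at h4 ⊢
      simp only [mul_zero, sub_zero] at h4 ⊢
      have : 0 ≤ (K : ℝ) * D * dist x y := by positivity
      linarith
  refine ⟨⟨M * L + K * D, LipschitzWith.of_dist_le_mul fun x y => ?_⟩, fun x hx => by simp [h0 x hx]⟩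
  by_cases hx : x ∈ Ω
  · exact key x y hx
  by_cases hy : y ∈ Ω
  · rw [dist_comm, dist_comm x]; exact key y x hy
  · simp [h0 x hx, h0 y hy]; positivity

theorem lipOn_of_grad {A : Set E3} (hA : Convex ℝ A) {m : E3 → ℝ} {G : E3 → E3} {K : ℝ}
    (hm : ∀ x ∈ A, HasGradientAt m (G x) x) (hG : ∀ x ∈ A, ‖G x‖ ≤ K) :
    LipschitzOnWith (Real.toNNReal K) m A :=
  hA.lipschitzOnWith_of_nnnorm_hasFDerivWithin_le
    (fun x hx => ((hasGradientAt_iff_hasFDerivAt.1 (hm x hx)).hasFDerivWithinAt))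
    fun x hx => by
      have := hG x hx
      rw [← NNReal.coe_le_coe, coe_nnnorm, LinearIsometryEquiv.norm_map]
      exact this.trans (Real.le_coe_toNNReal _)

theorem LO.mulG (hD : Dom Ω) {f m : E3 → ℝ} (hf : LO Ω f) {G : E3 → E3} {K : ℝ}
    (hm : ∀ x ∈ Ω, HasGradientAt m (G x) x) (hG : ∀ x ∈ Ω, ‖G x‖ ≤ K) :
    LO Ω (fun x => m x * f x) := hf.mulOn hD (lipOn_of_grad hD.cv hm hG)

theorem LO.mul (hD : Dom Ω) {f m : E3 → ℝ} (hf : LO Ω f) (hm : LO Ω m) :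
    LO Ω (fun x => m x * f x) :=
  let ⟨⟨_, h⟩, _⟩ := hm
  hf.mulOn hD h.lipschitzOnWith

theorem LO.cmul {f : E3 → ℝ} (c : ℝ) (hf : LO Ω f) : LO Ω (fun x => c * f x) := by
  obtain ⟨⟨K, hK⟩, h⟩ := hf
  refine ⟨⟨Real.nnabs c * K, LipschitzWith.of_dist_le_mul fun x y => ?_⟩,
    fun x hx => by simp [h x hx]⟩
  have := hK.dist_le_mul x y
  rw [Real.dist_eq] at *
  rw [← mul_sub, abs_mul]
  push_cast
  rw [mul_assoc]
  gcongr

/-- Integrals over `Ω` of quantities vanishing with the function and gradient. -/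
theorem LO.ae_zero (hD : Dom Ω) {f : E3 → ℝ} (hf : LO Ω f) :
    ∀ᵐ x, x ∉ Ω → f x = 0 ∧ gradient f x = 0 := by
  have h1 : ∀ᵐ x, x ∉ frontier Ω := by
    rw [ae_iff]; simpa using hD.cv.addHaar_frontier volume
  filter_upwards [h1] with x hx hxΩ
  refine ⟨hf.2 x hxΩ, ?_⟩
  have hxc : x ∈ (closure Ω)ᶜ := fun h => hx ⟨h, fun h' => hxΩ (interior_subset h')⟩
  rw [gradient_congr (isClosed_closure.isOpen_compl) (g := fun _ => 0)
    (fun y hy => hf.2 y fun h => hy (subset_closure h)) hxc]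
  simp

theorem setIntegral_eq_full (hD : Dom Ω) {V : Type*} [NormedAddCommGroup V] [NormedSpace ℝ V]
    {F : E3 → V} (h : ∀ᵐ x, x ∉ Ω → F x = 0) : ∫ x in Ω, F x = ∫ x, F x := by
  rw [← integral_indicator hD.meas]
  refine integral_congr_ae ?_
  filter_upwards [h] with x hx
  by_cases hxΩ : x ∈ Ω <;> simp [hxΩ]
  exact (hx hxΩ).symm

/-- The integral of a derivative of a compactly supported Lipschitz function vanishes. -/
theorem LO.ibp (hD : Dom Ω) {f : E3 → ℝ} (hf : LO Ω f) (a : E3) :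
    ∫ x in Ω, ⟪gradient f x, a⟫ = 0 := by
  rw [setIntegral_eq_full hD (by filter_upwards [hf.ae_zero hD] with x h hx; simp [(h hx).2])]
  have hae := hf.ae
  obtain ⟨⟨K, hK⟩, h0⟩ := id hf
  have := LipschitzWith.integral_lineDeriv_mul_eq (μ := volume) (LipschitzWith.const (1:ℝ)) hK
    (hf.cs hD) (-a)
  have h1 : ∀ x : E3, lineDeriv ℝ (fun _ : E3 => (1:ℝ)) x (-a) = 0 := fun x => by simp [lineDeriv]
  simp only [h1, zero_mul, integral_zero, neg_neg, mul_one] at this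
  rw [this]
  refine integral_congr_ae ?_
  filter_upwards [hae] with x hx
  rw [inner_gradient_left, hx.lineDeriv_eq_fderiv]

/-- Cauchy-Schwarz. -/
theorem cs_int {α : Type*} [MeasurableSpace α] {μ : Measure α} {F G : α → ℝ}
    (hF : Integrable (fun x => F x ^ 2) μ) (hG : Integrable (fun x => G x ^ 2) μ)
    (hFG : Integrable (fun x => F x * G x) μ) :
    (∫ x, F x * G x ∂μ) ^ 2 ≤ (∫ x, F x ^ 2 ∂μ) * ∫ x, G x ^ 2 ∂μ := by
  have key : ∀ t : ℝ, 0 ≤ (∫ x, G x ^ 2 ∂μ) * (t * t) + (2 * ∫ x, F x * G x ∂μ) * t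
      + ∫ x, F x ^ 2 ∂μ := by
    intro t
    have : 0 ≤ ∫ x, (F x + t * G x) ^ 2 ∂μ := integral_nonneg fun x => by positivity
    have e : ∫ x, (F x + t * G x) ^ 2 ∂μ =
        ∫ x, ((t * t) * G x ^ 2 + (2 * t) * (F x * G x)) + F x ^ 2 ∂μ := by
      congr 1; ext x; ring
    rw [e, integral_add (by exact (hG.const_mul _).add (hFG.const_mul _)) hF,
      integral_add (hG.const_mul _) (hFG.const_mul _), integral_const_mul, integral_const_mul] at this
    linarith
  have := discrim_le_zero key
  unfold discrim at this
  nlinarith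

theorem BM.cs (hD : Dom Ω) {F G : E3 → ℝ} (hF : BM Ω F) (hG : BM Ω G) :
    (∫ x in Ω, F x * G x) ^ 2 ≤ (∫ x in Ω, F x ^ 2) * ∫ x in Ω, G x ^ 2 :=
  cs_int (hF.sq.integrableOn hD) (hG.sq.integrableOn hD) ((hF.mul hG).integrableOn hD)

theorem ae_le_set (hD : Dom Ω) {F G : E3 → ℝ} (hF : BM Ω F) (hG : BM Ω G)
    (h : ∀ᵐ x, x ∈ Ω → F x ≤ G x) : ∫ x in Ω, F x ≤ ∫ x in Ω, G x :=
  setIntegral_mono_ae_restrict (hF.integrableOn hD) (hG.integrableOn hD)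
    ((ae_restrict_iff' hD.meas).2 h)

theorem ae_eq_set (hD : Dom Ω) {F G : E3 → ℝ} 
    (h : ∀ᵐ x, x ∈ Ω → F x = G x) : ∫ x in Ω, F x = ∫ x in Ω, G x :=
  setIntegral_congr_ae hD.meas h

end basics

section hardy
variable {Ω : Set E3}

/-- An exterior pole. -/
structure Pole (Ω : Set E3) (p n : E3) (κ : ℝ) : Prop where
  n1 : ‖n‖ = 1
  pos : 0 < κ
  le : ∀ x ∈ Ω, κ ≤ ⟪n, x - p⟫

theorem Pole.r {p n : E3} {κ : ℝ} (hp : Pole Ω p n κ) {x : E3} (hx : x ∈ Ω) : κ ≤ ‖x - p‖ := by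
  have h1 := hp.le x hx
  have h2 := real_inner_le_norm n (x - p)
  rw [hp.n1, one_mul] at h2
  linarith

theorem Pole.rpos {p n : E3} {κ : ℝ} (hp : Pole Ω p n κ) {x : E3} (hx : x ∈ Ω) : 0 < ‖x - p‖ :=
  hp.pos.trans_le (hp.r hx)

theorem hasGradientAt_inner (n p x : E3) : HasGradientAt (fun y => ⟪n, y - p⟫) n x := by
  rw [hasGradientAt_iff_hasFDerivAt]
  have := ((InnerProductSpace.toDual ℝ E3 n).hasFDerivAt (x := x - p)).comp x
    ((hasFDerivAt_id x).sub_const p)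
  exact this

theorem hasGradientAt_sq (p x : E3) : HasGradientAt (fun y => ‖y - p‖ ^ 2) ((2:ℝ) • (x - p)) x := by
  rw [hasGradientAt_iff_hasFDerivAt]
  have := ((hasFDerivAt_id x).sub_const p).norm_sq
  refine HasFDerivAt.congr_fderiv this ?_
  ext y
  simp

theorem hasGradientAt_rpow (p : E3) (a : ℝ) {x : E3} (hx : 0 < ‖x - p‖) :
    HasGradientAt (fun y => ‖y - p‖ ^ a) ((a * ‖x - p‖ ^ (a - 2)) • (x - p)) x := by
  have h1 := (Real.hasDerivAt_rpow_const (p := a / 2)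
    (Or.inl (by positivity : ‖x - p‖ ^ 2 ≠ 0)))
  have h2 := HasGradientAt.comp_real h1 (hasGradientAt_sq p x)
  have e : ∀ (s b : ℝ), 0 ≤ s → (s ^ 2) ^ b = s ^ (2 * b) := fun s b hs => by
    rw [← Real.rpow_natCast, ← Real.rpow_mul hs]; norm_num
  simp only [e _ _ (norm_nonneg _)] at h2
  rw [show 2 * (a / 2) = a by ring, show 2 * (a / 2 - 1) = a - 2 by ring, smul_smul] at h2
  convert h2 using 2
  ring

theorem sum_e3 (x y : E3) : ⟪x, y⟫ = x 0 * y 0 + x 1 * y 1 + x 2 * y 2 := by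
  simp [PiLp.inner_apply, Fin.sum_univ_three, mul_comm]

theorem nsq_e3 (x : E3) : ‖x‖ ^ 2 = x 0 ^ 2 + x 1 ^ 2 + x 2 ^ 2 := by
  rw [← real_inner_self_eq_norm_sq, sum_e3]; ring

theorem inner_single (x : E3) (i : Fin 3) : ⟪x, EuclideanSpace.single i (1:ℝ)⟫ = x i := by
  simp [EuclideanSpace.inner_single_right]

/-- Hardy-type inequality from a vector field. -/
theorem hardy_field (hD : Dom Ω) {f : E3 → ℝ} (hf : LO Ω f) {X : Fin 3 → E3 → ℝ}
    {G : Fin 3 → E3 → E3} (hX : ∀ i, BM Ω (X i)) (hG : ∀ i, BM Ω (G i))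
    (hXG : ∀ i, ∀ x ∈ Ω, HasGradientAt (X i) (G i x) x) {q : E3 → ℝ} (hq : BM Ω q)
    (hqe : ∀ x ∈ Ω, q x = -(∑ i, (G i x i + X i x ^ 2))) :
    ∫ x in Ω, q x * f x ^ 2 ≤ ∫ x in Ω, ‖gradient f x‖ ^ 2 := by
  have hff : LO Ω (fun x => f x * f x) := hf.mul hD hf
  have hF : ∀ i, LO Ω (fun x => X i x * (f x * f x)) := fun i =>
    let ⟨_, hC⟩ := (hG i).2
    hff.mulG hD (hXG i) hC
  have hg : ∀ i, ∀ᵐ x, x ∈ Ω → ⟪gradient (fun x => X i x * (f x * f x)) x,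
      EuclideanSpace.single i (1:ℝ)⟫ = 2 * X i x * f x * gradient f x i + f x ^ 2 * G i x i := by
    intro i
    filter_upwards [hf.ae] with x hx hxΩ
    rw [((hXG i x hxΩ).mul' (hx.hasGradientAt.mul' hx.hasGradientAt)).gradient, inner_single]
    simp
    ring
  have hgi : ∀ i, BM Ω (fun x => gradient f x i) := fun i => by
    have := hf.gbm.inner (BM.const (EuclideanSpace.single i (1:ℝ)))
    simpa only [inner_single] using this
  have hGi : ∀ i, BM Ω (fun x => G i x i) := fun i => by
    have := (hG i).inner (BM.const (EuclideanSpace.single i (1:ℝ)))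
    simpa only [inner_single] using this
  have hb := hf.bm hD
  have hbi : ∀ i, BM Ω (fun x => 2 * X i x * f x * gradient f x i + f x ^ 2 * G i x i) := fun i =>
    ((((hX i).cmul 2).mul hb).mul (hgi i)).add (hb.sq.mul (hGi i))
  have h0 : ∀ i, ∫ x in Ω, (2 * X i x * f x * gradient f x i + f x ^ 2 * G i x i) = 0 := fun i => by
    rw [← ae_eq_set hD (hg i)]; exact (hF i).ibp hD _
  have hsum : ∫ x in Ω, ∑ i, (2 * X i x * f x * gradient f x i + f x ^ 2 * G i x i) = 0 := by
    rw [integral_finsetSum _ fun i _ => (hbi i).integrableOn hD]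
    exact Finset.sum_eq_zero fun i _ => h0 i
  have hs : BM Ω (fun x => ∑ i, (2 * X i x * f x * gradient f x i + f x ^ 2 * G i x i)) := by
    simp only [Fin.sum_univ_three]
    exact ((hbi 0).add (hbi 1)).add (hbi 2)
  have hle := ae_le_set hD (hq.mul hb.sq) (hf.gbm.nsq.sub hs) (by
    refine Filter.Eventually.of_forall fun x hx => ?_
    rw [hqe x hx, nsq_e3]
    simp only [Fin.sum_univ_three]
    nlinarith [sq_nonneg (gradient f x 0 - X 0 x * f x), sq_nonneg (gradient f x 1 - X 1 x * f x),
      sq_nonneg (gradient f x 2 - X 2 x * f x)])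
  rw [integral_sub (hf.gbm.nsq.integrableOn hD) (hs.integrableOn hD), hsum, sub_zero] at hle
  exact hle

theorem BM.of_cont_le {V : Type*} [NormedAddCommGroup V] [MeasurableSpace V]
    {F : E3 → V} (hm : Measurable F) (C : ℝ) (h : ∀ x ∈ Ω, ‖F x‖ ≤ C) : BM Ω F := ⟨hm, C, h⟩

theorem Dom.bound (hD : Dom Ω) (p : E3) : ∃ R, 0 < R ∧ ∀ x ∈ Ω, ‖x - p‖ ≤ R := by
  obtain ⟨R, hR⟩ := hD.bd.subset_closedBall p
  exact ⟨max R 1, by positivity, fun x hx => by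
    have := hR hx
    rw [mem_closedBall, dist_eq_norm] at this
    exact this.trans (le_max_left _ _)⟩

/-- Weights are bounded. -/
theorem Pole.bm (hD : Dom Ω) {p n : E3} {κ : ℝ} (hp : Pole Ω p n κ) (a : ℝ) :
    BM Ω (fun x => ‖x - p‖ ^ a) := by
  obtain ⟨R, hR0, hR⟩ := hD.bound p
  refine ⟨by fun_prop, κ ^ a + R ^ a, fun x hx => ?_⟩
  have h1 := hp.r hx
  have h2 := hR x hx
  have h3 := hp.rpos hx
  have hκ := hp.pos
  rw [Real.norm_of_nonneg (by positivity)]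
  rcases le_total 0 a with ha | ha
  · have := Real.rpow_le_rpow h3.le h2 ha
    have : 0 ≤ κ ^ a := by positivity
    linarith
  · have := Real.rpow_le_rpow_of_nonpos hκ h1 ha
    have : 0 ≤ R ^ a := by positivity
    linarith

theorem BM.sub_pt (hD : Dom Ω) (p : E3) : BM Ω (fun x => x - p) :=
  let ⟨R, _, hR⟩ := hD.bound p
  ⟨by fun_prop, R, hR⟩

theorem Pole.gw (hD : Dom Ω) {p n : E3} {κ : ℝ} (hp : Pole Ω p n κ) (a : ℝ) :
    BM Ω (fun x => (a * ‖x - p‖ ^ (a - 2)) • (x - p)) :=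
  ((hp.bm hD _).cmul a).smul (BM.sub_pt hD p)

theorem Pole.mulLO (hD : Dom Ω) {p n : E3} {κ : ℝ} (hp : Pole Ω p n κ) (a : ℝ) {f : E3 → ℝ}
    (hf : LO Ω f) : LO Ω (fun x => ‖x - p‖ ^ a * f x) :=
  let ⟨_, hC⟩ := (hp.gw hD a).2
  hf.mulG hD (fun _ hx => hasGradientAt_rpow p a (hp.rpos hx)) hC

theorem hardy (hD : Dom Ω) {p n : E3} {κ : ℝ} (hp : Pole Ω p n κ) {f : E3 → ℝ} (hf : LO Ω f) :
    ∫ x in Ω, ‖x - p‖ ^ (-2:ℝ) * f x ^ 2 ≤ 4 / 9 * ∫ x in Ω, ‖gradient f x‖ ^ 2 := by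
  have hκ := hp.pos
  have hinv : ∀ x, ‖x - p‖ ^ (-2:ℝ) = (‖x - p‖ ^ 2)⁻¹ := fun x => by
    rw [Real.rpow_neg (norm_nonneg _)]; norm_cast
  have bL : BM Ω (fun x => (⟪n, x - p⟫)⁻¹) := ⟨by fun_prop, κ⁻¹, fun x hx => by
    have := hp.le x hx
    rw [norm_inv, Real.norm_of_nonneg (by linarith)]
    exact inv_anti₀ hκ this⟩
  have bQ : BM Ω (fun x => (‖x - p‖ ^ 2)⁻¹) := by
    simpa only [hinv] using hp.bm hD (-2)
  have bx : ∀ i, BM Ω (fun x : E3 => (x - p) i) := fun i => by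
    have := (BM.sub_pt hD p).inner (BM.const (EuclideanSpace.single i (1:ℝ)))
    simpa only [inner_single] using this
  have hci : ∀ (i : Fin 3) (x : E3), HasGradientAt (fun y : E3 => (y - p) i)
      (EuclideanSpace.single i (1:ℝ)) x := fun i x => by
    have := hasGradientAt_inner (EuclideanSpace.single i (1:ℝ)) p x
    simpa only [real_inner_comm _ (EuclideanSpace.single i (1:ℝ)), inner_single] using this
  have key := hardy_field hD hf (X := fun i x => n i * (⟪n, x - p⟫)⁻¹ -
      3 / 2 * ((x - p) i * (‖x - p‖ ^ 2)⁻¹))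
    (G := fun i x => n i • ((-(⟪n, x - p⟫ ^ 2)⁻¹) • n) -
      (3 / 2 : ℝ) • ((x - p) i • ((-((‖x - p‖ ^ 2) ^ 2)⁻¹) • ((2:ℝ) • (x - p))) +
        (‖x - p‖ ^ 2)⁻¹ • EuclideanSpace.single i (1:ℝ)))
    (q := fun x => 9 / 4 * (‖x - p‖ ^ 2)⁻¹)
    (fun i => (bL.cmul _).sub (((bx i).mul bQ).cmul _))
    (fun i => (((BM.const (n i)).smul (BM.smul
      (by simpa [inv_pow] using bL.sq.cmul (-1)) (BM.const n)))).sub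
      ((BM.const _).smul (((bx i).smul ((by simpa [inv_pow] using bQ.sq.cmul (-1) :
        BM Ω (fun x => -((‖x - p‖ ^ 2) ^ 2)⁻¹)).smul
        ((BM.const _).smul (BM.sub_pt hD p)))).add (bQ.smul (BM.const _)))))
    (fun i x hx => by
      have hL : ⟪n, x - p⟫ ≠ 0 := by have := hp.le x hx; linarith
      have hQ : ‖x - p‖ ^ 2 ≠ 0 := by have := hp.rpos hx; positivity
      exact ((HasGradientAt.comp_real (f := fun y => ⟪n, y - p⟫) (φ := fun s => s⁻¹) (hasDerivAt_inv hL)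
        (hasGradientAt_inner n p x)).cmul _).sub' (((hci i x).mul'
        (HasGradientAt.comp_real (f := fun y => ‖y - p‖ ^ 2) (φ := fun s => s⁻¹) (hasDerivAt_inv hQ)
          (hasGradientAt_sq p x))).cmul _))
    (bQ.cmul _)
    (fun x hx => by
      have hL : ⟪n, x - p⟫ ≠ 0 := by have := hp.le x hx; linarith
      have hQ : ‖x - p‖ ^ 2 ≠ 0 := by have := hp.rpos hx; positivity
      have e1 : n 0 ^ 2 + n 1 ^ 2 + n 2 ^ 2 = 1 := by rw [← nsq_e3, hp.n1]; norm_num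
      have e2 := sum_e3 n (x - p)
      have e3 := nsq_e3 (x - p)
      simp only [Fin.sum_univ_three]
      generalize ⟪n, x - p⟫ = L at *
      generalize ‖x - p‖ ^ 2 = Q at *
      generalize hy : x - p = y at *
      simp
      field_simp
      linear_combination (48*Q*L) * e2 - (84*L^2) * e3)
  simp only [hinv]
  simp only [mul_assoc] at key
  rw [integral_const_mul] at key
  linarith

/-- Agmon-type weighted coercivity. -/
theorem agmon (hD : Dom Ω) {p n : E3} {κ : ℝ} (hp : Pole Ω p n κ) {f : E3 → ℝ} (hf : LO Ω f)
    {b : ℝ} (hb : b ^ 2 ≤ 25 / 16) :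
    ∫ x in Ω, ‖x - p‖ ^ (2 * b) * ‖gradient f x‖ ^ 2 + ‖x - p‖ ^ (2 * b - 2) * f x ^ 2 ≤
      13 * ∫ x in Ω, ⟪gradient f x, gradient (fun y => ‖y - p‖ ^ (2 * b) * f y) x⟫ := by
  have hF := hp.mulLO hD b hf
  have hH := hardy hD hp hF
  have hw := hp.bm hD
  have hw2 := hp.mulLO hD (2 * b) hf
  have hb1 := (hw (2 * b)).mul hf.gbm.nsq
  have hb2 := (hw (2 * b - 2)).mul (hf.bm hD).sq
  have hb3 := hf.gbm.inner hw2.gbm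
  have hb4 := (hw (-2)).mul (hF.bm hD).sq
  have hb5 := hF.gbm.nsq
  have e : ∀ᵐ x, x ∈ Ω →
      ⟪gradient f x, gradient (fun y => ‖y - p‖ ^ (2 * b) * f y) x⟫ =
        ‖gradient (fun y => ‖y - p‖ ^ b * f y) x‖ ^ 2 - b ^ 2 * (‖x - p‖ ^ (2 * b - 2) * f x ^ 2) ∧
      ‖x - p‖ ^ (2 * b) * ‖gradient f x‖ ^ 2 ≤
        2 * ‖gradient (fun y => ‖y - p‖ ^ b * f y) x‖ ^ 2 +
        2 * b ^ 2 * (‖x - p‖ ^ (2 * b - 2) * f x ^ 2) ∧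
      ‖x - p‖ ^ (-2:ℝ) * (‖x - p‖ ^ b * f x) ^ 2 = ‖x - p‖ ^ (2 * b - 2) * f x ^ 2 := by
    filter_upwards [hf.ae] with x hx hxΩ
    have hr := hp.rpos hxΩ
    rw [((hasGradientAt_rpow p (2 * b) hr).mul' hx.hasGradientAt).gradient,
      ((hasGradientAt_rpow p b hr).mul' hx.hasGradientAt).gradient]
    have h1 : ‖x - p‖ ^ (2 * b) = (‖x - p‖ ^ b) ^ 2 := by
      rw [← Real.rpow_natCast, ← Real.rpow_mul hr.le]; congr 1; push_cast; ring
    have h2 : ‖x - p‖ ^ (2 * b - 2) = ‖x - p‖ ^ b * ‖x - p‖ ^ (b - 2) := by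
      rw [← Real.rpow_add hr]; congr 1; ring
    have h3 : ‖x - p‖ ^ b = ‖x - p‖ ^ (b - 2) * ‖x - p‖ ^ 2 := by
      rw [← Real.rpow_natCast, ← Real.rpow_add hr]; congr 1; push_cast; ring
    have h4 : ‖x - p‖ ^ (-2:ℝ) = (‖x - p‖ ^ 2)⁻¹ := by
      rw [Real.rpow_neg (norm_nonneg _)]; norm_cast
    rw [h1, h2, h4]
    have hn : ∀ s t : ℝ, ‖s • gradient f x + f x • t • (x - p)‖ ^ 2 =
        s ^ 2 * ‖gradient f x‖ ^ 2 + 2 * s * t * f x * ⟪gradient f x, x - p⟫ +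
          f x ^ 2 * t ^ 2 * ‖x - p‖ ^ 2 := by
      intro s t
      rw [← real_inner_self_eq_norm_sq, ← real_inner_self_eq_norm_sq, ← real_inner_self_eq_norm_sq]
      simp only [inner_add_left, inner_add_right, inner_smul_left, inner_smul_right,
        real_inner_comm (gradient f x) (x - p), RCLike.conj_to_real]
      ring
    rw [hn]
    simp only [inner_add_right, inner_smul_right, real_inner_self_eq_norm_sq]
    have hS : 0 < ‖x - p‖ ^ (b - 2) := by positivity
    have hcs := real_inner_le_norm (gradient f x) (x - p)
    have hcs2 := abs_real_inner_le_norm (gradient f x) (x - p)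
    generalize ⟪gradient f x, x - p⟫ = I at *
    generalize ‖x - p‖ ^ (b - 2) = S at *
    rw [h3]
    generalize ‖x - p‖ = r at *
    generalize ‖gradient f x‖ = g at *
    refine ⟨by ring, ?_, by field_simp⟩
    have hI : I ^ 2 ≤ g ^ 2 * r ^ 2 := by
      rw [← mul_pow, ← sq_abs I]; gcongr
    have h5 : 0 ≤ S ^ 2 * r ^ 2 * (g ^ 2 * r ^ 2 - I ^ 2) := by
      have := sub_nonneg.2 hI
      positivity
    nlinarith [sq_nonneg (S * (r * I) + 2 * b * f x * S * r)]
  have I1 : ∫ x in Ω, ‖x - p‖ ^ (-2:ℝ) * (‖x - p‖ ^ b * f x) ^ 2 =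
      ∫ x in Ω, ‖x - p‖ ^ (2 * b - 2) * f x ^ 2 :=
    ae_eq_set hD (by filter_upwards [e] with x h hx using (h hx).2.2)
  have I2 : ∫ x in Ω, ⟪gradient f x, gradient (fun y => ‖y - p‖ ^ (2 * b) * f y) x⟫ =
      (∫ x in Ω, ‖gradient (fun y => ‖y - p‖ ^ b * f y) x‖ ^ 2) -
        b ^ 2 * ∫ x in Ω, ‖x - p‖ ^ (2 * b - 2) * f x ^ 2 := by
    rw [← integral_const_mul, ← integral_sub (hb5.integrableOn hD) ((hb2.cmul _).integrableOn hD)]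
    exact ae_eq_set hD (by filter_upwards [e] with x h hx using (h hx).1)
  have I3 : ∫ x in Ω, ‖x - p‖ ^ (2 * b) * ‖gradient f x‖ ^ 2 ≤
      2 * (∫ x in Ω, ‖gradient (fun y => ‖y - p‖ ^ b * f y) x‖ ^ 2) +
        2 * b ^ 2 * ∫ x in Ω, ‖x - p‖ ^ (2 * b - 2) * f x ^ 2 := by
    rw [← integral_const_mul, ← integral_const_mul,
      ← integral_add ((hb5.cmul _).integrableOn hD) ((hb2.cmul _).integrableOn hD)]
    exact ae_le_set hD hb1 ((hb5.cmul _).add (hb2.cmul _))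
      (by filter_upwards [e] with x h hx using (h hx).2.1)
  rw [integral_add (hb1.integrableOn hD) (hb2.integrableOn hD), I2]
  rw [I1] at hH
  have hY : 0 ≤ ∫ x in Ω, ‖x - p‖ ^ (2 * b - 2) * f x ^ 2 :=
    integral_nonneg fun x => by positivity
  nlinarith
end hardy

section repro
open scoped Nat

/-- Average of a sub-family of points. -/
def avg {r : ℕ} (q : Fin r → E3) (S : Finset (Fin r)) : E3 := (S.card : ℝ)⁻¹ • ∑ i ∈ S, q i

/-- Polarised coefficient. -/
def bco (r : ℕ) (g : E3 → ℝ) (q : Fin r → E3) : ℝ :=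
  ((r ! : ℕ) : ℝ)⁻¹ * ∑ S : Finset (Fin r), (-1) ^ (r + S.card) * ((S.card : ℝ) ^ r * g (avg q S))

/-- Local interpolation formula. -/
def Iloc (r : ℕ) (g : E3 → ℝ) (v : Fin 4 → E3) (l : Fin 4 → ℝ) : ℝ :=
  ∑ f : Fin r → Fin 4, (∏ i, l (f i)) * bco r g (v ∘ f)

theorem ryser (r : ℕ) (A : Fin r → Fin r → ℝ) :
    ∑ S : Finset (Fin r), (-1 : ℝ) ^ (r + S.card) * ∏ j, ∑ i ∈ S, A j i =
      ∑ σ : Equiv.Perm (Fin r), ∏ j, A j (σ j) := by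
  classical
  have h1 : ∀ S : Finset (Fin r), ∏ j, ∑ i ∈ S, A j i =
      ∑ t : Fin r → Fin r, if Finset.univ.image t ⊆ S then ∏ j, A j (t j) else 0 := by
    intro S
    rw [Finset.prod_univ_sum, ← Finset.sum_filter]
    refine Finset.sum_congr ?_ fun _ _ => rfl
    ext t
    simp [Fintype.mem_piFinset, Finset.image_subset_iff]
  have h2 : ∀ R : Finset (Fin r), (∑ S : Finset (Fin r), if R ⊆ S then (-1 : ℝ) ^ (r + S.card) else 0)
      = if R = Finset.univ then 1 else 0 := by
    intro R
    rw [← Finset.sum_filter]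
    have : ∑ S ∈ Finset.univ.filter (fun S => R ⊆ S), (-1 : ℝ) ^ (r + S.card) =
        ∑ U ∈ Rᶜ.powerset, (-1 : ℝ) ^ U.card := by
      refine Finset.sum_nbij' (fun S => Sᶜ) (fun S => Sᶜ) ?_ ?_ ?_ ?_ ?_
      · intro S hS; simpa using hS
      · intro U hU
        simp only [Finset.mem_powerset] at hU
        simpa using Finset.subset_compl_comm.1 hU
      · simp
      · simp
      · intro S _
        rw [Finset.card_compl, Fintype.card_fin]
        have hle : S.card ≤ r := by simpa using S.card_le_univ
        obtain ⟨k, hk⟩ := Nat.exists_eq_add_of_le hle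
        have e1 : r - S.card = k := by omega
        rw [e1, show r + S.card = S.card * 2 + k by omega, pow_add, pow_mul']
        simp
    rw [this]
    have h3 := Finset.sum_powerset_neg_one_pow_card (x := Rᶜ)
    have h4 : ∑ U ∈ Rᶜ.powerset, (-1 : ℝ) ^ U.card = ((∑ m ∈ Rᶜ.powerset, (-1 : ℤ) ^ m.card : ℤ) : ℝ) := by
      push_cast; rfl
    rw [h4, h3]
    by_cases hR : R = Finset.univ <;> simp [hR, Finset.compl_eq_empty_iff]
  simp_rw [h1, Finset.mul_sum]
  rw [Finset.sum_comm]
  have h3 : ∀ t : Fin r → Fin r, (∑ S : Finset (Fin r), (-1 : ℝ) ^ (r + S.card) *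
      if Finset.univ.image t ⊆ S then ∏ j, A j (t j) else 0) =
      if Function.Bijective t then ∏ j, A j (t j) else 0 := by
    intro t
    have : ∀ S : Finset (Fin r), ((-1 : ℝ) ^ (r + S.card) *
      if Finset.univ.image t ⊆ S then ∏ j, A j (t j) else 0) =
      (if Finset.univ.image t ⊆ S then (-1 : ℝ) ^ (r + S.card) else 0) * ∏ j, A j (t j) := by
      intro S; split_ifs <;> simp
    simp_rw [this]
    rw [← Finset.sum_mul, h2]
    have : (Finset.univ.image t = Finset.univ) ↔ Function.Bijective t := by
      rw [← Finite.surjective_iff_bijective, ← Finset.coe_inj]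
      simp [Set.range_eq_univ]
    simp [this]
  simp_rw [h3]
  rw [← Finset.sum_filter]
  symm
  refine Finset.sum_bij (fun σ _ => ⇑σ) ?_ ?_ ?_ ?_
  · intro σ _; exact Finset.mem_filter.2 ⟨Finset.mem_univ _, σ.bijective⟩
  · intro σ _ τ _ h; exact Equiv.coe_fn_injective h
  · intro t ht
    simp only [Finset.mem_filter, Finset.mem_univ, true_and] at ht
    exact ⟨Equiv.ofBijective t ht, Finset.mem_univ _, rfl⟩
  · intro σ _; rfl

theorem aff_sum {ι : Type*} (s : Finset ι) (a : E3 →ᵃ[ℝ] ℝ) (w : ι → ℝ) (v : ι → E3)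
    (hw : ∑ k ∈ s, w k = 1) : a (∑ k ∈ s, w k • v k) = ∑ k ∈ s, w k * a (v k) := by
  have h : ∀ y, a y = a.linear y + a 0 := fun y => by
    have := a.map_vadd 0 y; simpa using this
  rw [h]
  simp_rw [h (v _), mul_add, Finset.sum_add_distrib, ← Finset.sum_mul, hw, map_sum, map_smul]
  simp

theorem bco_prod (r : ℕ) (hr : 1 ≤ r) (a : Fin r → E3 →ᵃ[ℝ] ℝ) (q : Fin r → E3) :
    bco r (fun x => ∏ j, a j x) q =
      ((r ! : ℕ) : ℝ)⁻¹ * ∑ σ : Equiv.Perm (Fin r), ∏ j, a j (q (σ j)) := by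
  unfold bco
  rw [← ryser r (fun j i => a j (q i))]
  congr 1
  refine Finset.sum_congr rfl fun S _ => ?_
  congr 1
  rcases S.eq_empty_or_nonempty with rfl | hS
  · have h0 : (0:ℝ) ^ r = 0 := zero_pow (by omega)
    have : Nonempty (Fin r) := ⟨⟨0, hr⟩⟩
    simp [show r ≠ 0 by omega]
  · have hc : (S.card : ℝ) ≠ 0 := by have := hS.card_pos; positivity
    have e : (S.card : ℝ) ^ r = ∏ _j : Fin r, (S.card : ℝ) := by simp
    rw [e, ← Finset.prod_mul_distrib]
    refine Finset.prod_congr rfl fun j _ => ?_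
    unfold avg
    rw [Finset.smul_sum, aff_sum S (a j) (fun _ => (S.card : ℝ)⁻¹) q (by simp [hc]), Finset.mul_sum]
    refine Finset.sum_congr rfl fun i _ => ?_
    field_simp

theorem Iloc_prod (r : ℕ) (hr : 1 ≤ r) (a : Fin r → E3 →ᵃ[ℝ] ℝ) (v : Fin 4 → E3) (l : Fin 4 → ℝ)
    (hl : ∑ k, l k = 1) :
    Iloc r (fun x => ∏ j, a j x) v l = ∏ j, a j (∑ k, l k • v k) := by
  unfold Iloc
  simp_rw [bco_prod r hr, Finset.mul_sum]
  rw [Finset.sum_comm]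
  have h1 : ∀ σ : Equiv.Perm (Fin r), ∑ f : Fin r → Fin 4, (∏ i, l (f i)) *
      (((r ! : ℕ) : ℝ)⁻¹ * ∏ j, a j ((v ∘ f) (σ j))) =
      ((r ! : ℕ) : ℝ)⁻¹ * ∏ j, a j (∑ k, l k • v k) := by
    intro σ
    simp_rw [aff_sum _ _ l v hl, Finset.prod_univ_sum, Finset.mul_sum, Fintype.piFinset_univ]
    refine Fintype.sum_equiv (Equiv.arrowCongr σ.symm (Equiv.refl _)) _ _ fun f => ?_
    rw [Finset.prod_mul_distrib, ← Equiv.prod_comp σ (fun i => l (f i))]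
    simp
    ring
  simp_rw [h1]
  rw [Finset.sum_const, Finset.card_univ, Fintype.card_perm, Fintype.card_fin]
  have : ((r ! : ℕ) : ℝ) ≠ 0 := by exact_mod_cast (Nat.factorial_pos r).ne'
  simp [this]

theorem bco_add (r : ℕ) (g g' : E3 → ℝ) (q : Fin r → E3) :
    bco r (fun x => g x + g' x) q = bco r g q + bco r g' q := by
  unfold bco
  rw [← mul_add, ← Finset.sum_add_distrib]
  congr 1
  exact Finset.sum_congr rfl fun S _ => by ring

theorem bco_smul (r : ℕ) (c : ℝ) (g : E3 → ℝ) (q : Fin r → E3) :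
    bco r (fun x => c * g x) q = c * bco r g q := by
  unfold bco
  simp only [Finset.mul_sum]
  exact Finset.sum_congr rfl fun S _ => by ring

theorem Iloc_add (r : ℕ) (g g' : E3 → ℝ) (v : Fin 4 → E3) (l : Fin 4 → ℝ) :
    Iloc r (fun x => g x + g' x) v l = Iloc r g v l + Iloc r g' v l := by
  unfold Iloc
  rw [← Finset.sum_add_distrib]
  exact Finset.sum_congr rfl fun f _ => by rw [bco_add]; ring

theorem Iloc_smul (r : ℕ) (c : ℝ) (g : E3 → ℝ) (v : Fin 4 → E3) (l : Fin 4 → ℝ) :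
    Iloc r (fun x => c * g x) v l = c * Iloc r g v l := by
  unfold Iloc
  rw [Finset.mul_sum]
  exact Finset.sum_congr rfl fun f _ => by rw [bco_smul]; ring

/-- Reproduction of monomials. -/
theorem Iloc_list (L : List (E3 →ᵃ[ℝ] ℝ)) (r : ℕ) (hr : 1 ≤ r) (hL : L.length ≤ r)
    (v : Fin 4 → E3) (l : Fin 4 → ℝ) (hl : ∑ k, l k = 1) :
    Iloc r (fun x => (L.map (fun a => a x)).prod) v l =
      (L.map (fun a => a (∑ k, l k • v k))).prod := by
  set L' := L ++ List.replicate (r - L.length) (AffineMap.const ℝ E3 (1:ℝ)) with hL'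
  have hlen : L'.length = r := by simp [hL']; omega
  have e : ∀ x, (L.map (fun a => a x)).prod = (L'.map (fun a => a x)).prod := by
    intro x; simp [hL']
  simp_rw [e]
  clear_value L'
  subst hlen
  have e2 : ∀ x, (L'.map (fun a => a x)).prod = ∏ j : Fin L'.length, (L'[j]) x := by
    intro x
    rw [← Fin.prod_univ_fun_getElem]
    rfl
  simp_rw [e2]
  exact Iloc_prod _ hr (fun j => L'[j]) v l hl

/-- Coordinates as affine maps. -/
def coordA (i : Fin 3) : E3 →ᵃ[ℝ] ℝ := (EuclideanSpace.proj (𝕜 := ℝ) i : E3 →L[ℝ] ℝ).toLinearMap.toAffineMap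

/-- Reproduction of polynomials of degree at most `r`. -/
theorem Iloc_poly (r : ℕ) (hr : 1 ≤ r) (p : MvPolynomial (Fin 3) ℝ) (hp : p.totalDegree ≤ r)
    (v : Fin 4 → E3) (l : Fin 4 → ℝ) (hl : ∑ k, l k = 1) :
    Iloc r (fun x => MvPolynomial.eval (fun i => x i) p) v l =
      MvPolynomial.eval (fun i => (∑ k, l k • v k) i) p := by
  classical
  have e : ∀ x : E3, MvPolynomial.eval (fun i => x i) p =
      ∑ m ∈ p.support, p.coeff m * ((m.toMultiset.toList.map coordA).map (fun a => a x)).prod := by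
    intro x
    rw [MvPolynomial.eval_eq]
    refine Finset.sum_congr rfl fun m _ => ?_
    congr 1
    rw [List.map_map]
    have : ((m.toMultiset.toList).map ((fun a : E3 →ᵃ[ℝ] ℝ => a x) ∘ coordA)).prod =
        (m.toMultiset.map (fun i => x i)).prod := by
      conv_rhs => rw [← Multiset.coe_toList m.toMultiset]
      rw [Multiset.map_coe, Multiset.prod_coe]; rfl
    rw [this, Finsupp.toMultiset_map, Finsupp.prod_toMultiset, Finsupp.prod_mapDomain_index]
    · rfl
    · simp
    · intro a b c; exact pow_add _ _ _
  simp_rw [e]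
  have hs : ∀ s : Finset (Fin 3 →₀ ℕ), s ⊆ p.support → Iloc r (fun x => ∑ m ∈ s, p.coeff m *
      ((m.toMultiset.toList.map coordA).map (fun a => a x)).prod) v l = ∑ m ∈ s, p.coeff m *
      ((m.toMultiset.toList.map coordA).map (fun a => a (∑ k, l k • v k))).prod := by
    intro s
    induction s using Finset.induction_on with
    | empty => intro _; simpa using Iloc_smul r 0 (fun _ => 0) v l
    | insert m s hm ih =>
      intro hsub
      simp_rw [Finset.sum_insert hm]
      rw [Iloc_add, Iloc_smul, ih ((Finset.subset_insert m s).trans hsub), Iloc_list _ r hr _ v l hl]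
      have h1 := MvPolynomial.le_totalDegree (hsub (Finset.mem_insert_self m s))
      simp only [List.length_map, Multiset.length_toList, Finsupp.card_toMultiset]
      exact h1.trans hp
  exact hs _ subset_rfl
end repro

section fe

/-- The affine basis of a nondegenerate tetrahedron. -/
def tbas (v : Fin 4 → E3) (hv : AffineIndependent ℝ v) : AffineBasis (Fin 4) ℝ E3 :=
  ⟨v, hv, by rw [hv.affineSpan_eq_top_iff_card_eq_finrank_add_one]; simp⟩

open Classical in
/-- Barycentric coordinates. -/
def bary (v : Fin 4 → E3) (k : Fin 4) : E3 →ᵃ[ℝ] ℝ :=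
  if hv : AffineIndependent ℝ v then (tbas v hv).coord k else 0

variable {v : Fin 4 → E3}

theorem bary_eq (hv : AffineIndependent ℝ v) (k : Fin 4) : bary v k = (tbas v hv).coord k := by
  simp [bary, hv]

theorem bary_sum (hv : AffineIndependent ℝ v) (x : E3) : ∑ k, bary v k x = 1 := by
  simp_rw [bary_eq hv]; exact (tbas v hv).sum_coord_apply_eq_one x

theorem bary_comb (hv : AffineIndependent ℝ v) (x : E3) : ∑ k, bary v k x • v k = x := by
  simp_rw [bary_eq hv]; exact (tbas v hv).linear_combination_coord_eq_self x

theorem bary_vert (hv : AffineIndependent ℝ v) (k j : Fin 4) :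
    bary v k (v j) = if k = j then 1 else 0 := by
  rw [bary_eq hv]; exact (tbas v hv).coord_apply k j

theorem mem_tet (hv : AffineIndependent ℝ v) {x : E3} : x ∈ tet v ↔ ∀ k, 0 ≤ bary v k x := by
  have := (tbas v hv).convexHull_eq_nonneg_coord
  simp_rw [bary_eq hv]
  exact (Set.ext_iff.1 this x).trans Iff.rfl

theorem bary_le_one (hv : AffineIndependent ℝ v) {x : E3} (hx : x ∈ tet v) (k : Fin 4) :
    bary v k x ≤ 1 := by
  rw [← bary_sum hv x]
  exact Finset.single_le_sum (fun i _ => (mem_tet hv).1 hx i) (Finset.mem_univ k)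

theorem vert_mem (v : Fin 4 → E3) (k : Fin 4) : v k ∈ tet v := subset_convexHull ℝ _ ⟨k, rfl⟩

theorem tet_convex (v : Fin 4 → E3) : Convex ℝ (tet v) := convex_convexHull ℝ _

theorem tet_compact (v : Fin 4 → E3) : IsCompact (tet v) := (Set.finite_range v).isCompact_convexHull (𝕜 := ℝ)

/-- The interpolation operator. -/
def Iop (T : Finset (Fin 4 → E3)) (r : ℕ) (g : E3 → ℝ) (x : E3) : ℝ :=
  open Classical in
  if h : ∃ v ∈ T, x ∈ tet v then Iloc r g h.choose (fun k => bary h.choose k x) else 0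

theorem Iloc_sub (r : ℕ) (g : E3 → ℝ) (hv : AffineIndependent ℝ v) (S : Finset E3)
    (hS : (S : Set E3) ⊆ Set.range v) (m : E3 → ℝ) (hm : ∑ p ∈ S, m p = 1) (x : E3)
    (hx : x = ∑ p ∈ S, m p • p) :
    Iloc r g v (fun k => bary v k x) =
      ∑ q ∈ Fintype.piFinset (fun _ : Fin r => S), (∏ i, m (q i)) * bco r g q := by
  classical
  have hb : ∀ k, bary v k x = if v k ∈ S then m (v k) else 0 := by
    intro k
    rw [hx]
    refine (aff_sum S (bary v k) m id hm).trans ?_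
    have : ∀ p ∈ S, m p * bary v k (id p) = if v k = p then m p else 0 := by
      intro p hp
      obtain ⟨j, rfl⟩ := hS hp
      rw [id, bary_vert hv]
      by_cases hkj : k = j
      · simp [hkj]
      · simp [hkj, hv.injective.eq_iff]
    rw [Finset.sum_congr rfl this, Finset.sum_ite_eq]
  unfold Iloc
  simp_rw [hb]
  have hinj : Function.Injective (fun f : Fin r → Fin 4 => v ∘ f) := fun f f' h =>
    funext fun i => hv.injective (congrFun h i)
  rw [show ∑ f : Fin r → Fin 4, (∏ i, if v (f i) ∈ S then m (v (f i)) else 0) * bco r g (v ∘ f) =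
    ∑ q ∈ Finset.univ.image (fun f : Fin r → Fin 4 => v ∘ f),
      (∏ i, if q i ∈ S then m (q i) else 0) * bco r g q by
      rw [Finset.sum_image (fun a _ b _ h => hinj h)]; rfl]
  rw [← Finset.sum_subset (s₁ := Fintype.piFinset (fun _ : Fin r => S))
    (s₂ := Finset.univ.image (fun f : Fin r → Fin 4 => v ∘ f))]
  · refine Finset.sum_congr rfl fun q hq => ?_
    rw [Fintype.mem_piFinset] at hq
    congr 1
    exact Finset.prod_congr rfl fun i _ => by simp [hq i]
  · intro q hq
    rw [Fintype.mem_piFinset] at hq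
    choose f hf using fun i => hS (hq i)
    exact Finset.mem_image.2 ⟨f, Finset.mem_univ _, funext hf⟩
  · intro q _ hq
    rw [Fintype.mem_piFinset] at hq
    push Not at hq
    obtain ⟨i, hi⟩ := hq
    rw [Finset.prod_eq_zero (Finset.mem_univ i) (by simp [hi]), zero_mul]

theorem range_eq_of_tet_eq {w : Fin 4 → E3} (hv : AffineIndependent ℝ v)
    (h : tet v = tet w) : Set.range v ⊆ Set.range w := by
  rintro _ ⟨k, rfl⟩
  have : v k ∈ (tet w).extremePoints ℝ := by
    rw [← h]
    refine ⟨vert_mem v k, ?_⟩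
    intro x hx y hy hxy
    have hs := hxy
    obtain ⟨a, b, ha, hb, hab, e⟩ := hxy
    have key : ∀ j, j ≠ k → bary v j x = 0 := by
      intro j hj
      have e1 := bary_vert hv j k
      rw [← e] at e1
      have := aff_sum Finset.univ (bary v j) ![a, b] ![x, y] (by simpa [Fin.sum_univ_two] using hab)
      simp only [Fin.sum_univ_two, Matrix.cons_val_zero, Matrix.cons_val_one] at this
      rw [this, if_neg hj] at e1
      have h1 := (mem_tet hv).1 hx j
      have h2 := (mem_tet hv).1 hy j
      have h3 := mul_nonneg ha.le h1
      have h4 := mul_nonneg hb.le h2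
      have h5 : a * bary v j x = 0 := by linarith
      exact (mul_eq_zero.1 h5).resolve_left ha.ne'
    have h1 : bary v k x = 1 := by
      rw [← bary_sum hv x, Finset.sum_eq_single k (fun j _ hj => key j hj) (by simp)]
    rw [← bary_comb hv x, Finset.sum_eq_single k (fun j _ hj => by rw [key j hj, zero_smul]) (by simp),
      h1, one_smul]
  exact extremePoints_convexHull_subset this

/-- Standing assumptions on the mesh. -/
structure Msh (Ω : Set E3) (T : Finset (Fin 4 → E3)) (h c : ℝ) (r : ℕ) : Prop where
  D : Dom Ω
  P : IsTetPartition Ω T h c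
  h0 : 0 < h
  c0 : 0 < c
  r1 : 1 ≤ r

variable {Ω : Set E3} {T : Finset (Fin 4 → E3)} {h c : ℝ} {r : ℕ}

theorem Msh.ai (M : Msh Ω T h c r) (hv : v ∈ T) : AffineIndependent ℝ v := M.P.1 v hv

theorem Msh.sub (M : Msh Ω T h c r) (hv : v ∈ T) : tet v ⊆ closure Ω := by
  rw [← M.P.2.1]; exact Set.subset_biUnion_of_mem (u := fun v => tet v) hv

theorem Msh.cover (M : Msh Ω T h c r) {x : E3} (hx : x ∈ closure Ω) : ∃ v ∈ T, x ∈ tet v := by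
  rw [← M.P.2.1] at hx; simpa using hx

theorem Msh.dist_le (M : Msh Ω T h c r) (hv : v ∈ T) {x y : E3} (hx : x ∈ tet v) (hy : y ∈ tet v) :
    ‖x - y‖ ≤ h := by
  rw [← dist_eq_norm]
  exact (dist_le_diam_of_mem (tet_compact v).isBounded hx hy).trans (M.P.2.2.2.2.1 v hv)

theorem Msh.Iop_eq (M : Msh Ω T h c r) (hv : v ∈ T) (g : E3 → ℝ) {x : E3} (hx : x ∈ tet v) :
    Iop T r g x = Iloc r g v (fun k => bary v k x) := by
  classical
  have hex : ∃ v ∈ T, x ∈ tet v := ⟨v, hv, hx⟩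
  unfold Iop
  rw [dif_pos hex]
  have hw := hex.choose_spec
  set w := hex.choose
  have hmem : x ∈ convexHull ℝ (Set.range v ∩ Set.range w) := by
    by_cases htw : tet v = tet w
    · rw [Set.inter_eq_left.2 (range_eq_of_tet_eq (M.ai hv) htw)]; exact hx
    · rcases M.P.2.2.2.1 v hv w hw.1 htw with h0 | h0
      · exact absurd (show x ∈ tet v ∩ tet w from ⟨hx, hw.2⟩) (by simp [h0])
      · rw [← h0]; exact ⟨hx, hw.2⟩
  have hfin : (Set.range v ∩ Set.range w).Finite := (Set.finite_range v).inter_of_left _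
  rw [← hfin.coe_toFinset, Finset.mem_convexHull] at hmem
  obtain ⟨m, _, hm1, hm2⟩ := hmem
  rw [Finset.centerMass_eq_of_sum_1 _ _ hm1] at hm2
  have hS : (hfin.toFinset : Set E3) = Set.range v ∩ Set.range w := hfin.coe_toFinset
  rw [Iloc_sub r g (M.ai hw.1) hfin.toFinset (by rw [hS]; exact Set.inter_subset_right) m hm1 x
      (by rw [← hm2]; rfl),
    Iloc_sub r g (M.ai hv) hfin.toFinset (by rw [hS]; exact Set.inter_subset_left) m hm1 x
      (by rw [← hm2]; rfl)]

theorem avg_mem {A : Set E3} (hA : Convex ℝ A) {q : Fin r → E3} (hq : ∀ i, q i ∈ A)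
    {S : Finset (Fin r)} (hS : S.Nonempty) : avg q S ∈ A := by
  unfold avg
  rw [Finset.smul_sum]
  refine hA.sum_mem (fun _ _ => by positivity) ?_ fun i _ => hq i
  have : (S.card : ℝ) ≠ 0 := by have := hS.card_pos; positivity
  simp [this]

/-- The constant in the coefficient bound. -/
def bK (r : ℕ) : ℝ := ∑ S : Finset (Fin r), (S.card : ℝ) ^ r

theorem bK_nonneg (r : ℕ) : 0 ≤ bK r := Finset.sum_nonneg fun _ _ => by positivity

theorem bco_bound (hr : 1 ≤ r) {A : Set E3} (hA : Convex ℝ A) {q : Fin r → E3} (hq : ∀ i, q i ∈ A)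
    {g : E3 → ℝ} {B : ℝ} (hg : ∀ x ∈ A, |g x| ≤ B) : |bco r g q| ≤ bK r * B := by
  unfold bco bK
  rw [abs_mul, Finset.sum_mul]
  have h1 : |((r.factorial : ℕ) : ℝ)⁻¹| ≤ 1 := by
    rw [abs_of_nonneg (by positivity)]
    exact inv_le_one_of_one_le₀ (by exact_mod_cast Nat.succ_le_of_lt (Nat.factorial_pos r))
  refine (mul_le_of_le_one_left (abs_nonneg _) h1).trans ?_
  refine (Finset.abs_sum_le_sum_abs _ _).trans (Finset.sum_le_sum fun S _ => ?_)
  rw [abs_mul, abs_pow, abs_neg, abs_one, one_pow, one_mul, abs_mul, abs_of_nonneg (by positivity)]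
  rcases S.eq_empty_or_nonempty with rfl | hS
  · simp [show r ≠ 0 by omega]
  · gcongr
    exact hg _ (avg_mem hA hq hS)

theorem Iop_zero_bdry (M : Msh Ω T h c r) {g : E3 → ℝ} (hg : ∀ x ∈ frontier Ω, g x = 0) {x : E3}
    (hx : x ∉ Ω) : Iop T r g x = 0 := by
  classical
  by_cases hxc : x ∈ closure Ω
  swap
  · unfold Iop
    rw [dif_neg]
    rintro ⟨v, hv, hxv⟩
    exact hxc (M.sub hv hxv)
  obtain ⟨v, hv, hxv⟩ := M.cover hxc
  rw [M.Iop_eq hv g hxv]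
  obtain ⟨f, hf⟩ := geometric_hahn_banach_open_point M.D.cv M.D.op hx
  have hfc : ∀ y ∈ closure Ω, f y ≤ f x := by
    intro y hy
    exact closure_minimal (fun a ha => (hf a ha).le) (isClosed_le f.continuous continuous_const) hy
  have hai := M.ai hv
  have hk : ∀ k, bary v k x ≠ 0 → v k ∈ frontier Ω ∩ {y | f y = f x} := by
    have hs : ∑ k, bary v k x * (f x - f (v k)) = 0 := by
      simp_rw [mul_sub, Finset.sum_sub_distrib, ← Finset.sum_mul, bary_sum hai]
      conv_lhs => rw [one_mul]; enter [1]; rw [← bary_comb hai x]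
      simp
    rw [Finset.sum_eq_zero_iff_of_nonneg fun k _ => mul_nonneg ((mem_tet hai).1 hxv k)
      (sub_nonneg.2 (hfc _ (M.sub hv (vert_mem v k))))] at hs
    intro k hk0
    have h1 : f (v k) = f x := by
      have := (mul_eq_zero.1 (hs k (Finset.mem_univ k))).resolve_left hk0
      linarith
    refine ⟨⟨M.sub hv (vert_mem v k), fun hi => ?_⟩, h1⟩
    exact absurd (hf _ (interior_subset hi)) (by simp [h1])
  unfold Iloc
  refine Finset.sum_eq_zero fun q _ => ?_
  by_cases h0 : ∏ i, bary v (q i) x = 0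
  · simp [h0]
  have h1 : ∀ i, (v ∘ q) i ∈ closure Ω ∩ {y | f y = f x} := fun i =>
    have := hk (q i) (fun h => h0 (Finset.prod_eq_zero (Finset.mem_univ i) h))
    ⟨this.1.1, this.2⟩
  have hcv : Convex ℝ (closure Ω ∩ {y | f y = f x}) :=
    M.D.cv.closure.inter (convex_hyperplane f.toLinearMap.isLinear (f x))
  have := bco_bound M.r1 hcv h1 (g := g) (B := 0) (fun y hy => by
    rw [hg y ⟨hy.1, fun hi => absurd (hf _ (interior_subset hi)) (by simp [show f y = f x from hy.2])⟩]
    simp)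
  rw [mul_zero] at this
  rw [abs_nonpos_iff.1 this, mul_zero]

theorem Iloc_congr (M : Msh Ω T h c r) (v : Fin 4 → E3) {g g' : E3 → ℝ}
    (hg : ∀ x ∈ tet v, g x = g' x) (l : Fin 4 → ℝ) : Iloc r g v l = Iloc r g' v l := by
  unfold Iloc
  refine Finset.sum_congr rfl fun q _ => ?_
  congr 1
  have h1 := bco_bound M.r1 (tet_convex v) (q := v ∘ q) (fun i => vert_mem v _)
    (g := fun x => g x + (-1) * g' x) (B := 0) (fun x hx => by simp [hg x hx])
  rw [mul_zero, bco_add, bco_smul] at h1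
  have := abs_nonpos_iff.1 h1
  linarith
end fe

section quant
variable {v : Fin 4 → E3} {Ω : Set E3} {T : Finset (Fin 4 → E3)} {h c : ℝ} {r : ℕ}

theorem bary_lip (M : Msh Ω T h c r) (hv : v ∈ T) (k : Fin 4) (x y : E3) :
    |bary v k x - bary v k y| ≤ (c * h)⁻¹ * ‖x - y‖ := by
  obtain ⟨z, hz⟩ := M.P.2.2.2.2.2 v hv
  have hai := M.ai hv
  have hs : 0 < c * h := mul_pos M.c0 M.h0
  have e : ∀ a b : E3, bary v k a - bary v k b = (bary v k).linear (a - b) := by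
    intro a b; rw [← vsub_eq_sub a b, AffineMap.linearMap_vsub]; rfl
  rcases eq_or_ne x y with rfl | hxy
  · simp
  have hn : 0 < ‖x - y‖ := norm_pos_iff.2 (sub_ne_zero.2 hxy)
  set t := c * h / ‖x - y‖ with ht
  have htp : 0 < t := div_pos hs hn
  have hmem : z + t • (x - y) ∈ tet v := hz (by
    rw [mem_closedBall, dist_eq_norm, add_sub_cancel_left, norm_smul, Real.norm_of_nonneg htp.le, ht,
      div_mul_cancel₀ _ hn.ne'])
  have hz' : z ∈ tet v := hz (mem_closedBall_self hs.le)
  have h1 : |bary v k (z + t • (x - y)) - bary v k z| ≤ 1 := by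
    rw [abs_le]
    have := (mem_tet hai).1 hmem k
    have := (mem_tet hai).1 hz' k
    have := bary_le_one hai hmem k
    have := bary_le_one hai hz' k
    constructor <;> linarith
  rw [e, add_sub_cancel_left, map_smul, ← e, smul_eq_mul, abs_mul, abs_of_pos htp] at h1
  rw [inv_mul_eq_div, le_div_iff₀ hs]
  rw [ht, div_mul_eq_mul_div, div_le_one hn] at h1
  linarith

theorem prod_diff {ι : Type*} (s : Finset ι) (a b : ι → ℝ) (ha : ∀ i, |a i| ≤ 1) (hb : ∀ i, |b i| ≤ 1) :
    |∏ i ∈ s, a i - ∏ i ∈ s, b i| ≤ ∑ i ∈ s, |a i - b i| := by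
  classical
  induction s using Finset.induction_on with
  | empty => simp
  | insert i s hi ih =>
    rw [Finset.prod_insert hi, Finset.prod_insert hi, Finset.sum_insert hi]
    have e : a i * ∏ j ∈ s, a j - b i * ∏ j ∈ s, b j =
      (a i - b i) * ∏ j ∈ s, a j + b i * (∏ j ∈ s, a j - ∏ j ∈ s, b j) := by ring
    rw [e]
    refine (abs_add_le _ _).trans ?_
    rw [abs_mul, abs_mul, Finset.abs_prod]
    have h1 : ∏ j ∈ s, |a j| ≤ 1 := Finset.prod_le_one (fun _ _ => abs_nonneg _) fun j _ => ha j
    gcongr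
    · exact mul_le_of_le_one_right (abs_nonneg _) h1
    · exact (mul_le_of_le_one_left (abs_nonneg _) (hb i)).trans ih

/-- The interpolation constant. -/
def CI (r : ℕ) (c : ℝ) : ℝ := 4 ^ r * r * bK r / c

theorem CI_nonneg (hc : 0 < c) : 0 ≤ CI r c := by
  have := bK_nonneg r
  unfold CI; positivity

theorem Iloc_lip (M : Msh Ω T h c r) (hv : v ∈ T) {g : E3 → ℝ} {B : ℝ} (hg : ∀ x ∈ tet v, |g x| ≤ B)
    {x y : E3} (hx : x ∈ tet v) (hy : y ∈ tet v) :
    |Iloc r g v (fun k => bary v k x) - Iloc r g v (fun k => bary v k y)| ≤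
      CI r c / h * B * ‖x - y‖ := by
  have hai := M.ai hv
  have hc := M.c0
  have hh := M.h0
  have hB : 0 ≤ B := (abs_nonneg _).trans (hg x hx)
  unfold Iloc
  rw [← Finset.sum_sub_distrib]
  have hb := bK_nonneg r
  have ht : ∀ z ∈ tet v, ∀ k, |bary v k z| ≤ 1 := fun z hz k => by
    rw [abs_of_nonneg ((mem_tet hai).1 hz k)]; exact bary_le_one hai hz k
  have h1 : ∀ f : Fin r → Fin 4, |(∏ i, bary v (f i) x) * bco r g (v ∘ f) -
      (∏ i, bary v (f i) y) * bco r g (v ∘ f)| ≤ (r * ((c * h)⁻¹ * ‖x - y‖)) * (bK r * B) := by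
    intro f
    rw [← sub_mul, abs_mul]
    gcongr
    · refine (prod_diff _ _ _ (fun i => ht x hx _) (fun i => ht y hy _)).trans ?_
      refine (Finset.sum_le_card_nsmul _ _ _ fun i _ => bary_lip M hv (f i) x y).trans ?_
      simp
    · exact bco_bound M.r1 (tet_convex v) (fun i => vert_mem v _) hg
  refine (Finset.abs_sum_le_sum_abs _ _).trans
    ((Finset.sum_le_card_nsmul _ _ _ fun f _ => h1 f).trans (le_of_eq ?_))
  simp [CI]
  field_simp

/-- Basic interpolation error. -/
theorem Iop_err (M : Msh Ω T h c r) (hv : v ∈ T) {g q : E3 → ℝ} {B : ℝ}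
    (p : MvPolynomial (Fin 3) ℝ) (hp : p.totalDegree ≤ r)
    (hgq : ∀ x ∈ tet v, g x = q x + MvPolynomial.eval (fun i => x i) p)
    (hq : ∀ x ∈ tet v, |q x| ≤ B * h ^ 2)
    (hql : ∀ x ∈ tet v, ∀ y ∈ tet v, |q x - q y| ≤ B * h * ‖x - y‖)
    {x y : E3} (hx : x ∈ tet v) (hy : y ∈ tet v) :
    |(g x - Iop T r g x) - (g y - Iop T r g y)| ≤ (CI r c + 1) * B * h * ‖x - y‖ := by
  have hai := M.ai hv
  have hI : ∀ z ∈ tet v, g z - Iop T r g z = q z - Iloc r q v (fun k => bary v k z) := by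
    intro z hz
    rw [M.Iop_eq hv g hz, Iloc_congr M v hgq, Iloc_add, Iloc_poly r M.r1 p hp v _ (bary_sum hai z),
      bary_comb hai, hgq z hz]
    ring
  rw [hI x hx, hI y hy]
  have h1 := hql x hx y hy
  have h2 := Iloc_lip M hv hq hx hy
  have e : CI r c / h * (B * h ^ 2) = CI r c * B * h := by field_simp [M.h0.ne']
  rw [e] at h2
  calc |q x - Iloc r q v (fun k => bary v k x) - (q y - Iloc r q v (fun k => bary v k y))|
      = |(q x - q y) - (Iloc r q v (fun k => bary v k x) - Iloc r q v (fun k => bary v k y))| := by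
        congr 1; ring
    _ ≤ _ := (abs_sub _ _).trans (by linarith)

theorem grad_le_of_lip {A : Set E3} {f : E3 → ℝ} {L : ℝ} (hL : 0 ≤ L)
    (hf : ∀ x ∈ A, ∀ y ∈ A, |f x - f y| ≤ L * ‖x - y‖) {x : E3} (hx : x ∈ interior A) :
    ‖gradient f x‖ ≤ L := by
  rw [norm_gradient_eq]
  refine norm_fderiv_le_of_lip' ℝ hL ?_
  filter_upwards [mem_interior_iff_mem_nhds.1 hx] with y hy
  exact hf y hy x (interior_subset hx)

/-- Affine polynomials. -/
theorem exists_affpoly (a : E3) (b : ℝ) (hr : 1 ≤ r) : ∃ p : MvPolynomial (Fin 3) ℝ, p.totalDegree ≤ r ∧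
    ∀ x : E3, MvPolynomial.eval (fun i => x i) p = ⟪a, x⟫ + b := by
  refine ⟨(∑ i, MvPolynomial.C (a i) * MvPolynomial.X i) + MvPolynomial.C b, ?_, fun x => ?_⟩
  · refine (MvPolynomial.totalDegree_add _ _).trans (max_le ?_ (by simp))
    refine (MvPolynomial.totalDegree_finsetSum _ _).trans (Finset.sup_le fun i _ => ?_)
    refine (MvPolynomial.totalDegree_mul _ _).trans ?_
    simpa using hr
  · simp [sum_e3, Fin.sum_univ_three]

/-- Superapproximation, pointwise Lipschitz form. -/
theorem superapprox (M : Msh Ω T h c r) (hv : v ∈ T) {ω w : E3 → ℝ} {A1 A2 W0 W1 : ℝ} (a : E3)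
    (hA1 : 0 ≤ A1) (hA2 : 0 ≤ A2)
    (hω1 : ∀ x ∈ tet v, ∀ y ∈ tet v, |ω x - ω y| ≤ A1 * ‖x - y‖)
    (hω2 : ∀ x ∈ tet v, ∀ y ∈ tet v, |ω x - ω y - ⟪a, x - y⟫| ≤ A2 * h * ‖x - y‖)
    (p : MvPolynomial (Fin 3) ℝ) (hp : p.totalDegree ≤ r)
    (hw : ∀ x ∈ tet v, w x = MvPolynomial.eval (fun i => x i) p)
    (hw0 : ∀ x ∈ tet v, |w x| ≤ W0)
    (hw1 : ∀ x ∈ tet v, ∀ y ∈ tet v, |w x - w y| ≤ W1 * ‖x - y‖) (hW1 : 0 ≤ W1)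
    {x y : E3} (hx : x ∈ tet v) (hy : y ∈ tet v) :
    |(ω x * w x - Iop T r (fun z => ω z * w z) x) - (ω y * w y - Iop T r (fun z => ω z * w z) y)| ≤
      (CI r c + 1) * (2 * A1 * W1 + A2 * W0) * h * ‖x - y‖ := by
  set z := v 0
  have hz : z ∈ tet v := vert_mem v 0
  have hh := M.h0
  obtain ⟨P, hP, hPe⟩ := exists_affpoly (r := r) (w z • a) (- ω z * w z + w z * ω z - w z * ⟪a, z⟫) M.r1
  have hW0 := (abs_nonneg _).trans (hw0 z hz)
  refine Iop_err M hv (g := fun z => ω z * w z)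
    (q := fun x => (ω x - ω z) * (w x - w z) + w z * (ω x - ω z - ⟪a, x - z⟫))
    (MvPolynomial.C (ω z) * p + P) ?_ ?_ ?_ ?_ hx hy
  · refine (MvPolynomial.totalDegree_add _ _).trans (max_le ?_ hP)
    refine (MvPolynomial.totalDegree_mul _ _).trans ?_
    simpa using hp
  · intro x hx
    simp only [map_add, map_mul, MvPolynomial.eval_C, hPe, ← hw x hx, inner_smul_left, inner_sub_right]
    simp
    ring
  · intro x hx
    have h1 := hω1 x hx z hz
    have h2 := hω2 x hx z hz
    have h3 := hw1 x hx z hz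
    have h4 := M.dist_le hv hx hz
    refine (abs_add_le _ _).trans ?_
    rw [abs_mul, abs_mul]
    calc |ω x - ω z| * |w x - w z| + |w z| * |ω x - ω z - ⟪a, x - z⟫|
        ≤ (A1 * h) * (W1 * h) + W0 * (A2 * h * h) := by
          gcongr
          · exact h1.trans (by gcongr)
          · exact h3.trans (by gcongr)
          · exact hw0 z hz
          · exact h2.trans (by gcongr)
      _ ≤ _ := by nlinarith [mul_nonneg (mul_nonneg hA1 hW1) (sq_nonneg h)]
  · intro x hx y hy
    have h1 := hω1 x hx y hy
    have h2 := hω2 x hx y hy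
    have h3 := hw1 x hx y hy
    have h4 := M.dist_le hv hx hz
    have h4' := M.dist_le hv hy hz
    have h5 := hω1 y hy z hz
    have h6 := hw1 x hx z hz
    have e : (ω x - ω z) * (w x - w z) + w z * (ω x - ω z - ⟪a, x - z⟫) -
      ((ω y - ω z) * (w y - w z) + w z * (ω y - ω z - ⟪a, y - z⟫)) =
      (ω x - ω y) * (w x - w z) + (ω y - ω z) * (w x - w y) + w z * (ω x - ω y - ⟪a, x - y⟫) := by
      simp only [inner_sub_right]; ring
    simp only [e]
    refine (abs_add_three _ _ _).trans ?_
    rw [abs_mul, abs_mul, abs_mul]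
    calc |ω x - ω y| * |w x - w z| + |ω y - ω z| * |w x - w y| + |w z| * |ω x - ω y - ⟪a, x - y⟫|
        ≤ (A1 * ‖x - y‖) * (W1 * h) + (A1 * h) * (W1 * ‖x - y‖) + W0 * (A2 * h * ‖x - y‖) := by
          gcongr
          · exact h6.trans (by gcongr)
          · exact h5.trans (by gcongr)
          · exact hw0 z hz
      _ = _ := by ring
end quant

section inv
open MvPolynomial (eval pderiv)
variable {v : Fin 4 → E3} {Ω : Set E3} {T : Finset (Fin 4 → E3)} {h c : ℝ} {r : ℕ}

/-- Polynomial function. -/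
def ev (p : MvPolynomial (Fin 3) ℝ) (x : E3) : ℝ := eval (fun i => x i) p

theorem ev_cont (p : MvPolynomial (Fin 3) ℝ) : Continuous (ev p) := by
  exact (MvPolynomial.continuous_eval p).comp (by fun_prop)

theorem deg_pderiv (p : MvPolynomial (Fin 3) ℝ) (i : Fin 3) :
    (pderiv i p).totalDegree ≤ p.totalDegree := by
  conv_lhs => rw [p.as_sum, map_sum]
  refine (MvPolynomial.totalDegree_finsetSum _ _).trans (Finset.sup_le fun m hm => ?_)
  rw [MvPolynomial.pderiv_monomial]
  refine (MvPolynomial.totalDegree_monomial_le _ _).trans ?_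
  refine le_trans ?_ (MvPolynomial.le_totalDegree hm)
  change (m - _).degree ≤ m.degree
  exact Finsupp.degree_mono tsub_le_self

theorem ev_grad (p : MvPolynomial (Fin 3) ℝ) (x : E3) :
    HasGradientAt (ev p) (∑ i, ev (pderiv i p) x • EuclideanSpace.single i (1:ℝ)) x := by
  unfold ev
  induction p using MvPolynomial.induction_on with
  | C a => simpa using hasGradientAt_const x a
  | add p q hp hq =>
    simp only [map_add, add_smul, Finset.sum_add_distrib]
    exact hp.add' hq
  | mul_X p j hp =>
    have hj : HasGradientAt (fun y : E3 => y j) (EuclideanSpace.single j (1:ℝ)) x := by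
      have := hasGradientAt_inner (EuclideanSpace.single j (1:ℝ)) 0 x
      convert this using 2
      rw [sub_zero, real_inner_comm, inner_single]
    have := hp.mul' hj
    simp only [map_mul, MvPolynomial.eval_X, MvPolynomial.pderiv_mul, MvPolynomial.pderiv_X, map_add]
    convert this using 1
    simp only [add_smul, Finset.sum_add_distrib, Finset.smul_sum, smul_smul]
    rw [add_comm]
    congr 1
    · rw [Finset.sum_eq_single j]
      · simp
      · intro i _ hij; simp [hij.symm]
      · simp
    · exact Finset.sum_congr rfl fun i _ => by rw [mul_comm]

/-- Volume of the unit ball. -/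
def vb : ℝ := (volume (ball (0 : E3) 1)).toReal

theorem vb_pos : 0 < vb := ENNReal.toReal_pos (measure_ball_pos _ _ one_pos).ne' measure_ball_lt_top.ne

theorem vol_ball (x : E3) {s : ℝ} (hs : 0 ≤ s) : (volume (ball x s)).toReal = s ^ 3 * vb := by
  rw [Measure.addHaar_ball _ _ hs, ENNReal.toReal_mul, ENNReal.toReal_ofReal (by positivity)]
  simp [vb]

/-- reference corner points -/
def crn : Fin 4 → E3 := ![0, EuclideanSpace.single 0 1, EuclideanSpace.single 1 1, EuclideanSpace.single 2 1]

theorem crn_le (k : Fin 4) : ‖crn k‖ ≤ 1 := by fin_cases k <;> simp [crn]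

theorem bco_corner (hr : 1 ≤ r) (g : E3 → ℝ) (o : E3) (s : ℝ) (f : Fin r → Fin 4) :
    |bco r g (fun i => o + s • crn (f i))| ≤
      ∑ S : Finset (Fin r), (r:ℝ) ^ r * |g (o + s • avg (fun i => crn (f i)) S)| := by
  unfold bco
  rw [abs_mul]
  have h1 : |((r.factorial : ℕ) : ℝ)⁻¹| ≤ 1 := by
    rw [abs_of_nonneg (by positivity)]
    exact inv_le_one_of_one_le₀ (by exact_mod_cast Nat.succ_le_of_lt (Nat.factorial_pos r))
  refine (mul_le_of_le_one_left (abs_nonneg _) h1).trans ?_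
  refine (Finset.abs_sum_le_sum_abs _ _).trans (Finset.sum_le_sum fun S _ => ?_)
  rw [abs_mul, abs_pow, abs_neg, abs_one, one_pow, one_mul, abs_mul, abs_of_nonneg (by positivity)]
  rcases S.eq_empty_or_nonempty with rfl | hS
  · simp [show r ≠ 0 by omega]; positivity
  · have : (S.card : ℝ) ≠ 0 := by have := hS.card_pos; positivity
    have e : avg (fun i => o + s • crn (f i)) S = o + s • avg (fun i => crn (f i)) S := by
      unfold avg
      rw [Finset.sum_add_distrib, ← Finset.smul_sum, smul_add, smul_comm]
      simp [← Nat.cast_smul_eq_nsmul ℝ, smul_smul, this]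
    rw [e]
    gcongr
    exact_mod_cast (by simpa using S.card_le_univ)

/-- The constant of the inverse estimate. -/
def Cinv (r : ℕ) (c : ℝ) : ℝ :=
  (((Finset.univ : Finset ((Fin r → Fin 4) × Finset (Fin r))).card : ℝ) *
    ((4 + 12 / c) ^ r * r ^ r)) ^ 2 / ((c / 4) ^ 3 * vb)

theorem Cinv_nonneg (hc : 0 < c) : 0 ≤ Cinv r c := by
  have := vb_pos
  unfold Cinv; positivity

/-- Inverse estimate. -/
theorem inv_est (M : Msh Ω T h c r) (hv : v ∈ T) (p : MvPolynomial (Fin 3) ℝ) (hp : p.totalDegree ≤ r)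
    {x : E3} (hx : x ∈ tet v) : ev p x ^ 2 ≤ Cinv r c / h ^ 3 * ∫ y in interior (tet v), ev p y ^ 2 := by
  have hc := M.c0
  have hh := M.h0
  obtain ⟨x0, hx0⟩ := M.P.2.2.2.2.2 v hv
  set s := c * h / 4 with hs
  have hsp : 0 < s := by positivity
  set ι := (Fin r → Fin 4) × Finset (Fin r)
  set N : ℝ := ((Finset.univ : Finset ι).card : ℝ)
  set C0 : ℝ := (4 + 12 / c) ^ r * r ^ r with hC0
  set A : ι → E3 := fun i => avg (fun j => crn (i.1 j)) i.2 with hA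
  have hA1 : ∀ i, ‖A i‖ ≤ 1 := by
    intro i
    rcases i.2.eq_empty_or_nonempty with h0 | h0
    · simp [hA, avg, h0]
    · have := avg_mem (convex_closedBall (0:E3) 1) (q := fun j => crn (i.1 j))
        (fun j => by simpa using crn_le _) h0
      simpa using this
  have key : ∀ y ∈ ball (0:E3) s, ev p x ^ 2 ≤ (N * C0 ^ 2) * ∑ i, ev p (x0 + y + s • A i) ^ 2 := by
    intro y hy
    set o := x0 + y
    set l : Fin 4 → ℝ := ![1 - ((x - o) 0 + (x - o) 1 + (x - o) 2) / s, (x - o) 0 / s, (x - o) 1 / s, (x - o) 2 / s]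
    have hl1 : ∑ k, l k = 1 := by
      simp [l, Fin.sum_univ_four]; ring
    have hlx : ∑ k, l k • (o + s • crn k) = x := by
      simp only [smul_add, Finset.sum_add_distrib, ← Finset.sum_smul, hl1, one_smul]
      rw [← eq_sub_iff_add_eq']
      ext i
      fin_cases i <;> simp [Fin.sum_univ_four, l, crn] <;> field_simp
    have hno : ‖x - o‖ ≤ h + s := by
      have h1 := M.dist_le hv hx (hx0 (mem_closedBall_self (by positivity)))
      have h2 : ‖y‖ < s := by simpa using hy
      calc ‖x - o‖ = ‖(x - x0) - y‖ := by congr 1; simp only [o]; abel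
        _ ≤ _ := (norm_sub_le _ _).trans (by linarith)
    have hlb : ∀ i : Fin 3, |(x - o) i / s| ≤ 1 + 4 / c := by
      intro i
      rw [abs_div, abs_of_pos hsp, div_le_iff₀ hsp]
      have h3 : |(x - o) i| ≤ ‖x - o‖ := by simpa using PiLp.norm_apply_le (x - o) i
      refine (h3.trans hno).trans (le_of_eq ?_)
      rw [hs]; field_simp; ring
    have hl : ∀ k, |l k| ≤ 4 + 12 / c := by
      have h0 := hlb 0
      have h1 := hlb 1
      have h2 := hlb 2
      have hcp : 0 < 1 / c := by positivity
      have e4 : 4 / c = 4 * (1 / c) := by ring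
      have e12 : 12 / c = 12 * (1 / c) := by ring
      rw [e4, abs_le] at h0 h1 h2
      intro k
      rw [e12, abs_le]
      fin_cases k <;> simp [l, add_div] <;> norm_num at * <;> constructor <;> linarith
    have h1 : ev p x = Iloc r (ev p) (fun k => o + s • crn k) l := by
      have := Iloc_poly r M.r1 p hp (fun k => o + s • crn k) l hl1
      rw [hlx] at this
      exact this.symm
    have h2 : |ev p x| ≤ ∑ i : ι, C0 * |ev p (o + s • A i)| := by
      rw [h1]
      unfold Iloc
      refine (Finset.abs_sum_le_sum_abs _ _).trans ?_
      rw [Fintype.sum_prod_type]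
      refine Finset.sum_le_sum fun f _ => ?_
      rw [abs_mul]
      have h3 : |∏ i, l (f i)| ≤ (4 + 12 / c) ^ r := by
        rw [Finset.abs_prod]
        refine (Finset.prod_le_prod (fun _ _ => abs_nonneg _) fun i _ => hl (f i)).trans ?_
        simp
      calc _ ≤ (4 + 12 / c) ^ r * ∑ S : Finset (Fin r), (r:ℝ) ^ r * |ev p (o + s • A (f, S))| := by
            gcongr
            exact bco_corner M.r1 (ev p) o s f
        _ = _ := by rw [Finset.mul_sum]; exact Finset.sum_congr rfl fun S _ => by rw [hC0]; ring
    calc ev p x ^ 2 = |ev p x| ^ 2 := (sq_abs _).symm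
      _ ≤ (∑ i : ι, C0 * |ev p (o + s • A i)|) ^ 2 := by gcongr
      _ ≤ N * ∑ i : ι, (C0 * |ev p (o + s • A i)|) ^ 2 := sq_sum_le_card_mul_sum_sq
      _ = _ := by
        simp only [mul_pow, sq_abs, ← Finset.mul_sum]; ring
  have hcont := ev_cont p
  have hint : ∀ i, IntegrableOn (fun y => ev p (x0 + y + s • A i) ^ 2) (ball 0 s) := fun i =>
    ((Continuous.continuousOn (by fun_prop)).integrableOn_compact (isCompact_closedBall 0 s)).mono_set
      ball_subset_closedBall
  have hI : ∀ i, ∫ y in ball (0:E3) s, ev p (x0 + y + s • A i) ^ 2 ≤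
      ∫ y in interior (tet v), ev p y ^ 2 := by
    intro i
    have e : ∫ y in ball (0:E3) s, ev p (x0 + y + s • A i) ^ 2 =
        ∫ y in ball (x0 + s • A i) s, ev p y ^ 2 := by
      rw [← integral_indicator measurableSet_ball, ← integral_indicator measurableSet_ball,
        ← integral_add_left_eq_self (indicator (ball (x0 + s • A i) s) _) (x0 + s • A i)]
      congr 1; ext y
      simp only [indicator, mem_ball, dist_zero_right, dist_self_add_left]
      rw [show x0 + y + s • A i = x0 + s • A i + y by abel]
    rw [e]
    refine setIntegral_mono_set ?_ (ae_of_all _ fun y => sq_nonneg _) (LE.le.eventuallyLE ?_)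
    · exact ((hcont.pow 2).continuousOn.integrableOn_compact (tet_compact v)).mono_set interior_subset
    · refine interior_maximal ?_ isOpen_ball
      refine (ball_subset_closedBall.trans (closedBall_subset_closedBall' ?_)).trans hx0
      rw [dist_self_add_left, norm_smul, Real.norm_of_nonneg hsp.le]
      have := mul_le_mul_of_nonneg_left (hA1 i) hsp.le
      rw [hs] at *
      nlinarith [mul_pos hc hh]
  have h1 : (s ^ 3 * vb) * ev p x ^ 2 ≤ (N * C0 ^ 2) * (N * ∫ y in interior (tet v), ev p y ^ 2) := by
    rw [← vol_ball (0:E3) hsp.le]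
    calc _ = ∫ _ in ball (0:E3) s, ev p x ^ 2 := by
            rw [setIntegral_const]; rfl
      _ ≤ ∫ y in ball (0:E3) s, (N * C0 ^ 2) * ∑ i, ev p (x0 + y + s • A i) ^ 2 := by
            refine setIntegral_mono_on ?_ ?_ measurableSet_ball key
            · exact integrableOn_const measure_ball_lt_top.ne
            · exact (integrable_finsetSum _ fun i _ => hint i).const_mul _
      _ = (N * C0 ^ 2) * ∑ i, ∫ y in ball (0:E3) s, ev p (x0 + y + s • A i) ^ 2 := by
            rw [integral_const_mul, integral_finsetSum _ fun i _ => hint i]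
      _ ≤ _ := by
            gcongr
            refine (Finset.sum_le_card_nsmul _ _ _ fun i _ => hI i).trans ?_
            rw [nsmul_eq_mul]
  have hvb := vb_pos
  rw [← le_div_iff₀' (by positivity)] at h1
  refine h1.trans (le_of_eq ?_)
  have : Cinv r c = (N * C0) ^ 2 / ((c / 4) ^ 3 * vb) := rfl
  rw [this, hs]
  field_simp
end inv

section glob
open MvPolynomial (eval pderiv)
variable {v : Fin 4 → E3} {Ω : Set E3} {T : Finset (Fin 4 → E3)} {h c : ℝ} {r : ℕ}

theorem Msh.int_sub (M : Msh Ω T h c r) (hv : v ∈ T) : interior (tet v) ⊆ Ω := by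
  rcases Ω.eq_empty_or_nonempty with h0 | h0
  · have := M.sub hv
    rw [h0, closure_empty] at this
    exact absurd (this (vert_mem v 0)) (by simp)
  · refine (interior_mono (M.sub hv)).trans ?_
    rw [M.D.cv.interior_closure_eq_interior_of_nonempty_interior (by rwa [M.D.op.interior_eq]),
      M.D.op.interior_eq]

theorem Msh.ae_int (M : Msh Ω T h c r) : ∀ᵐ x, x ∈ Ω → ∃ v ∈ T, x ∈ interior (tet v) := by
  have h1 : ∀ᵐ x, ∀ v ∈ T, x ∉ frontier (tet v) := by
    rw [Filter.eventually_all_finset]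
    intro v _
    rw [ae_iff]; simpa using (tet_convex v).addHaar_frontier volume
  filter_upwards [h1] with x hx hxΩ
  obtain ⟨v, hv, hxv⟩ := M.cover (subset_closure hxΩ)
  refine ⟨v, hv, ?_⟩
  by_contra hn
  exact hx v hv ⟨subset_closure hxv, hn⟩

theorem Msh.sum_le (M : Msh Ω T h c r) {F G : E3 → ℝ} (hF : IntegrableOn F Ω) (hG : IntegrableOn G Ω)
    (hle : ∀ v ∈ T, ∫ x in interior (tet v), F x ≤ ∫ x in interior (tet v), G x) :
    ∫ x in Ω, F x ≤ ∫ x in Ω, G x := by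
  classical
  have e0 : (⋃ K ∈ T.image tet, interior K) =ᵐ[volume] Ω := by
    filter_upwards [M.ae_int] with x hx
    refine propext ⟨fun hx' => ?_, fun hx' => ?_⟩
    · obtain ⟨K, hK, hxK⟩ := Set.mem_iUnion₂.1 hx'
      obtain ⟨v, hv, rfl⟩ := Finset.mem_image.1 hK
      exact M.int_sub hv hxK
    · obtain ⟨v, hv, hxv⟩ := hx hx'
      exact Set.mem_iUnion₂.2 ⟨tet v, Finset.mem_image_of_mem _ hv, hxv⟩
  have e : ∀ H : E3 → ℝ, IntegrableOn H Ω → ∫ x in Ω, H x = ∑ K ∈ T.image tet, ∫ x in interior K, H x := by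
    intro H hH
    rw [← setIntegral_congr_set e0, integral_biUnion_finset]
    · intro K _; exact isOpen_interior.measurableSet
    · intro K hK K' hK' hne
      obtain ⟨v, hv, rfl⟩ := Finset.mem_image.1 hK
      obtain ⟨w, hw, rfl⟩ := Finset.mem_image.1 hK'
      exact Set.disjoint_iff_inter_eq_empty.2 (M.P.2.2.1 v hv w hw hne)
    · intro K hK
      obtain ⟨v, hv, rfl⟩ := Finset.mem_image.1 hK
      exact hH.mono_set (M.int_sub hv)
  rw [e F hF, e G hG]
  refine Finset.sum_le_sum fun K hK => ?_
  obtain ⟨v, hv, rfl⟩ := Finset.mem_image.1 hK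
  exact hle v hv

theorem Msh.lip (M : Msh Ω T h c r) {f : E3 → ℝ} {L : ℝ} (hf : ContinuousOn f (closure Ω))
    (hL : ∀ v ∈ T, ∀ x ∈ tet v, ∀ y ∈ tet v, |f x - f y| ≤ L * ‖x - y‖) :
    ∀ x ∈ closure Ω, ∀ y ∈ closure Ω, |f x - f y| ≤ L * ‖x - y‖ := by
  have key : ∀ x ∈ closure Ω, ∀ y ∈ closure Ω, f y - f x ≤ L * ‖x - y‖ := by
    intro x hx y hy
    set γ : ℝ → E3 := fun t => x + t • (y - x) with hγ
    have hγc : Continuous γ := by fun_prop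
    have hγm : ∀ t ∈ Icc (0:ℝ) 1, γ t ∈ closure Ω := fun t ht =>
      M.D.cv.closure.add_smul_sub_mem hx hy ht
    have hγd : ∀ s t, ‖γ s - γ t‖ = |s - t| * ‖x - y‖ := by
      intro s t
      have : γ s - γ t = (s - t) • (y - x) := by simp only [hγ]; rw [sub_smul]; abel
      rw [this, norm_smul, norm_sub_rev y x]; rfl
    have := image_le_of_liminf_slope_right_le_deriv_boundary (f := fun t => f (γ t)) (a := 0) (b := 1)
      (hf.comp hγc.continuousOn hγm) (B := fun t => f x + (L * ‖x - y‖) * t) (B' := fun _ => L * ‖x - y‖)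
      (by simp [hγ]) (by fun_prop)
      (fun t _ => by
        have := ((hasDerivAt_id t).const_mul (L * ‖x - y‖)).const_add (f x)
        simpa using this.hasDerivWithinAt) ?_ (right_mem_Icc.2 zero_le_one)
    · simp [hγ] at this; linarith
    intro t ht q hq
    have h1 : ∃ᶠ z in nhdsWithin t (Ioi t), ∃ v ∈ T, γ z ∈ tet v := by
      refine Filter.Eventually.frequently ?_
      filter_upwards [Ioo_mem_nhdsGT ht.2] with z hz
      exact M.cover (hγm z ⟨ht.1.trans hz.1.le, hz.2.le⟩)
    obtain ⟨v, hv, h2⟩ : ∃ v ∈ T, ∃ᶠ z in nhdsWithin t (Ioi t), γ z ∈ tet v := by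
      by_contra hcon
      push Not at hcon
      apply h1
      have := (Filter.eventually_all_finset T).2 (fun v hv => hcon v hv)
      filter_upwards [this] with z hz
      push Not
      exact hz
    have h3 : γ t ∈ tet v := by
      have h4 : ∃ᶠ z in nhds t, z ∈ γ ⁻¹' tet v := h2.filter_mono nhdsWithin_le_nhds
      have h5 := mem_closure_iff_frequently.2 h4
      rwa [((tet_compact v).isClosed.preimage hγc).closure_eq] at h5
    refine (h2.and_eventually self_mem_nhdsWithin).mono fun z hz => ?_
    have hzt : t < z := hz.2
    have := hL v hv _ hz.1 _ h3
    rw [hγd, abs_of_pos (sub_pos.2 hzt)] at this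
    rw [slope_def_field]
    refine lt_of_le_of_lt ?_ hq
    rw [div_le_iff₀ (sub_pos.2 hzt)]
    linarith [le_abs_self (f (γ z) - f (γ t))]
  intro x hx y hy
  rw [abs_le]
  have h1 := key x hx y hy
  have h2 := key y hy x hx
  rw [norm_sub_rev] at h2
  constructor <;> linarith

theorem ev_lip (p : MvPolynomial (Fin 3) ℝ) (v : Fin 4 → E3) : ∃ L, 0 ≤ L ∧ ∀ x ∈ tet v, ∀ y ∈ tet v,
    |ev p x - ev p y| ≤ L * ‖x - y‖ := by
  have hc : Continuous fun x => ∑ i, ev (pderiv i p) x • EuclideanSpace.single i (1:ℝ) := by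
    have := fun i => ev_cont (pderiv i p)
    fun_prop
  obtain ⟨L, hL⟩ := (tet_compact v).exists_bound_of_continuousOn hc.continuousOn
  refine ⟨L.toNNReal, L.toNNReal.2, fun x hx y hy => ?_⟩
  exact (lipOn_of_grad (tet_convex v) (fun x _ => ev_grad p x) hL).norm_sub_le hx hy

theorem Msh.lipOn (M : Msh Ω T h c r) {f : E3 → ℝ} (hf : ContinuousOn f (closure Ω))
    (hL : ∀ v ∈ T, ∃ L, 0 ≤ L ∧ ∀ x ∈ tet v, ∀ y ∈ tet v, |f x - f y| ≤ L * ‖x - y‖) :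
    ∃ K, LipschitzOnWith K f (closure Ω) := by
  classical
  choose! L hL0 hL using hL
  refine ⟨(∑ v ∈ T, L v).toNNReal, LipschitzOnWith.of_dist_le_mul fun x hx y hy => ?_⟩
  rw [dist_eq_norm, dist_eq_norm, Real.coe_toNNReal _ (Finset.sum_nonneg hL0)]
  refine M.lip hf (fun v hv x hx y hy => (hL v hv x hx y hy).trans ?_) x hx y hy
  gcongr
  exact Finset.single_le_sum hL0 hv

theorem Msh.LO_of_Sh0 (M : Msh Ω T h c r) {f : E3 → ℝ} (hf : MemSh0 Ω T r f) : LO Ω (Ω.indicator f) := by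
  obtain ⟨K, hK⟩ := M.lipOn hf.1.1 (fun v hv => by
    obtain ⟨p, _, hp⟩ := hf.1.2 v hv
    obtain ⟨L, hL0, hL⟩ := ev_lip p v
    exact ⟨L, hL0, fun x hx y hy => by rw [hp x hx, hp y hy]; exact hL x hx y hy⟩)
  exact LO.of_lipOn hK hf.2

theorem aff_poly (a : E3 →ᵃ[ℝ] ℝ) : ∃ p : MvPolynomial (Fin 3) ℝ, p.totalDegree ≤ 1 ∧
    ∀ x : E3, ev p x = a x := by
  obtain ⟨p, hp, he⟩ := exists_affpoly (r := 1)
    ((InnerProductSpace.toDual ℝ E3).symm a.linear.toContinuousLinearMap) (a 0) le_rfl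
  refine ⟨p, hp, fun x => ?_⟩
  rw [ev, he, InnerProductSpace.toDual_symm_apply]
  have := a.map_vadd 0 x
  simpa using this.symm

theorem Iloc_mempoly (g : E3 → ℝ) (v : Fin 4 → E3) : ∃ p : MvPolynomial (Fin 3) ℝ, p.totalDegree ≤ r ∧
    ∀ x, Iloc r g v (fun k => bary v k x) = ev p x := by
  choose P hP hPe using fun k => aff_poly (bary v k)
  refine ⟨∑ f : Fin r → Fin 4, (∏ i, P (f i)) * MvPolynomial.C (bco r g (v ∘ f)), ?_, fun x => ?_⟩
  · refine (MvPolynomial.totalDegree_finsetSum _ _).trans (Finset.sup_le fun f _ => ?_)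
    refine (MvPolynomial.totalDegree_mul _ _).trans ?_
    rw [MvPolynomial.totalDegree_C, add_zero]
    refine (MvPolynomial.totalDegree_finsetProd _ _).trans ?_
    refine (Finset.sum_le_card_nsmul _ _ 1 fun i _ => hP _).trans (by simp)
  · simp only [Iloc, ev, map_sum, map_mul, map_prod, MvPolynomial.eval_C]
    refine Finset.sum_congr rfl fun f _ => ?_
    congr 1
    exact Finset.prod_congr rfl fun i _ => (hPe _ x).symm

theorem Msh.contOn (M : Msh Ω T h c r) {f : E3 → ℝ} (hf : ∀ v ∈ T, ContinuousOn f (tet v)) :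
    ContinuousOn f (closure Ω) := by
  have := (locallyFinite_of_finite (fun v : T => tet v.1)).continuousOn_iUnion (g := f)
    (fun v => (tet_compact v.1).isClosed) (fun v => hf v.1 v.2)
  rw [← M.P.2.1]
  convert this using 1
  simp [Set.iUnion_subtype]

theorem Msh.Iop_mem (M : Msh Ω T h c r) {g : E3 → ℝ}
    (hg0 : ∀ x ∈ frontier Ω, g x = 0) : MemSh0 Ω T r (Iop T r g) := by
  have hp : ∀ v ∈ T, ∃ p : MvPolynomial (Fin 3) ℝ, p.totalDegree ≤ r ∧ ∀ x ∈ tet v, Iop T r g x = ev p x := by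
    intro v hv
    obtain ⟨p, h1, h2⟩ := Iloc_mempoly (r := r) g v
    exact ⟨p, h1, fun x hx => by rw [M.Iop_eq hv g hx, h2]⟩
  refine ⟨⟨M.contOn fun v hv => ?_, hp⟩, fun x hx => Iop_zero_bdry M hg0 fun h => ?_⟩
  · obtain ⟨p, _, h2⟩ := hp v hv
    exact (ev_cont p).continuousOn.congr h2
  · exact hx.2 (by rwa [M.D.op.interior_eq])

theorem Msh.Iop_LO (M : Msh Ω T h c r) {g : E3 → ℝ}
    (hg0 : ∀ x ∈ frontier Ω, g x = 0) : LO Ω (Iop T r g) := by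
  have := M.LO_of_Sh0 (M.Iop_mem hg0)
  convert this using 1
  ext x
  by_cases hx : x ∈ Ω
  · simp [hx]
  · rw [indicator_of_notMem hx, Iop_zero_bdry M hg0 hx]

theorem LO.front {f : E3 → ℝ} (hD : Dom Ω) (hf : LO Ω f) : ∀ x ∈ frontier Ω, f x = 0 := fun x hx =>
  hf.2 x fun h => hx.2 (by rwa [hD.op.interior_eq])

/-- Constant in the superapproximation estimate. -/
def Csa (r : ℕ) (c : ℝ) : ℝ := 8 * (CI r c + 1) ^ 2 * Cinv r c

theorem Csa_nonneg (hc : 0 < c) : 0 ≤ Csa r c := by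
  have := Cinv_nonneg (r := r) hc
  unfold Csa; positivity

theorem sai (M : Msh Ω T h c r) (hv : v ∈ T) {ω w : E3 → ℝ} {A1 A2 : ℝ} (a : E3)
    (hA1 : 0 ≤ A1) (hA2 : 0 ≤ A2)
    (hω1 : ∀ x ∈ tet v, ∀ y ∈ tet v, |ω x - ω y| ≤ A1 * ‖x - y‖)
    (hω2 : ∀ x ∈ tet v, ∀ y ∈ tet v, |ω x - ω y - ⟪a, x - y⟫| ≤ A2 * h * ‖x - y‖)
    (hw : ∃ p : MvPolynomial (Fin 3) ℝ, p.totalDegree ≤ r ∧ ∀ x ∈ tet v, w x = ev p x)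
    {x : E3} (hx : x ∈ interior (tet v)) :
    ‖gradient (fun z => ω z * w z - Iop T r (fun z => ω z * w z) z) x‖ ^ 2 ≤ Csa r c / h *
      (A1 ^ 2 * (∫ y in interior (tet v), ‖gradient w y‖ ^ 2) +
       A2 ^ 2 * ∫ y in interior (tet v), w y ^ 2) := by
  obtain ⟨p, hp, hpw⟩ := hw
  have hh := M.h0
  have hCi := Cinv_nonneg (r := r) M.c0
  have hCI := CI_nonneg (r := r) M.c0
  have e1 : ∫ y in interior (tet v), w y ^ 2 = ∫ y in interior (tet v), ev p y ^ 2 :=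
    setIntegral_congr_fun isOpen_interior.measurableSet fun y hy => by
      simp only [hpw y (interior_subset hy)]
  have hns : ∀ y, ‖∑ i, ev (pderiv i p) y • EuclideanSpace.single i (1:ℝ)‖ ^ 2 = ∑ i, ev (pderiv i p) y ^ 2 := by
    intro y
    rw [nsq_e3]; simp [Fin.sum_univ_three]
  have e2 : ∫ y in interior (tet v), ‖gradient w y‖ ^ 2 =
      ∑ i, ∫ y in interior (tet v), ev (pderiv i p) y ^ 2 := by
    rw [← integral_finsetSum]
    · refine setIntegral_congr_fun isOpen_interior.measurableSet fun y hy => ?_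
      rw [gradient_congr isOpen_interior (fun z hz => hpw z (interior_subset hz)) hy, (ev_grad p y).gradient, hns]
    · intro i _
      exact (((ev_cont _).pow 2).continuousOn.integrableOn_compact (tet_compact v)).mono_set interior_subset
  set I0 := ∫ y in interior (tet v), w y ^ 2 with hI0
  set I1 := ∫ y in interior (tet v), ‖gradient w y‖ ^ 2 with hI1
  have hI0n : 0 ≤ I0 := integral_nonneg fun _ => sq_nonneg _
  have hI1n : 0 ≤ I1 := integral_nonneg fun _ => sq_nonneg _
  set W0 := Real.sqrt (Cinv r c / h ^ 3 * I0)
  set W1 := Real.sqrt (Cinv r c / h ^ 3 * I1)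
  have hW0 : W0 ^ 2 = Cinv r c / h ^ 3 * I0 := Real.sq_sqrt (by positivity)
  have hW1 : W1 ^ 2 = Cinv r c / h ^ 3 * I1 := Real.sq_sqrt (by positivity)
  have hW0n : 0 ≤ W0 := Real.sqrt_nonneg _
  have hW1n : 0 ≤ W1 := Real.sqrt_nonneg _
  have h0 : ∀ x ∈ tet v, |w x| ≤ W0 := fun x hx => Real.abs_le_sqrt (by
    rw [hpw x hx, e1]; exact inv_est M hv p hp hx)
  have h1 : ∀ x ∈ tet v, ‖∑ i, ev (pderiv i p) x • EuclideanSpace.single i (1:ℝ)‖ ≤ W1 := fun x hx =>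
    Real.le_sqrt_of_sq_le (by
      rw [hns, e2, Finset.mul_sum]
      exact Finset.sum_le_sum fun i _ => inv_est M hv _ ((deg_pderiv p i).trans hp) hx)
  have h2 : ∀ x ∈ tet v, ∀ y ∈ tet v, |w x - w y| ≤ W1 * ‖x - y‖ := fun x hx y hy => by
    have := (lipOn_of_grad (tet_convex v) (fun x _ => ev_grad p x) h1).norm_sub_le hx hy
    rw [Real.coe_toNNReal _ hW1n] at this
    rw [hpw x hx, hpw y hy]; exact this
  have h3 := grad_le_of_lip (f := fun z => ω z * w z - Iop T r (fun z => ω z * w z) z)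
    (L := (CI r c + 1) * (2 * A1 * W1 + A2 * W0) * h) (by positivity)
    (fun x hx y hy => superapprox M hv a hA1 hA2 hω1 hω2 p hp hpw h0 h2 hW1n hx hy) hx
  calc _ ≤ ((CI r c + 1) * (2 * A1 * W1 + A2 * W0) * h) ^ 2 := by gcongr
    _ = ((CI r c + 1) * h) ^ 2 * (2 * A1 * W1 + A2 * W0) ^ 2 := by ring
    _ ≤ ((CI r c + 1) * h) ^ 2 * (8 * (A1 ^ 2 * W1 ^ 2) + 8 * (A2 ^ 2 * W0 ^ 2)) := by
        gcongr
        nlinarith [sq_nonneg (2 * A1 * W1 - A2 * W0), sq_nonneg (A2 * W0)]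
    _ = _ := by rw [hW0, hW1, Csa]; field_simp

/-- Local hypotheses for the weighted superapproximation. -/
def SAH (T : Finset (Fin 4 → E3)) (h : ℝ) (ω m b1 b2 : E3 → ℝ) : Prop :=
  ∀ v ∈ T, ∃ A1 A2 : ℝ, ∃ a : E3, 0 ≤ A1 ∧ 0 ≤ A2 ∧
    (∀ x ∈ tet v, ∀ y ∈ tet v, |ω x - ω y| ≤ A1 * ‖x - y‖) ∧
    (∀ x ∈ tet v, ∀ y ∈ tet v, |ω x - ω y - ⟪a, x - y⟫| ≤ A2 * h * ‖x - y‖) ∧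
    ∀ x ∈ interior (tet v), ∀ y ∈ interior (tet v), m x * A1 ^ 2 ≤ b1 y ∧ m x * A2 ^ 2 ≤ b2 y

theorem sag (M : Msh Ω T h c r) {ω w m b1 b2 : E3 → ℝ} (H : SAH T h ω m b1 b2)
    (hw : ∀ v ∈ T, ∃ p : MvPolynomial (Fin 3) ℝ, p.totalDegree ≤ r ∧ ∀ x ∈ tet v, w x = ev p x)
    (hwb : BM Ω w) (hwg : BM Ω (gradient w)) (hL : LO Ω (fun z => ω z * w z))
    (hm : BM Ω m) (hm0 : ∀ x ∈ Ω, 0 ≤ m x) (hb1 : BM Ω b1) (hb2 : BM Ω b2) :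
    ∫ x in Ω, m x * ‖gradient (fun z => ω z * w z - Iop T r (fun z => ω z * w z) z) x‖ ^ 2 ≤
      Csa r c * vb * h ^ 2 * ∫ x in Ω, (b1 x * ‖gradient w x‖ ^ 2 + b2 x * w x ^ 2) := by
  have hh := M.h0
  have hC := Csa_nonneg (r := r) M.c0
  have hvb := vb_pos
  have hLI := hL.sub (M.Iop_LO (hL.front M.D))
  have hF := hm.mul hLI.gbm.nsq
  have hG := (hb1.mul hwg.nsq).add (hb2.mul hwb.sq)
  rw [← integral_const_mul]
  refine M.sum_le (hF.integrableOn M.D) ((hG.cmul _).integrableOn M.D) fun v hv => ?_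
  obtain ⟨A1, A2, a, hA1, hA2, hω1, hω2, hmb⟩ := H v hv
  have hiΩ := M.int_sub hv
  have hJ := (hG.integrableOn M.D).mono_set hiΩ
  set J := ∫ y in interior (tet v), (b1 y * ‖gradient w y‖ ^ 2 + b2 y * w y ^ 2) with hJd
  have hvol : (volume (interior (tet v))).toReal ≤ h ^ 3 * vb := by
    rw [← vol_ball (v 0) hh.le]
    have : volume (interior (tet v)) ≤ volume (ball (v 0) h) := by
      rw [← Measure.addHaar_closedBall_eq_addHaar_ball]
      refine measure_mono fun x hx => ?_
      rw [mem_closedBall, dist_eq_norm]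
      exact M.dist_le hv (interior_subset hx) (vert_mem v 0)
    exact ENNReal.toReal_mono measure_ball_lt_top.ne this
  have hI1 := (hwg.nsq.integrableOn M.D).mono_set hiΩ
  have hI0 := (hwb.sq.integrableOn M.D).mono_set hiΩ
  have hpt : ∀ x ∈ interior (tet v), m x * ‖gradient (fun z => ω z * w z - Iop T r (fun z => ω z * w z) z) x‖ ^ 2
      ≤ Csa r c / h * J := by
    intro x hx
    have h1 := sai M hv a hA1 hA2 hω1 hω2 (hw v hv) hx
    refine (mul_le_mul_of_nonneg_left h1 (hm0 x (hiΩ hx))).trans ?_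
    rw [mul_left_comm]
    gcongr
    calc _ = ∫ y in interior (tet v), (m x * A1 ^ 2 * ‖gradient w y‖ ^ 2 + m x * A2 ^ 2 * w y ^ 2) := by
          rw [integral_add (hI1.const_mul _) (hI0.const_mul _), integral_const_mul, integral_const_mul]; ring
      _ ≤ J := by
          refine setIntegral_mono_on ((hI1.const_mul _).add (hI0.const_mul _)) hJ isOpen_interior.measurableSet ?_
          intro y hy
          have := hmb x hx y hy
          exact add_le_add (mul_le_mul_of_nonneg_right this.1 (sq_nonneg _))
            (mul_le_mul_of_nonneg_right this.2 (sq_nonneg _))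
  have hJ0 : 0 ≤ J := setIntegral_nonneg isOpen_interior.measurableSet fun y hy => by
    have h1 := hmb y hy y hy
    have h2 := hm0 y (hiΩ hy)
    have h3 : 0 ≤ b1 y := le_trans (by positivity) h1.1
    have h4 : 0 ≤ b2 y := le_trans (by positivity) h1.2
    positivity
  have hfin : volume (interior (tet v)) ≠ ⊤ := ((tet_compact v).isBounded.subset interior_subset).measure_lt_top.ne
  calc _ ≤ ∫ x in interior (tet v), Csa r c / h * J :=
        setIntegral_mono_on ((hF.integrableOn M.D).mono_set hiΩ) (integrableOn_const hfin)
          isOpen_interior.measurableSet hpt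
    _ = (volume (interior (tet v))).toReal * (Csa r c / h * J) := by rw [setIntegral_const]; rfl
    _ ≤ (h ^ 3 * vb) * (Csa r c / h * J) := by gcongr
    _ = _ := by rw [integral_const_mul, ← hJd]; field_simp
end glob

/-- Finite element functions extended by zero. -/
def FE (Ω : Set E3) (T : Finset (Fin 4 → E3)) (r : ℕ) (f : E3 → ℝ) : Prop :=
  MemSh0 Ω T r f ∧ ∀ x, x ∉ Ω → f x = 0

section ritz
variable {Ω : Set E3} {T : Finset (Fin 4 → E3)} {h c : ℝ} {r : ℕ}

theorem FE.LO (M : Msh Ω T h c r) {f : E3 → ℝ} (hf : FE Ω T r f) : LO Ω f := by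
  have := M.LO_of_Sh0 hf.1
  rwa [Set.indicator_eq_self.2 (fun x hx => by_contra fun hn => hx (hf.2 x hn))] at this

theorem Msh.Iop_FE (M : Msh Ω T h c r) {g : E3 → ℝ} (hg0 : ∀ x ∈ frontier Ω, g x = 0) :
    FE Ω T r (Iop T r g) := ⟨M.Iop_mem hg0, (M.Iop_LO hg0).2⟩

theorem FE.lin {f g : E3 → ℝ} (a b : ℝ) (hf : FE Ω T r f) (hg : FE Ω T r g) :
    FE Ω T r (fun x => a * f x + b * g x) := by
  refine ⟨⟨⟨(hf.1.1.1.const_smul a).add (hg.1.1.1.const_smul b), fun v hv => ?_⟩, fun x hx => ?_⟩,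
    fun x hx => ?_⟩
  · obtain ⟨p, hp, hpe⟩ := hf.1.1.2 v hv
    obtain ⟨q, hq, hqe⟩ := hg.1.1.2 v hv
    refine ⟨MvPolynomial.C a * p + MvPolynomial.C b * q, ?_, fun x hx => ?_⟩
    · refine (MvPolynomial.totalDegree_add _ _).trans (max_le ?_ ?_) <;>
      · refine (MvPolynomial.totalDegree_mul _ _).trans ?_
        simpa
    · simp [hpe x hx, hqe x hx]
  · simp [hf.1.2 x hx, hg.1.2 x hx]
  · simp [hf.2 x hx, hg.2 x hx]

/-- The finite element space as a submodule. -/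
def FEs (Ω : Set E3) (T : Finset (Fin 4 → E3)) (r : ℕ) : Submodule ℝ (E3 → ℝ) where
  carrier := {f | FE Ω T r f}
  add_mem' {f g} hf hg := by
    have := FE.lin 1 1 hf hg
    simp only [one_mul] at this; exact this
  zero_mem' := ⟨⟨⟨continuousOn_const, fun v _ => ⟨0, by simp, by simp⟩⟩, by simp⟩, by simp⟩
  smul_mem' a f hf := by
    have := FE.lin a 0 hf hf
    simp only [zero_mul, add_zero] at this; exact this

theorem Msh.fd (M : Msh Ω T h c r) : FiniteDimensional ℝ (FEs Ω T r) := by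
  let N : FEs Ω T r →ₗ[ℝ] (T × (Fin r → Fin 4) × Finset (Fin r) → ℝ) :=
    { toFun := fun f i => (f : E3 → ℝ) (avg ((i.1 : Fin 4 → E3) ∘ i.2.1) i.2.2)
      map_add' := fun f g => by ext i; rfl
      map_smul' := fun a f => by ext i; rfl }
  refine FiniteDimensional.of_injective N ?_
  rw [← LinearMap.ker_eq_bot, LinearMap.ker_eq_bot']
  intro f hf
  ext x
  have hF : FE Ω T r f := f.2
  by_cases hx : x ∈ Ω
  swap
  · exact hF.2 x hx
  obtain ⟨v, hv, hxv⟩ := M.cover (subset_closure hx)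
  obtain ⟨p, hp, hpe⟩ := hF.1.1.2 v hv
  have h1 := Iloc_poly r M.r1 p hp v (fun k => bary v k x) (bary_sum (M.ai hv) x)
  rw [bary_comb (M.ai hv) x, ← hpe x hxv, ← Iloc_congr M v hpe] at h1
  rw [← h1]
  show _ = (0:ℝ)
  unfold Iloc
  refine Finset.sum_eq_zero fun q _ => ?_
  have : bco r f (v ∘ q) = 0 := by
    unfold bco
    rw [Finset.sum_eq_zero, mul_zero]
    intro S _
    have := congrFun hf (⟨v, hv⟩, q, S)
    have e : (f : E3 → ℝ) (avg (v ∘ q) S) = 0 := this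
    rw [e]; ring
  rw [this, mul_zero]

theorem Dom.exists_pole (hD : Dom Ω) : ∃ p n κ, Pole Ω p n κ := by
  obtain ⟨R, hR, hb⟩ := hD.bound 0
  set n : E3 := EuclideanSpace.single 0 1
  have hn : ‖n‖ = 1 := by simp [n]
  refine ⟨-(R + 1) • n, n, 1, hn, one_pos, fun x hx => ?_⟩
  have h1 := abs_real_inner_le_norm n x
  have h2 := hb x hx
  rw [sub_zero] at h2
  rw [hn, one_mul] at h1
  rw [inner_sub_right, inner_smul_right, real_inner_self_eq_norm_sq, hn]
  linarith [neg_abs_le ⟪n, x⟫]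

theorem LO.eq_zero (hD : Dom Ω) {f : E3 → ℝ} (hf : LO Ω f)
    (h0 : ∫ x in Ω, ‖gradient f x‖ ^ 2 = 0) : f = 0 := by
  obtain ⟨p, n, κ, hp⟩ := hD.exists_pole
  have h1 := hardy hD hp hf
  rw [h0, mul_zero] at h1
  have hb : BM Ω (fun x => ‖x - p‖ ^ (-2:ℝ) * f x ^ 2) := (hp.bm hD _).mul (hf.bm hD).sq
  have hnn : ∀ x, 0 ≤ ‖x - p‖ ^ (-2:ℝ) * f x ^ 2 := fun x => by positivity
  have h2 := (integral_eq_zero_iff_of_nonneg hnn (hb.integrableOn hD)).1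
    (le_antisymm h1 (integral_nonneg hnn))
  have h3 := (ae_restrict_iff' hD.meas).1 h2
  refine MeasureTheory.Measure.eq_of_ae_eq (μ := volume) ?_ hf.cont continuous_zero
  filter_upwards [h3] with x hx
  by_cases hxO : x ∈ Ω
  · have h4 : ‖x - p‖ ^ (-2:ℝ) * f x ^ 2 = 0 := hx hxO
    have h5 : ‖x - p‖ ^ (-2:ℝ) ≠ 0 := (Real.rpow_pos_of_pos (hp.rpos hxO) _).ne'
    exact pow_eq_zero_iff two_ne_zero |>.1 ((mul_eq_zero.1 h4).resolve_left h5)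
  · simpa using hf.2 x hxO

theorem LO.grad_lin {f g : E3 → ℝ} (hf : LO Ω f) (hg : LO Ω g) (a b : ℝ) :
    ∀ᵐ x, gradient (fun y => a * f y + b * g y) x = a • gradient f x + b • gradient g x := by
  filter_upwards [hf.ae, hg.ae] with x h1 h2
  exact ((h1.hasGradientAt.cmul a).add' (h2.hasGradientAt.cmul b)).gradient

theorem LO.inner_lin (hD : Dom Ω) {f g : E3 → ℝ} (hf : LO Ω f) (hg : LO Ω g) (a b : ℝ)
    {G : E3 → E3} (hG : BM Ω G) :
    ∫ x in Ω, ⟪G x, gradient (fun y => a * f y + b * g y) x⟫ =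
      a * (∫ x in Ω, ⟪G x, gradient f x⟫) + b * ∫ x in Ω, ⟪G x, gradient g x⟫ := by
  rw [← integral_const_mul, ← integral_const_mul, ← integral_add]
  · refine ae_eq_set hD ?_
    filter_upwards [hf.grad_lin hg a b] with x hx _
    rw [hx, inner_add_right, inner_smul_right, inner_smul_right]
  · exact ((hG.inner hf.gbm).cmul a).integrableOn hD
  · exact ((hG.inner hg.gbm).cmul b).integrableOn hD

/-- The functional `χ ↦ ∫ G·∇χ` on the finite element space. -/
def Msh.func (M : Msh Ω T h c r) {G : E3 → E3} (hG : BM Ω G) : FEs Ω T r →ₗ[ℝ] ℝ where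
  toFun χ := ∫ x in Ω, ⟪G x, gradient (χ : E3 → ℝ) x⟫
  map_add' f g := by
    have := LO.inner_lin M.D (FE.LO M f.2) (FE.LO M g.2) 1 1 hG
    simp only [one_mul] at this; exact this
  map_smul' a f := by
    have := LO.inner_lin M.D (FE.LO M f.2) (FE.LO M f.2) a 0 hG
    simp only [zero_mul, add_zero] at this; exact this

/-- Existence of Ritz projections. -/
theorem Msh.exists_ritz (M : Msh Ω T h c r) {G : E3 → E3} (hG : BM Ω G) :
    ∃ w, FE Ω T r w ∧ ∀ χ, FE Ω T r χ →
      ∫ x in Ω, ⟪gradient w x, gradient χ x⟫ = ∫ x in Ω, ⟪G x, gradient χ x⟫ := by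
  have := M.fd
  let B : FEs Ω T r →ₗ[ℝ] Module.Dual ℝ (FEs Ω T r) :=
    { toFun := fun f => M.func (FE.LO M f.2).gbm
      map_add' := fun f g => by
        ext χ
        have := LO.inner_lin M.D (FE.LO M f.2) (FE.LO M g.2) 1 1 (FE.LO M χ.2).gbm
        simp only [one_mul, fun x y => real_inner_comm y (gradient (χ : E3 → ℝ) x)] at this
        exact this
      map_smul' := fun a f => by
        ext χ
        have := LO.inner_lin M.D (FE.LO M f.2) (FE.LO M f.2) a 0 (FE.LO M χ.2).gbm
        simp only [zero_mul, add_zero, fun x y => real_inner_comm y (gradient (χ : E3 → ℝ) x)] at this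
        exact this }
  have hinj : Function.Injective B := by
    rw [← LinearMap.ker_eq_bot, LinearMap.ker_eq_bot']
    intro f hf
    have h1 : ∫ x in Ω, ⟪gradient (f : E3 → ℝ) x, gradient (f : E3 → ℝ) x⟫ = 0 :=
      LinearMap.congr_fun hf f
    simp only [real_inner_self_eq_norm_sq] at h1
    exact Subtype.ext (LO.eq_zero M.D (FE.LO M f.2) h1)
  have hsur := (LinearMap.injective_iff_surjective_of_finrank_eq_finrank
    (Subspace.dual_finrank_eq (K := ℝ) (V := FEs Ω T r)).symm).1 hinj
  obtain ⟨w, hw⟩ := hsur (M.func hG)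
  exact ⟨w, w.2, fun χ hχ => LinearMap.congr_fun hw ⟨χ, hχ⟩⟩

end ritz


/-- Geometric data of the domain. -/
structure Geo (Ω : Set E3) (z0 : E3) (r0 d : ℝ) : Prop where
  D : Dom Ω
  r0p : 0 < r0
  inb : ball z0 (3 * r0) ⊆ Ω
  dia : ∀ x ∈ Ω, ∀ y ∈ Ω, ‖x - y‖ ≤ d

/-- The boundary strip. -/
def Lam (Ω : Set E3) (h : ℝ) : Set E3 := {x ∈ Ω | Metric.infDist x (frontier Ω) ≤ h}

section strip
variable {Ω : Set E3} {z0 : E3} {r0 d : ℝ}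

theorem Lam_sub (h : ℝ) : Lam Ω h ⊆ Ω := fun _ hx => hx.1
theorem Lam_meas (hD : Dom Ω) (h : ℝ) : MeasurableSet (Lam Ω h) :=
  hD.meas.inter (measurableSet_le (continuous_infDist_pt _).measurable measurable_const)

theorem Geo.z0m (G : Geo Ω z0 r0 d) : z0 ∈ Ω := G.inb (mem_ball_self (by linarith [G.r0p]))

theorem Geo.balls (G : Geo Ω z0 r0 d) {z : E3} (hz : z ∈ ball z0 (2 * r0)) : ball z r0 ⊆ Ω := by
  refine (ball_subset_ball' ?_).trans G.inb
  have := mem_ball.1 hz; linarith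

theorem Geo.r0d (G : Geo Ω z0 r0 d) : r0 ≤ d := by
  have hr := G.r0p
  have h1 : z0 + r0 • (EuclideanSpace.single 0 1 : E3) ∈ Ω := by
    apply G.inb
    rw [mem_ball, dist_eq_norm]; simp [norm_smul, abs_of_pos hr]; linarith
  have := G.dia _ h1 _ G.z0m
  simpa [norm_smul, abs_of_pos hr] using this

theorem Geo.dpos (G : Geo Ω z0 r0 d) : 0 < d := G.r0p.trans_le G.r0d

theorem Geo.fne (G : Geo Ω z0 r0 d) : (frontier Ω).Nonempty := by
  rw [nonempty_frontier_iff]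
  refine ⟨⟨_, G.z0m⟩, fun h => ?_⟩
  have := G.D.bd
  rw [h] at this
  exact NormedSpace.unbounded_univ ℝ E3 this

theorem Dom.frontier_not (hD : Dom Ω) {y : E3} (hy : y ∈ frontier Ω) : y ∉ Ω := by
  rw [hD.op.frontier_eq] at hy; exact hy.2

theorem Geo.clos (G : Geo Ω z0 r0 d) {x y : E3} (hx : x ∈ closure Ω) (hy : y ∈ closure Ω) : ‖x - y‖ ≤ d := by
  have h1 := diam_le_of_forall_dist_le G.dpos.le (s := Ω)
    (fun x hx y hy => by rw [dist_eq_norm]; exact G.dia x hx y hy)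
  rw [← dist_eq_norm]
  refine (dist_le_diam_of_mem G.D.bd.closure hx hy).trans ?_
  rwa [diam_closure]

theorem Geo.poleAt (G : Geo Ω z0 r0 d) {y : E3} (hy : y ∈ frontier Ω) :
    ∃ n : E3, ‖n‖ = 1 ∧ ∀ κ, 0 < κ → Pole Ω (y - κ • n) n κ := by
  obtain ⟨f, hf⟩ := geometric_hahn_banach_open_point G.D.cv G.D.op (G.D.frontier_not hy)
  set m := (InnerProductSpace.toDual ℝ E3).symm f with hm
  have hfm : ∀ x, f x = ⟪m, x⟫ := fun x => by simp [hm]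
  have hm0 : 0 < ‖m‖ := by
    rw [norm_pos_iff]; intro h0
    have := hf _ G.z0m
    rw [hfm, hfm, h0] at this; simp at this
  have hn : ‖-(‖m‖⁻¹ • m)‖ = 1 := by
    rw [norm_neg, norm_smul, norm_inv, norm_norm, inv_mul_cancel₀ hm0.ne']
  refine ⟨_, hn, fun κ hκ => ⟨hn, hκ, fun x hx => ?_⟩⟩
  have h1 : ⟪m, x - y⟫ < 0 := by
    rw [inner_sub_right, ← hfm, ← hfm]; linarith [hf x hx]
  rw [sub_sub_eq_add_sub, add_sub_right_comm, inner_add_right, inner_smul_right,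
    real_inner_self_eq_norm_sq, hn, inner_neg_left, real_inner_smul_left]
  have := mul_pos (inv_pos.2 hm0) (neg_pos.2 h1)
  linarith

theorem cov {f : E3 → ℝ} {τ : ℝ} (hτ : 0 ≤ τ) (z : E3) :
    ∫ x, f ((1 + τ) • x - τ • z) = ((1 + τ) ^ 3)⁻¹ * ∫ x, f x := by
  rw [Measure.integral_comp_smul volume (fun y => f (y - τ • z)), integral_sub_right_eq_self]
  simp only [finrank_euclideanSpace, Fintype.card_fin, smul_eq_mul]
  rw [abs_of_pos (by positivity)]

/-- Inverse dilation. -/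
def Ti (τ : ℝ) (z y : E3) : E3 := (1 + τ)⁻¹ • (y + τ • z)

theorem Ti_T {τ : ℝ} (hτ : 0 ≤ τ) (z x : E3) : Ti τ z ((1 + τ) • x - τ • z) = x := by
  rw [Ti, sub_add_cancel, smul_smul, inv_mul_cancel₀ (by positivity), one_smul]

theorem T_Ti {τ : ℝ} (hτ : 0 ≤ τ) (z x : E3) : (1 + τ) • Ti τ z x - τ • z = x := by
  rw [Ti, smul_smul, mul_inv_cancel₀ (by positivity), one_smul, add_sub_cancel_right]

theorem Ti_mem (hD : Dom Ω) {τ : ℝ} (hτ : 0 ≤ τ) {z y : E3} (hz : z ∈ Ω) (hy : y ∈ Ω) : Ti τ z y ∈ Ω := by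
  have h1 : 0 < 1 + τ := by positivity
  have := hD.cv hy hz (a := (1 + τ)⁻¹) (b := (1 + τ)⁻¹ * τ) (by positivity) (by positivity)
    (by field_simp)
  rwa [Ti, smul_add, smul_smul]

theorem Ti_dist (τ : ℝ) (hτ : 0 ≤ τ) (z y : E3) : ‖Ti τ z y - y‖ ≤ τ * ‖z - y‖ := by
  have h1 : 0 < 1 + τ := by positivity
  have : Ti τ z y - y = (1 + τ)⁻¹ • (τ • (z - y)) := by
    have e : y = (1 + τ)⁻¹ • ((1 + τ) • y) := by rw [smul_smul, inv_mul_cancel₀ h1.ne', one_smul]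
    nth_rewrite 2 [e]
    rw [Ti, ← smul_sub]; congr 1
    rw [add_smul, one_smul, smul_sub]; abel
  rw [this, norm_smul, norm_smul, Real.norm_of_nonneg (by positivity), Real.norm_of_nonneg hτ]
  have : (1 + τ)⁻¹ ≤ 1 := inv_le_one_of_one_le₀ (by linarith)
  have h2 : 0 ≤ τ * ‖z - y‖ := by positivity
  nlinarith

/-- Dilating from `z` pushes the strip out of the domain. -/
theorem Geo.push (G : Geo Ω z0 r0 d) {h : ℝ} (hh : 0 < h) (hs : 4 * h ≤ r0) {z x : E3}
    (hz : z ∈ ball z0 (2 * r0)) (hx : x ∈ Lam Ω h) :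
    (1 + 4 * h / r0) • x - (4 * h / r0) • z ∉ Ω := by
  intro hy
  set τ := 4 * h / r0
  have hr := G.r0p
  have hτ : 0 < τ := by positivity
  have hτ1 : τ ≤ 1 := by rw [div_le_one hr]; exact hs
  have hτr : τ * r0 = 4 * h := by simp only [τ]; field_simp
  have h2 : 2 * h ≤ infDist x (frontier Ω) := by
    rw [le_infDist G.fne]
    intro q hq
    by_contra hlt
    push Not at hlt
    apply G.D.frontier_not hq
    have hq' : z + ((1 + τ) / τ) • (q - x) ∈ Ω := by
      apply G.balls hz
      rw [mem_ball, dist_eq_norm, add_sub_cancel_left, norm_smul, Real.norm_of_nonneg (by positivity),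
        div_mul_eq_mul_div, div_lt_iff₀ hτ, ← dist_eq_norm, dist_comm]
      have : (0:ℝ) ≤ dist x q := dist_nonneg
      nlinarith
    have := Ti_mem G.D hτ.le hq' hy
    convert this using 1
    rw [Ti, smul_add τ, smul_smul τ, mul_div_cancel₀ _ hτ.ne', ← add_assoc, sub_add_cancel, ← smul_add,
      smul_smul, inv_mul_cancel₀ (by positivity), one_smul, add_sub_cancel]
  linarith [hx.2]

theorem tail_int : ∃ J, 0 < J ∧ ∀ {Ω : Set E3} {p n : E3} {κ : ℝ}, Dom Ω → Pole Ω p n κ →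
    ∫ x in Ω, ‖x - p‖ ^ (-(7/2) : ℝ) ≤ J * κ ^ (-(1/2) : ℝ) := by
  have hint : Integrable (fun x : E3 => (1 + ‖x‖) ^ (-(7/2) : ℝ)) := by
    refine integrable_one_add_norm ?_
    simp; norm_num
  set J0 := ∫ x : E3, (1 + ‖x‖) ^ (-(7/2) : ℝ)
  have hJ0 : 0 ≤ J0 := integral_nonneg fun x => by positivity
  refine ⟨(2:ℝ) ^ (7/2 : ℝ) * J0 + 1, by positivity, fun {Ω p n κ} hD hp => ?_⟩
  have hκ := hp.pos
  set f : E3 → ℝ := fun x => (1 + ‖x‖) ^ (-(7/2) : ℝ)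
  have h1 : ∫ x, f (κ⁻¹ • (x - p)) = κ ^ 3 * J0 := by
    rw [integral_sub_right_eq_self (fun x => f (κ⁻¹ • x)), Measure.integral_comp_smul]
    simp only [finrank_euclideanSpace, Fintype.card_fin, smul_eq_mul]
    rw [abs_of_pos (by positivity)]; simp [J0, f]
  have h2 : Integrable (fun x => f (κ⁻¹ • (x - p))) :=
    ((integrable_comp_smul_iff volume f (by positivity : κ⁻¹ ≠ 0)).2 hint).comp_sub_right p
  have hle : ∫ x in Ω, ‖x - p‖ ^ (-(7/2) : ℝ) ≤
      ∫ x in Ω, (2:ℝ) ^ (7/2 : ℝ) * κ ^ (-(7/2) : ℝ) * f (κ⁻¹ • (x - p)) := by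
    refine setIntegral_mono_on ((hp.bm hD _).integrableOn hD) (h2.const_mul _).integrableOn hD.meas fun x hx => ?_
    have hr := hp.r hx
    have hn : 0 ≤ ‖x - p‖ := norm_nonneg _
    have e : 1 + ‖κ⁻¹ • (x - p)‖ = (κ + ‖x - p‖) / κ := by
      rw [norm_smul, Real.norm_of_nonneg (by positivity)]; field_simp
    simp only [f, e]
    rw [Real.div_rpow (by positivity) hκ.le, mul_assoc, mul_div_cancel₀ _ (by positivity)]
    calc ‖x - p‖ ^ (-(7/2) : ℝ) ≤ ((κ + ‖x - p‖) / 2) ^ (-(7/2) : ℝ) :=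
          Real.rpow_le_rpow_of_nonpos (by positivity) (by linarith) (by norm_num)
      _ = _ := by
          rw [Real.div_rpow (by positivity) (by norm_num), Real.rpow_neg (by norm_num : (0:ℝ) ≤ 2), div_inv_eq_mul,
            mul_comm]
  refine hle.trans ?_
  rw [integral_const_mul]
  calc _ ≤ (2:ℝ) ^ (7/2 : ℝ) * κ ^ (-(7/2) : ℝ) * (κ ^ 3 * J0) := by
        rw [← h1]
        exact mul_le_mul_of_nonneg_left
          (setIntegral_le_integral h2 (Filter.Eventually.of_forall fun x => by positivity)) (by positivity)
    _ = (2:ℝ) ^ (7/2 : ℝ) * J0 * κ ^ (-(1/2) : ℝ) := by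
        have : κ ^ (-(1/2) : ℝ) = κ ^ (-(7/2) : ℝ) * κ ^ 3 := by
          rw [← Real.rpow_natCast, ← Real.rpow_add hκ]; norm_num
        rw [this]; ring
    _ ≤ _ := by gcongr; linarith

theorem strip_pt {r r' d R τ : ℝ} (hr : 0 < r) (hrR : r ≤ R) (hd : 0 ≤ d) (hdR : d ≤ R) (hτ : 0 ≤ τ) (hτ1 : τ ≤ 1)
    (hr'0 : 0 < r') (hr' : r' ≤ r + τ * d) :
    r ^ (-(5/2) : ℝ) - ((1 + τ) ^ 3)⁻¹ * r' ^ (-(5/2) : ℝ) ≤ 9 * τ * R * r ^ (-(7/2) : ℝ) := by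
  set b := τ * d / r with hb
  have hb0 : 0 ≤ b := by positivity
  have h1 : r ^ (-(5/2) : ℝ) * ((1 + b) ^ 3)⁻¹ ≤ r' ^ (-(5/2) : ℝ) := by
    calc r ^ (-(5/2) : ℝ) * ((1 + b) ^ 3)⁻¹ ≤ r ^ (-(5/2) : ℝ) * (1 + b) ^ (-(5/2) : ℝ) := by
          gcongr
          rw [Real.rpow_neg (by positivity)]
          gcongr
          rw [← Real.rpow_natCast]
          exact Real.rpow_le_rpow_of_exponent_le (by linarith) (by norm_num)
      _ = (r + τ * d) ^ (-(5/2) : ℝ) := by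
          rw [← Real.mul_rpow hr.le (by positivity)]; congr 1; rw [hb]; field_simp
      _ ≤ _ := Real.rpow_le_rpow_of_nonpos hr'0 hr' (by norm_num)
  have h2 : 1 - ((1 + τ) ^ 3)⁻¹ * ((1 + b) ^ 3)⁻¹ ≤ 3 * τ + 6 * b := by
    set u := (1 + τ) * (1 + b) with hu
    have hu1 : 1 ≤ u := by rw [hu]; nlinarith [mul_nonneg hτ hb0]
    have h3 : ((1 + τ) ^ 3)⁻¹ * ((1 + b) ^ 3)⁻¹ = (u ^ 3)⁻¹ := by rw [hu, mul_pow, mul_inv]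
    have h4 : 1 + (3:ℕ) * (u⁻¹ - 1) ≤ (1 + (u⁻¹ - 1)) ^ 3 :=
      one_add_mul_le_pow (by have : 0 ≤ u⁻¹ := by positivity
                             linarith) 3
    have h5 : 1 - u⁻¹ ≤ u - 1 := by
      have : u * u⁻¹ = 1 := mul_inv_cancel₀ (by positivity)
      have : 0 ≤ u⁻¹ := by positivity
      nlinarith
    rw [h3, ← inv_pow]
    push_cast at h4
    rw [add_sub_cancel] at h4
    have : u - 1 ≤ τ + 2 * b := by rw [hu]; nlinarith
    linarith
  have h3 : r ^ (-(5/2) : ℝ) = r * r ^ (-(7/2) : ℝ) := by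
    rw [mul_comm, ← Real.rpow_add_one hr.ne']; norm_num
  have h4 : b * r = τ * d := by rw [hb]; field_simp
  calc _ ≤ r ^ (-(5/2) : ℝ) - ((1 + τ) ^ 3)⁻¹ * (r ^ (-(5/2) : ℝ) * ((1 + b) ^ 3)⁻¹) := by gcongr
    _ = r ^ (-(5/2) : ℝ) * (1 - ((1 + τ) ^ 3)⁻¹ * ((1 + b) ^ 3)⁻¹) := by ring
    _ ≤ r ^ (-(5/2) : ℝ) * (3 * τ + 6 * b) := by gcongr
    _ = (3 * τ * r + 6 * (b * r)) * r ^ (-(7/2) : ℝ) := by rw [h3]; ring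
    _ ≤ (9 * τ * R) * r ^ (-(7/2) : ℝ) := by
        gcongr; rw [h4]; nlinarith
    _ = _ := rfl

/-- Weighted measure of the boundary strip. -/
theorem Geo.strip (G : Geo Ω z0 r0 d) {R : ℝ} (hR : d ≤ R) : ∃ C, 0 < C ∧ ∀ {h κ : ℝ} {p n : E3},
    0 < h → 4 * h ≤ r0 → Pole Ω p n κ → (∀ x ∈ Ω, ‖x - p‖ ≤ R) →
    ∫ x in Lam Ω h, ‖x - p‖ ^ (-(5/2) : ℝ) ≤ C * h * κ ^ (-(1/2) : ℝ) := by
  obtain ⟨J, hJ, HJ⟩ := tail_int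
  have hr := G.r0p
  have hR0 := G.dpos.trans_le hR
  refine ⟨9 * (4 / r0) * R * J, by positivity, fun {h κ p n} hh hs hp hpR => ?_⟩
  have hpush := fun x (hx : x ∈ Lam Ω h) => G.push hh hs (mem_ball_self (by positivity)) hx
  set τ := 4 * h / r0 with hτd
  have hτ : 0 < τ := by positivity
  have hτ1 : τ ≤ 1 := by rw [div_le_one hr]; exact hs
  set f : E3 → ℝ := fun x => ‖x - p‖ ^ (-(5/2) : ℝ) with hf
  have hfm : Measurable f := (hp.bm G.D (-(5/2))).1
  have hfb : BM Ω f := hp.bm G.D _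
  have hf0 : ∀ x, 0 ≤ f x := fun x => by positivity
  have hTc : Continuous (Ti τ z0) := by unfold Ti; fun_prop
  have hgb : BM Ω (fun y => f (Ti τ z0 y)) :=
    ⟨hfm.comp hTc.measurable, hfb.2.imp fun C hC x hx => hC _ (Ti_mem G.D hτ.le G.z0m hx)⟩
  set g : E3 → ℝ := Ω.indicator (fun y => f (Ti τ z0 y)) with hg
  have hgi : Integrable g := (integrable_indicator_iff G.D.meas).2 (hgb.integrableOn G.D)
  have hTm : MeasurableEmbedding (fun x : E3 => (1 + τ) • x - τ • z0) :=
    ((Homeomorph.smulOfNeZero (1 + τ) (by positivity : (1:ℝ) + τ ≠ 0)).trans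
      (Homeomorph.subRight (τ • z0))).measurableEmbedding
  have hgT : Integrable (fun x => g ((1 + τ) • x - τ • z0)) :=
    (integrable_comp_smul_iff volume (fun y => g (y - τ • z0)) (by positivity : (1:ℝ) + τ ≠ 0)).2
      (hgi.comp_sub_right _)
  have hΩi : Integrable (Ω.indicator f) := (integrable_indicator_iff G.D.meas).2 (hfb.integrableOn G.D)
  have hΛi : Integrable ((Lam Ω h).indicator f) := (integrable_indicator_iff (Lam_meas G.D h)).2
    ((hfb.integrableOn G.D).mono_set (Lam_sub h))
  calc ∫ x in Lam Ω h, f x = ∫ x, (Lam Ω h).indicator f x := (integral_indicator (Lam_meas G.D h)).symm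
    _ ≤ ∫ x, (Ω.indicator f x - g ((1 + τ) • x - τ • z0)) := by
        refine integral_mono hΛi (hΩi.sub hgT) fun x => ?_
        by_cases hx : x ∈ Lam Ω h
        · have := hpush x hx
          simp [hg, hx, hx.1, this]
        · by_cases hT : (1 + τ) • x - τ • z0 ∈ Ω
          · have hxO : x ∈ Ω := by
              have := Ti_mem G.D hτ.le G.z0m hT
              rwa [Ti_T hτ.le] at this
            simp [hg, hx, hT, hxO, Ti_T hτ.le]
          · simp [hg, hx, hT]
            exact Set.indicator_nonneg (fun x _ => hf0 x) x
    _ = (∫ x in Ω, f x) - ((1 + τ) ^ 3)⁻¹ * ∫ x in Ω, f (Ti τ z0 x) := by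
        rw [integral_sub hΩi hgT, cov hτ.le, integral_indicator G.D.meas, hg, integral_indicator G.D.meas]
    _ = ∫ x in Ω, (f x - ((1 + τ) ^ 3)⁻¹ * f (Ti τ z0 x)) := by
        rw [integral_sub (hfb.integrableOn G.D) ((hgb.cmul _).integrableOn G.D), integral_const_mul]
    _ ≤ ∫ x in Ω, 9 * τ * R * ‖x - p‖ ^ (-(7/2) : ℝ) := by
        refine setIntegral_mono_on ((hfb.sub (hgb.cmul _)).integrableOn G.D)
          (((hp.bm G.D _).cmul _).integrableOn G.D) G.D.meas fun x hx => ?_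
        refine strip_pt (d := d) (hp.rpos hx) (hpR x hx) G.dpos.le hR hτ.le hτ1
          (hp.rpos (Ti_mem G.D hτ.le G.z0m hx)) ?_
        have h1 := Ti_dist τ hτ.le z0 x
        have h2 := G.dia _ G.z0m _ hx
        have h3 : ‖Ti τ z0 x - p‖ ≤ ‖Ti τ z0 x - x‖ + ‖x - p‖ := norm_sub_le_norm_sub_add_norm_sub _ _ _
        nlinarith
    _ ≤ 9 * τ * R * (J * κ ^ (-(1/2) : ℝ)) := by
        rw [integral_const_mul]
        gcongr
        exact HJ G.D hp
    _ = _ := by rw [hτd]; ring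

end strip


/-- Discrete dual solution attached to a field supported in the strip. -/
structure Ritz (Ω : Set E3) (T : Finset (Fin 4 → E3)) (r : ℕ) (h : ℝ) (g : E3 → E3) (w : E3 → ℝ) : Prop where
  gm : Measurable g
  gb : ∀ x, ‖g x‖ ≤ 1
  gz : ∀ x, x ∉ Lam Ω h → g x = 0
  fe : FE Ω T r w
  orth : ∀ χ, FE Ω T r χ → ∫ x in Ω, ⟪gradient w x, gradient χ x⟫ = ∫ x in Ω, ⟪g x, gradient χ x⟫

theorem Ritz.bm {Ω : Set E3} {T : Finset (Fin 4 → E3)} {r : ℕ} {h : ℝ} {g : E3 → E3} {w : E3 → ℝ}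
    (W : Ritz Ω T r h g w) : BM Ω g := ⟨W.gm, 1, fun x _ => W.gb x⟩

section wb
variable {Ω : Set E3} {T : Finset (Fin 4 → E3)} {h c : ℝ} {r : ℕ} {z0 : E3} {r0 d : ℝ}

theorem rpow_lip {A : Set E3} (hA : Convex ℝ A) {p : E3} {σ b : ℝ} (hσ : 0 < σ) (hr : ∀ x ∈ A, σ ≤ ‖x - p‖)
    (hb : b ≤ 1) {x y : E3} (hx : x ∈ A) (hy : y ∈ A) :
    |‖x - p‖ ^ b - ‖y - p‖ ^ b| ≤ |b| * σ ^ (b - 1) * ‖x - y‖ := by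
  have h := (lipOn_of_grad hA (K := |b| * σ ^ (b - 1))
    (fun x hx => hasGradientAt_rpow p b (hσ.trans_le (hr x hx))) (fun x hx => ?_)).norm_sub_le hx hy
  · rwa [Real.coe_toNNReal _ (by positivity)] at h
  · have h0 := hσ.trans_le (hr x hx)
    rw [norm_smul, norm_mul, Real.norm_eq_abs, Real.norm_of_nonneg (by positivity), mul_assoc,
      ← Real.rpow_add_one h0.ne']
    gcongr
    rw [show b - 2 + 1 = b - 1 by ring]
    exact Real.rpow_le_rpow_of_nonpos hσ (hr x hx) (by linarith)

theorem rpow_lip2 {A : Set E3} (hA : Convex ℝ A) {p x0 : E3} {σ b : ℝ} (hσ : ‖x0 - p‖ = σ) (hσ0 : 0 < σ)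
    (h0 : x0 ∈ A) {h : ℝ} (hd : ∀ x ∈ A, ‖x - x0‖ ≤ h)
    (hr : ∀ x ∈ A, σ ≤ ‖x - p‖) (hb : b ≤ 1) {x y : E3} (hx : x ∈ A) (hy : y ∈ A) :
    |‖x - p‖ ^ b - ‖y - p‖ ^ b - ⟪(b * σ ^ (b - 2)) • (x0 - p), x - y⟫| ≤
      |b| * (1 + |b - 2|) * σ ^ (b - 2) * h * ‖x - y‖ := by
  have hh : 0 ≤ h := (norm_nonneg _).trans (hd x0 h0)
  set a := (b * σ ^ (b - 2)) • (x0 - p)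
  have h := (lipOn_of_grad hA (K := |b| * (1 + |b - 2|) * σ ^ (b - 2) * h)
    (m := fun x => ‖x - p‖ ^ b - ⟪a, x - p⟫)
    (fun x hx => (hasGradientAt_rpow p b (hσ0.trans_le (hr x hx))).sub' (hasGradientAt_inner a p x))
    (fun x hx => ?_)).norm_sub_le hx hy
  · rw [Real.coe_toNNReal _ (by positivity), Real.norm_eq_abs] at h
    convert h using 2
    rw [sub_sub_sub_comm, ← inner_sub_right, sub_sub_sub_cancel_right]
  · have h1 := rpow_lip hA hσ0 hr (by linarith : b - 2 ≤ 1) hx h0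
    rw [hσ] at h1
    have e : (b * ‖x - p‖ ^ (b - 2)) • (x - p) - a =
        b • (‖x - p‖ ^ (b - 2) • (x - x0) + (‖x - p‖ ^ (b - 2) - σ ^ (b - 2)) • (x0 - p)) := by
      simp only [a]; module
    rw [e, norm_smul, Real.norm_eq_abs, mul_assoc, mul_assoc]
    gcongr
    refine (norm_add_le _ _).trans ?_
    rw [norm_smul, norm_smul, hσ, Real.norm_of_nonneg (by positivity : 0 ≤ ‖x - p‖ ^ (b - 2)), Real.norm_eq_abs]
    have h2 := hd x hx
    have h3 : ‖x - p‖ ^ (b - 2) ≤ σ ^ (b - 2) := Real.rpow_le_rpow_of_nonpos hσ0 (hr x hx) (by linarith)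
    have h4 : σ ^ (b - 2 - 1) * σ = σ ^ (b - 2) := by
      rw [← Real.rpow_add_one hσ0.ne']; congr 1; ring
    calc _ ≤ σ ^ (b - 2) * h + |b - 2| * σ ^ (b - 2 - 1) * h * σ := by
          gcongr; exact h1.trans (by gcongr)
      _ = σ ^ (b - 2) * h + |b - 2| * (σ ^ (b - 2 - 1) * σ) * h := by ring
      _ = _ := by rw [h4]; ring

theorem Pole.clos {p n : E3} {κ : ℝ} (hp : Pole Ω p n κ) {x : E3} (hx : x ∈ closure Ω) : κ ≤ ‖x - p‖ := by
  have : closure Ω ⊆ {x | κ ≤ ‖x - p‖} :=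
    closure_minimal (fun x hx => hp.r hx) (isClosed_le continuous_const (by fun_prop))
  exact this hx

theorem wb_sah (M : Msh Ω T h c r) {p n : E3} {κ : ℝ} (hp : Pole Ω p n κ) (hκ : h ≤ κ) :
    SAH T h (fun x => ‖x - p‖ ^ (-(5/2) : ℝ)) (fun x => ‖x - p‖ ^ (5/2 : ℝ))
      (fun x => 200000 * ‖x - p‖ ^ (-(9/2) : ℝ)) (fun x => 200000 * ‖x - p‖ ^ (-(13/2) : ℝ)) := by
  intro v hv
  obtain ⟨x0, hx0, hmin⟩ := (tet_compact v).exists_isMinOn ⟨_, vert_mem v 0⟩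
    (f := fun x => ‖x - p‖) (by fun_prop)
  set σ := ‖x0 - p‖ with hσ
  have hmin' : ∀ x ∈ tet v, σ ≤ ‖x - p‖ := fun x hx => hmin hx
  have hκσ : κ ≤ σ := hp.clos (M.sub hv hx0)
  have hσ0 : 0 < σ := hp.pos.trans_le hκσ
  have hdd : ∀ x ∈ tet v, ‖x - x0‖ ≤ h := fun x hx => M.dist_le hv hx hx0
  have hup : ∀ x ∈ tet v, ‖x - p‖ ≤ 2 * σ := fun x hx => by
    have := norm_sub_le_norm_sub_add_norm_sub x x0 p
    have := hdd x hx
    linarith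
  have pw : ∀ a b : ℝ, σ ^ a * (σ ^ b) ^ 2 = σ ^ (a + 2 * b) := fun a b => by
    rw [← Real.rpow_natCast, ← Real.rpow_mul hσ0.le, ← Real.rpow_add hσ0]; congr 1; push_cast; ring
  refine ⟨|(-(5/2) : ℝ)| * σ ^ (-(5/2) - 1 : ℝ), |(-(5/2) : ℝ)| * (1 + |(-(5/2) - 2 : ℝ)|) * σ ^ (-(5/2) - 2 : ℝ), _,
    by positivity, by positivity, fun x hx y hy => rpow_lip (tet_convex v) hσ0 hmin' (by norm_num) hx hy,
    fun x hx y hy => rpow_lip2 (tet_convex v) rfl hσ0 hx0 hdd hmin' (by norm_num) hx hy, fun x hx y hy => ?_⟩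
  have hx' := hup x (interior_subset hx)
  have hy' := hup y (interior_subset hy)
  have hy0 := hσ0.trans_le (hmin' y (interior_subset hy))
  have hm : ‖x - p‖ ^ (5/2 : ℝ) ≤ 8 * σ ^ (5/2 : ℝ) := by
    calc _ ≤ (2 * σ) ^ (5/2 : ℝ) := by gcongr
      _ = 2 ^ (5/2 : ℝ) * σ ^ (5/2 : ℝ) := Real.mul_rpow (by norm_num) hσ0.le
      _ ≤ 2 ^ (3 : ℝ) * σ ^ (5/2 : ℝ) := by gcongr <;> norm_num
      _ = _ := by norm_num
  have hlow : ∀ a : ℝ, 0 ≤ a → ∀ k : ℕ, a ≤ k → σ ^ (-a) ≤ 2 ^ k * ‖y - p‖ ^ (-a) := fun a ha k hk => by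
    have h1 : (2 * σ) ^ (-a) ≤ ‖y - p‖ ^ (-a) := Real.rpow_le_rpow_of_nonpos hy0 hy' (by linarith)
    rw [Real.mul_rpow (by norm_num) hσ0.le] at h1
    have h2 : (1:ℝ) ≤ 2 ^ k * 2 ^ (-a) := by
      rw [← Real.rpow_natCast, ← Real.rpow_add (by norm_num)]
      exact Real.one_le_rpow (by norm_num) (by linarith)
    calc σ ^ (-a) = 1 * σ ^ (-a) := (one_mul _).symm
      _ ≤ (2 ^ k * 2 ^ (-a)) * σ ^ (-a) := by gcongr
      _ = 2 ^ k * (2 ^ (-a) * σ ^ (-a)) := by ring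
      _ ≤ _ := by gcongr
  have e1 := pw (5/2) (-(5/2) - 1)
  have e2 := pw (5/2) (-(5/2) - 2)
  norm_num at e1 e2
  constructor
  · have h1 := hlow (9/2) (by norm_num) 5 (by norm_num)
    have h2 : 0 ≤ ‖y - p‖ ^ (-(9/2) : ℝ) := by positivity
    norm_num at h1 h2 ⊢
    calc _ ≤ 8 * σ ^ (5/2 : ℝ) * (5/2 * σ ^ (-(7/2) : ℝ)) ^ 2 := by gcongr
      _ = 50 * (σ ^ (5/2 : ℝ) * (σ ^ (-(7/2) : ℝ)) ^ 2) := by ring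
      _ ≤ _ := by rw [e1]; linarith
  · have h1 := hlow (13/2) (by norm_num) 7 (by norm_num)
    have h2 : 0 ≤ ‖y - p‖ ^ (-(13/2) : ℝ) := by positivity
    norm_num at h1 h2 ⊢
    calc _ ≤ 8 * σ ^ (5/2 : ℝ) * (5/2 * (11/2) * σ ^ (-(9/2) : ℝ)) ^ 2 := by gcongr; norm_num
      _ = 1512.5 * (σ ^ (5/2 : ℝ) * (σ ^ (-(9/2) : ℝ)) ^ 2) := by ring
      _ ≤ _ := by rw [e2]; linarith


theorem wb_pt {W Y Q A B C om m k : ℝ} (hom : 0 < om) (hm : om * m = 1) (hk : k ^ 2 ≤ 25/4 * om * B)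
    (hB : 0 ≤ B) (hk0 : 0 ≤ k)
    (h1 : C ≤ (W + Y) * Q + om * (Y * W) + k * (Y * A)) :
    C ≤ 1/52 * (om * W ^ 2 + B * A ^ 2) + 400 * (om * Y ^ 2) + 39 * (m * Q ^ 2) := by
  have hm0 : 0 ≤ m := by
    by_contra hn; push Not at hn; nlinarith
  have a1 : (W + Y) * Q ≤ 1/78 * (om * (W ^ 2 + Y ^ 2)) + 39 * (m * Q ^ 2) := by
    have e : (W + Y) * Q = om * m * ((W + Y) * Q) := by rw [hm, one_mul]
    have e2 : m * Q ^ 2 = om * (m * Q) ^ 2 := by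
      calc m * Q ^ 2 = (om * m) * (m * Q ^ 2) := by rw [hm, one_mul]
        _ = _ := by ring
    rw [e, e2]
    have : (W + Y) * (m * Q) ≤ 1/78 * (W ^ 2 + Y ^ 2) + 39 * (m * Q) ^ 2 := by
      nlinarith [sq_nonneg (W - 78 * (m * Q) + Y), sq_nonneg (W - Y)]
    nlinarith
  have a2 : Y * W ≤ 1/156 * W ^ 2 + 39 * Y ^ 2 := by nlinarith [sq_nonneg (W - 78 * Y)]
  have a3 : k * (Y * A) ≤ 1/156 * (B * A ^ 2) + 39 * (25/4 * om) * Y ^ 2 := by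
    rcases hB.eq_or_lt with hB0 | hB0
    · have : k = 0 := by rw [← hB0] at hk; nlinarith
      rw [this]; nlinarith [mul_nonneg hom.le (sq_nonneg Y), mul_nonneg hB (sq_nonneg A)]
    · have : 0 ≤ B * (1/156 * (B * A ^ 2) + 39 * (25/4 * om) * Y ^ 2 - k * (Y * A)) := by
        nlinarith [sq_nonneg (B * A - 78 * (k * Y)), mul_le_mul_of_nonneg_right hk (sq_nonneg Y)]
      linarith [(mul_nonneg_iff_of_pos_left hB0).1 this]
  nlinarith [mul_le_mul_of_nonneg_left a2 hom.le, mul_nonneg hom.le (sq_nonneg Y), mul_nonneg hB (sq_nonneg A)]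

/-- Weighted energy estimate for the discrete dual solution. -/
theorem wb_main (hc : 0 < c) (r : ℕ) : ∃ K1, 1 ≤ K1 ∧ ∀ {Ω : Set E3} {T : Finset (Fin 4 → E3)} {h : ℝ}
    {g : E3 → E3} {w : E3 → ℝ} {p n : E3} {κ : ℝ}, Msh Ω T h c r → Ritz Ω T r h g w → Pole Ω p n κ →
    K1 * h ≤ κ →
    ∫ x in Ω, (‖x - p‖ ^ (-(5/2) : ℝ) * ‖gradient w x‖ ^ 2 + ‖x - p‖ ^ (-(9/2) : ℝ) * w x ^ 2) ≤
      10400 * ∫ x in Ω, ‖x - p‖ ^ (-(5/2) : ℝ) * ‖g x‖ ^ 2 := by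
  have hCsa := Csa_nonneg (r := r) hc
  have hvb := vb_pos
  set S := Csa r c * vb * 200000 with hS
  have hS0 : 0 ≤ S := by positivity
  refine ⟨1 + 2028 * S, by linarith, fun {Ω T h g w p n κ} M W hp hκ => ?_⟩
  have hh := M.h0
  have hκ0 := hp.pos
  have hhκ : h ≤ κ := by nlinarith
  have hD := M.D
  have hw := FE.LO M W.fe
  have hm1 := hp.bm hD (-(5/2))
  have hωw : LO Ω (fun x => ‖x - p‖ ^ (-(5/2) : ℝ) * w x) := hp.mulLO hD _ hw
  have hχ := M.Iop_FE (hωw.front hD)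
  have hχL := FE.LO M hχ
  have hq := hωw.sub hχL
  set χ := Iop T r (fun x => ‖x - p‖ ^ (-(5/2) : ℝ) * w x)
  set q := gradient (fun z => ‖z - p‖ ^ (-(5/2) : ℝ) * w z - χ z) with hqd
  have hqb : BM Ω q := hq.gbm
  have hsag := sag M (wb_sah M hp hhκ) W.fe.1.1.2 (hw.bm hD) hw.gbm hωw (hp.bm hD _) (fun x _ => by positivity)
    ((hp.bm hD _).cmul _) ((hp.bm hD _).cmul _)
  have hag := agmon hD hp hw (b := -(5/4)) (by norm_num)
  rw [show (2:ℝ) * -(5/4) = -(5/2) by norm_num, show -(5/2:ℝ) - 2 = -(9/2) by norm_num] at hag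
  set X := ∫ x in Ω, (‖x - p‖ ^ (-(5/2) : ℝ) * ‖gradient w x‖ ^ 2 + ‖x - p‖ ^ (-(9/2) : ℝ) * w x ^ 2) with hX
  have bX : BM Ω (fun x => ‖x - p‖ ^ (-(5/2) : ℝ) * ‖gradient w x‖ ^ 2 + ‖x - p‖ ^ (-(9/2) : ℝ) * w x ^ 2) :=
    (hm1.mul hw.gbm.nsq).add ((hp.bm hD _).mul (hw.bm hD).sq)
  have bY : BM Ω (fun x => ‖x - p‖ ^ (-(5/2) : ℝ) * ‖g x‖ ^ 2) := hm1.mul W.bm.nsq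
  have bQ : BM Ω (fun x => ‖x - p‖ ^ (5/2 : ℝ) * ‖q x‖ ^ 2) := (hp.bm hD _).mul hqb.nsq
  have bO : BM Ω (fun x => ⟪gradient w x, gradient χ x⟫ - ⟪g x, gradient χ x⟫) :=
    (hw.gbm.inner hχL.gbm).sub (W.bm.inner hχL.gbm)
  have hsag2 : ∫ x in Ω, ‖x - p‖ ^ (5/2 : ℝ) * ‖q x‖ ^ 2 ≤ S * (h / κ) ^ 2 * X := by
    refine hsag.trans ?_
    have : ∫ x in Ω, (200000 * ‖x - p‖ ^ (-(9/2) : ℝ) * ‖gradient w x‖ ^ 2 +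
        200000 * ‖x - p‖ ^ (-(13/2) : ℝ) * w x ^ 2) ≤ 200000 * (κ ^ 2)⁻¹ * X := by
      rw [hX, ← integral_const_mul]
      refine setIntegral_mono_on (((((hp.bm hD _).cmul _).mul hw.gbm.nsq).add
        (((hp.bm hD _).cmul _).mul (hw.bm hD).sq)).integrableOn hD) ((bX.cmul _).integrableOn hD) hD.meas fun x hx => ?_
      have hr := hp.r hx
      have hr0 := hp.rpos hx
      have e : ∀ a : ℝ, ‖x - p‖ ^ (a - 2) ≤ (κ ^ 2)⁻¹ * ‖x - p‖ ^ a := fun a => by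
        rw [Real.rpow_sub hr0, Real.rpow_two, div_eq_inv_mul]; gcongr
      have e1 := e (-(5/2))
      have e2 := e (-(9/2))
      norm_num at e1 e2
      calc _ ≤ 200000 * ((κ ^ 2)⁻¹ * ‖x - p‖ ^ (-(5/2) : ℝ)) * ‖gradient w x‖ ^ 2 +
          200000 * ((κ ^ 2)⁻¹ * ‖x - p‖ ^ (-(9/2) : ℝ)) * w x ^ 2 := by gcongr
        _ = _ := by ring
    calc _ ≤ Csa r c * vb * h ^ 2 * (200000 * (κ ^ 2)⁻¹ * X) := by gcongr
      _ = _ := by rw [hS, div_pow]; ring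
  have hpt : ∫ x in Ω, ⟪gradient w x, gradient (fun y => ‖y - p‖ ^ (-(5/2) : ℝ) * w y) x⟫ ≤
      ∫ x in Ω, (1/52 * (‖x - p‖ ^ (-(5/2) : ℝ) * ‖gradient w x‖ ^ 2 + ‖x - p‖ ^ (-(9/2) : ℝ) * w x ^ 2) +
        400 * (‖x - p‖ ^ (-(5/2) : ℝ) * ‖g x‖ ^ 2) + 39 * (‖x - p‖ ^ (5/2 : ℝ) * ‖q x‖ ^ 2) +
        (⟪gradient w x, gradient χ x⟫ - ⟪g x, gradient χ x⟫)) := by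
    refine ae_le_set hD (hw.gbm.inner hωw.gbm) ((((bX.cmul _).add (bY.cmul _)).add (bQ.cmul _)).add bO) ?_
    filter_upwards [hw.ae, hωw.ae, hχL.ae] with x h1 h2 h3 hx
    have hr0 := hp.rpos hx
    have hqx : q x = gradient (fun y => ‖y - p‖ ^ (-(5/2) : ℝ) * w y) x - gradient χ x := gradient_sub' h2 h3
    have hgx : gradient (fun y => ‖y - p‖ ^ (-(5/2) : ℝ) * w y) x = ‖x - p‖ ^ (-(5/2) : ℝ) • gradient w x +
        w x • ((-(5/2) * ‖x - p‖ ^ (-(5/2) - 2 : ℝ)) • (x - p)) :=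
      ((hasGradientAt_rpow p _ hr0).mul' h1.hasGradientAt).gradient
    rw [← sub_le_iff_le_add]
    refine wb_pt (om := ‖x - p‖ ^ (-(5/2) : ℝ)) (W := ‖gradient w x‖) (A := |w x|) (k := 5/2 * ‖x - p‖ ^ (-(7/2) : ℝ)) (B := ‖x - p‖ ^ (-(9/2) : ℝ))
      (Y := ‖g x‖) (Q := ‖q x‖) (m := ‖x - p‖ ^ (5/2 : ℝ)) (by positivity) ?_ ?_ (by positivity) (by positivity)
      ?_ |>.trans_eq (by rw [sq_abs])
    · rw [← Real.rpow_add hr0]; norm_num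
    · rw [mul_assoc, ← Real.rpow_add hr0, mul_pow, ← Real.rpow_natCast (‖x - p‖ ^ _), ← Real.rpow_mul hr0.le]; norm_num
    · have i1 : ⟪gradient w x, gradient (fun y => ‖y - p‖ ^ (-(5/2) : ℝ) * w y) x⟫ -
          (⟪gradient w x, gradient χ x⟫ - ⟪g x, gradient χ x⟫) =
          ⟪gradient w x - g x, q x⟫ + ⟪g x, gradient (fun y => ‖y - p‖ ^ (-(5/2) : ℝ) * w y) x⟫ := by
        rw [hqx]; simp only [inner_sub_left, inner_sub_right]; ring
      have i2 : ⟪gradient w x - g x, q x⟫ ≤ (‖gradient w x‖ + ‖g x‖) * ‖q x‖ :=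
        (real_inner_le_norm _ _).trans (by gcongr; exact norm_sub_le _ _)
      have i3 : ⟪g x, gradient (fun y => ‖y - p‖ ^ (-(5/2) : ℝ) * w y) x⟫ ≤
          ‖x - p‖ ^ (-(5/2) : ℝ) * (‖g x‖ * ‖gradient w x‖) + 5/2 * ‖x - p‖ ^ (-(7/2) : ℝ) * (‖g x‖ * |w x|) := by
        rw [hgx, inner_add_right, inner_smul_right]
        have j1 := real_inner_le_norm (g x) (gradient w x)
        have j2 := real_inner_le_norm (g x) (w x • ((-(5/2) * ‖x - p‖ ^ (-(5/2) - 2 : ℝ)) • (x - p)))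
        have j3 : ‖w x • ((-(5/2) * ‖x - p‖ ^ (-(5/2) - 2 : ℝ)) • (x - p))‖ =
            5/2 * ‖x - p‖ ^ (-(7/2) : ℝ) * |w x| := by
          rw [norm_smul, norm_smul, norm_mul, Real.norm_eq_abs, Real.norm_eq_abs, Real.norm_eq_abs,
            abs_of_nonneg (by positivity : 0 ≤ ‖x - p‖ ^ (-(5/2) - 2 : ℝ)), mul_assoc |(-(5/2) : ℝ)|,
            ← Real.rpow_add_one hr0.ne']
          norm_num [abs_of_pos]; ring
        rw [j3] at j2
        have : 0 ≤ ‖x - p‖ ^ (-(5/2) : ℝ) := by positivity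
        nlinarith
      rw [i1]; linarith
  rw [integral_add ((((bX.cmul _).add (bY.cmul _)).add (bQ.cmul _)).integrableOn hD) (bO.integrableOn hD),
    integral_add (((bX.cmul _).add (bY.cmul _)).integrableOn hD) ((bQ.cmul _).integrableOn hD),
    integral_add ((bX.cmul _).integrableOn hD) ((bY.cmul _).integrableOn hD),
    integral_sub ((hw.gbm.inner hχL.gbm).integrableOn hD) ((W.bm.inner hχL.gbm).integrableOn hD),
    W.orth χ hχ, sub_self, integral_const_mul, integral_const_mul, integral_const_mul, ← hX] at hpt
  have hX0 : 0 ≤ X := integral_nonneg fun x => by positivity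
  have hsm : 2028 * (S * (h / κ) ^ 2) ≤ 1 := by
    have h1 : h / κ * (1 + 2028 * S) ≤ 1 := by rw [div_mul_eq_mul_div, div_le_one hκ0]; linarith
    have h2 : 0 ≤ h / κ := by positivity
    have h3 : h / κ ≤ 1 := by rw [div_le_one hκ0]; exact hhκ
    nlinarith [mul_nonneg h2 hS0]
  have := mul_le_mul_of_nonneg_right hsm hX0
  linarith

/-- Local energy. -/
def En (w : E3 → ℝ) (x : E3) (t : ℝ) : ℝ := ∫ y in ball x t, ‖gradient w y‖ ^ 2

theorem LO.gsq_int (hD : Dom Ω) {f : E3 → ℝ} (hf : LO Ω f) : Integrable (fun x => ‖gradient f x‖ ^ 2) := by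
  have h1 : IntegrableOn (fun x => ‖gradient f x‖ ^ 2) Ω := hf.gbm.nsq.integrableOn hD
  rw [← integrable_indicator_iff hD.meas] at h1
  refine h1.congr ?_
  filter_upwards [hf.ae_zero hD] with x hx
  by_cases hxO : x ∈ Ω
  · simp [hxO]
  · simp [hxO, (hx hxO).2]

theorem En_nonneg (w : E3 → ℝ) (x : E3) (t : ℝ) : 0 ≤ En w x t := integral_nonneg fun _ => by positivity

theorem LO.En_mono (hD : Dom Ω) {f : E3 → ℝ} (hf : LO Ω f) {x y : E3} {s t : ℝ} (h : ball x s ⊆ ball y t) :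
    En f x s ≤ En f y t :=
  setIntegral_mono_set (hf.gsq_int hD).integrableOn (Filter.Eventually.of_forall fun _ => by positivity)
    h.eventuallyLE

theorem LO.En_le (hD : Dom Ω) {f : E3 → ℝ} (hf : LO Ω f) {x : E3} {t : ℝ} {m : E3 → ℝ} (hm : BM Ω m)
    (hm0 : ∀ y ∈ Ω, 0 ≤ m y) (h1 : ∀ y ∈ Ω, y ∈ ball x t → 1 ≤ m y) :
    En f x t ≤ ∫ y in Ω, m y * ‖gradient f y‖ ^ 2 := by
  rw [En, ← integral_indicator measurableSet_ball, ← setIntegral_eq_full hD]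
  · refine integral_mono_of_nonneg (Filter.Eventually.of_forall fun y => indicator_nonneg (fun _ _ => by positivity) y)
      ((hm.mul hf.gbm.nsq).integrableOn hD) ?_
    refine (ae_restrict_iff' hD.meas).2 (Filter.Eventually.of_forall fun y hy => ?_)
    by_cases hyb : y ∈ ball x t
    · simp only [hyb, indicator_of_mem]
      nlinarith [h1 y hy hyb, sq_nonneg ‖gradient f y‖]
    · simp only [hyb, not_false_iff, indicator_of_notMem]
      have := hm0 y hy
      positivity
  · filter_upwards [hf.ae_zero hD] with y hy hyO
    simp [indicator, (hy hyO).2]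

theorem Geo.wbs (G : Geo Ω z0 r0 d) (hc : 0 < c) (r : ℕ) : ∃ K1, 1 ≤ K1 ∧ ∀ m : ℝ, 1 ≤ m → ∃ C, 0 < C ∧
    ∀ {T : Finset (Fin 4 → E3)} {h : ℝ} {g : E3 → E3} {w : E3 → ℝ} {p n y0 : E3} {t : ℝ}, Msh Ω T h c r →
    Ritz Ω T r h g w → 4 * h ≤ r0 → h ≤ t → t ≤ m * d → Pole Ω p n (K1 * t) → y0 ∈ closure Ω → ‖y0 - p‖ = K1 * t →
    ∫ x in Ω, ‖x - p‖ ^ (-(5/2) : ℝ) * ‖g x‖ ^ 2 ≤ C * h * t ^ (-(1/2) : ℝ) ∧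
    ∫ x in Ω, ‖x - p‖ ^ (-(5/2) : ℝ) * ‖gradient w x‖ ^ 2 ≤ C * h * t ^ (-(1/2) : ℝ) := by
  obtain ⟨K1, hK1, HK1⟩ := wb_main hc r
  have hd := G.dpos
  refine ⟨K1, hK1, fun m hm => ?_⟩
  obtain ⟨C, hC, HC⟩ := G.strip (R := (1 + K1 * m) * d) (by nlinarith [mul_pos (by linarith : 0 < K1) (by linarith : 0 < m)])
  refine ⟨10400 * C, by positivity, fun {T h g w p n y0 t} M W hs ht htd hp hy0 hyp => ?_⟩
  have hh := M.h0
  have ht0 := hh.trans_le ht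
  have hD := G.D
  have hw := FE.LO M W.fe
  have h1 := HK1 M W hp (mul_le_mul_of_nonneg_left ht (by linarith))
  have hpR : ∀ x ∈ Ω, ‖x - p‖ ≤ (1 + K1 * m) * d := fun x hx => by
    have h1 := G.clos (subset_closure hx) hy0
    have h2 := norm_sub_le_norm_sub_add_norm_sub x y0 p
    have : K1 * t ≤ K1 * (m * d) := mul_le_mul_of_nonneg_left htd (by linarith)
    rw [hyp] at h2; linarith
  have h2 := HC hh hs hp hpR
  have h3 : ∫ x in Ω, ‖x - p‖ ^ (-(5/2) : ℝ) * ‖g x‖ ^ 2 ≤ ∫ x in Lam Ω h, ‖x - p‖ ^ (-(5/2) : ℝ) := by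
    rw [← integral_indicator (Lam_meas hD h), ← setIntegral_eq_full hD]
    · refine setIntegral_mono_on (((hp.bm hD _).mul W.bm.nsq).integrableOn hD)
        (((hp.bm hD _).integrableOn hD).indicator (Lam_meas hD h)) hD.meas fun y hy => ?_
      by_cases hyL : y ∈ Lam Ω h
      · simp only [hyL, indicator_of_mem]
        exact mul_le_of_le_one_right (by positivity) (pow_le_one₀ (norm_nonneg _) (W.gb y))
      · simp [hyL, W.gz y hyL]
    · exact Filter.Eventually.of_forall fun y hy => indicator_of_notMem (fun hL => hy (Lam_sub h hL)) _
  have h5 : C * h * (K1 * t) ^ (-(1/2) : ℝ) ≤ C * h * t ^ (-(1/2) : ℝ) :=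
    mul_le_mul_of_nonneg_left (Real.rpow_le_rpow_of_nonpos ht0 (le_mul_of_one_le_left ht0.le hK1) (by norm_num))
      (by positivity)
  have h6 : 0 ≤ C * h * t ^ (-(1/2) : ℝ) := by positivity
  have h7 : ∫ x in Ω, ‖x - p‖ ^ (-(5/2) : ℝ) * ‖gradient w x‖ ^ 2 ≤
      ∫ x in Ω, (‖x - p‖ ^ (-(5/2) : ℝ) * ‖gradient w x‖ ^ 2 + ‖x - p‖ ^ (-(9/2) : ℝ) * w x ^ 2) :=
    setIntegral_mono_on (((hp.bm hD _).mul hw.gbm.nsq).integrableOn hD)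
      ((((hp.bm hD _).mul hw.gbm.nsq).add ((hp.bm hD _).mul (hw.bm hD).sq)).integrableOn hD) hD.meas
      fun y hy => le_add_of_nonneg_right (by positivity)
  constructor <;> nlinarith

/-- Energy of the dual solution near the boundary. -/
theorem Geo.near (G : Geo Ω z0 r0 d) (hc : 0 < c) (r : ℕ) {m : ℝ} (hm : 1 ≤ m) : ∃ C, 0 < C ∧
    ∀ {T : Finset (Fin 4 → E3)} {h : ℝ} {g : E3 → E3} {w : E3 → ℝ} {x : E3} {t : ℝ}, Msh Ω T h c r →
    Ritz Ω T r h g w → 4 * h ≤ r0 → h ≤ t → t ≤ m * d → infDist x (frontier Ω) ≤ m * t →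
    En w x t ≤ C * h * t ^ 2 := by
  obtain ⟨K1, hK1, H1⟩ := G.wbs hc r
  obtain ⟨C, hC, HC⟩ := H1 m hm
  refine ⟨(1 + m + K1) ^ (5/2 : ℝ) * C, by positivity, fun {T h g w x t} M W hs ht htd hx => ?_⟩
  have hh := M.h0
  have ht0 := hh.trans_le ht
  obtain ⟨y0, hy0, hxy⟩ := isClosed_frontier.exists_infDist_eq_dist G.fne x
  obtain ⟨n, hn, hpole⟩ := G.poleAt hy0
  set κ := K1 * t with hκd
  have hκ : 0 < κ := by positivity
  have hp := hpole κ hκ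
  set p := y0 - κ • n
  have hyp : ‖y0 - p‖ = κ := by simp [p, norm_smul, hn, abs_of_pos hκ]
  have h1 := (HC M W hs ht htd hp (frontier_subset_closure hy0) hyp).2
  have hD := G.D
  have hw := FE.LO M W.fe
  set L := (1 + m + K1) * t with hL
  have hL0 : 0 < L := by positivity
  have h4 : En w x t ≤ ∫ y in Ω, (L ^ (5/2 : ℝ) * ‖y - p‖ ^ (-(5/2) : ℝ)) * ‖gradient w y‖ ^ 2 := by
    refine hw.En_le hD ((hp.bm hD _).cmul _) (fun y _ => by positivity) fun y hy hyb => ?_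
    have hr0 := hp.rpos hy
    have : ‖y - p‖ ≤ L := by
      have e1 := norm_sub_le_norm_sub_add_norm_sub y x p
      have e2 := norm_sub_le_norm_sub_add_norm_sub x y0 p
      rw [mem_ball, dist_eq_norm] at hyb
      rw [dist_eq_norm] at hxy
      rw [hyp] at e2
      rw [hL]; nlinarith
    rw [Real.rpow_neg hr0.le, ← div_eq_mul_inv, one_le_div (by positivity)]
    gcongr
  simp only [mul_assoc] at h4
  rw [integral_const_mul] at h4
  calc En w x t ≤ _ := h4
    _ ≤ L ^ (5/2 : ℝ) * (C * h * t ^ (-(1/2) : ℝ)) := mul_le_mul_of_nonneg_left h1 (by positivity)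
    _ = (1 + m + K1) ^ (5/2 : ℝ) * C * h * (t ^ (5/2 : ℝ) * t ^ (-(1/2) : ℝ)) := by
        rw [hL, Real.mul_rpow (by positivity) ht0.le]; ring
    _ = _ := by rw [← Real.rpow_add ht0, ← Real.rpow_two]; norm_num

end wb

section tr
variable {Ω : Set E3} {T : Finset (Fin 4 → E3)} {h c : ℝ} {r : ℕ} {v : Fin 4 → E3}

theorem tr_pt0 {f : E3 → ℝ} {K : ℝ≥0} (hK : LipschitzWith K f) (b y : E3) (hy : ∀ᵐ s : ℝ, DifferentiableAt ℝ f (y + s • b)) :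
    (f (y + b) - f y) ^ 2 ≤ ‖b‖ ^ 2 * ∫ s in Ioc (0:ℝ) 1, ‖gradient f (y + s • b)‖ ^ 2 := by
  have hline : LipschitzWith ‖b‖₊ (fun s : ℝ => y + s • b) := LipschitzWith.of_dist_le_mul fun s t => by
    simp [dist_eq_norm, ← sub_smul, norm_smul, mul_comm]
  have hφ := ((hK.comp hline).lipschitzOnWith (s := uIcc 0 1)).absolutelyContinuousOnInterval.integral_deriv_eq_sub
  have e1 : ∫ s in (0:ℝ)..1, deriv (f ∘ fun s : ℝ => y + s • b) s =
      ∫ s in Ioc (0:ℝ) 1, 1 * ⟪gradient f (y + s • b), b⟫ := by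
    rw [intervalIntegral.integral_of_le zero_le_one]
    refine integral_congr_ae (ae_restrict_of_ae ?_)
    filter_upwards [hy] with s hs
    have hs' : DifferentiableAt ℝ f (y + s • b) := hs
    have h1 : HasDerivAt (fun s : ℝ => y + s • b) b s := by
      simpa using ((hasDerivAt_id s).smul_const b).const_add y
    rw [(hs'.hasFDerivAt.comp_hasDerivAt s h1).deriv, one_mul, inner_gradient_left]
  have hgm : Measurable (fun s : ℝ => gradient f (y + s • b)) :=
    (measurable_gradient f).comp hline.continuous.measurable
  have hb1 : IntegrableOn (fun s : ℝ => ‖gradient f (y + s • b)‖ ^ 2) (Ioc 0 1) :=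
    IntegrableOn.of_bound (by simp) (hgm.norm.pow_const 2).aestronglyMeasurable (K ^ 2) (Filter.Eventually.of_forall fun s => by
      rw [Real.norm_of_nonneg (by positivity)]; gcongr; exact norm_gradient_le hK _)
  have hle : ∀ s : ℝ, ⟪gradient f (y + s • b), b⟫ ^ 2 ≤ ‖b‖ ^ 2 * ‖gradient f (y + s • b)‖ ^ 2 := fun s => by
    rw [← mul_pow, mul_comm, ← sq_abs]; gcongr; exact abs_real_inner_le_norm _ _
  have hb2 : IntegrableOn (fun s : ℝ => ⟪gradient f (y + s • b), b⟫ ^ 2) (Ioc 0 1) :=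
    (hb1.const_mul (‖b‖ ^ 2)).mono' ((hgm.inner measurable_const).pow_const 2).aestronglyMeasurable (Filter.Eventually.of_forall fun s => by
      rw [Real.norm_of_nonneg (by positivity)]; exact hle s)
  have hb3 : IntegrableOn (fun s : ℝ => 1 * ⟪gradient f (y + s • b), b⟫) (Ioc 0 1) :=
    IntegrableOn.of_bound (by simp) ((hgm.inner measurable_const).const_mul 1).aestronglyMeasurable (K * ‖b‖) (Filter.Eventually.of_forall fun s => by
      rw [one_mul]; exact (norm_inner_le_norm _ _).trans (by gcongr; exact norm_gradient_le hK _))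
  have h2 := cs_int (F := fun _ : ℝ => (1:ℝ)) (μ := volume.restrict (Ioc (0:ℝ) 1)) (by simp) hb2 hb3
  rw [← e1, hφ] at h2
  simp only [Function.comp, one_smul, zero_smul, add_zero] at h2
  refine h2.trans ?_
  have h3 := setIntegral_mono hb2 (hb1.const_mul _) hle
  rw [show ∫ _ in Ioc (0:ℝ) 1, (1:ℝ) ^ 2 = 1 by simp, one_mul, ← integral_const_mul]
  exact h3

theorem tr_pt {f : E3 → ℝ} {K : ℝ≥0} (hK : LipschitzWith K f) (b : E3) :
    ∀ᵐ y, (f (y + b) - f y) ^ 2 ≤ ‖b‖ ^ 2 * ∫ s in Ioc (0:ℝ) 1, ‖gradient f (y + s • b)‖ ^ 2 := by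
  have h0 := (ae_ae_add_linearMap_mem_iff (LinearMap.toSpanSingleton ℝ E3 b) volume volume
    (measurableSet_of_differentiableAt ℝ f)).2 hK.ae_differentiableAt
  filter_upwards [h0] with y hy
  exact tr_pt0 hK b y hy

theorem ball_tr (x b : E3) (R : ℝ) (F : E3 → ℝ) : ∫ y in ball x R, F (y + b) = ∫ y in ball (x + b) R, F y := by
  rw [← integral_indicator measurableSet_ball, ← integral_indicator measurableSet_ball,
    ← integral_add_right_eq_self ((ball (x + b) R).indicator F) b]
  congr 1; ext y
  simp [indicator, mem_ball]

theorem LO.tr (hD : Dom Ω) {f : E3 → ℝ} (hf : LO Ω f) (x : E3) (R : ℝ) {b : E3} {s : ℝ} (hb : ‖b‖ ≤ s) :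
    ∫ y in ball x R, (f (y + b) - f y) ^ 2 ≤ s ^ 2 * En f x (R + s) := by
  obtain ⟨K, hK⟩ := hf.1
  have hm : Measurable (Function.uncurry fun (y : E3) (t : ℝ) => ‖gradient f (y + t • b)‖ ^ 2) := by
    have := (measurable_gradient f).comp (by fun_prop : Measurable fun q : E3 × ℝ => q.1 + q.2 • b)
    exact this.norm.pow_const 2
  have hI : Integrable (Function.uncurry fun (y : E3) (t : ℝ) => ‖gradient f (y + t • b)‖ ^ 2)
      ((volume.restrict (ball x R)).prod (volume.restrict (Ioc (0:ℝ) 1))) := by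
    have : IsFiniteMeasure ((volume : Measure E3).restrict (ball x R)) := isFiniteMeasure_restrict.2 measure_ball_lt_top.ne
    refine Integrable.of_bound hm.aestronglyMeasurable (K ^ 2) (Filter.Eventually.of_forall fun q => ?_)
    simp only [Function.uncurry]
    rw [Real.norm_of_nonneg (by positivity)]; gcongr; exact norm_gradient_le hK _
  have hI2 : Integrable (fun y => ‖b‖ ^ 2 * ∫ t in Ioc (0:ℝ) 1, ‖gradient f (y + t • b)‖ ^ 2)
      (volume.restrict (ball x R)) := hI.integral_prod_left.const_mul _
  calc _ ≤ ∫ y in ball x R, ‖b‖ ^ 2 * ∫ t in Ioc (0:ℝ) 1, ‖gradient f (y + t • b)‖ ^ 2 :=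
        integral_mono_of_nonneg (Filter.Eventually.of_forall fun y => sq_nonneg _) hI2 (ae_restrict_of_ae (tr_pt hK b))
    _ = ‖b‖ ^ 2 * ∫ t in Ioc (0:ℝ) 1, En f (x + t • b) R := by
        rw [integral_const_mul, integral_integral_swap hI]
        simp only [ball_tr x _ R fun z => ‖gradient f z‖ ^ 2, En]
    _ ≤ s ^ 2 * En f x (R + s) := by
        have h1 : ∫ t in Ioc (0:ℝ) 1, En f (x + t • b) R ≤ ∫ t in Ioc (0:ℝ) 1, En f x (R + s) := by
          refine integral_mono_of_nonneg (Filter.Eventually.of_forall fun t => En_nonneg _ _ _) (integrable_const _)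
            ((ae_restrict_iff' measurableSet_Ioc).2 (Filter.Eventually.of_forall fun t ht => ?_))
          refine hf.En_mono hD (ball_subset_ball' ?_)
          have : ‖t • b‖ ≤ ‖b‖ := by
            rw [norm_smul, Real.norm_of_nonneg ht.1.le]; exact mul_le_of_le_one_left (norm_nonneg _) ht.2
          simp only [dist_self_add_left]; linarith
        have h2 : ∫ t in Ioc (0:ℝ) 1, En f x (R + s) = En f x (R + s) := by simp
        rw [h2] at h1
        exact mul_le_mul (pow_le_pow_left₀ (norm_nonneg _) hb 2) h1 (integral_nonneg fun t => En_nonneg _ _ _) (sq_nonneg _)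

/-- Ball averages. -/
def Av (s : ℝ) (f : E3 → ℝ) (y : E3) : ℝ := (s ^ 3 * vb)⁻¹ * ∫ z in ball y s, f z

theorem Av_eq0 (s : ℝ) (f : E3 → ℝ) (y : E3) : Av s f y = (s ^ 3 * vb)⁻¹ * ∫ b in ball 0 s, f (y + b) := by
  rw [Av, ← zero_add y, ← ball_tr, zero_add]; simp only [add_comm]

theorem ball_one (x : E3) {s : ℝ} (hs : 0 ≤ s) : ∫ _ in ball x s, (1:ℝ) = s ^ 3 * vb := by
  rw [setIntegral_const, Measure.real, vol_ball x hs, smul_eq_mul, mul_one]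

theorem ball_cs {s : ℝ} (hs : 0 < s) (y : E3) {F : E3 → ℝ} (hF : Continuous F) :
    ((s ^ 3 * vb)⁻¹ * ∫ b in ball y s, F b) ^ 2 ≤ (s ^ 3 * vb)⁻¹ * ∫ b in ball y s, F b ^ 2 := by
  have hi : ∀ G : E3 → ℝ, Continuous G → IntegrableOn G (ball y s) := fun G hG =>
    (hG.continuousOn.integrableOn_compact (isCompact_closedBall y s)).mono_set ball_subset_closedBall
  have hv := vb_pos
  have := cs_int (F := fun _ => (1:ℝ)) (hi _ (by fun_prop)) (hi _ (hF.pow 2)) (hi _ (by fun_prop))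
  simp only [one_mul, one_pow, ball_one y hs.le] at this
  rw [mul_pow, sq (s ^ 3 * vb)⁻¹, mul_assoc]
  refine mul_le_mul_of_nonneg_left ?_ (by positivity)
  rwa [inv_mul_le_iff₀ (by positivity)]

theorem LO.av1 (hD : Dom Ω) {f : E3 → ℝ} (hf : LO Ω f) (x : E3) (R : ℝ) {s : ℝ} (hs : 0 < s) :
    ∫ y in ball x R, (f y - Av s f y) ^ 2 ≤ s ^ 2 * En f x (R + s) := by
  have hc := hf.cont
  have hv := vb_pos
  obtain ⟨K, hK⟩ := hf.1
  have : ∀ (x : E3) s, IsFiniteMeasure ((volume : Measure E3).restrict (ball x s)) := fun x s =>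
    isFiniteMeasure_restrict.2 measure_ball_lt_top.ne
  have hI : Integrable (Function.uncurry fun (y b : E3) => (f (y + b) - f y) ^ 2)
      ((volume.restrict (ball x R)).prod (volume.restrict (ball 0 s))) := by
    have hcc : Continuous (Function.uncurry fun (y b : E3) => (f (y + b) - f y) ^ 2) := by
      simp only [Function.uncurry_def]; fun_prop
    rw [Measure.prod_restrict]
    refine (hcc.continuousOn.integrableOn_compact
      ((isCompact_closedBall x R).prod (isCompact_closedBall (0:E3) s))).mono_set
      (prod_mono ball_subset_closedBall ball_subset_closedBall)
  have hpt : ∀ y, (f y - Av s f y) ^ 2 ≤ (s ^ 3 * vb)⁻¹ * ∫ b in ball 0 s, (f (y + b) - f y) ^ 2 := fun y => by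
    have h1 := ball_cs hs 0 (F := fun b => f (y + b) - f y) (by fun_prop)
    have hi : IntegrableOn (fun b => f (y + b)) (ball 0 s) :=
      ((by fun_prop : Continuous fun b => f (y + b)).continuousOn.integrableOn_compact (isCompact_closedBall 0 s)).mono_set
        ball_subset_closedBall
    rw [integral_sub hi (by simp), mul_sub, ← Av_eq0] at h1
    have h2 : (s ^ 3 * vb)⁻¹ * ∫ _ in ball (0:E3) s, f y = f y := by
      have e : ∫ _ in ball (0:E3) s, f y = f y * ∫ _ in ball (0:E3) s, (1:ℝ) := by
        rw [← integral_const_mul]; simp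
      rw [e, ball_one 0 hs.le]; field_simp
    rw [h2] at h1
    rwa [← neg_sub, neg_sq]
  calc _ ≤ ∫ y in ball x R, (s ^ 3 * vb)⁻¹ * ∫ b in ball 0 s, (f (y + b) - f y) ^ 2 :=
        integral_mono_of_nonneg (Filter.Eventually.of_forall fun y => by positivity)
          (hI.integral_prod_left.const_mul _) (Filter.Eventually.of_forall hpt)
    _ = (s ^ 3 * vb)⁻¹ * ∫ b in ball 0 s, ∫ y in ball x R, (f (y + b) - f y) ^ 2 := by
        rw [integral_const_mul, integral_integral_swap hI]
    _ ≤ (s ^ 3 * vb)⁻¹ * ∫ b in ball (0:E3) s, (s ^ 2 * En f x (R + s)) * 1 := by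
        refine mul_le_mul_of_nonneg_left ?_ (by positivity)
        refine integral_mono_of_nonneg (Filter.Eventually.of_forall fun t => integral_nonneg fun _ => by positivity)
          (integrable_const _) ((ae_restrict_iff' measurableSet_ball).2 (Filter.Eventually.of_forall fun b hb => ?_))
        rw [mul_one]
        exact hf.tr hD x R (mem_ball_zero_iff.1 hb).le
    _ = _ := by rw [integral_const_mul, ball_one 0 hs.le]; field_simp

theorem LO.av2 (hD : Dom Ω) {f : E3 → ℝ} (hf : LO Ω f) (x y : E3) {s : ℝ} (hs : 0 < s) {t : ℝ} (ht : ‖y - x‖ ≤ t) :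
    (Av s f y - Av s f x) ^ 2 ≤ (s ^ 3 * vb)⁻¹ * (t ^ 2 * En f x (s + t)) := by
  have hc := hf.cont
  have hv := vb_pos
  have hi : ∀ G : E3 → ℝ, Continuous G → IntegrableOn G (ball x s) := fun G hG =>
    (hG.continuousOn.integrableOn_compact (isCompact_closedBall x s)).mono_set ball_subset_closedBall
  have e : Av s f y = (s ^ 3 * vb)⁻¹ * ∫ b in ball x s, f (b + (y - x)) := by
    rw [ball_tr, Av, add_sub_cancel]
  have := ball_cs hs x (F := fun b => f (b + (y - x)) - f b) (by fun_prop)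
  rw [integral_sub (hi _ (by fun_prop)) (hi _ hc), mul_sub, ← e] at this
  exact this.trans (mul_le_mul_of_nonneg_left (hf.tr hD x s ht) (by positivity))
end tr

/-- Regularized Newton field. -/
def Fk (s : ℝ) (x : E3) : E3 := ((max ‖x‖ s) ^ 3)⁻¹ • x

section kern
variable {Ω : Set E3} {T : Finset (Fin 4 → E3)} {h c : ℝ} {r : ℕ} {v : Fin 4 → E3}

theorem inv_cube {a b : ℝ} (ha : 0 < a) (hab : a ≤ b) : |(b ^ 3)⁻¹ - (a ^ 3)⁻¹| * a ≤ 3 * (a ^ 3)⁻¹ * (b - a) := by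
  have hb := ha.trans_le hab
  rw [abs_of_nonpos (sub_nonpos.2 (by gcongr))]
  have : -((b ^ 3)⁻¹ - (a ^ 3)⁻¹) * a = (a ^ 3)⁻¹ * (b ^ 3)⁻¹ * ((b ^ 3 - a ^ 3) * a) := by field_simp; ring
  rw [this, show 3 * (a ^ 3)⁻¹ * (b - a) = (a ^ 3)⁻¹ * (b ^ 3)⁻¹ * (3 * b ^ 3 * (b - a)) by field_simp]
  refine mul_le_mul_of_nonneg_left ?_ (by positivity)
  have h1 : (b ^ 3 - a ^ 3) * a = (b - a) * ((b ^ 2 + a * b + a ^ 2) * a) := by ring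
  rw [h1, mul_comm _ (b - a)]
  refine mul_le_mul_of_nonneg_left ?_ (by linarith)
  nlinarith [mul_le_mul hab hab ha.le hb.le, pow_le_pow_left₀ ha.le hab 3, mul_le_mul_of_nonneg_left hab (sq_nonneg b),
    mul_le_mul_of_nonneg_left (mul_le_mul hab hab ha.le hb.le) hb.le]

theorem Fk_lip {s : ℝ} (hs : 0 < s) (x y : E3) : ‖Fk s x - Fk s y‖ ≤ 4 * (s ^ 3)⁻¹ * ‖x - y‖ := by
  wlog hxy : ‖y‖ ≤ ‖x‖ generalizing x y
  · rw [norm_sub_rev, norm_sub_rev x]; exact this y x (le_of_not_ge hxy)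
  set a := max ‖y‖ s
  set b := max ‖x‖ s
  have ha : s ≤ a := le_max_right _ _
  have ha0 := hs.trans_le ha
  have hab : a ≤ b := max_le_max_right s hxy
  have hba : b - a ≤ ‖x - y‖ :=
    (le_abs_self _).trans ((abs_max_sub_max_le_abs _ _ _).trans (abs_norm_sub_norm_le x y))
  have e : Fk s x - Fk s y = (b ^ 3)⁻¹ • (x - y) + ((b ^ 3)⁻¹ - (a ^ 3)⁻¹) • y := by
    simp only [Fk, a, b]; module
  rw [e]
  refine (norm_add_le _ _).trans ?_
  have hb0 := ha0.trans_le hab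
  rw [norm_smul, norm_smul, Real.norm_of_nonneg (by positivity), Real.norm_eq_abs]
  have h1 := inv_cube ha0 hab
  have h2 : |(b ^ 3)⁻¹ - (a ^ 3)⁻¹| * ‖y‖ ≤ |(b ^ 3)⁻¹ - (a ^ 3)⁻¹| * a :=
    mul_le_mul_of_nonneg_left (le_max_left _ _) (abs_nonneg _)
  have h3 : (b ^ 3)⁻¹ ≤ (s ^ 3)⁻¹ := by have := ha.trans hab; gcongr
  have h4 : 3 * (a ^ 3)⁻¹ * (b - a) ≤ 3 * (s ^ 3)⁻¹ * ‖x - y‖ := by gcongr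
  nlinarith [norm_nonneg (x - y)]

theorem Fk_cont {s : ℝ} (hs : 0 < s) : Continuous (Fk s) :=
  (LipschitzWith.of_dist_le_mul (K := Real.toNNReal (4 * (s ^ 3)⁻¹)) fun x y => by
    rw [dist_eq_norm, dist_eq_norm, Real.coe_toNNReal _ (by positivity)]; exact Fk_lip hs x y).continuous

theorem Fk_le {s : ℝ} (hs : 0 < s) (x : E3) : ‖Fk s x‖ ≤ (s ^ 2)⁻¹ := by
  have h0 : 0 < max ‖x‖ s := lt_max_of_lt_right hs
  rw [Fk, norm_smul, Real.norm_of_nonneg (by positivity)]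
  calc _ ≤ ((max ‖x‖ s) ^ 3)⁻¹ * max ‖x‖ s := by gcongr; exact le_max_left _ _
    _ = ((max ‖x‖ s) ^ 2)⁻¹ := by field_simp
    _ ≤ _ := by gcongr; exact le_max_right _ _

theorem mk_grad {s : ℝ} (hs : 0 < s) {y x : E3} (hx : ‖x - y‖ ≠ s) : ∃ a,
    HasGradientAt (fun z => ((max ‖z - y‖ s) ^ 3)⁻¹) a x ∧
    3 * ((max ‖x - y‖ s) ^ 3)⁻¹ + ⟪a, x - y⟫ = (ball y s).indicator (fun _ => 3 * (s ^ 3)⁻¹) x := by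
  rcases lt_or_gt_of_ne hx with h1 | h1
  · refine ⟨0, ?_, ?_⟩
    · have : HasGradientAt (fun _ : E3 => (s ^ 3)⁻¹) 0 x := hasGradientAt_const _ _
      refine this.congr_of_eventuallyEq ?_
      filter_upwards [(isOpen_lt (f := fun z : E3 => ‖z - y‖) (by fun_prop) continuous_const).mem_nhds h1] with z hz
      rw [max_eq_right (le_of_lt hz)]
    · rw [indicator_of_mem (by rwa [mem_ball, dist_eq_norm]), max_eq_right h1.le]; simp
  · have h0 := hs.trans h1
    refine ⟨_, (hasGradientAt_rpow y (-3) h0).congr_of_eventuallyEq ?_, ?_⟩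
    · filter_upwards [(isOpen_lt (g := fun z : E3 => ‖z - y‖) continuous_const (by fun_prop)).mem_nhds h1] with z hz
      rw [max_eq_left (le_of_lt hz), Real.rpow_neg (norm_nonneg _)]; norm_cast
    · rw [indicator_of_notMem (by rw [mem_ball, dist_eq_norm]; exact h1.not_gt), max_eq_left h1.le, inner_smul_left,
        real_inner_self_eq_norm_sq, show (-3 - 2 : ℝ) = -5 by norm_num, Real.rpow_neg (norm_nonneg _)]
      norm_cast
      simp only [conj_trivial]
      have := h0.ne'
      push_cast
      field_simp; ring

theorem LO.av_eq (hD : Dom Ω) {f : E3 → ℝ} (hf : LO Ω f) {s : ℝ} (hs : 0 < s) (y : E3) :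
    Av s f y = -(3 * vb)⁻¹ * ∫ x, ⟪Fk s (x - y), gradient f x⟫ := by
  have hae := hf.ae
  have hv := vb_pos
  obtain ⟨K, hK⟩ := hf.1
  have hcs := hf.cs hD
  have hX : ∀ i, LipschitzWith (Real.toNNReal (4 * (s ^ 3)⁻¹)) (fun x => Fk s (x - y) i) := fun i =>
    LipschitzWith.of_dist_le_mul fun x z => by
      rw [dist_eq_norm, dist_eq_norm, Real.coe_toNNReal _ (by positivity)]
      have h1 := Fk_lip hs (x - y) (z - y)
      rw [sub_sub_sub_cancel_right] at h1
      exact (PiLp.norm_apply_le (Fk s (x - y) - Fk s (z - y)) i).trans h1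
  have hi := fun i => LipschitzWith.integral_lineDeriv_mul_eq (μ := volume) (hX i) hK hcs (EuclideanSpace.single i (1:ℝ))
  have hg : ∀ i : Fin 3, ∀ᵐ x, lineDeriv ℝ f x (-EuclideanSpace.single i (1:ℝ)) * Fk s (x - y) i =
      -(Fk s (x - y) i * gradient f x i) := fun i => by
    filter_upwards [hae] with x hx
    rw [hx.lineDeriv_eq_fderiv, map_neg, ← inner_gradient_left, inner_single]; ring
  have hint : ∀ i : Fin 3, Integrable (fun x => Fk s (x - y) i * gradient f x i) := fun i => by
    have hb : BM Ω (fun x => Fk s (x - y) i * gradient f x i) := by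
      refine BM.mul ⟨?_, (s ^ 2)⁻¹, fun x _ => (PiLp.norm_apply_le _ i).trans (Fk_le hs _)⟩
        ⟨by have := measurable_gradient f; fun_prop, K, fun x _ => (PiLp.norm_apply_le _ i).trans (norm_gradient_le hK x)⟩
      exact (hX i).continuous.measurable
    refine (integrable_indicator_iff hD.meas).2 (hb.integrableOn hD) |>.congr ?_
    filter_upwards [hf.ae_zero hD] with x hx
    by_cases hxO : x ∈ Ω <;> simp [hxO]
    simp [(hx hxO).2]
  have hint2 : ∀ i : Fin 3, Integrable (fun x => lineDeriv ℝ (fun x => Fk s (x - y) i) x (EuclideanSpace.single i 1) * f x) :=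
    fun i => by
      refine (hf.cont.integrable_of_hasCompactSupport hcs).bdd_mul (c := 4 * (s ^ 3)⁻¹)
        (measurable_lineDeriv (hX i).continuous).aestronglyMeasurable (Filter.Eventually.of_forall fun x => ?_)
      have := norm_lineDeriv_le_of_lipschitz ℝ (hX i) (x₀ := x) (v := EuclideanSpace.single i (1:ℝ))
      rwa [Real.coe_toNNReal _ (by positivity), PiLp.norm_single, norm_one, mul_one] at this
  have hsum : ∑ i : Fin 3, ∫ x, lineDeriv ℝ (fun x => Fk s (x - y) i) x (EuclideanSpace.single i 1) * f x =
      3 * (s ^ 3)⁻¹ * ∫ x in ball y s, f x := by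
    rw [← integral_finsetSum _ fun i _ => hint2 i, ← integral_const_mul, ← integral_indicator measurableSet_ball]
    refine integral_congr_ae ?_
    have hsp : ∀ᵐ x : E3, x ∉ sphere y s := by
      exact measure_eq_zero_iff_ae_notMem.1 (Measure.addHaar_sphere volume y s)
    filter_upwards [hsp] with x hx
    rw [mem_sphere, dist_eq_norm] at hx
    obtain ⟨a, ha, hae⟩ := mk_grad hs hx
    have hd : ∀ i : Fin 3, lineDeriv ℝ (fun x => Fk s (x - y) i) x (EuclideanSpace.single i 1) =
        ((max ‖x - y‖ s) ^ 3)⁻¹ + (x - y) i * a i := fun i => by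
      have h2 := ha.mul' (hasGradientAt_inner (EuclideanSpace.single i (1:ℝ)) y x)
      simp only [real_inner_comm _ (EuclideanSpace.single i (1:ℝ)), inner_single] at h2
      have h3 : (fun x => Fk s (x - y) i) = fun x => ((max ‖x - y‖ s) ^ 3)⁻¹ * (x - y) i := by
        ext z; simp [Fk]
      rw [h3, h2.differentiableAt.lineDeriv_eq_fderiv, ← inner_gradient_left, h2.gradient, inner_single]
      simp
    rw [← Finset.sum_mul, Fin.sum_univ_three, hd, hd, hd]
    have : ((max ‖x - y‖ s) ^ 3)⁻¹ + (x - y) 0 * a 0 + (((max ‖x - y‖ s) ^ 3)⁻¹ + (x - y) 1 * a 1) +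
        (((max ‖x - y‖ s) ^ 3)⁻¹ + (x - y) 2 * a 2) = 3 * ((max ‖x - y‖ s) ^ 3)⁻¹ + ⟪a, x - y⟫ := by
      rw [sum_e3]; ring
    rw [this, hae]
    by_cases hb : x ∈ ball y s <;> simp [hb]
  have hR : ∫ x, ⟪Fk s (x - y), gradient f x⟫ = ∑ i : Fin 3, ∫ x, Fk s (x - y) i * gradient f x i := by
    rw [← integral_finsetSum _ fun i _ => hint i]
    simp only [sum_e3, Fin.sum_univ_three]
  rw [hR, Av]
  have h4 : ∑ i : Fin 3, ∫ x, Fk s (x - y) i * gradient f x i = -(3 * (s ^ 3)⁻¹ * ∫ x in ball y s, f x) := by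
    rw [← hsum, ← Finset.sum_neg_distrib]
    refine Finset.sum_congr rfl fun i _ => ?_
    rw [hi i, integral_congr_ae (hg i), integral_neg, neg_neg]
  rw [h4]; field_simp

/-- Difference of regularized Newton kernels. -/
def kk (s S : ℝ) (x : E3) : ℝ := ∫ t in (‖x‖ ^ 2)..(S ^ 2), (((max √t s) ^ 3)⁻¹ - ((max √t S) ^ 3)⁻¹) / 2

theorem kk_grad {s S : ℝ} (hs : 0 < s) (hS : 0 < S) (x : E3) : HasGradientAt (kk s S) (Fk S x - Fk s x) x := by
  have hc : ∀ s : ℝ, 0 < s → Continuous fun t : ℝ => ((max √t s) ^ 3)⁻¹ := fun s hs =>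
    Continuous.inv₀ (by fun_prop) fun t => (pow_pos (lt_max_of_lt_right hs) 3).ne'
  have hc2 : Continuous fun t : ℝ => (((max √t s) ^ 3)⁻¹ - ((max √t S) ^ 3)⁻¹) / 2 :=
    ((hc s hs).sub (hc S hS)).div_const 2
  have h1 := intervalIntegral.integral_hasDerivAt_left (hc2.intervalIntegrable (‖x - 0‖ ^ 2) (S ^ 2))
    hc2.aestronglyMeasurable.stronglyMeasurableAtFilter hc2.continuousAt
  have h2 := HasGradientAt.comp_real h1 (hasGradientAt_sq 0 x)
  simp only [sub_zero, Real.sqrt_sq (norm_nonneg x)] at h2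
  have e : Fk S x - Fk s x = (-((((max ‖x‖ s) ^ 3)⁻¹ - ((max ‖x‖ S) ^ 3)⁻¹) / 2)) • (2:ℝ) • x := by
    simp only [Fk]; module
  rw [e]
  exact h2

theorem Fk_eq {s S : ℝ} (hsS : s ≤ S) {x : E3} (hx : S ≤ ‖x‖) : Fk S x - Fk s x = 0 := by
  rw [Fk, Fk, max_eq_left hx, max_eq_left (hsS.trans hx), sub_self]

theorem kk_zero {s S : ℝ} (hs : 0 < s) (hsS : s ≤ S) {x : E3} (hx : S ≤ ‖x‖) : kk s S x = 0 := by
  have hS := hs.trans_le hsS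
  rw [kk]
  refine (intervalIntegral.integral_congr (g := fun _ => 0) fun t ht => ?_).trans (by simp)
  rw [uIcc_of_ge (pow_le_pow_left₀ hS.le hx 2)] at ht
  have := Real.le_sqrt_of_sq_le ht.1
  simp [max_eq_left this, max_eq_left (hsS.trans this)]

theorem Iop_c11 (M : Msh Ω T h c r) (hv : v ∈ T) {k : E3 → ℝ} {K : E3 → E3} {B : ℝ} (hB : 0 ≤ B)
    (hd : ∀ x ∈ tet v, HasGradientAt k (K x) x) (hL : ∀ x ∈ tet v, ∀ y ∈ tet v, ‖K x - K y‖ ≤ B * ‖x - y‖)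
    {x : E3} (hx : x ∈ interior (tet v)) : ‖gradient (fun z => k z - Iop T r k z) x‖ ≤ (CI r c + 1) * B * h := by
  have hh := M.h0
  have hCI := CI_nonneg (r := r) M.c0
  set z := v 0
  have hz : z ∈ tet v := vert_mem v 0
  obtain ⟨P, hP, hPe⟩ := exists_affpoly (r := r) (K z) (k z - ⟪K z, z⟫) M.r1
  have hlip : ∀ x ∈ tet v, ∀ y ∈ tet v, |(k x - ⟪K z, x - 0⟫ - (k z - ⟪K z, z⟫)) - (k y - ⟪K z, y - 0⟫ - (k z - ⟪K z, z⟫))| ≤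
      B * h * ‖x - y‖ := fun x hx y hy => by
    have := (lipOn_of_grad (tet_convex v) (K := B * h) (m := fun x => k x - ⟪K z, x - 0⟫)
      (fun x hx => (hd x hx).sub' (hasGradientAt_inner (K z) 0 x)) fun x hx => (hL x hx z hz).trans
        (mul_le_mul_of_nonneg_left (M.dist_le hv hx hz) hB)).norm_sub_le hx hy
    rw [Real.coe_toNNReal _ (by positivity), Real.norm_eq_abs] at this
    rwa [sub_sub_sub_cancel_right]
  refine grad_le_of_lip (by positivity) (fun x hx y hy => Iop_err M hv P hP
    (q := fun x => k x - ⟪K z, x - 0⟫ - (k z - ⟪K z, z⟫)) (fun x _ => ?_) (fun x hx => ?_) hlip hx hy) hx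
  · rw [hPe, sub_zero]; ring
  · have := hlip x hx z hz
    rw [sub_zero z, sub_self, sub_zero] at this
    refine this.trans ?_
    rw [sq, ← mul_assoc]
    exact mul_le_mul_of_nonneg_left (M.dist_le hv hx hz) (by positivity)

theorem ball_in {y : E3} (hy : y ∈ Ω) {s : ℝ} (hs : s ≤ infDist y (frontier Ω)) : ball y s ⊆ Ω := fun z hz => by
  by_contra hzO
  obtain ⟨p, hp, hpf⟩ := exists_frontier_segment hy hzO
  have h1 := infDist_le_dist_of_mem (x := y) hpf
  have h2 := (convex_ball y s).segment_subset (mem_ball_self (dist_nonneg.trans_lt hz)) hz hp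
  rw [mem_ball, dist_comm] at h2
  linarith

theorem av_step (hc : 0 < c) (r : ℕ) : ∃ C, 0 < C ∧ ∀ {Ω : Set E3} {T : Finset (Fin 4 → E3)} {h : ℝ}
    {g : E3 → E3} {w : E3 → ℝ} {y : E3} {s Q : ℝ}, Msh Ω T h c r → Ritz Ω T r h g w → y ∈ Ω → h ≤ s →
    6 * s ≤ infDist y (frontier Ω) → En w y (3 * s) ≤ Q * s ^ 2 →
    |Av s w y - Av (2 * s) w y| ≤ C * h * √(Q / s) := by
  have hCI := CI_nonneg (r := r) hc
  have hv := vb_pos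
  set A := (3 * vb)⁻¹ * ((CI r c + 1) * 8) with hA
  have hA0 : 0 < A := by positivity
  refine ⟨A * √(27 * vb), by positivity, fun {Ω T h g w y s Q} M W hy hhs hs6 hE => ?_⟩
  have hh := M.h0
  have hs := hh.trans_le hhs
  have hD := M.D
  have hw := FE.LO M W.fe
  obtain ⟨K, hK⟩ := hw.1
  set k : E3 → ℝ := fun x => kk s (2 * s) (x - y) with hk
  have hkg : ∀ x, HasGradientAt k (Fk (2 * s) (x - y) - Fk s (x - y)) x := fun x => by
    have := kk_grad hs (by positivity : 0 < 2 * s) (x - y)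
    rw [hasGradientAt_iff_hasFDerivAt] at this ⊢
    have h2 := this.comp x ((hasFDerivAt_id x).sub_const y)
    rwa [ContinuousLinearMap.comp_id] at h2
  have hkL : ∀ x z, ‖(Fk (2 * s) (x - y) - Fk s (x - y)) - (Fk (2 * s) (z - y) - Fk s (z - y))‖ ≤
      8 * (s ^ 3)⁻¹ * ‖x - z‖ := fun x z => by
    have h1 := Fk_lip (by positivity : 0 < 2 * s) (x - y) (z - y)
    have h2 := Fk_lip hs (x - y) (z - y)
    have h3 : ((2 * s) ^ 3)⁻¹ ≤ (s ^ 3)⁻¹ := by gcongr; linarith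
    rw [sub_sub_sub_cancel_right] at h1 h2
    rw [sub_sub_sub_comm]
    refine (norm_sub_le _ _).trans ?_
    nlinarith [norm_nonneg (x - z)]
  have hk0 : ∀ x, x ∉ ball y (2 * s) → k x = 0 := fun x hx => by
    rw [mem_ball, dist_eq_norm, not_lt] at hx
    exact kk_zero hs (by linarith) hx
  have hin : ball y (6 * s) ⊆ Ω := ball_in hy hs6
  have hkLO : LO Ω k := by
    refine ⟨⟨Real.toNNReal (2 * (s ^ 2)⁻¹), ?_⟩, fun x hx => hk0 x fun hxb =>
      hx (hin (ball_subset_ball (by linarith) hxb))⟩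
    rw [← lipschitzOnWith_univ]
    refine lipOn_of_grad convex_univ (fun x _ => hkg x) fun x _ => (norm_sub_le _ _).trans ?_
    have h1 := Fk_le hs (x - y)
    have h2 := Fk_le (by positivity : 0 < 2 * s) (x - y)
    have h3 : ((2 * s) ^ 2)⁻¹ ≤ (s ^ 2)⁻¹ := by gcongr; linarith
    linarith
  have hfr := hkLO.front hD
  have hχ := M.Iop_FE hfr
  have hχL := FE.LO M hχ
  set χ := Iop T r k with hχd
  have hloc : ∀ᵐ x, x ∈ Ω → ‖gradient (fun z => k z - χ z) x‖ ≤ (CI r c + 1) * (8 * (s ^ 3)⁻¹) * h ∧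
      (x ∉ ball y (3 * s) → gradient (fun z => k z - χ z) x = 0) := by
    filter_upwards [M.ae_int] with x hx hxO
    obtain ⟨v, hv, hxv⟩ := hx hxO
    refine ⟨Iop_c11 M hv (by positivity) (fun z _ => hkg z) (fun z _ z' _ => hkL z z') hxv, fun hxb => ?_⟩
    have := Iop_c11 M hv le_rfl (fun z _ => hkg z) (fun z hz z' hz' => ?_) hxv
    · rw [mul_zero, zero_mul] at this; exact norm_le_zero_iff.1 this
    · have e : ∀ z ∈ tet v, Fk (2 * s) (z - y) - Fk s (z - y) = 0 := fun z hz => by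
        refine Fk_eq (by linarith) ?_
        have h1 := M.dist_le hv (interior_subset hxv) hz
        rw [mem_ball, dist_eq_norm, not_lt] at hxb
        have := norm_sub_le_norm_sub_add_norm_sub x z y
        linarith
      rw [e z hz, e z' hz']; simp
  have horth : ∫ x in Ω, ⟪gradient w x, gradient χ x⟫ = 0 := by
    rw [W.orth χ hχ]
    refine (ae_eq_set hD (G := fun _ => 0) ?_).trans (by simp)
    filter_upwards [hloc, hχL.ae] with x hx h2 hxO
    by_cases hxL : x ∈ Lam Ω h
    · have hxb : x ∉ ball y (3 * s) := fun hxb => by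
        rw [mem_ball, dist_comm] at hxb
        have := infDist_le_infDist_add_dist (s := frontier Ω) (x := y) (y := x)
        have := hxL.2
        linarith
      have h3 := (hx hxO).2 hxb
      rw [gradient_sub' (hkg x).differentiableAt h2, (hkg x).gradient, Fk_eq (by linarith)
        (by rw [mem_ball, dist_eq_norm, not_lt] at hxb; linarith), zero_sub, neg_eq_zero] at h3
      rw [h3, inner_zero_right]
    · rw [W.gz x hxL, inner_zero_left]
  have hF : ∀ s : ℝ, 0 < s → BM Ω (fun x => Fk s (x - y)) := fun s hs =>
    ⟨((Fk_cont hs).comp (by fun_prop)).measurable, _, fun x _ => Fk_le hs _⟩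
  have e1 : ∀ s, 0 < s → ∫ x, ⟪Fk s (x - y), gradient w x⟫ = ∫ x in Ω, ⟪Fk s (x - y), gradient w x⟫ := fun s hs => by
    rw [setIntegral_eq_full hD]
    filter_upwards [hw.ae_zero hD] with x hx hxO
    rw [(hx hxO).2, inner_zero_right]
  have hdiff : Av s w y - Av (2 * s) w y = (3 * vb)⁻¹ * ∫ x in Ω, ⟪gradient w x, gradient (fun z => k z - χ z) x⟫ := by
    rw [hw.av_eq hD hs, hw.av_eq hD (by positivity : 0 < 2 * s), e1 _ hs, e1 _ (by positivity)]
    have : ∫ x in Ω, ⟪gradient w x, gradient (fun z => k z - χ z) x⟫ = (∫ x in Ω, (⟪Fk (2 * s) (x - y), gradient w x⟫ -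
        ⟪Fk s (x - y), gradient w x⟫)) - ∫ x in Ω, ⟪gradient w x, gradient χ x⟫ := by
      rw [← integral_sub ((((hF _ (by positivity)).inner hw.gbm).sub ((hF _ hs).inner hw.gbm)).integrableOn hD)
        ((hw.gbm.inner hχL.gbm).integrableOn hD)]
      refine ae_eq_set hD ?_
      filter_upwards [hχL.ae] with x h2 _
      rw [gradient_sub' (hkg x).differentiableAt h2, (hkg x).gradient, inner_sub_right, inner_sub_right,
        real_inner_comm _ (Fk s _), real_inner_comm _ (Fk (2 * s) _)]
    rw [this, horth, sub_zero, integral_sub (((hF _ (by positivity)).inner hw.gbm).integrableOn hD)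
      (((hF _ hs).inner hw.gbm).integrableOn hD)]
    ring
  have hb1 : |∫ x in Ω, ⟪gradient w x, gradient (fun z => k z - χ z) x⟫| ≤
      (CI r c + 1) * (8 * (s ^ 3)⁻¹) * h * ∫ x in ball y (3 * s), 1 * ‖gradient w x‖ := by
    have hbm : BM Ω (fun x => (ball y (3 * s)).indicator (fun x => 1 * ‖gradient w x‖) x) :=
      ⟨((measurable_gradient w).norm.const_mul 1).indicator measurableSet_ball, K, fun x _ => by
        refine (norm_indicator_le_norm_self _ _).trans ?_
        simpa using norm_gradient_le hK x⟩
    have hsub := hkLO.sub hχL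
    refine (abs_integral_le_integral_abs).trans ?_
    have e2 : ∫ x in ball y (3 * s), 1 * ‖gradient w x‖ =
        ∫ x in Ω, (ball y (3 * s)).indicator (fun x => 1 * ‖gradient w x‖) x := by
      rw [← integral_indicator measurableSet_ball, setIntegral_eq_full hD]
      filter_upwards [hw.ae_zero hD] with x hx hxO
      simp [indicator, (hx hxO).2]
    rw [e2, ← integral_const_mul]
    refine ae_le_set hD (hw.gbm.inner hsub.gbm).norm (hbm.cmul _) ?_
    filter_upwards [hloc] with x hx hxO
    by_cases hxb : x ∈ ball y (3 * s)
    · rw [indicator_of_mem hxb, one_mul, mul_comm]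
      exact (abs_real_inner_le_norm _ _).trans (mul_le_mul_of_nonneg_left (hx hxO).1 (norm_nonneg _))
    · rw [indicator_of_notMem hxb, (hx hxO).2 hxb]; simp
  have hb2 : (∫ x in ball y (3 * s), 1 * ‖gradient w x‖) ^ 2 ≤ (27 * s ^ 3 * vb) * (Q * s ^ 2) := by
    have hi : IntegrableOn (fun x => ‖gradient w x‖ ^ 2) (ball y (3 * s)) := (hw.gsq_int hD).integrableOn
    have h1 : IntegrableOn (fun _ : E3 => (1:ℝ) ^ 2) (ball y (3 * s)) :=
      integrableOn_const measure_ball_lt_top.ne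
    have h2 : IntegrableOn (fun x => 1 * ‖gradient w x‖) (ball y (3 * s)) :=
      IntegrableOn.of_bound measure_ball_lt_top ((measurable_gradient w).norm.const_mul 1).aestronglyMeasurable K
        (Filter.Eventually.of_forall fun x => by simpa using norm_gradient_le hK x)
    have := cs_int h1 hi h2
    simp only [one_pow] at this
    rw [ball_one y (by positivity)] at this
    refine this.trans ((mul_le_mul_of_nonneg_left hE (by positivity)).trans_eq ?_)
    ring
  have hb3 : ∫ x in ball y (3 * s), 1 * ‖gradient w x‖ ≤ √(27 * vb) * (s ^ 3 * √(Q / s)) := by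
    refine (Real.le_sqrt_of_sq_le hb2).trans_eq ?_
    have e : s ^ 3 * √(Q / s) = √((s ^ 3) ^ 2 * (Q / s)) := by
      rw [Real.sqrt_mul (by positivity), Real.sqrt_sq (by positivity)]
    rw [e, ← Real.sqrt_mul (by positivity)]
    congr 1; field_simp
  rw [hdiff, abs_mul, abs_of_pos (by positivity)]
  calc _ ≤ (3 * vb)⁻¹ * ((CI r c + 1) * (8 * (s ^ 3)⁻¹) * h * (√(27 * vb) * (s ^ 3 * √(Q / s)))) := by
        refine mul_le_mul_of_nonneg_left (hb1.trans (mul_le_mul_of_nonneg_left hb3 (by positivity))) (by positivity)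
    _ = _ := by rw [hA]; field_simp

theorem tel (hc : 0 < c) (r : ℕ) : ∃ C, 0 < C ∧ ∀ {Ω : Set E3} {T : Finset (Fin 4 → E3)} {h : ℝ}
    {g : E3 → E3} {w : E3 → ℝ} {y : E3} {Q : ℝ}, Msh Ω T h c r → Ritz Ω T r h g w → y ∈ Ω → ∀ (J : ℕ) {s : ℝ}, h ≤ s →
    3 * (2 ^ J * s) ≤ infDist y (frontier Ω) →
    (∀ t, s ≤ t → 6 * t ≤ infDist y (frontier Ω) → En w y (3 * t) ≤ Q * t ^ 2) →
    |Av s w y - Av (2 ^ J * s) w y| ≤ C * h * √(Q / s) := by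
  obtain ⟨C, hC, H⟩ := av_step hc r
  refine ⟨4 * C, by positivity, fun {Ω T h g w y Q} M W hy J => ?_⟩
  have hh := M.h0
  induction J with
  | zero => intro s hs _ _; simp; positivity
  | succ J ih =>
    intro s hs hd HE
    have hs0 := hh.trans_le hs
    have h2 : (1:ℝ) ≤ 2 ^ J := one_le_pow₀ (by norm_num)
    have e : (2:ℝ) ^ (J + 1) * s = 2 ^ J * (2 * s) := by ring
    rw [e] at hd ⊢
    have h6 : 6 * s ≤ infDist y (frontier Ω) := by nlinarith
    have h1 := H M W hy hs h6 (HE s le_rfl h6)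
    have h3 := ih (s := 2 * s) (by linarith) hd fun t ht => HE t (by linarith)
    have hQ : 0 ≤ Q := by
      have := (En_nonneg w y (3 * s)).trans (HE s le_rfl h6)
      exact nonneg_of_mul_nonneg_left this (by positivity)
    have h4 : √(Q / (2 * s)) ≤ 3 / 4 * √(Q / s) := by
      rw [show (3/4 : ℝ) = √(9/16) by rw [show (9/16 : ℝ) = (3/4) ^ 2 by norm_num, Real.sqrt_sq (by norm_num)],
        ← Real.sqrt_mul (by norm_num)]
      refine Real.sqrt_le_sqrt ?_
      rw [mul_comm 2 s, ← div_div, div_eq_mul_inv _ (2:ℝ)]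
      have : 0 ≤ Q / s := by positivity
      linarith
    have h5 := abs_sub_le (Av s w y) (Av (2 * s) w y) (Av (2 ^ J * (2 * s)) w y)
    have h6 := mul_le_mul_of_nonneg_left h4 (by positivity : 0 ≤ 4 * C * h)
    linarith
end kern

section interior
variable {Ω : Set E3} {T : Finset (Fin 4 → E3)} {h c : ℝ} {r : ℕ} {v : Fin 4 → E3}

theorem cutoff : ∃ L : ℝ, 1 ≤ L ∧ ∀ (x : E3) {t : ℝ}, 0 < t → ∃ (ω : E3 → ℝ) (K : E3 → E3),
    (∀ y, HasGradientAt ω (K y) y) ∧ (∀ y, 0 ≤ ω y) ∧ (∀ y, ω y ≤ 1) ∧ (∀ y ∈ ball x t, ω y = 1) ∧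
    (∀ y, y ∉ ball x (3/2 * t) → ω y = 0) ∧ (∀ y, ‖K y‖ ^ 2 ≤ (L / t) ^ 2 * ω y) ∧
    ∀ y z, ‖K y - K z‖ ≤ L / t ^ 2 * ‖y - z‖ := by
  let B : ContDiffBump (0 : E3) := ⟨1, 3/2, by norm_num, by norm_num⟩
  have hB : ContDiff ℝ 2 B := B.contDiff
  have hBg : ∀ y, HasGradientAt B (gradient B y) y := fun y => (hB.differentiable (by norm_num) y).hasGradientAt
  set k : E3 → E3 := fun y => (2 * B y) • gradient B y with hk
  have hg1 : ContDiff ℝ 1 (gradient B) :=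
    (InnerProductSpace.toDual ℝ E3).symm.contDiff.comp (hB.fderiv_right (by norm_num))
  have hcs : HasCompactSupport k := B.hasCompactSupport.mono fun y hy => by
    contrapose! hy
    simp only [Function.mem_support, not_not] at hy ⊢
    simp [hk, hy]
  obtain ⟨L1, hL1⟩ := ContDiff.lipschitzWith_of_hasCompactSupport hcs
    (((contDiff_const (c := (2:ℝ))).mul (hB.of_le (by norm_num))).smul hg1) one_ne_zero
  obtain ⟨L2, hL2⟩ := ContDiff.lipschitzWith_of_hasCompactSupport B.hasCompactSupport hB two_ne_zero
  refine ⟨1 + L1 + 2 * L2, by linarith [L1.2, L2.2, NNReal.coe_nonneg L1, NNReal.coe_nonneg L2], fun x {t} ht => ?_⟩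
  have l1 := NNReal.coe_nonneg L1
  have l2 := NNReal.coe_nonneg L2
  have hn : ∀ y, ‖t⁻¹ • (y - x)‖ = t⁻¹ * ‖y - x‖ := fun y => by
    rw [norm_smul, Real.norm_of_nonneg (by positivity)]
  refine ⟨fun y => B (t⁻¹ • (y - x)) ^ 2, fun y => t⁻¹ • k (t⁻¹ • (y - x)), fun y => ?_, fun y => sq_nonneg _,
    fun y => pow_le_one₀ B.nonneg B.le_one, fun y hy => ?_, fun y hy => ?_, fun y => ?_, fun y z => ?_⟩
  · have h1 := hBg (t⁻¹ • (y - x))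
    rw [hasGradientAt_iff_hasFDerivAt] at h1 ⊢
    have h2 := (h1.comp y (((hasFDerivAt_id y).sub_const x).const_smul t⁻¹)).pow 2
    refine h2.congr_fderiv ?_
    ext u
    simp [hk]
    ring
  · rw [mem_ball, dist_eq_norm] at hy
    beta_reduce
    rw [B.one_of_mem_closedBall, one_pow]
    rw [mem_closedBall_zero_iff, hn, inv_mul_le_iff₀ ht]
    change ‖y - x‖ ≤ t * 1
    linarith
  · rw [mem_ball, dist_eq_norm, not_lt] at hy
    beta_reduce
    rw [B.zero_of_le_dist, zero_pow two_ne_zero]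
    rw [dist_zero_right, hn, le_inv_mul_iff₀ ht]
    change t * (3 / 2) ≤ _
    linarith
  · have h1 := norm_gradient_le hL2 (t⁻¹ • (y - x))
    have h2 : 0 ≤ B (t⁻¹ • (y - x)) := B.nonneg
    rw [norm_smul, hk]
    simp only
    rw [norm_smul, Real.norm_of_nonneg (by positivity), Real.norm_of_nonneg (by positivity)]
    have h3 : ‖gradient B (t⁻¹ • (y - x))‖ ^ 2 ≤ L2 ^ 2 := pow_le_pow_left₀ (norm_nonneg _) h1 2
    calc _ = (t⁻¹) ^ 2 * B (t⁻¹ • (y - x)) ^ 2 * (4 * ‖gradient B (t⁻¹ • (y - x))‖ ^ 2) := by ring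
      _ ≤ (t⁻¹) ^ 2 * B (t⁻¹ • (y - x)) ^ 2 * (1 + L1 + 2 * L2) ^ 2 := by
          refine mul_le_mul_of_nonneg_left ?_ (by positivity)
          nlinarith [mul_nonneg l1 l2]
      _ = _ := by rw [div_pow, inv_pow]; ring
  · rw [← smul_sub, norm_smul, Real.norm_of_nonneg (by positivity)]
    have h1 := hL1.norm_sub_le (t⁻¹ • (y - x)) (t⁻¹ • (z - x))
    rw [← smul_sub, sub_sub_sub_cancel_right, norm_smul, Real.norm_of_nonneg (by positivity)] at h1
    calc _ ≤ t⁻¹ * (L1 * (t⁻¹ * ‖y - z‖)) := mul_le_mul_of_nonneg_left h1 (by positivity)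
      _ = (t⁻¹) ^ 2 * ‖y - z‖ * L1 := by ring
      _ ≤ (t⁻¹) ^ 2 * ‖y - z‖ * (1 + L1 + 2 * L2) := mul_le_mul_of_nonneg_left (by linarith) (by positivity)
      _ = _ := by rw [inv_pow]; ring

theorem ind_int {B : Set E3} (hB : B ⊆ Ω) (hm : MeasurableSet B) (F : E3 → ℝ) :
    ∫ x in Ω, B.indicator (fun _ => (1:ℝ)) x * F x = ∫ x in B, F x := by
  have : (fun x => B.indicator (fun _ => (1:ℝ)) x * F x) = B.indicator F := by
    ext x; by_cases hx : x ∈ B <;> simp [hx]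
  rw [this, setIntegral_indicator hm, inter_eq_self_of_subset_right hB]

theorem cacc (hc : 0 < c) (r : ℕ) : ∃ C, 1 ≤ C ∧ ∀ {Ω : Set E3} {T : Finset (Fin 4 → E3)} {h : ℝ}
    {g : E3 → E3} {w : E3 → ℝ} {x : E3} {t : ℝ} (a : ℝ), Msh Ω T h c r → Ritz Ω T r h g w → x ∈ Ω → h ≤ t →
    4 * t ≤ infDist x (frontier Ω) →
    En w x t ≤ C * (h / t) * En w x (3 * t) + C * (t ^ 2)⁻¹ * ∫ y in ball x (3 * t), (w y - a) ^ 2 := by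
  obtain ⟨L, hL1, HL⟩ := cutoff
  have hCsa := Csa_nonneg (r := r) hc
  have hvb := vb_pos
  set S := Csa r c * vb * L ^ 2 with hS
  have hS0 : 0 ≤ S := by positivity
  refine ⟨1 + S + L ^ 2, by nlinarith, fun {Ω T h g w x t} a M W hx ht hd => ?_⟩
  have hh := M.h0
  have ht0 := hh.trans_le ht
  have hD := M.D
  have hw := FE.LO M W.fe
  obtain ⟨ω, K, hK, hω0, hω1, hω2, hω3, hKb, hKL⟩ := HL x ht0
  have hB4 : ball x (4 * t) ⊆ Ω := ball_in hx hd
  have hB3 : ball x (3 * t) ⊆ Ω := (ball_subset_ball (by linarith)).trans hB4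
  have hKn : ∀ y, ‖K y‖ ≤ L / t := fun y => by
    refine abs_le_of_sq_le_sq' ?_ (by positivity) |>.2
    exact (hKb y).trans (mul_le_of_le_one_right (by positivity) (hω1 y))
  have hωL : LO Ω ω := by
    refine ⟨⟨Real.toNNReal (L / t), ?_⟩, fun y hy => hω3 y fun hyb => hy (hB4 (ball_subset_ball (by linarith) hyb))⟩
    rw [← lipschitzOnWith_univ]
    exact lipOn_of_grad convex_univ (fun y _ => hK y) fun y _ => hKn y
  have hq0 : LO Ω (fun y => ω y * (w y - a)) := by
    have := (hw.mul hD hωL).sub (hωL.cmul a)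
    refine ⟨this.1.imp fun _ hk => ?_, fun y hy => by simp [hωL.2 y hy]⟩
    convert hk using 2; ring
  set k : E3 → ℝ := fun y => ω y * (w y - a) with hk
  have hχ := M.Iop_FE (hq0.front hD)
  have hχL := FE.LO M hχ
  have hqL := hq0.sub hχL
  set χ := Iop T r k with hχd
  set q := gradient (fun z => k z - χ z) with hq
  set b : E3 → ℝ := (ball x (3 * t)).indicator (fun _ => (1:ℝ)) with hb
  have hbm : BM Ω b := ⟨measurable_const.indicator measurableSet_ball, 1, fun y _ => by
    simp only [hb, indicator]; split_ifs <;> simp⟩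
  have hb1 : ∀ y ∈ ball x (3 * t), b y = 1 := fun y hy => by simp [hb, hy]
  have hb0 : ∀ y, 0 ≤ b y := fun y => indicator_nonneg (fun _ _ => zero_le_one) y
  have hnear : ∀ v ∈ T, ∀ y ∈ tet v, y ∉ ball x (3 * t) → ∀ z ∈ tet v, z ∉ ball x (2 * t) := fun v hv y hy hyb z hz => by
    rw [mem_ball, dist_eq_norm, not_lt] at *
    have h1 := M.dist_le hv hy hz
    have := norm_sub_le_norm_sub_add_norm_sub y z x
    linarith
  have hz2 : ∀ z, z ∉ ball x (2 * t) → ω z = 0 ∧ K z = 0 := fun z hz => by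
    have h1 : ω z = 0 := hω3 z fun hzb => hz (ball_subset_ball (by linarith) hzb)
    refine ⟨h1, ?_⟩
    have := hKb z
    rw [h1, mul_zero] at this
    exact norm_le_zero_iff.1 (by nlinarith [norm_nonneg (K z)])
  have hkz : ∀ z, z ∉ ball x (2 * t) → HasGradientAt k 0 z := fun z hz => by
    refine (hasGradientAt_const z (0:ℝ)).congr_of_eventuallyEq ?_
    have ho : IsOpen (closedBall x (3/2 * t))ᶜ := isClosed_closedBall.isOpen_compl
    filter_upwards [ho.mem_nhds (fun hzb : z ∈ closedBall x (3/2 * t) => hz (closedBall_subset_ball (by linarith) hzb))] with y hy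
    rw [hk]; simp only
    rw [hω3 y fun hyb => hy (ball_subset_closedBall hyb), zero_mul]
  have hloc : ∀ᵐ y, y ∈ Ω → y ∉ ball x (3 * t) → q y = 0 ∧ gradient χ y = 0 := by
    filter_upwards [M.ae_int, hχL.ae] with y hy hyd hyO hyb
    obtain ⟨v, hv, hyv⟩ := hy hyO
    have hz := hnear v hv y (interior_subset hyv) hyb
    have h1 := Iop_c11 M hv (k := k) (K := fun _ => 0) le_rfl (fun z hzv => hkz z (hz z hzv)) (fun z _ z' _ => by simp) hyv
    rw [mul_zero, zero_mul] at h1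
    have h2 : q y = 0 := norm_le_zero_iff.1 h1
    refine ⟨h2, ?_⟩
    have h3 := hkz y (hz y (interior_subset hyv))
    rw [hq, gradient_sub' h3.differentiableAt hyd, h3.gradient, zero_sub, neg_eq_zero] at h2
    exact h2
  have horth : ∫ y in Ω, ⟪gradient w y, gradient χ y⟫ = 0 := by
    rw [W.orth χ hχ]
    refine (ae_eq_set hD (G := fun _ => 0) ?_).trans (by simp)
    filter_upwards [hloc] with y hy hyO
    by_cases hyL : y ∈ Lam Ω h
    · have hyb : y ∉ ball x (3 * t) := fun hyb => by
        rw [mem_ball, dist_comm] at hyb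
        have := infDist_le_infDist_add_dist (s := frontier Ω) (x := x) (y := y)
        have := hyL.2
        linarith
      rw [(hy hyO hyb).2, inner_zero_right]
    · rw [W.gz y hyL, inner_zero_left]
  have hsah : SAH T h ω (fun _ => 1) (fun y => (L / t) ^ 2 * b y) (fun y => (L / t ^ 2) ^ 2 * b y) := by
    intro v hv
    by_cases hz : ∀ z ∈ tet v, z ∉ ball x (2 * t)
    · refine ⟨0, 0, 0, le_rfl, le_rfl, fun y hy z hz' => ?_, fun y hy z hz' => ?_, fun y _ z _ => ?_⟩
      · simp [(hz2 y (hz y hy)).1, (hz2 z (hz z hz')).1]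
      · simp [(hz2 y (hz y hy)).1, (hz2 z (hz z hz')).1]
      · have := hb0 z
        constructor <;> simp <;> positivity
    · have hin : ∀ z ∈ tet v, b z = 1 := fun z hz' => hb1 z (by
        by_contra hzb
        exact hz (hnear v hv z hz' hzb))
      refine ⟨L / t, L / t ^ 2, K (v 0), by positivity, by positivity, fun y hy z hz' => ?_, fun y hy z hz' => ?_,
        fun y _ z hz' => by beta_reduce; rw [hin z (interior_subset hz')]; simp⟩
      · have := (lipOn_of_grad (tet_convex v) (fun y _ => hK y) fun y _ => hKn y).norm_sub_le hy hz'
        rwa [Real.coe_toNNReal _ (by positivity)] at this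
      · have := (lipOn_of_grad (tet_convex v) (K := L / t ^ 2 * h) (m := fun y => ω y - ⟪K (v 0), y - 0⟫)
          (fun y _ => (hK y).sub' (hasGradientAt_inner (K (v 0)) 0 y)) fun y hy => (hKL y (v 0)).trans
          (mul_le_mul_of_nonneg_left (M.dist_le hv hy (vert_mem v 0)) (by positivity))).norm_sub_le hy hz'
        rw [Real.coe_toNNReal _ (by positivity), Real.norm_eq_abs] at this
        refine le_trans (le_of_eq ?_) this
        congr 1
        rw [inner_sub_right, sub_zero, sub_zero]; ring
  have hwa : BM Ω (fun y => w y - a) := (hw.bm hD).sub (BM.const a)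
  have hga : gradient (fun y => w y - a) = gradient w := by
    ext1 y; simp [gradient, fderiv_sub_const]
  have hsag := sag M hsah (w := fun y => w y - a) (fun v hv => by
      obtain ⟨p, hp, he⟩ := W.fe.1.1.2 v hv
      refine ⟨p - MvPolynomial.C a, (MvPolynomial.totalDegree_sub_C_le p a).trans hp, fun y hy => ?_⟩
      rw [he y hy]; simp [ev]) hwa (by rw [hga]; exact hw.gbm) hq0 (BM.const 1) (fun _ _ => zero_le_one)
      (hbm.cmul _) (hbm.cmul _)
  rw [hga] at hsag
  change ∫ y in Ω, 1 * ‖q y‖ ^ 2 ≤ _ at hsag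
  have bG := hw.gbm.nsq
  have bA := hwa.sq
  have i1 : ∫ y in Ω, ((L / t) ^ 2 * b y * ‖gradient w y‖ ^ 2 + (L / t ^ 2) ^ 2 * b y * (w y - a) ^ 2) =
      (L / t) ^ 2 * En w x (3 * t) + (L / t ^ 2) ^ 2 * ∫ y in ball x (3 * t), (w y - a) ^ 2 := by
    rw [integral_add (((hbm.cmul _).mul bG).integrableOn hD) (((hbm.cmul _).mul bA).integrableOn hD), En,
      ← ind_int hB3 measurableSet_ball, ← ind_int hB3 measurableSet_ball, ← integral_const_mul, ← integral_const_mul]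
    simp only [← hb, mul_assoc]
  rw [i1] at hsag
  have bω := hωL.bm hD
  have hmain : ∫ y in Ω, ω y * ‖gradient w y‖ ^ 2 ≤ ∫ y in Ω, (h / t * (b y * ‖gradient w y‖ ^ 2) + t / h * (1 * ‖q y‖ ^ 2) +
      (L / t) ^ 2 * (b y * (w y - a) ^ 2) + 2 * ⟪gradient w y, gradient χ y⟫) := by
    refine ae_le_set hD (bω.mul bG) ((((hbm.mul bG).cmul _).add (((BM.const 1).mul hqL.gbm.nsq).cmul _)).add
      ((hbm.mul bA).cmul _) |>.add ((hw.gbm.inner hχL.gbm).cmul 2)) ?_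
    filter_upwards [hloc, hw.ae, hχL.ae, hq0.ae] with y hy h1 h2 h3 hyO
    by_cases hyb : y ∈ ball x (3 * t)
    · have e1 : gradient k y = ω y • gradient w y + (w y - a) • K y := by
        have := ((hK y).mul' (h1.hasGradientAt.sub' (hasGradientAt_const y a))).gradient
        rwa [sub_zero] at this
      have e2 : q y = gradient k y - gradient χ y := gradient_sub' h3 h2
      have e3 : ω y * ‖gradient w y‖ ^ 2 = ⟪gradient w y, q y⟫ + ⟪gradient w y, gradient χ y⟫ -
          (w y - a) * ⟪gradient w y, K y⟫ := by
        rw [← inner_add_right, e2, sub_add_cancel, e1, inner_add_right, inner_smul_right, inner_smul_right,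
          real_inner_self_eq_norm_sq]; ring
      have j1 : 2 * ⟪gradient w y, q y⟫ ≤ h / t * ‖gradient w y‖ ^ 2 + t / h * ‖q y‖ ^ 2 := by
        have h4 := real_inner_le_norm (gradient w y) (q y)
        have h5 : 0 ≤ h / t * (‖gradient w y‖ - t / h * ‖q y‖) ^ 2 := by positivity
        have h6 : h / t * (‖gradient w y‖ - t / h * ‖q y‖) ^ 2 = h / t * ‖gradient w y‖ ^ 2 + t / h * ‖q y‖ ^ 2 -
            2 * (‖gradient w y‖ * ‖q y‖) := by field_simp; ring
        linarith
      have j2 : -(2 * ((w y - a) * ⟪gradient w y, K y⟫)) ≤ ω y * ‖gradient w y‖ ^ 2 + (L / t) ^ 2 * (w y - a) ^ 2 := by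
        have h4 := abs_real_inner_le_norm (gradient w y) (K y)
        have h5 : -((w y - a) * ⟪gradient w y, K y⟫) ≤ |w y - a| * (‖gradient w y‖ * ‖K y‖) := by
          refine (neg_le_abs _).trans ?_
          rw [abs_mul]; exact mul_le_mul_of_nonneg_left h4 (abs_nonneg _)
        set s := √(ω y) with hs
        have hs2 : s ^ 2 = ω y := Real.sq_sqrt (hω0 y)
        have h6 : ‖K y‖ ≤ L / t * s := abs_le_of_sq_le_sq' (by rw [mul_pow, hs2]; exact hKb y) (by positivity) |>.2
        have h7 : |w y - a| * (‖gradient w y‖ * ‖K y‖) ≤ |w y - a| * (‖gradient w y‖ * (L / t * s)) := by gcongr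
        rw [← hs2, ← sq_abs (w y - a)]
        nlinarith [sq_nonneg (s * ‖gradient w y‖ - L / t * |w y - a|)]
      rw [hb1 y hyb, one_mul, one_mul, one_mul]
      linarith
    · have hzero : ω y = 0 := (hz2 y fun hh' => hyb (ball_subset_ball (by linarith) hh')).1
      have := hb0 y
      rw [hzero, (hy hyO hyb).1, (hy hyO hyb).2, inner_zero_right]
      simp only [zero_mul, norm_zero]
      positivity
  have i2 : ∫ y in Ω, (h / t * (b y * ‖gradient w y‖ ^ 2) + t / h * (1 * ‖q y‖ ^ 2) +
      (L / t) ^ 2 * (b y * (w y - a) ^ 2) + 2 * ⟪gradient w y, gradient χ y⟫) =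
      h / t * En w x (3 * t) + t / h * (∫ y in Ω, 1 * ‖q y‖ ^ 2) + (L / t) ^ 2 * ∫ y in ball x (3 * t), (w y - a) ^ 2 := by
    have hqb : BM Ω q := hqL.gbm
    have a1 := (hbm.mul bG).cmul (h / t)
    have a2 := ((BM.const 1).mul hqb.nsq).cmul (t / h)
    have a3 := (hbm.mul bA).cmul ((L / t) ^ 2)
    rw [integral_add (((a1.add a2).add a3).integrableOn hD) (((hw.gbm.inner hχL.gbm).cmul 2).integrableOn hD),
      integral_add ((a1.add a2).integrableOn hD) (a3.integrableOn hD), integral_add (a1.integrableOn hD) (a2.integrableOn hD)]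
    simp only [integral_const_mul]
    rw [horth, ind_int hB3 measurableSet_ball, ind_int hB3 measurableSet_ball, En]; ring
  rw [i2] at hmain
  have hE := hw.En_le hD (x := x) (t := t) bω (fun y _ => hω0 y) (fun y _ hyb => (hω2 y hyb).ge)
  set E := En w x (3 * t) with hEd
  have hE0 : 0 ≤ E := En_nonneg _ _ _
  set A := ∫ y in ball x (3 * t), (w y - a) ^ 2 with hA
  have hA0 : 0 ≤ A := setIntegral_nonneg measurableSet_ball fun _ _ => sq_nonneg _
  have f1 := mul_le_mul_of_nonneg_left hsag (by positivity : 0 ≤ t / h)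
  have f2 : t / h * (Csa r c * vb * h ^ 2 * ((L / t) ^ 2 * E + (L / t ^ 2) ^ 2 * A)) =
      S * (h / t) * E + S * (h / t) * ((t ^ 2)⁻¹ * A) := by rw [hS]; field_simp
  have f3 : S * (h / t) * ((t ^ 2)⁻¹ * A) ≤ S * 1 * ((t ^ 2)⁻¹ * A) := by
    gcongr; exact (div_le_one ht0).2 ht
  have f4 : (L / t) ^ 2 * A = L ^ 2 * ((t ^ 2)⁻¹ * A) := by rw [div_pow]; ring
  have f5 : 0 ≤ (t ^ 2)⁻¹ * A := by positivity
  have f6 : 0 ≤ h / t * E := by positivity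
  rw [f2] at f1
  rw [f4] at hmain
  have : 0 ≤ L ^ 2 * (h / t * E) := by positivity
  nlinarith
end interior

section interior
variable {Ω : Set E3} {T : Finset (Fin 4 → E3)} {h c : ℝ} {r : ℕ} {v : Fin 4 → E3} {z0 : E3} {r0 d : ℝ}

theorem LO.av_cont (hD : Dom Ω) {f : E3 → ℝ} (hf : LO Ω f) (s : ℝ) : Continuous (Av s f) := by
  obtain ⟨C, hC⟩ := hf.bdd hD
  have : IsFiniteMeasure (volume.restrict (ball (0:E3) s)) := isFiniteMeasure_restrict.2 measure_ball_lt_top.ne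
  have hc := hf.cont
  rw [funext (Av_eq0 s f)]
  refine continuous_const.mul (continuous_of_dominated (bound := fun _ => C) (fun y => ?_) (fun y => ?_) (integrable_const _) ?_)
  · exact (by fun_prop : Continuous fun b => f (y + b)).aestronglyMeasurable
  · exact Filter.Eventually.of_forall fun b => hC _
  · exact Filter.Eventually.of_forall fun b => by fun_prop

theorem Geo.int_le (G : Geo Ω z0 r0 d) {x : E3} (hx : x ∈ Ω) : infDist x (frontier Ω) ≤ d := by
  obtain ⟨y, hy⟩ := G.fne
  exact (infDist_le_dist_of_mem hy).trans (by
    rw [dist_eq_norm]; exact G.clos (subset_closure hx) (frontier_subset_closure hy))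

theorem ci_ball {f : E3 → ℝ} (hf : Continuous f) (x : E3) (s : ℝ) : IntegrableOn f (ball x s) :=
  (hf.continuousOn.integrableOn_compact (isCompact_closedBall x s)).mono_set ball_subset_closedBall

set_option maxHeartbeats 1000000 in
theorem Geo.int_step (G : Geo Ω z0 r0 d) (hc : 0 < c) (r : ℕ) : ∃ K : ℝ, 1 ≤ K ∧ ∀ m : ℝ, 8 ≤ m → ∃ C, 0 < C ∧
    ∀ {T : Finset (Fin 4 → E3)} {h : ℝ} {g : E3 → E3} {w : E3 → ℝ} {S : ℝ}, Msh Ω T h c r →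
    Ritz Ω T r h g w → 4 * h ≤ r0 → (∀ x ∈ Ω, ∀ t, K * h ≤ t → t ≤ m * d → En w x t ≤ S * t ^ 2) →
    ∀ x ∈ Ω, ∀ t, K * h ≤ t → t ≤ m * d → En w x t ≤ (S / 2 + C * h) * t ^ 2 := by
  obtain ⟨C1, hC1, H1⟩ := cacc hc r
  obtain ⟨C2, hC2, H2⟩ := tel hc r
  have hv := vb_pos
  set ε := 1 / (20 * C1) with hε
  have hε0 : 0 < ε := by positivity
  have hε1 : ε * (20 * C1) = 1 := by rw [hε]; field_simp
  have hε2 : ε ≤ 1 / 20 := by nlinarith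
  set A := 648 * C1 * vb * C2 ^ 2 / ε ^ 3 with hA
  have hA0 : 0 < A := by positivity
  set K := 72 * C1 + A with hK
  have hK1 : 1 ≤ K := by linarith
  refine ⟨K, hK1, fun m hm => ?_⟩
  obtain ⟨C3, hC3, H3⟩ := G.near hc r (m := m) (by linarith)
  refine ⟨C3 + 729 * 4096 * C1 * C3, by positivity, fun {T h g w S} M W hs HS x hx t hKt htd => ?_⟩
  have hh := M.h0
  have hD := M.D
  have hw := FE.LO M W.fe
  have hKh : 0 < K * h := by positivity
  have ht0 : 0 < t := hKh.trans_le hKt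
  have hht : h ≤ t := (le_mul_of_one_le_left hh.le hK1).trans hKt
  have h72 : 72 * C1 * h ≤ t := by
    have h2 : 0 ≤ A * h := by positivity
    have h3 : K * h = 72 * C1 * h + A * h := by rw [hK]; ring
    linarith
  have hd := G.dpos
  have hS0 : 0 ≤ S := by
    have := (En_nonneg w x t).trans (HS x hx t hKt htd)
    exact nonneg_of_mul_nonneg_left this (by positivity)
  set D := infDist x (frontier Ω) with hDd
  by_cases hDt : D ≤ m * t
  · have := H3 M W hs hht htd hDt
    have h1 : 0 ≤ (S / 2 + 729 * 4096 * C1 * C3 * h) * t ^ 2 := by positivity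
    linarith
  push Not at hDt
  have hD8 : 8 * t < D := lt_of_le_of_lt (mul_le_mul_of_nonneg_right hm ht0.le) hDt
  have hDle : D ≤ d := G.int_le hx
  have hdm : d ≤ m * d := le_mul_of_one_le_left hd.le (by linarith)
  set s := ε * t with hsd
  have hs0 : 0 < s := by positivity
  have hst : s ≤ t / 20 := by linarith [mul_le_mul_of_nonneg_right hε2 ht0.le]
  have hhs : h ≤ s := by
    have h2 := mul_le_mul_of_nonneg_left h72 hε0.le
    have h3 : ε * (72 * C1 * h) = ε * (20 * C1) * (72 / 20 * h) := by ring
    rw [h3, hε1] at h2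
    linarith
  obtain ⟨J, hJ1, hJ2⟩ := exists_nat_pow_near (x := D / (16 * s)) (y := (2:ℝ)) (by
    rw [le_div_iff₀ (by positivity)]; linarith) (by norm_num)
  set δ := 2 ^ J * s with hδ
  have hδ0 : 0 < δ := by positivity
  have hδ1 : δ ≤ D / 16 := by
    rw [le_div_iff₀ (by positivity)] at hJ1; linarith
  have hδ2 : D / 32 ≤ δ := by
    rw [div_lt_iff₀ (by positivity), pow_succ] at hJ2; linarith
  have hca := H1 (Av δ w x) M W hx hht (by linarith)
  have e3 := HS x hx (3 * t) (by linarith) (by linarith)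
  have e4 : En w x (3 * t + s) ≤ S * (4 * t) ^ 2 :=
    (hw.En_mono hD (ball_subset_ball (by linarith))).trans (HS x hx (4 * t) (by linarith) (by linarith))
  have a1 := hw.av1 hD x (3 * t) hs0
  have eD := H3 (x := x) (t := D) M W hs (by linarith) (by linarith) (le_mul_of_one_le_left infDist_nonneg (by linarith))
  set b2 := (C2 * h) ^ 2 * (S / ε ^ 2 / s) with hb2
  set b3 := (δ ^ 3 * vb)⁻¹ * ((3 * t) ^ 2 * (C3 * h * D ^ 2)) with hb3
  have p2 : ∀ y ∈ ball x (3 * t), (Av s w y - Av δ w y) ^ 2 ≤ b2 := fun y hy => by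
    have hyO : y ∈ Ω := ball_in hx (by linarith : 3 * t ≤ D) hy
    have hyd : D - 3 * t ≤ infDist y (frontier Ω) := by
      have := infDist_le_infDist_add_dist (s := frontier Ω) (x := x) (y := y)
      rw [mem_ball, dist_comm] at hy
      linarith
    have hyd2 := G.int_le hyO
    have := H2 (Q := S / ε ^ 2) M W hyO J hhs (by linarith) fun τ hτ hτ6 => by
      have hτ0 := hs0.trans_le hτ
      have h1 : En w y (3 * τ) ≤ En w y (max (3 * τ) t) := hw.En_mono hD (ball_subset_ball (le_max_left _ _))
      have h2 := HS y hyO (max (3 * τ) t) (hKt.trans (le_max_right _ _)) (max_le (by linarith) htd)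
      have h3 : max (3 * τ) t ≤ τ / ε := max_le (by
        rw [le_div_iff₀ hε0]; linarith [mul_le_mul_of_nonneg_left hε2 hτ0.le])
        (by rw [le_div_iff₀ hε0]; linarith)
      have h4 : max (3 * τ) t ^ 2 ≤ (τ / ε) ^ 2 := pow_le_pow_left₀ (ht0.le.trans (le_max_right _ _)) h3 2
      refine h1.trans (h2.trans ((mul_le_mul_of_nonneg_left h4 hS0).trans_eq ?_))
      rw [div_pow]; ring
    have h5 := pow_le_pow_left₀ (abs_nonneg _) this 2
    rw [sq_abs, mul_pow, Real.sq_sqrt (by positivity)] at h5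
    exact h5
  have p3 : ∀ y ∈ ball x (3 * t), (Av δ w y - Av δ w x) ^ 2 ≤ b3 := fun y hy => by
    have h1 := hw.av2 hD x y hδ0 (t := 3 * t) (by rw [mem_ball, dist_eq_norm] at hy; exact hy.le)
    refine h1.trans (mul_le_mul_of_nonneg_left (mul_le_mul_of_nonneg_left (le_trans ?_ eD) (by positivity)) (by positivity))
    exact hw.En_mono hD (ball_subset_ball (by linarith))
  have hwc := hw.cont
  have hac := hw.av_cont hD s
  have hI : ∫ y in ball x (3 * t), (w y - Av δ w x) ^ 2 ≤ 3 * (s ^ 2 * (S * (4 * t) ^ 2)) + 3 * (b2 + b3) * ((3 * t) ^ 3 * vb) := by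
    calc _ ≤ ∫ y in ball x (3 * t), (3 * (w y - Av s w y) ^ 2 + 3 * (b2 + b3) * 1) := by
          refine setIntegral_mono_on (ci_ball (by fun_prop) _ _) (ci_ball (by fun_prop) _ _) measurableSet_ball fun y hy => ?_
          have q2 := p2 y hy
          have q3 := p3 y hy
          clear_value b2 b3
          linarith [sq_nonneg ((w y - Av s w y) - (Av s w y - Av δ w y)), sq_nonneg ((w y - Av s w y) - (Av δ w y - Av δ w x)),
            sq_nonneg ((Av s w y - Av δ w y) - (Av δ w y - Av δ w x))]
      _ = 3 * (∫ y in ball x (3 * t), (w y - Av s w y) ^ 2) + 3 * (b2 + b3) * ((3 * t) ^ 3 * vb) := by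
          rw [integral_add (ci_ball (by fun_prop) _ _) (ci_ball (by fun_prop) _ _), integral_const_mul, integral_const_mul,
            ball_one x (by positivity)]
      _ ≤ _ := by
          have := a1.trans (mul_le_mul_of_nonneg_left e4 (sq_nonneg s))
          linarith
  have f1 : C1 * (h / t) * En w x (3 * t) ≤ 1 / 8 * (S * t ^ 2) := by
    have h1 : C1 * (h / t) ≤ 1 / 72 := by
      rw [← mul_div_assoc, div_le_iff₀ ht0]; linarith
    calc _ ≤ 1 / 72 * (S * (3 * t) ^ 2) := mul_le_mul h1 e3 (En_nonneg _ _ _) (by norm_num)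
      _ = _ := by ring
  have f2 : C1 * (t ^ 2)⁻¹ * (3 * (s ^ 2 * (S * (4 * t) ^ 2))) ≤ 1 / 8 * (S * t ^ 2) := by
    have : C1 * (t ^ 2)⁻¹ * (3 * (s ^ 2 * (S * (4 * t) ^ 2))) = 48 * (C1 * ε * ε) * (S * t ^ 2) := by
      rw [hsd]; field_simp; ring
    rw [this]
    refine mul_le_mul_of_nonneg_right ?_ (by positivity)
    have : C1 * ε = 1 / 20 := by linarith
    rw [this]; linarith
  have f3 : C1 * (t ^ 2)⁻¹ * (3 * b2 * ((3 * t) ^ 3 * vb)) ≤ 1 / 8 * (S * t ^ 2) := by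
    have : C1 * (t ^ 2)⁻¹ * (3 * b2 * ((3 * t) ^ 3 * vb)) = 1 / 8 * (A * h ^ 2 * S) := by
      rw [hb2, hA, hsd]; field_simp; ring
    rw [this]
    have h1 : A * h ^ 2 ≤ t ^ 2 := by
      have : A ≤ K ^ 2 := by
        have h5 : A ≤ K := by rw [hK]; linarith
        have h6 : K * 1 ≤ K * K := mul_le_mul_of_nonneg_left hK1 (by linarith)
        linarith [sq K]
      calc A * h ^ 2 ≤ K ^ 2 * h ^ 2 := by gcongr
        _ = (K * h) ^ 2 := by ring
        _ ≤ _ := by gcongr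
    have h2 := mul_le_mul_of_nonneg_right h1 hS0
    linarith
  have f4 : C1 * (t ^ 2)⁻¹ * (3 * b3 * ((3 * t) ^ 3 * vb)) ≤ 729 * 4096 * C1 * C3 * h * t ^ 2 := by
    have : C1 * (t ^ 2)⁻¹ * (3 * b3 * ((3 * t) ^ 3 * vb)) = 729 * C1 * C3 * h * t ^ 2 * (t * D ^ 2 / δ ^ 3) := by
      rw [hb3]; field_simp; ring
    rw [this]
    have h1 : t * D ^ 2 / δ ^ 3 ≤ 4096 := by
      rw [div_le_iff₀ (by positivity)]
      have h2 : (D / 32) ^ 3 ≤ δ ^ 3 := pow_le_pow_left₀ (by linarith) hδ2 3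
      have h3 : 8 * t * D ^ 2 ≤ D * D ^ 2 := mul_le_mul_of_nonneg_right hD8.le (sq_nonneg D)
      have h4 : D * D ^ 2 = 32768 * (D / 32) ^ 3 := by ring
      linarith
    have h2 := mul_le_mul_of_nonneg_left h1 (by positivity : 0 ≤ 729 * C1 * C3 * h * t ^ 2)
    linarith
  have f5 := mul_le_mul_of_nonneg_left hI (by positivity : 0 ≤ C1 * (t ^ 2)⁻¹)
  have f6 : 0 ≤ S * t ^ 2 := by positivity
  have f7 : 0 ≤ C3 * h * t ^ 2 := by positivity
  clear_value b2 b3 A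
  have f8 : C1 * (t ^ 2)⁻¹ * (3 * (s ^ 2 * (S * (4 * t) ^ 2)) + 3 * (b2 + b3) * ((3 * t) ^ 3 * vb)) =
    C1 * (t ^ 2)⁻¹ * (3 * (s ^ 2 * (S * (4 * t) ^ 2))) + C1 * (t ^ 2)⁻¹ * (3 * b2 * ((3 * t) ^ 3 * vb)) +
    C1 * (t ^ 2)⁻¹ * (3 * b3 * ((3 * t) ^ 3 * vb)) := by ring
  have f9 : (S / 2 + (C3 + 729 * 4096 * C1 * C3) * h) * t ^ 2 = S * t ^ 2 / 2 + C3 * h * t ^ 2 + 729 * 4096 * C1 * C3 * h * t ^ 2 := by ring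
  rw [f9]
  linarith

theorem Geo.int (G : Geo Ω z0 r0 d) (hc : 0 < c) (r : ℕ) {m : ℝ} (hm : 1 ≤ m) : ∃ C : ℝ, 0 < C ∧
    ∀ {T : Finset (Fin 4 → E3)} {h : ℝ} {g : E3 → E3} {w : E3 → ℝ} {x : E3} {t : ℝ}, Msh Ω T h c r →
    Ritz Ω T r h g w → 4 * h ≤ r0 → x ∈ Ω → h ≤ t → t ≤ m * d → En w x t ≤ C * h * t ^ 2 := by
  obtain ⟨K, hK, HK⟩ := G.int_step hc r
  obtain ⟨C, hC, H⟩ := HK (m + 8 + K) (by linarith)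
  refine ⟨2 * C * K ^ 2, by positivity, fun {T h g w x t} M W hs hx ht htd => ?_⟩
  have hh := M.h0
  have hd := G.dpos
  have hD := M.D
  have hw := FE.LO M W.fe
  have hr := G.r0d
  set E0 := ∫ y, ‖gradient w y‖ ^ 2 with hE0
  have hE00 : 0 ≤ E0 := integral_nonneg fun _ => by positivity
  have hP : ∀ n : ℕ, ∀ x ∈ Ω, ∀ t, K * h ≤ t → t ≤ (m + 8 + K) * d → En w x t ≤ (2 * C * h + E0 / h ^ 2 / 2 ^ n) * t ^ 2 := by
    intro n
    induction n with
    | zero =>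
      intro x hx t h1 h2
      have h3 : En w x t ≤ E0 := setIntegral_le_integral (hw.gsq_int hD) (Filter.Eventually.of_forall fun _ => by positivity)
      have h4 : h ^ 2 ≤ t ^ 2 := pow_le_pow_left₀ hh.le (by nlinarith) 2
      refine h3.trans ?_
      have h5 : E0 ≤ E0 / h ^ 2 * t ^ 2 := by
        rw [div_mul_eq_mul_div, le_div_iff₀ (by positivity)]
        exact mul_le_mul_of_nonneg_left h4 hE00
      have : 0 ≤ 2 * C * h * t ^ 2 := by positivity
      rw [pow_zero, div_one]; linarith
    | succ n ih =>
      intro x hx t h1 h2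
      refine (H M W hs ih x hx t h1 h2).trans_eq ?_
      rw [pow_succ]; field_simp; ring
  have hfin : ∀ x ∈ Ω, ∀ t, K * h ≤ t → t ≤ (m + 8 + K) * d → En w x t ≤ 2 * C * h * t ^ 2 := fun x hx t h1 h2 => by
    have h3 : Filter.Tendsto (fun n : ℕ => (2 * C * h + E0 / h ^ 2 / 2 ^ n) * t ^ 2) Filter.atTop (nhds ((2 * C * h + 0) * t ^ 2)) := by
      refine (Filter.Tendsto.const_add _ ?_).mul_const _
      have := (tendsto_pow_atTop_nhds_zero_of_lt_one (r := (1/2 : ℝ)) (by norm_num) (by norm_num)).const_mul (E0 / h ^ 2)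
      rw [mul_zero] at this
      refine this.congr fun n => ?_
      rw [one_div, inv_pow]; rfl
    rw [add_zero] at h3
    exact ge_of_tendsto' h3 fun n => hP n x hx t h1 h2
  have h1 : t ≤ K * t := by nlinarith
  have ht0 := hh.trans_le ht
  rcases le_total (K * h) t with h2 | h2
  · refine (hfin x hx t h2 (by nlinarith)).trans ?_
    have : 1 ≤ K ^ 2 := one_le_pow₀ hK
    nlinarith [mul_le_mul_of_nonneg_left this (by positivity : 0 ≤ 2 * C * h * t ^ 2)]
  · refine (hw.En_mono hD (ball_subset_ball h2)).trans ((hfin x hx _ le_rfl (by nlinarith)).trans ?_)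
    have : (K * h) ^ 2 ≤ (K * t) ^ 2 := by gcongr
    nlinarith [mul_le_mul_of_nonneg_left this (by positivity : 0 ≤ 2 * C * h)]
end interior

section bl
variable {Ω : Set E3} {T : Finset (Fin 4 → E3)} {h c : ℝ} {r : ℕ} {z0 : E3} {r0 d : ℝ} {u φ : E3 → ℝ}

/-- Continuously differentiable functions with compact support in `Ω`. -/
structure CU (Ω : Set E3) (u : E3 → ℝ) : Prop where
  cd : ContDiff ℝ 1 u
  ts : tsupport u ⊆ Ω

/-- Approximate weak solutions. -/
def WS (Ω : Set E3) (u φ : E3 → ℝ) (ε : ℝ) : Prop := ∀ ζ, LO Ω ζ →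
  |(∫ x in Ω, ⟪gradient u x, gradient ζ x⟫) - ∫ x in Ω, φ x * ζ x| ≤ ε * √(∫ x in Ω, ‖gradient ζ x‖ ^ 2)

theorem CU.cs (hu : CU Ω u) (hD : Dom Ω) : HasCompactSupport u :=
  hD.bd.isCompact_closure.of_isClosed_subset (isClosed_tsupport u) (hu.ts.trans subset_closure)

theorem CU.lo (hu : CU Ω u) (hD : Dom Ω) : LO Ω u :=
  ⟨hu.cd.lipschitzWith_of_hasCompactSupport (hu.cs hD) one_ne_zero,
    fun _ hx => image_eq_zero_of_notMem_tsupport fun h => hx (hu.ts h)⟩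

theorem CU.gc (hu : CU Ω u) : Continuous (gradient u) :=
  (LinearIsometryEquiv.continuous _).comp (hu.cd.continuous_fderiv one_ne_zero)

theorem CU.g0 (hu : CU Ω u) {x : E3} (hx : x ∉ Ω) : gradient u x = 0 := by
  rw [gradient, fderiv_of_notMem_tsupport ℝ fun h => hx (hu.ts h), map_zero]

theorem CU.hg (hu : CU Ω u) (x : E3) : HasGradientAt u (gradient u x) x :=
  (hu.cd.differentiable one_ne_zero x).hasGradientAt

theorem CU.dl (hu : CU Ω u) (hD : Dom Ω) {τ : ℝ} (hτ : 0 ≤ τ) {z : E3} (hz : z ∈ Ω) :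
    CU Ω (fun x => u ((1 + τ) • x - τ • z)) := by
  refine ⟨hu.cd.comp (by fun_prop), fun x hx => ?_⟩
  have h1 := tsupport_comp_subset_preimage u (f := fun x : E3 => (1 + τ) • x - τ • z) (by fun_prop) hx
  rw [← Ti_T hτ z x]
  exact Ti_mem hD hτ hz (hu.ts h1)

theorem CU.dlg (hu : CU Ω u) (τ : ℝ) (z x : E3) :
    HasGradientAt (fun x => u ((1 + τ) • x - τ • z)) ((1 + τ) • gradient u ((1 + τ) • x - τ • z)) x := by
  have h1 := hasGradientAt_iff_hasFDerivAt.1 (hu.hg ((1 + τ) • x - τ • z))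
  have h2 : HasFDerivAt (fun x : E3 => (1 + τ) • x - τ • z) ((1 + τ) • ContinuousLinearMap.id ℝ E3) x :=
    ((hasFDerivAt_id x).const_smul (1 + τ)).sub_const _
  rw [hasGradientAt_iff_hasFDerivAt]
  refine (h1.comp x h2).congr_fderiv ?_
  ext y; simp

theorem CU.tcv (hu : CU Ω u) (hD : Dom Ω) {τ : ℝ} (hτ : 0 ≤ τ) {z : E3} (hz : z ∈ Ω) (p : E3) (a : ℝ) :
    ∫ x in Ω, ‖x - p‖ ^ a * ‖gradient u ((1 + τ) • x - τ • z)‖ ^ 2 =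
      ((1 + τ) ^ 3)⁻¹ * ∫ y in Ω, ‖Ti τ z y - p‖ ^ a * ‖gradient u y‖ ^ 2 := by
  rw [setIntegral_eq_full hD (Filter.Eventually.of_forall fun x hx => ?_),
    setIntegral_eq_full hD (Filter.Eventually.of_forall fun x hx => ?_), ← cov hτ z]
  · simp only [Ti_T hτ]
  · simp [hu.g0 hx]
  · rw [hu.g0 fun h => hx (by rw [← Ti_T hτ z x]; exact Ti_mem hD hτ hz h)]; simp

theorem Ti_r {τ σ d : ℝ} (hτ : 0 ≤ τ) (hστ : τ ≤ σ) {z y : E3} (hd : ‖y - z‖ ≤ d) (p : E3) : ‖Ti τ z y - p‖ ≤ ‖y - p‖ + σ * d := by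
  have h1 := norm_add_le (Ti τ z y - y) (y - p)
  rw [sub_add_sub_cancel] at h1
  have h2 := Ti_dist τ hτ z y
  rw [norm_sub_rev] at hd
  have h3 : τ * ‖z - y‖ ≤ σ * d := mul_le_mul hστ hd (norm_nonneg _) (hτ.trans hστ)
  linarith

theorem Ti_bm (hD : Dom Ω) {τ : ℝ} (hτ : 0 ≤ τ) {z : E3} (hz : z ∈ Ω) {p n : E3} {κ : ℝ} (hp : Pole Ω p n κ) (a : ℝ) :
    BM Ω (fun y => ‖Ti τ z y - p‖ ^ a) := by
  obtain ⟨hm, C, hC⟩ := hp.bm hD a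
  have : Measurable (Ti τ z) := by unfold Ti; fun_prop
  exact ⟨hm.comp this, C, fun x hx => hC _ (Ti_mem hD hτ hz hx)⟩

theorem CU.dsq (hu : CU Ω u) (hD : Dom Ω) {τ : ℝ} (hτ : 0 ≤ τ) {z : E3} (hz : z ∈ Ω) (hd : ∀ x ∈ Ω, ‖x - z‖ ≤ d)
    {p n : E3} {κ q : ℝ} (hp : Pole Ω p n κ) (hq : 0 ≤ q) (hθ : τ * d ≤ q * κ) :
    ∫ x in Ω, ‖x - p‖ ^ (3/2 : ℝ) * (u x - u ((1 + τ) • x - τ • z)) ^ 2 ≤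
      (τ * d) ^ 2 * (1 + q) ^ 2 * ∫ x in Ω, ‖x - p‖ ^ (3/2 : ℝ) * ‖gradient u x‖ ^ 2 := by
  have hlo := hu.lo hD
  obtain ⟨K, hK⟩ := hlo.1
  have hd0 : 0 ≤ d := (norm_nonneg _).trans (hd z hz)
  have hgc := hu.gc
  have hw := hp.bm hD (3/2)
  obtain ⟨hwm, Cw, hCw⟩ := hw
  have : IsFiniteMeasure (volume.restrict Ω) := isFiniteMeasure_restrict.2 hD.fin.ne
  set Fs : E3 → ℝ → ℝ := fun x s => ‖x - p‖ ^ (3/2 : ℝ) * ‖gradient u ((1 + s * τ) • x - (s * τ) • z)‖ ^ 2 with hFs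
  have hFm : Measurable (Function.uncurry Fs) := by
    have h1 : Measurable fun x : E3 × ℝ => gradient u ((1 + x.2 * τ) • x.1 - (x.2 * τ) • z) := by
      refine hgc.measurable.comp ?_
      fun_prop
    exact ((hwm.comp measurable_fst).mul (h1.norm.pow_const 2))
  have hFb : ∀ x ∈ Ω, ∀ s, ‖Fs x s‖ ≤ Cw * K ^ 2 := fun x hx s => by
    rw [hFs, norm_mul, norm_pow, norm_norm]
    exact mul_le_mul (hCw x hx) (pow_le_pow_left₀ (norm_nonneg _) (norm_gradient_le hK _) 2) (by positivity) ((norm_nonneg _).trans (hCw x hx))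
  have hI : Integrable (Function.uncurry Fs) ((volume.restrict Ω).prod (volume.restrict (Ioc (0:ℝ) 1))) := by
    refine Integrable.of_bound hFm.aestronglyMeasurable (Cw * K ^ 2) ?_
    have h1 : ∀ᵐ x ∂(volume.restrict Ω), x ∈ Ω := ae_restrict_mem hD.meas
    have := (Measure.quasiMeasurePreserving_fst (μ := volume.restrict Ω) (ν := volume.restrict (Ioc (0:ℝ) 1))).ae h1
    filter_upwards [this] with x hx
    exact hFb x.1 hx x.2
  have hpt : ∀ x ∈ Ω, ‖x - p‖ ^ (3/2 : ℝ) * (u x - u ((1 + τ) • x - τ • z)) ^ 2 ≤ (τ * d) ^ 2 * ∫ s in Ioc (0:ℝ) 1, Fs x s := fun x hx => by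
    have h1 := tr_pt0 hK (τ • (x - z)) x (Filter.Eventually.of_forall fun s => hu.cd.differentiable one_ne_zero _)
    have e1 : ∀ s : ℝ, x + s • τ • (x - z) = (1 + s * τ) • x - (s * τ) • z := fun s => by module
    have e2 : x + τ • (x - z) = (1 + τ) • x - τ • z := by module
    simp only [e1, e2] at h1
    have h2 : ‖τ • (x - z)‖ ^ 2 ≤ (τ * d) ^ 2 := by
      rw [norm_smul, Real.norm_of_nonneg hτ]
      exact pow_le_pow_left₀ (by positivity) (mul_le_mul_of_nonneg_left (hd x hx) hτ) 2
    rw [hFs, integral_const_mul]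
    have h3 : (0:ℝ) ≤ ∫ s in Ioc (0:ℝ) 1, ‖gradient u ((1 + s * τ) • x - (s * τ) • z)‖ ^ 2 := integral_nonneg fun _ => by positivity
    have h4 := h1.trans (mul_le_mul_of_nonneg_right h2 h3)
    have h5 := mul_le_mul_of_nonneg_left h4 (by positivity : 0 ≤ ‖x - p‖ ^ (3/2 : ℝ))
    rw [← neg_sub (u _) (u x), neg_sq]
    linarith
  have hA0 : (0:ℝ) ≤ ∫ x in Ω, ‖x - p‖ ^ (3/2 : ℝ) * ‖gradient u x‖ ^ 2 := integral_nonneg fun _ => by positivity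
  calc _ ≤ ∫ x in Ω, (τ * d) ^ 2 * ∫ s in Ioc (0:ℝ) 1, Fs x s :=
        integral_mono_of_nonneg (Filter.Eventually.of_forall fun x => by positivity) (hI.integral_prod_left.const_mul _)
          ((ae_restrict_iff' hD.meas).2 (Filter.Eventually.of_forall hpt))
    _ = (τ * d) ^ 2 * ∫ s in Ioc (0:ℝ) 1, ∫ x in Ω, Fs x s := by rw [integral_const_mul, integral_integral_swap hI]
    _ ≤ (τ * d) ^ 2 * ((1 + q) ^ 2 * ∫ x in Ω, ‖x - p‖ ^ (3/2 : ℝ) * ‖gradient u x‖ ^ 2) := by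
        refine mul_le_mul_of_nonneg_left ?_ (sq_nonneg _)
        set A := (1 + q) ^ 2 * ∫ x in Ω, ‖x - p‖ ^ (3/2 : ℝ) * ‖gradient u x‖ ^ 2 with hA
        have h1 : ∀ s ∈ Ioc (0:ℝ) 1, ∫ x in Ω, Fs x s ≤ A := fun s hs => by
          have hsτ : 0 ≤ s * τ := mul_nonneg hs.1.le hτ
          have hsτ2 : s * τ ≤ τ := mul_le_of_le_one_left hτ hs.2
          simp only [hFs]
          rw [hu.tcv hD hsτ hz]
          have h0 : ((1 + s * τ) ^ 3)⁻¹ ≤ 1 := inv_le_one_of_one_le₀ (one_le_pow₀ (by linarith))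
          have h00 : 0 ≤ ∫ y in Ω, ‖Ti (s * τ) z y - p‖ ^ (3/2 : ℝ) * ‖gradient u y‖ ^ 2 := integral_nonneg fun _ => by positivity
          refine (mul_le_of_le_one_left h00 h0).trans ?_
          rw [hA, ← integral_const_mul]
          refine ae_le_set hD ((Ti_bm hD hsτ hz hp _).mul hlo.gbm.nsq) (((hp.bm hD _).mul hlo.gbm.nsq).cmul _)
            (Filter.Eventually.of_forall fun x hx => ?_)
          rw [← mul_assoc]
          refine mul_le_mul_of_nonneg_right ?_ (by positivity)
          have h2 : ‖Ti (s * τ) z x - p‖ ≤ (1 + q) * ‖x - p‖ := by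
            have := Ti_r hsτ hsτ2 (hd x hx) p
            have := mul_le_mul_of_nonneg_left (hp.r hx) hq
            linarith
          calc _ ≤ ((1 + q) * ‖x - p‖) ^ (3/2 : ℝ) := Real.rpow_le_rpow (norm_nonneg _) h2 (by norm_num)
            _ = (1 + q) ^ (3/2 : ℝ) * ‖x - p‖ ^ (3/2 : ℝ) := Real.mul_rpow (by positivity) (by positivity)
            _ ≤ (1 + q) ^ (2:ℝ) * ‖x - p‖ ^ (3/2 : ℝ) := mul_le_mul_of_nonneg_right
                (Real.rpow_le_rpow_of_exponent_le (by linarith) (by norm_num)) (by positivity)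
            _ = _ := by norm_cast
        have h2 := setIntegral_mono_on (μ := volume) (s := Ioc (0:ℝ) 1) (f := fun s => ∫ x in Ω, Fs x s) (g := fun _ => A) hI.integral_prod_right
          (integrable_const _) measurableSet_Ioc h1
        simpa using h2
    _ = _ := by ring
end bl

section bl2
variable {Ω : Set E3} {T : Finset (Fin 4 → E3)} {h c : ℝ} {r : ℕ} {z0 : E3} {r0 d : ℝ} {u φ : E3 → ℝ}

theorem wgrad (hD : Dom Ω) {p n : E3} {κ : ℝ} (hp : Pole Ω p n κ) {f : E3 → ℝ} (hf : LO Ω f) {R : ℝ} (hR1 : 1 ≤ R)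
    (hR : ∀ x ∈ Ω, ‖x - p‖ ≤ R) {a : ℝ} (ha : 0 ≤ a) (ha2 : a ≤ 5/2) :
    ∫ x in Ω, ‖gradient (fun y => ‖y - p‖ ^ a * f y) x‖ ^ 2 ≤ 8 * R ^ 6 * ∫ x in Ω, ‖gradient f x‖ ^ 2 := by
  have hh := hardy hD hp hf
  have b1 := hf.gbm.nsq
  have b2 := (hp.bm hD (-2)).mul (hf.bm hD).sq
  calc _ ≤ ∫ x in Ω, (2 * R ^ 6 * ‖gradient f x‖ ^ 2 + 25 / 2 * R ^ 6 * (‖x - p‖ ^ (-2:ℝ) * f x ^ 2)) := by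
        refine ae_le_set hD (hp.mulLO hD a hf).gbm.nsq ((b1.cmul _).add (b2.cmul _)) ?_
        filter_upwards [hf.ae] with x hx hxO
        have hr := hp.rpos hxO
        rw [((hasGradientAt_rpow p a hr).mul' hx.hasGradientAt).gradient]
        set P := ‖x - p‖ ^ a
        have hP0 : 0 ≤ P := by positivity
        have hP : P ^ 2 ≤ R ^ 6 := by
          have h1 : P ≤ R ^ (3:ℝ) := (Real.rpow_le_rpow hr.le (hR x hxO) ha).trans
            (Real.rpow_le_rpow_of_exponent_le hR1 (by linarith))
          have h2 : R ^ (3:ℝ) = R ^ 3 := by norm_cast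
          rw [h2] at h1
          calc P ^ 2 ≤ (R ^ 3) ^ 2 := pow_le_pow_left₀ hP0 h1 2
            _ = _ := by ring
        have e1 : ‖x - p‖ ^ (a - 2) * ‖x - p‖ = P * ‖x - p‖⁻¹ := by
          rw [Real.rpow_sub hr, Real.rpow_two]; field_simp
          rfl
        have e2 : ‖x - p‖ ^ (-2:ℝ) = ‖x - p‖⁻¹ ^ 2 := by
          rw [Real.rpow_neg hr.le, Real.rpow_two, inv_pow]
        have h1 := norm_add_le (P • gradient f x) (f x • (a * ‖x - p‖ ^ (a - 2)) • (x - p))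
        rw [norm_smul, norm_smul, norm_smul, Real.norm_of_nonneg hP0, Real.norm_of_nonneg (by positivity : 0 ≤ a * ‖x - p‖ ^ (a - 2)),
          mul_assoc a, e1] at h1
        have h2 := pow_le_pow_left₀ (norm_nonneg _) h1 2
        rw [e2]
        set g := ‖gradient f x‖
        set s := ‖x - p‖⁻¹ * ‖f x‖ with hs
        have e3 : ‖x - p‖⁻¹ ^ 2 * f x ^ 2 = s ^ 2 := by rw [hs, mul_pow, Real.norm_eq_abs, sq_abs]
        rw [e3]
        have e4 : ‖f x‖ * (a * (P * ‖x - p‖⁻¹)) = a * P * s := by rw [hs]; ring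
        rw [e4] at h2
        refine h2.trans ?_
        have h3 : (P * g + a * P * s) ^ 2 ≤ P ^ 2 * (2 * g ^ 2 + 2 * (a ^ 2 * s ^ 2)) := by
          have : 0 ≤ P ^ 2 * (g - a * s) ^ 2 := by positivity
          nlinarith
        have h4 : a ^ 2 * s ^ 2 ≤ 25 / 4 * s ^ 2 := mul_le_mul_of_nonneg_right (by nlinarith) (sq_nonneg _)
        have h5 : P ^ 2 * (2 * g ^ 2 + 2 * (a ^ 2 * s ^ 2)) ≤ R ^ 6 * (2 * g ^ 2 + 2 * (25 / 4 * s ^ 2)) :=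
          mul_le_mul hP (by linarith) (by positivity) (by positivity)
        linarith
    _ = 2 * R ^ 6 * (∫ x in Ω, ‖gradient f x‖ ^ 2) + 25 / 2 * R ^ 6 * ∫ x in Ω, ‖x - p‖ ^ (-2:ℝ) * f x ^ 2 := by
        rw [integral_add ((b1.cmul _).integrableOn hD) ((b2.cmul _).integrableOn hD), integral_const_mul, integral_const_mul]
    _ ≤ _ := by
        have h1 := mul_le_mul_of_nonneg_left hh (by positivity : 0 ≤ 25 / 2 * R ^ 6)
        have h2 : 0 ≤ R ^ 6 * ∫ x in Ω, ‖gradient f x‖ ^ 2 := mul_nonneg (by positivity) (integral_nonneg fun _ => by positivity)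
        linarith

/-- Data for the local dual estimates. -/
structure LD (Ω : Set E3) (u φ : E3 → ℝ) (p n : E3) (κ R Q N B ε : ℝ) : Prop where
  D : Dom Ω
  hp : Pole Ω p n κ
  cu : CU Ω u
  bm : BM Ω φ
  ws : WS Ω u φ ε
  R1 : 1 ≤ R
  rR : ∀ x ∈ Ω, ‖x - p‖ ≤ R
  Q0 : 0 ≤ Q
  rQ : ∀ x ∈ Ω, φ x ≠ 0 → ‖x - p‖ ^ (7/2 : ℝ) ≤ Q
  phi : ∫ x in Ω, φ x ^ 2 ≤ N
  B0 : 0 ≤ B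
  e0 : 0 ≤ ε
  gB : ∫ x in Ω, ‖gradient u x‖ ^ 2 ≤ B ^ 2

theorem LD.wsz {p n : E3} {κ R Q N B ε : ℝ} (H : LD Ω u φ p n κ R Q N B ε) {f : E3 → ℝ} (hf : LO Ω f)
    (hfB : ∫ x in Ω, ‖gradient f x‖ ^ 2 ≤ 4 * B ^ 2) {a : ℝ} (ha : 0 ≤ a) (ha2 : a ≤ 5/2) :
    ∫ x in Ω, ⟪gradient u x, gradient (fun y => ‖y - p‖ ^ a * f y) x⟫ ≤
      (∫ x in Ω, φ x * (‖x - p‖ ^ a * f x)) + 6 * ε * R ^ 3 * B := by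
  have h1 := H.ws _ (H.hp.mulLO H.D a hf)
  have h2 := wgrad H.D H.hp hf H.R1 H.rR ha ha2
  have h3 := (abs_le.1 h1).2
  have hR := H.R1
  have hB := H.B0
  have h4 : √(∫ x in Ω, ‖gradient (fun y => ‖y - p‖ ^ a * f y) x‖ ^ 2) ≤ 6 * R ^ 3 * B := by
    rw [Real.sqrt_le_left (by positivity)]
    refine h2.trans ((mul_le_mul_of_nonneg_left hfB (by positivity)).trans ?_)
    have : 0 ≤ R ^ 6 * B ^ 2 := by positivity
    linarith
  have h5 := mul_le_mul_of_nonneg_left h4 H.e0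
  linarith

theorem LD.F1 {p n : E3} {κ R Q N B ε : ℝ} (H : LD Ω u φ p n κ R Q N B ε) :
    ∫ x in Ω, ‖x - p‖ ^ (3/2 : ℝ) * ‖gradient u x‖ ^ 2 ≤ 170 * Q * N + 156 * ε * R ^ 3 * B := by
  have hD := H.D
  have hp := H.hp
  have hlo := H.cu.lo hD
  have h1 := agmon hD hp hlo (b := 3/4) (by norm_num)
  rw [show (2:ℝ) * (3/4) = 3/2 by norm_num, show (3/2 : ℝ) - 2 = -(1/2) by norm_num] at h1
  have h2 := H.wsz hlo (H.gB.trans (by nlinarith [H.B0])) (a := 3/2) (by norm_num) (by norm_num)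
  have b1 := (hp.bm hD (3/2)).mul hlo.gbm.nsq
  have b2 := (hp.bm hD (-(1/2))).mul (hlo.bm hD).sq
  rw [integral_add (b1.integrableOn hD) (b2.integrableOn hD)] at h1
  have h3 : ∫ x in Ω, φ x * (‖x - p‖ ^ (3/2 : ℝ) * u x) ≤ 1 / 26 * (∫ x in Ω, ‖x - p‖ ^ (-(1/2) : ℝ) * u x ^ 2) + 13 / 2 * Q * N := by
    calc _ ≤ ∫ x in Ω, (1 / 26 * (‖x - p‖ ^ (-(1/2) : ℝ) * u x ^ 2) + 13 / 2 * Q * φ x ^ 2) := by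
          refine ae_le_set hD (H.bm.mul ((hp.bm hD _).mul (hlo.bm hD))) ((b2.cmul _).add (H.bm.sq.cmul _))
            (Filter.Eventually.of_forall fun x hx => ?_)
          by_cases hφ : φ x = 0
          · rw [hφ]
            have : 0 ≤ ‖x - p‖ ^ (-(1/2) : ℝ) * u x ^ 2 := by positivity
            linarith
          have hr := hp.rpos hx
          have hq := H.rQ x hx hφ
          set s := ‖x - p‖ ^ (-(1/4) : ℝ)
          set t := ‖x - p‖ ^ (7/4 : ℝ)
          have e1 : ‖x - p‖ ^ (-(1/2) : ℝ) = s ^ 2 := by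
            rw [← Real.rpow_natCast, ← Real.rpow_mul hr.le]; norm_num
          have e2 : ‖x - p‖ ^ (7/2 : ℝ) = t ^ 2 := by
            rw [← Real.rpow_natCast, ← Real.rpow_mul hr.le]; norm_num
          have e3 : ‖x - p‖ ^ (3/2 : ℝ) = s * t := by
            rw [← Real.rpow_add hr]; norm_num
          rw [e1, e3]; rw [e2] at hq
          have h4 := mul_le_mul_of_nonneg_right hq (sq_nonneg (φ x))
          nlinarith [sq_nonneg (s * u x - 13 * (t * φ x))]
      _ ≤ _ := by
          rw [integral_add ((b2.cmul _).integrableOn hD) ((H.bm.sq.cmul _).integrableOn hD), integral_const_mul, integral_const_mul]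
          have := mul_le_mul_of_nonneg_left H.phi (by linarith [H.Q0] : 0 ≤ 13 / 2 * Q)
          linarith
  have h5 : 0 ≤ ∫ x in Ω, ‖x - p‖ ^ (-(1/2) : ℝ) * u x ^ 2 := integral_nonneg fun _ => by positivity
  have h6 : 0 ≤ Q * N := mul_nonneg H.Q0 (le_trans (integral_nonneg fun _ => by positivity) H.phi)
  have h7 : 0 ≤ ε * R ^ 3 * B := mul_nonneg (mul_nonneg H.e0 (pow_nonneg (by linarith [H.R1]) 3)) H.B0
  linarith

theorem up_pt {r r' δ q h : ℝ} (hr : 0 < r) (h0 : 0 ≤ r') (hδ : 0 ≤ δ) (h1 : r' ≤ r + δ) (h2 : δ ≤ q * r) (hq : 0 ≤ q) (hδh : δ ≤ q * h) :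
    r' ^ (5/2 : ℝ) ≤ r ^ (5/2 : ℝ) + q * (3 + 3 * q + q ^ 2) * h * r ^ (3/2 : ℝ) := by
  set b := δ / r with hb
  have hb0 : 0 ≤ b := by positivity
  have hbq : b ≤ q := by rw [hb, div_le_iff₀ hr]; exact h2
  have e1 : r + δ = r * (1 + b) := by rw [hb]; field_simp
  have e2 : r ^ (5/2 : ℝ) = r ^ (3/2 : ℝ) * r := by
    rw [← Real.rpow_add_one hr.ne']; norm_num
  calc r' ^ (5/2 : ℝ) ≤ (r * (1 + b)) ^ (5/2 : ℝ) := Real.rpow_le_rpow h0 (e1 ▸ h1) (by norm_num)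
    _ = r ^ (5/2 : ℝ) * (1 + b) ^ (5/2 : ℝ) := Real.mul_rpow hr.le (by positivity)
    _ ≤ r ^ (5/2 : ℝ) * (1 + b) ^ (3:ℝ) := mul_le_mul_of_nonneg_left
        (Real.rpow_le_rpow_of_exponent_le (by linarith) (by norm_num)) (by positivity)
    _ = r ^ (5/2 : ℝ) * (1 + b) ^ 3 := by norm_cast
    _ = r ^ (5/2 : ℝ) + r ^ (3/2 : ℝ) * (r * b * (3 + 3 * b + b ^ 2)) := by rw [e2]; ring
    _ ≤ _ := by
        have e3 : r * b = δ := by rw [hb]; field_simp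
        have h3 : r * b * (3 + 3 * b + b ^ 2) ≤ q * h * (3 + 3 * q + q ^ 2) := by
          rw [e3]
          refine mul_le_mul hδh ?_ (by positivity) (hδ.trans hδh)
          linarith [pow_le_pow_left₀ hb0 hbq 2]
        have := mul_le_mul_of_nonneg_left h3 (by positivity : 0 ≤ r ^ (3/2 : ℝ))
        linarith

theorem LD.F2 {p n : E3} {κ R Q N B ε : ℝ} (H : LD Ω u φ p n κ R Q N B ε) (hh : 0 < h) (hhκ : h ≤ κ) {τ q : ℝ} (hτ : 0 ≤ τ)
    (hq : 0 ≤ q) (hτq : τ * d ≤ q * h) {z : E3} (hz : z ∈ Ω) (hd : ∀ x ∈ Ω, ‖x - z‖ ≤ d) :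
    ∫ x in Ω, ‖x - p‖ ^ (5/2 : ℝ) * ‖gradient u x - (1 + τ) • gradient u ((1 + τ) • x - τ • z)‖ ^ 2 ≤
      h * (q * (3 + 3 * q + q ^ 2) + 5 / 2 + 7 / 2 * (q ^ 2 * (1 + q) ^ 2)) *
        (∫ x in Ω, ‖x - p‖ ^ (3/2 : ℝ) * ‖gradient u x‖ ^ 2) + h * Q * N + 12 * ε * R ^ 3 * B := by
  have hD := H.D
  have hp := H.hp
  have hu := H.cu
  have hlo := hu.lo hD
  have hV := hu.dl hD hτ hz
  have hVg := hu.dlg τ z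
  have hVl := hV.lo hD
  set V := fun x => u ((1 + τ) • x - τ • z) with hVd
  have hd0 : 0 ≤ d := (norm_nonneg _).trans (hd z hz)
  have hτκ : τ * d ≤ q * κ := hτq.trans (mul_le_mul_of_nonneg_left hhκ hq)
  have hf := hlo.sub hVl
  set f := fun x => u x - V x with hfd
  have eV : ∀ x, (1 + τ) • gradient u ((1 + τ) • x - τ • z) = gradient V x := fun x => (hVg x).gradient.symm
  have ef : ∀ x, gradient f x = gradient u x - gradient V x := fun x => ((hu.hg x).sub' (hV.hg x)).gradient
  have hG : ∫ x in Ω, ‖gradient V x‖ ^ 2 ≤ B ^ 2 := by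
    have h1 := hu.tcv hD hτ hz p 0
    simp only [Real.rpow_zero, one_mul] at h1
    simp only [← eV, norm_smul, mul_pow, integral_const_mul, h1]
    rw [Real.norm_of_nonneg (by linarith), ← mul_assoc]
    have h2 : (1 + τ) ^ 2 * ((1 + τ) ^ 3)⁻¹ ≤ 1 := by
      rw [mul_inv_le_iff₀ (by positivity), one_mul]
      exact pow_le_pow_right₀ (by linarith) (by norm_num)
    have h3 : 0 ≤ ∫ x in Ω, ‖gradient u x‖ ^ 2 := integral_nonneg fun _ => by positivity
    exact (mul_le_of_le_one_left h3 h2).trans H.gB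
  have hGf : ∫ x in Ω, ‖gradient f x‖ ^ 2 ≤ 4 * B ^ 2 := by
    calc _ ≤ ∫ x in Ω, (2 * ‖gradient u x‖ ^ 2 + 2 * ‖gradient V x‖ ^ 2) := by
          refine ae_le_set hD hf.gbm.nsq ((hlo.gbm.nsq.cmul _).add (hVl.gbm.nsq.cmul _)) (Filter.Eventually.of_forall fun x _ => ?_)
          rw [ef]
          have := pow_le_pow_left₀ (norm_nonneg _) (norm_sub_le (gradient u x) (gradient V x)) 2
          linarith [sq_nonneg (‖gradient u x‖ - ‖gradient V x‖)]
      _ ≤ _ := by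
          rw [integral_add ((hlo.gbm.nsq.cmul _).integrableOn hD) ((hVl.gbm.nsq.cmul _).integrableOn hD), integral_const_mul, integral_const_mul]
          linarith [H.gB]
  set A := ∫ x in Ω, ‖x - p‖ ^ (3/2 : ℝ) * ‖gradient u x‖ ^ 2 with hA
  have hA0 : 0 ≤ A := integral_nonneg fun _ => by positivity
  set X := ∫ x in Ω, ‖x - p‖ ^ (3/2 : ℝ) * f x ^ 2 with hX
  have hXle : X ≤ (q * h) ^ 2 * (1 + q) ^ 2 * A := by
    refine (hu.dsq hD hτ hz hd hp hq hτκ).trans ?_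
    have h1 : (τ * d) ^ 2 ≤ (q * h) ^ 2 := pow_le_pow_left₀ (by positivity) hτq 2
    exact mul_le_mul_of_nonneg_right (mul_le_mul_of_nonneg_right h1 (sq_nonneg _)) hA0
  have hI1 : ∫ x in Ω, ‖x - p‖ ^ (5/2 : ℝ) * ‖gradient V x‖ ^ 2 ≤
      (∫ x in Ω, ‖x - p‖ ^ (5/2 : ℝ) * ‖gradient u x‖ ^ 2) + q * (3 + 3 * q + q ^ 2) * h * A := by
    have h1 := hu.tcv hD hτ hz p (5/2)
    have bu := (hp.bm hD (5/2)).mul hlo.gbm.nsq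
    have bu2 := ((hp.bm hD (3/2)).mul hlo.gbm.nsq).cmul (q * (3 + 3 * q + q ^ 2) * h)
    have e1 : ∫ x in Ω, ‖x - p‖ ^ (5/2 : ℝ) * ‖gradient V x‖ ^ 2 =
        (1 + τ) ^ 2 * ∫ x in Ω, ‖x - p‖ ^ (5/2 : ℝ) * ‖gradient u ((1 + τ) • x - τ • z)‖ ^ 2 := by
      rw [← integral_const_mul]
      refine integral_congr_ae (Filter.Eventually.of_forall fun x => ?_)
      beta_reduce
      rw [← eV, norm_smul, mul_pow, Real.norm_of_nonneg (by linarith)]; ring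
    rw [e1, h1, ← mul_assoc]
    have h2 : (1 + τ) ^ 2 * ((1 + τ) ^ 3)⁻¹ ≤ 1 := by
      rw [mul_inv_le_iff₀ (by positivity), one_mul]
      exact pow_le_pow_right₀ (by linarith) (by norm_num)
    have h3 : 0 ≤ ∫ y in Ω, ‖Ti τ z y - p‖ ^ (5/2 : ℝ) * ‖gradient u y‖ ^ 2 := integral_nonneg fun _ => by positivity
    refine (mul_le_of_le_one_left h3 h2).trans ?_
    rw [hA, ← integral_const_mul, ← integral_add (bu.integrableOn hD) (bu2.integrableOn hD)]
    refine ae_le_set hD ((Ti_bm hD hτ hz hp _).mul hlo.gbm.nsq) (bu.add bu2) (Filter.Eventually.of_forall fun x hx => ?_)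
    have h4 := up_pt (h := h) (hp.rpos hx) (norm_nonneg _) (by positivity) (Ti_r hτ le_rfl (hd x hx) p)
      (hτκ.trans (mul_le_mul_of_nonneg_left (hp.r hx) hq)) hq hτq
    have h5 := mul_le_mul_of_nonneg_right h4 (sq_nonneg ‖gradient u x‖)
    linarith
  have hw := H.wsz hf hGf (a := 5/2) (by norm_num) le_rfl
  have bX := (hp.bm hD (3/2)).mul (hf.bm hD).sq
  have hI2 : ∫ x in Ω, φ x * (‖x - p‖ ^ (5/2 : ℝ) * f x) ≤ h / 2 * Q * N + h⁻¹ / 2 * X := by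
    calc _ ≤ ∫ x in Ω, (h / 2 * Q * φ x ^ 2 + h⁻¹ / 2 * (‖x - p‖ ^ (3/2 : ℝ) * f x ^ 2)) := by
          refine ae_le_set hD (H.bm.mul ((hp.bm hD _).mul (hf.bm hD))) ((H.bm.sq.cmul _).add (bX.cmul _))
            (Filter.Eventually.of_forall fun x hx => ?_)
          by_cases hφ : φ x = 0
          · rw [hφ]
            have : 0 ≤ h⁻¹ / 2 * (‖x - p‖ ^ (3/2 : ℝ) * f x ^ 2) := by positivity
            linarith
          have hr := hp.rpos hx
          have hQ := H.rQ x hx hφ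
          set s := ‖x - p‖ ^ (3/4 : ℝ)
          set t := ‖x - p‖ ^ (7/4 : ℝ)
          have e1 : ‖x - p‖ ^ (3/2 : ℝ) = s ^ 2 := by
            rw [← Real.rpow_natCast, ← Real.rpow_mul hr.le]; norm_num
          have e2 : ‖x - p‖ ^ (7/2 : ℝ) = t ^ 2 := by
            rw [← Real.rpow_natCast, ← Real.rpow_mul hr.le]; norm_num
          have e3 : ‖x - p‖ ^ (5/2 : ℝ) = s * t := by
            rw [← Real.rpow_add hr]; norm_num
          rw [e1, e3]; rw [e2] at hQ
          have h4 := mul_le_mul_of_nonneg_left (mul_le_mul_of_nonneg_right hQ (sq_nonneg (φ x))) hh.le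
          have h5 : 0 ≤ h⁻¹ * (s * f x - h * (t * φ x)) ^ 2 := by positivity
          have e4 : h⁻¹ * (s * f x - h * (t * φ x)) ^ 2 = h⁻¹ * (s ^ 2 * f x ^ 2) - 2 * (φ x * (s * t * f x)) + h * (t ^ 2 * φ x ^ 2) := by
            field_simp; ring
          rw [e4] at h5
          linarith
      _ ≤ _ := by
          rw [integral_add ((H.bm.sq.cmul _).integrableOn hD) ((bX.cmul _).integrableOn hD), integral_const_mul, integral_const_mul]
          have h0 := H.Q0
          have := mul_le_mul_of_nonneg_left H.phi (by positivity : 0 ≤ h / 2 * Q)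
          linarith
  have c1 := (hp.bm hD (5/2)).mul hVl.gbm.nsq
  have c2 := ((hp.bm hD (5/2)).mul hlo.gbm.nsq).cmul (-1)
  have c3 := (hlo.gbm.inner (hp.mulLO hD (5/2) hf).gbm).cmul 2
  have c4 := ((hp.bm hD (3/2)).mul hlo.gbm.nsq).cmul (5 / 2 * h)
  have c5 := bX.cmul (5 / 2 * h⁻¹)
  have hY : ∫ x in Ω, ‖x - p‖ ^ (5/2 : ℝ) * ‖gradient u x - (1 + τ) • gradient u ((1 + τ) • x - τ • z)‖ ^ 2 ≤
      (∫ x in Ω, ‖x - p‖ ^ (5/2 : ℝ) * ‖gradient V x‖ ^ 2) + -1 * (∫ x in Ω, ‖x - p‖ ^ (5/2 : ℝ) * ‖gradient u x‖ ^ 2) +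
      2 * (∫ x in Ω, ⟪gradient u x, gradient (fun y => ‖y - p‖ ^ (5/2 : ℝ) * f y) x⟫) + 5 / 2 * h * A + 5 / 2 * h⁻¹ * X := by
    rw [hA, hX, ← integral_const_mul, ← integral_const_mul, ← integral_const_mul, ← integral_const_mul, ← integral_add (c1.integrableOn hD) (c2.integrableOn hD),
      ← integral_add ((c1.add c2).integrableOn hD) (c3.integrableOn hD), ← integral_add (((c1.add c2).add c3).integrableOn hD) (c4.integrableOn hD),
      ← integral_add ((((c1.add c2).add c3).add c4).integrableOn hD) (c5.integrableOn hD)]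
    simp only [eV]
    refine ae_le_set hD ((hp.bm hD _).mul (hlo.gbm.sub hVl.gbm).nsq) ((((c1.add c2).add c3).add c4).add c5)
      (Filter.Eventually.of_forall fun x hx => ?_)
    have hr := hp.rpos hx
    rw [((hasGradientAt_rpow p (5/2) hr).mul' ((hu.hg x).sub' (hV.hg x))).gradient, norm_sub_sq_real, inner_add_right, inner_smul_right,
      inner_smul_right, inner_smul_right, inner_sub_right, real_inner_self_eq_norm_sq]
    have e1 : ‖x - p‖ ^ (5/2 - 2 : ℝ) * ‖x - p‖ = ‖x - p‖ ^ (3/2 : ℝ) := by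
      rw [← Real.rpow_add_one hr.ne']; norm_num
    set s := ‖x - p‖ ^ (3/2 : ℝ)
    set P := ‖x - p‖ ^ (5/2 : ℝ)
    set U := ‖gradient u x‖
    have hs0 : 0 ≤ s := by positivity
    have e2 : u x - V x = f x := rfl
    rw [e2]
    set w := ‖x - p‖ ^ (5/2 - 2 : ℝ)
    have hw0 : 0 ≤ w := by positivity
    have h1 : |f x * (w * ⟪gradient u x, x - p⟫)| ≤ s * (|f x| * U) := by
      rw [abs_mul, abs_mul, abs_of_nonneg hw0]
      have h2 := mul_le_mul_of_nonneg_left (abs_real_inner_le_norm (gradient u x) (x - p)) (mul_nonneg (abs_nonneg (f x)) hw0)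
      have e3 : |f x| * w * (‖gradient u x‖ * ‖x - p‖) = w * ‖x - p‖ * (|f x| * U) := by ring
      rw [e3, e1] at h2
      linarith
    have h2 := (abs_le.1 h1).1
    have h3 : 0 ≤ h⁻¹ * (|f x| - h * U) ^ 2 := by positivity
    have e4 : h⁻¹ * (|f x| - h * U) ^ 2 = h⁻¹ * f x ^ 2 - 2 * (|f x| * U) + h * U ^ 2 := by
      rw [← sq_abs (f x)]; field_simp; ring
    rw [e4] at h3
    have h4 := mul_nonneg hs0 h3
    linarith
  have h6 : h⁻¹ * X ≤ h * (q ^ 2 * (1 + q) ^ 2) * A := by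
    rw [inv_mul_le_iff₀ hh]; linarith
  linarith
end bl2

section avg
variable {Ω : Set E3} {T : Finset (Fin 4 → E3)} {h c : ℝ} {r : ℕ} {z0 : E3} {r0 d : ℝ} {u φ : E3 → ℝ}

theorem hcs_of_ball {s : ℝ} {V : Type*} [Zero V] {k : E3 → V} (h0 : ∀ z, z ∉ ball z0 s → k z = 0) : HasCompactSupport k :=
  HasCompactSupport.intro (isCompact_closedBall z0 s) fun z hz => h0 z fun h => hz (ball_subset_closedBall h)

theorem wt_est {s L : ℝ} {k : E3 → ℝ} (hk : Continuous k) (h0 : ∀ z, z ∉ ball z0 s → k z = 0) (hL : ∀ z, |k z| ≤ L)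
    {D : E3 → E3} (hD : Continuous D) (a : E3) :
    ‖(∫ z, k z • D z) - (∫ z, k z) • a‖ ≤ L * ∫ z in ball z0 s, ‖a - D z‖ := by
  have h1 : Integrable fun z => k z • D z := (hk.smul hD).integrable_of_hasCompactSupport
    (hcs_of_ball (z0 := z0) (s := s) fun z hz => by simp [h0 z hz])
  have h2 : Integrable k := hk.integrable_of_hasCompactSupport (hcs_of_ball h0)
  rw [← integral_smul_const, ← integral_sub h1 (h2.smul_const a)]
  have h3 : ∫ z, (k z • D z - k z • a) = ∫ z in ball z0 s, (k z • D z - k z • a) :=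
    (setIntegral_eq_integral_of_forall_compl_eq_zero fun z hz => by rw [h0 z hz]; simp).symm
  rw [h3, ← integral_const_mul]
  refine norm_integral_le_of_norm_le (f := fun z => k z • D z - k z • a) ?_ (Filter.Eventually.of_forall fun z => ?_)
  · exact ci_ball (by fun_prop) z0 s
  · rw [← smul_sub, norm_smul, norm_sub_rev]
    exact mul_le_mul_of_nonneg_right (hL z) (norm_nonneg _)

/-- Averaged dilation. -/
def Vt (u k : E3 → ℝ) (τ : ℝ) (x : E3) : ℝ := ∫ z, k z * u ((1 + τ) • x - τ • z)

theorem Vt_grad (hD : Dom Ω) (hu : CU Ω u) {s : ℝ} {k : E3 → ℝ} (hk : Continuous k) (h0 : ∀ z, z ∉ ball z0 s → k z = 0) (τ : ℝ) (x : E3) :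
    HasGradientAt (Vt u k τ) (∫ z, k z • ((1 + τ) • gradient u ((1 + τ) • x - τ • z))) x := by
  have hgc := hu.gc
  have huc := hu.cd.continuous
  obtain ⟨Cb, hCb⟩ : ∃ C, ∀ y, ‖gradient u y‖ ≤ C := by
    obtain ⟨⟨K, hK⟩, _⟩ := hu.lo hD
    exact ⟨K, fun y => norm_gradient_le hK y⟩
  have hi : ∀ x : E3, Integrable fun z => k z • ((1 + τ) • gradient u ((1 + τ) • x - τ • z)) := fun x =>
    (Continuous.integrable_of_hasCompactSupport (by fun_prop)
      (hcs_of_ball fun z hz => by rw [h0 z hz, zero_smul]))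
  have hkI : Integrable k := hk.integrable_of_hasCompactSupport (hcs_of_ball h0)
  rw [hasGradientAt_iff_hasFDerivAt]
  have e1 : (InnerProductSpace.toDual ℝ E3) (∫ z, k z • ((1 + τ) • gradient u ((1 + τ) • x - τ • z))) =
      ∫ z, (InnerProductSpace.toDual ℝ E3) (k z • ((1 + τ) • gradient u ((1 + τ) • x - τ • z))) :=
    ((InnerProductSpace.toDual ℝ E3).toContinuousLinearEquiv.toContinuousLinearMap.integral_comp_comm (hi x)).symm
  rw [e1]
  refine hasFDerivAt_integral_of_dominated_of_fderiv_le (F := fun x z => k z * u ((1 + τ) • x - τ • z))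
    (F' := fun x z => (InnerProductSpace.toDual ℝ E3) (k z • ((1 + τ) • gradient u ((1 + τ) • x - τ • z))))
    (bound := fun z => ‖k z‖ * (|1 + τ| * Cb)) (s := univ) Filter.univ_mem (Filter.Eventually.of_forall fun y => ?_) ?_ ?_ ?_ ?_ ?_
  · exact (Continuous.aestronglyMeasurable (by fun_prop))
  · exact Continuous.integrable_of_hasCompactSupport (by fun_prop) (hcs_of_ball fun z hz => by rw [h0 z hz, zero_mul])
  · exact ((InnerProductSpace.toDual ℝ E3).continuous.comp (by fun_prop)).aestronglyMeasurable
  · refine Filter.Eventually.of_forall fun z y _ => ?_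
    rw [LinearIsometryEquiv.norm_map, norm_smul, norm_smul, Real.norm_eq_abs (1 + τ)]
    exact mul_le_mul_of_nonneg_left (mul_le_mul_of_nonneg_left (hCb _) (abs_nonneg _)) (norm_nonneg _)
  · exact hkI.norm.mul_const _
  · refine Filter.Eventually.of_forall fun z y _ => ?_
    have := (hu.dlg τ z y).cmul (k z)
    rwa [hasGradientAt_iff_hasFDerivAt] at this

theorem Geo.avg (G : Geo Ω z0 r0 d) (hc : 0 < c) (r : ℕ) : ∃ C, 0 < C ∧ ∀ {T : Finset (Fin 4 → E3)} {h : ℝ} {u : E3 → ℝ},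
    Msh Ω T h c r → 4 * h ≤ r0 → CU Ω u → ∃ χ, FE Ω T r χ ∧ ∀ᵐ x, x ∈ Ω → ‖gradient u x - gradient χ x‖ ^ 2 ≤
      C * ∫ z in ball z0 (2 * r0), ‖gradient u x - (1 + 4 * h / r0) • gradient u ((1 + 4 * h / r0) • x - (4 * h / r0) • z)‖ ^ 2 := by
  have hr := G.r0p
  have hD := G.D
  have hCI := CI_nonneg (r := r) hc
  have hv := vb_pos
  set b : E3 → ℝ := fun z => max 0 (r0 - ‖z - z0‖) with hb
  have hbc : Continuous b := by fun_prop
  have hb0 : ∀ z, z ∉ ball z0 r0 → b z = 0 := fun z hz => by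
    rw [mem_ball, dist_eq_norm, not_lt] at hz
    exact max_eq_left (by linarith)
  have hbn : ∀ z, 0 ≤ b z := fun z => le_max_left _ _
  have hbL : ∀ z, b z ≤ r0 := fun z => max_le hr.le (by linarith [norm_nonneg (z - z0)])
  have hbl : ∀ y z, |b y - b z| ≤ ‖y - z‖ := fun y z => by
    refine (abs_max_sub_max_le_max 0 _ 0 _).trans (max_le (by simp) ?_)
    rw [sub_sub_sub_cancel_left, norm_sub_rev y z]
    refine (abs_norm_sub_norm_le _ _).trans (le_of_eq (by congr 1; abel))
  have hbi : Integrable b := hbc.integrable_of_hasCompactSupport (hcs_of_ball hb0)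
  set k0 := ∫ z, b z with hk0
  have hk0p : 0 < k0 := by
    refine (hbc.integral_pos_of_hasCompactSupport_nonneg_nonzero (hcs_of_ball hb0) hbn (x := z0) ?_)
    simp [hb, hr.ne', hr.le]
  set k : E3 → ℝ := fun z => k0⁻¹ * b z with hk
  have hkc : Continuous k := by fun_prop
  have hk1 : ∫ z, k z = 1 := by rw [hk, integral_const_mul, ← hk0, inv_mul_cancel₀ hk0p.ne']
  have hkz : ∀ z, z ∉ ball z0 r0 → k z = 0 := fun z hz => by simp [hk, hb0 z hz]
  have hkl : ∀ y z, |k y - k z| ≤ k0⁻¹ * ‖y - z‖ := fun y z => by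
    simp only [hk]
    rw [← mul_sub, abs_mul, abs_of_pos (by positivity)]
    exact mul_le_mul_of_nonneg_left (hbl y z) (by positivity)
  have hkI : Integrable k := hbi.const_mul _
  set A := k0⁻¹ * r0 * (CI r c + 2) with hA
  have hA0 : 0 < A := by positivity
  refine ⟨A ^ 2 * ((2 * r0) ^ 3 * vb), by positivity, fun {T h u} M hs hu => ?_⟩
  have hh := M.h0
  set τ := 4 * h / r0 with hτ
  have hτ0 : 0 < τ := by positivity
  have hτ1 : τ ≤ 1 := by rw [hτ, div_le_one hr]; exact hs
  have hτh : h = τ * r0 / 4 := by rw [hτ]; field_simp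
  have hgr := Vt_grad hD hu hkc hkz τ
  have hgc := hu.gc
  have hfr : ∀ x ∈ frontier Ω, Vt u k τ x = 0 := fun x hx => by
    unfold Vt
    rw [integral_congr_ae (g := fun _ => 0) (Filter.Eventually.of_forall fun z => ?_), integral_zero]
    by_cases hz : z ∈ ball z0 r0
    · have hzΩ : z ∈ Ω := G.inb (ball_subset_ball (by linarith) hz)
      have : u ((1 + τ) • x - τ • z) = 0 := (hu.lo hD).2 _ fun h => hD.frontier_not hx (by
        rw [← Ti_T hτ0.le z x]; exact Ti_mem hD hτ0.le hzΩ h)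
      simp [this]
    · simp [hkz z hz]
  refine ⟨Iop T r (Vt u k τ), M.Iop_FE hfr, ?_⟩
  filter_upwards [M.ae_int, (M.Iop_LO hfr).ae] with x hxi hχd hxΩ
  obtain ⟨v, hv, hxv⟩ := hxi hxΩ
  have hxv' := interior_subset hxv
  set De : E3 → E3 := fun z => (1 + τ) • gradient u ((1 + τ) • x - τ • z) with hDe
  have hDc : Continuous De := by fun_prop
  set J := ∫ z in ball z0 (2 * r0), ‖gradient u x - De z‖ with hJ
  have hJ0 : 0 ≤ J := integral_nonneg fun _ => norm_nonneg _
  have h1 : ‖gradient u x - ∫ z, k z • De z‖ ≤ k0⁻¹ * r0 * J := by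
    rw [norm_sub_rev]
    have := wt_est (z0 := z0) (s := 2 * r0) (L := k0⁻¹ * r0) hkc (fun z hz => hkz z fun h => hz (ball_subset_ball (by linarith) h))
      (fun z => by
        rw [abs_of_nonneg (mul_nonneg (by positivity) (hbn z))]
        exact mul_le_mul_of_nonneg_left (hbL z) (by positivity)) hDc (gradient u x)
    rwa [hk1, one_smul] at this
  have hsh : ∀ y : E3, ∫ z, k z • ((1 + τ) • gradient u ((1 + τ) • y - τ • z)) =
      ∫ z, k (z + ((1 + τ) / τ) • (y - x)) • De z := fun y => by
    rw [← integral_add_right_eq_self (fun z => k z • ((1 + τ) • gradient u ((1 + τ) • y - τ • z))) (((1 + τ) / τ) • (y - x))]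
    congr 1; ext1 z
    have : (1 + τ) • y - τ • (z + ((1 + τ) / τ) • (y - x)) = (1 + τ) • x - τ • z := by
      rw [smul_add, smul_smul, mul_div_cancel₀ _ hτ0.ne']; module
    rw [this]
  have hbd : ∀ y ∈ tet v, ‖((1 + τ) / τ) • (y - x)‖ ≤ r0 / 2 := fun y hy => by
    rw [norm_smul, Real.norm_of_nonneg (by positivity)]
    calc (1 + τ) / τ * ‖y - x‖ ≤ (1 + τ) / τ * (τ * r0 / 4) :=
          mul_le_mul_of_nonneg_left (hτh ▸ M.dist_le hv hy hxv') (by positivity)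
      _ = (1 + τ) * (r0 / 4) := by field_simp
      _ ≤ 2 * (r0 / 4) := mul_le_mul_of_nonneg_right (by linarith) (by positivity)
      _ = r0 / 2 := by ring
  have hzz : ∀ y ∈ tet v, ∀ z, z ∉ ball z0 (2 * r0) → k (z + ((1 + τ) / τ) • (y - x)) = 0 := fun y hy z hz => by
    refine hkz _ fun h => hz ?_
    rw [mem_ball, dist_eq_norm] at h ⊢
    have h2 := norm_sub_le (z + ((1 + τ) / τ) • (y - x) - z0) (((1 + τ) / τ) • (y - x))
    rw [show z + ((1 + τ) / τ) • (y - x) - z0 - ((1 + τ) / τ) • (y - x) = z - z0 by abel] at h2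
    linarith [hbd y hy]
  have h2 := Iop_c11 M hv (B := k0⁻¹ * ((1 + τ) / τ) * J) (by positivity) (fun y _ => hgr y) (fun y hy y' hy' => by
    rw [hsh, hsh, ← integral_sub]
    · have := wt_est (z0 := z0) (s := 2 * r0) (k := fun z => k (z + ((1 + τ) / τ) • (y - x)) - k (z + ((1 + τ) / τ) • (y' - x)))
        (L := k0⁻¹ * ((1 + τ) / τ) * ‖y - y'‖) (by fun_prop)
        (fun z hz => by rw [hzz y hy z hz, hzz y' hy' z hz, sub_zero]) (fun z => by
          refine (hkl _ _).trans (le_of_eq ?_)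
          rw [mul_assoc, add_sub_add_left_eq_sub, ← smul_sub, sub_sub_sub_cancel_right, norm_smul, Real.norm_of_nonneg (by positivity)])
        hDc (gradient u x)
      rw [integral_sub (hkI.comp_add_right _) (hkI.comp_add_right _), integral_add_right_eq_self k, integral_add_right_eq_self k,
        sub_self, zero_smul, sub_zero] at this
      simp only [sub_smul] at this
      refine this.trans (le_of_eq (by ring))
    · exact (Continuous.integrable_of_hasCompactSupport (by fun_prop)
        (hcs_of_ball fun z hz => by rw [hzz y hy z hz, zero_smul]))
    · exact (Continuous.integrable_of_hasCompactSupport (by fun_prop)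
        (hcs_of_ball fun z hz => by rw [hzz y' hy' z hz, zero_smul]))) hxv
  rw [((hgr x).sub' hχd.hasGradientAt).gradient] at h2
  have h3 : (CI r c + 1) * (k0⁻¹ * ((1 + τ) / τ) * J) * h ≤ k0⁻¹ * r0 * (CI r c + 1) * J := by
    rw [hτh, show (CI r c + 1) * (k0⁻¹ * ((1 + τ) / τ) * J) * (τ * r0 / 4) = (k0⁻¹ * r0 * (CI r c + 1) * J) * ((1 + τ) / 4) by
      field_simp]
    exact mul_le_of_le_one_right (by positivity) (by linarith)
  have h4 : ‖gradient u x - gradient (Iop T r (Vt u k τ)) x‖ ≤ A * J := by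
    have := norm_add_le (gradient u x - ∫ z, k z • De z) ((∫ z, k z • De z) - gradient (Iop T r (Vt u k τ)) x)
    rw [sub_add_sub_cancel] at this
    have e : A * J = k0⁻¹ * r0 * J + k0⁻¹ * r0 * (CI r c + 1) * J := by rw [hA]; ring
    linarith
  have h5 := ball_cs (s := 2 * r0) (by positivity) z0 (F := fun z => ‖gradient u x - De z‖) (by fun_prop)
  have hV : 0 < (2 * r0) ^ 3 * vb := by positivity
  set V := (2 * r0) ^ 3 * vb
  rw [mul_pow, inv_pow, ← div_eq_inv_mul, ← div_eq_inv_mul, div_le_div_iff₀ (by positivity) hV] at h5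
  have h6 : J ^ 2 ≤ V * ∫ z in ball z0 (2 * r0), ‖gradient u x - De z‖ ^ 2 := by
    refine le_of_mul_le_mul_right (h5.trans (le_of_eq ?_)) hV; ring
  calc _ ≤ (A * J) ^ 2 := pow_le_pow_left₀ (norm_nonneg _) h4 2
    _ = A ^ 2 * J ^ 2 := by ring
    _ ≤ A ^ 2 * (V * ∫ z in ball z0 (2 * r0), ‖gradient u x - De z‖ ^ 2) := mul_le_mul_of_nonneg_left h6 (by positivity)
    _ = _ := by ring
end avg

section blm
variable {Ω : Set E3} {T : Finset (Fin 4 → E3)} {h c : ℝ} {r : ℕ} {z0 : E3} {r0 d : ℝ} {u φ : E3 → ℝ}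

theorem Geo.Z (G : Geo Ω z0 r0 d) (hc : 0 < c) (r : ℕ) : ∃ C, 0 < C ∧ ∀ {T : Finset (Fin 4 → E3)} {h : ℝ} {u φ : E3 → ℝ}
    {p n : E3} {κ R Q N B ε : ℝ}, Msh Ω T h c r → 4 * h ≤ r0 → h ≤ κ → LD Ω u φ p n κ R Q N B ε → 0 ≤ N → ∃ χ, FE Ω T r χ ∧
      ∫ x in Ω, ‖x - p‖ ^ (5/2 : ℝ) * ‖gradient u x - gradient χ x‖ ^ 2 ≤ C * (h * Q * N + ε * R ^ 3 * B) := by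
  obtain ⟨C, hC, HC⟩ := G.avg hc r
  have hr := G.r0p
  have hdp := G.dpos
  have hv := vb_pos
  set q := 4 * d / r0 with hq
  have hq0 : 0 < q := by positivity
  set Kq := q * (3 + 3 * q + q ^ 2) + 5 / 2 + 7 / 2 * (q ^ 2 * (1 + q) ^ 2) with hKq
  have hKq0 : 0 < Kq := by positivity
  refine ⟨C * ((2 * r0) ^ 3 * vb) * (170 * Kq + 156 * Kq * r0 + 12), by positivity, fun {T h u φ p n κ R Q N B ε} M hs hκ H hN => ?_⟩
  have hh := M.h0
  have hD := H.D
  have hu := H.cu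
  have hgc := hu.gc
  obtain ⟨χ, hχ, hae⟩ := HC M hs hu
  refine ⟨χ, hχ, ?_⟩
  set τ := 4 * h / r0 with hτ
  have hτ0 : 0 < τ := by positivity
  set F : E3 → E3 → ℝ := fun x z => ‖x - p‖ ^ (5/2 : ℝ) * ‖gradient u x - (1 + τ) • gradient u ((1 + τ) • x - τ • z)‖ ^ 2 with hF
  have hFc : Continuous (Function.uncurry F) := by
    have h1 : Continuous fun x : E3 × E3 => ‖x.1 - p‖ ^ (5/2 : ℝ) := (by fun_prop : Continuous fun x : E3 × E3 => ‖x.1 - p‖).rpow_const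
      fun _ => Or.inr (by norm_num)
    exact h1.mul (by fun_prop)
  have hFi : Integrable (Function.uncurry F) ((volume.restrict Ω).prod (volume.restrict (ball z0 (2 * r0)))) := by
    rw [Measure.prod_restrict]
    exact (hFc.continuousOn.integrableOn_compact (hD.bd.isCompact_closure.prod (isCompact_closedBall z0 (2 * r0)))).mono_set
      (prod_mono subset_closure ball_subset_closedBall)
  have hlo := hu.lo hD
  have hχl := hχ.LO M
  have b1 := (H.hp.bm hD (5/2)).mul (hlo.gbm.sub hχl.gbm).nsq
  have h1 : ∫ x in Ω, ‖x - p‖ ^ (5/2 : ℝ) * ‖gradient u x - gradient χ x‖ ^ 2 ≤ ∫ x in Ω, C * ∫ z in ball z0 (2 * r0), F x z := by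
    refine setIntegral_mono_ae_restrict (b1.integrableOn hD) (hFi.integral_prod_left.const_mul C) ((ae_restrict_iff' hD.meas).2 ?_)
    filter_upwards [hae] with x hx hxΩ
    have := mul_le_mul_of_nonneg_left (hx hxΩ) (by positivity : 0 ≤ ‖x - p‖ ^ (5/2 : ℝ))
    simp only [hF]
    rw [integral_const_mul]
    linarith
  rw [integral_const_mul, integral_integral_swap hFi] at h1
  set E := h * Q * N + ε * R ^ 3 * B with hE
  have hQN : 0 ≤ h * Q * N := by have := H.Q0; positivity
  have hR := H.R1
  have he : 0 ≤ ε * R ^ 3 * B := by have := H.e0; have := H.B0; positivity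
  have hF1 := H.F1
  have h2 : ∀ z ∈ ball z0 (2 * r0), ∫ x in Ω, F x z ≤ (170 * Kq + 156 * Kq * r0 + 12) * E := fun z hz => by
    have hzΩ : z ∈ Ω := G.inb (ball_subset_ball (by linarith) hz)
    have h3 := H.F2 hh hκ hτ0.le hq0.le (d := d) (le_of_eq (by rw [hτ, hq]; ring)) hzΩ fun x hx => G.dia x hx z hzΩ
    rw [← hKq] at h3
    refine h3.trans ?_
    clear h3 HC hae hFi hFc b1 h1
    have h4 := mul_le_mul_of_nonneg_left hF1 (by positivity : 0 ≤ h * Kq)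
    have h5 : h * Kq * (156 * ε * R ^ 3 * B) ≤ 156 * Kq * r0 * (ε * R ^ 3 * B) := by
      have := mul_le_mul_of_nonneg_right (by linarith : h ≤ r0) (by positivity : 0 ≤ 156 * Kq * (ε * R ^ 3 * B))
      linarith
    have e2 : (170 * Kq + 156 * Kq * r0 + 12) * E = 170 * Kq * (h * Q * N) + (156 * Kq * r0 * (h * Q * N)) + 12 * (h * Q * N) +
      170 * Kq * (ε * R ^ 3 * B) + 156 * Kq * r0 * (ε * R ^ 3 * B) + 12 * (ε * R ^ 3 * B) := by rw [hE]; ring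
    have p1 : 0 ≤ 156 * Kq * r0 * (h * Q * N) := by positivity
    have p2 : 0 ≤ 170 * Kq * (ε * R ^ 3 * B) := by positivity
    linarith
  have h3 : ∫ z in ball z0 (2 * r0), ∫ x in Ω, F x z ≤ ∫ _ in ball z0 (2 * r0), (170 * Kq + 156 * Kq * r0 + 12) * E :=
    setIntegral_mono_on hFi.integral_prod_right (ci_ball continuous_const _ _) measurableSet_ball h2
  rw [setIntegral_const, Measure.real, vol_ball z0 (by positivity), smul_eq_mul] at h3
  have := mul_le_mul_of_nonneg_left h3 hC.le
  linarith

theorem Geo.BL (G : Geo Ω z0 r0 d) (hc : 0 < c) (r : ℕ) {m : ℝ} (hm : 1 ≤ m) : ∃ C, 0 < C ∧ ∀ {T : Finset (Fin 4 → E3)} {h : ℝ}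
    {g : E3 → E3} {w u φ : E3 → ℝ} {x0 : E3} {t N B ε : ℝ}, Msh Ω T h c r → Ritz Ω T r h g w → 4 * h ≤ r0 → h ≤ t → t ≤ m * d →
    x0 ∈ closure Ω → infDist x0 (frontier Ω) ≤ m * t → CU Ω u → BM Ω φ → (∀ x ∈ Ω, φ x ≠ 0 → ‖x - x0‖ ≤ t) →
    ∫ x in Ω, φ x ^ 2 ≤ N → WS Ω u φ ε → 0 ≤ ε → 0 ≤ B → ∫ x in Ω, ‖gradient u x‖ ^ 2 ≤ B ^ 2 →
    (∫ x in Ω, ⟪gradient u x, g x - gradient w x⟫) ^ 2 ≤ C * (h ^ 2 * t ^ 3 * N + ε * B) := by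
  obtain ⟨K1, hK1, HK⟩ := G.wbs hc r
  obtain ⟨C1, hC1, H1⟩ := HK m hm
  obtain ⟨C2, hC2, H2⟩ := G.Z hc r
  have hdp := G.dpos
  set K := 1 + m + K1 with hK
  have hK0 : 0 < K := by positivity
  set R := 1 + d + K1 * (m * d) with hR
  have hR1 : 1 ≤ R := by have : 0 ≤ K1 * (m * d) := by positivity
                         linarith
  refine ⟨4 * C1 * C2 * (K ^ (7/2 : ℝ) + R ^ 3 * √(m * d)), by positivity,
    fun {T h g w u φ x0 t N B ε} M W hs hht htd hx0 hxf hu hφ hsupp hN hws he hB hgB => ?_⟩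
  have hh := M.h0
  have hD := G.D
  have ht := hh.trans_le hht
  obtain ⟨y0, hy0, hyd⟩ := isClosed_frontier.exists_infDist_eq_dist G.fne x0
  rw [hyd, dist_eq_norm] at hxf
  obtain ⟨n, hn, hP⟩ := G.poleAt hy0
  have hp := hP (K1 * t) (by positivity)
  set p := y0 - (K1 * t) • n with hpd
  have hyp : ‖y0 - p‖ = K1 * t := by
    rw [hpd, sub_sub_cancel, norm_smul, hn, mul_one, Real.norm_of_nonneg (by positivity)]
  have hyc : y0 ∈ closure Ω := frontier_subset_closure hy0
  obtain ⟨w1, w2⟩ := H1 M W hs hht htd hp hyc hyp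
  have hN0 : 0 ≤ N := le_trans (integral_nonneg fun _ => by positivity) hN
  have H : LD Ω u φ p n (K1 * t) R (K ^ (7/2 : ℝ) * t ^ (7/2 : ℝ)) N B ε := by
    refine ⟨hD, hp, hu, hφ, hws, hR1, fun x hx => ?_, by positivity, fun x hx hφx => ?_, hN, hB, he, hgB⟩
    · have h1 := norm_sub_le_norm_sub_add_norm_sub x y0 p
      have h2 := G.clos (subset_closure hx) hyc
      have h3 : K1 * t ≤ K1 * (m * d) := mul_le_mul_of_nonneg_left htd (by positivity)
      linarith
    · rw [← Real.mul_rpow hK0.le ht.le]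
      refine Real.rpow_le_rpow (norm_nonneg _) ?_ (by norm_num)
      have h1 := norm_sub_le_norm_sub_add_norm_sub x y0 p
      have h2 := norm_sub_le_norm_sub_add_norm_sub x x0 y0
      have h3 := hsupp x hx hφx
      rw [hK]; linarith
  obtain ⟨χ, hχ, hZ⟩ := H2 M hs (hht.trans (le_mul_of_one_le_left ht.le hK1)) H hN0
  have hlo := hu.lo hD
  have hχl := hχ.LO M
  have hwl := W.fe.LO M
  have bR := W.bm.sub hwl.gbm
  have o1 : ∫ x in Ω, ⟪gradient χ x, g x - gradient w x⟫ = 0 := by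
    have := W.orth χ hχ
    simp only [inner_sub_right]
    rw [integral_sub ((hχl.gbm.inner W.bm).integrableOn hD) ((hχl.gbm.inner hwl.gbm).integrableOn hD)]
    simp only [real_inner_comm (gradient χ _)] at this ⊢
    rw [sub_eq_zero]
    simp only [real_inner_comm] at this ⊢
    linarith
  have o2 : ∫ x in Ω, ⟪gradient u x, g x - gradient w x⟫ = ∫ x in Ω, ⟪gradient u x - gradient χ x, g x - gradient w x⟫ := by
    simp only [inner_sub_left]
    rw [integral_sub ((hlo.gbm.inner bR).integrableOn hD) ((hχl.gbm.inner bR).integrableOn hD), o1, sub_zero]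
  have bU := hlo.gbm.sub hχl.gbm
  have bF := (hp.bm hD (5/4)).mul bU.norm
  have bG := (hp.bm hD (-(5/4))).mul bR.norm
  have o3 : |∫ x in Ω, ⟪gradient u x - gradient χ x, g x - gradient w x⟫| ≤
      ∫ x in Ω, (‖x - p‖ ^ (5/4 : ℝ) * ‖gradient u x - gradient χ x‖) * (‖x - p‖ ^ (-(5/4) : ℝ) * ‖g x - gradient w x‖) := by
    rw [← Real.norm_eq_abs]
    refine norm_integral_le_of_norm_le ((bF.mul bG).integrableOn hD) ((ae_restrict_iff' hD.meas).2 (Filter.Eventually.of_forall fun x hx => ?_))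
    have h1 : ‖x - p‖ ^ (5/4 : ℝ) * ‖x - p‖ ^ (-(5/4) : ℝ) = 1 := by
      rw [← Real.rpow_add (hp.rpos hx)]; norm_num
    calc _ ≤ ‖gradient u x - gradient χ x‖ * ‖g x - gradient w x‖ := norm_inner_le_norm _ _
      _ = (‖x - p‖ ^ (5/4 : ℝ) * ‖x - p‖ ^ (-(5/4) : ℝ)) * (‖gradient u x - gradient χ x‖ * ‖g x - gradient w x‖) := by rw [h1, one_mul]
      _ = _ := by ring
  have o4 := bF.cs hD bG
  have e1 : ∫ x in Ω, (‖x - p‖ ^ (5/4 : ℝ) * ‖gradient u x - gradient χ x‖) ^ 2 =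
      ∫ x in Ω, ‖x - p‖ ^ (5/2 : ℝ) * ‖gradient u x - gradient χ x‖ ^ 2 := by
    refine setIntegral_congr_fun hD.meas fun x hx => ?_
    rw [mul_pow, ← Real.rpow_mul_natCast (norm_nonneg _)]; norm_num
  have e2 : ∫ x in Ω, (‖x - p‖ ^ (-(5/4) : ℝ) * ‖g x - gradient w x‖) ^ 2 ≤ 4 * (C1 * h * t ^ (-(1/2) : ℝ)) := by
    calc _ ≤ ∫ x in Ω, (2 * (‖x - p‖ ^ (-(5/2) : ℝ) * ‖g x‖ ^ 2) + 2 * (‖x - p‖ ^ (-(5/2) : ℝ) * ‖gradient w x‖ ^ 2)) := by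
          refine ae_le_set hD bG.sq ((((hp.bm hD _).mul W.bm.nsq).cmul 2).add (((hp.bm hD _).mul hwl.gbm.nsq).cmul 2))
            (Filter.Eventually.of_forall fun x hx => ?_)
          rw [mul_pow, ← Real.rpow_mul_natCast (norm_nonneg _), show (-(5/4) : ℝ) * (2 : ℕ) = -(5/2) by norm_num]
          have h1 : ‖g x - gradient w x‖ ^ 2 ≤ 2 * ‖g x‖ ^ 2 + 2 * ‖gradient w x‖ ^ 2 := by
            have := pow_le_pow_left₀ (norm_nonneg _) (norm_sub_le (g x) (gradient w x)) 2
            nlinarith [sq_nonneg (‖g x‖ - ‖gradient w x‖)]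
          have := mul_le_mul_of_nonneg_left h1 (by positivity : 0 ≤ ‖x - p‖ ^ (-(5/2) : ℝ))
          linarith
      _ ≤ _ := by
          rw [integral_add ((((hp.bm hD _).mul W.bm.nsq).cmul 2).integrableOn hD) ((((hp.bm hD _).mul hwl.gbm.nsq).cmul 2).integrableOn hD),
            integral_const_mul, integral_const_mul]
          linarith
  rw [e1] at o4
  have q1 : t ^ (7/2 : ℝ) * t ^ (-(1/2) : ℝ) = t ^ 3 := by
    rw [← Real.rpow_add ht, ← Real.rpow_natCast]; norm_num
  have q2 : h * t ^ (-(1/2) : ℝ) ≤ √(m * d) := by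
    calc h * t ^ (-(1/2) : ℝ) ≤ t * t ^ (-(1/2) : ℝ) := mul_le_mul_of_nonneg_right hht (by positivity)
      _ = √t := by rw [Real.sqrt_eq_rpow, ← Real.rpow_one_add' ht.le (by norm_num)]; norm_num
      _ ≤ _ := Real.sqrt_le_sqrt htd
  rw [o2, ← sq_abs]
  have hZ0 : 0 ≤ C2 * (h * (K ^ (7/2 : ℝ) * t ^ (7/2 : ℝ)) * N + ε * R ^ 3 * B) := by positivity
  calc _ ≤ _ := pow_le_pow_left₀ (abs_nonneg _) o3 2
    _ ≤ _ := o4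
    _ ≤ C2 * (h * (K ^ (7/2 : ℝ) * t ^ (7/2 : ℝ)) * N + ε * R ^ 3 * B) * (4 * (C1 * h * t ^ (-(1/2) : ℝ))) :=
        mul_le_mul hZ e2 (integral_nonneg fun _ => by positivity) hZ0
    _ = 4 * C1 * C2 * (K ^ (7/2 : ℝ) * (h ^ 2 * (t ^ (7/2 : ℝ) * t ^ (-(1/2) : ℝ)) * N) + R ^ 3 * (ε * B) * (h * t ^ (-(1/2) : ℝ))) := by ring
    _ ≤ 4 * C1 * C2 * (K ^ (7/2 : ℝ) * (h ^ 2 * t ^ 3 * N) + R ^ 3 * (ε * B) * √(m * d)) := by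
        rw [q1]
        have := mul_le_mul_of_nonneg_left q2 (by positivity : 0 ≤ R ^ 3 * (ε * B))
        exact mul_le_mul_of_nonneg_left (by linarith) (by positivity)
    _ ≤ _ := by
        have p1 : 0 ≤ K ^ (7/2 : ℝ) * (ε * B) := by positivity
        have p2 : 0 ≤ R ^ 3 * √(m * d) * (h ^ 2 * t ^ 3 * N) := by positivity
        rw [mul_assoc (4 * C1 * C2) (_ + _)]
        exact mul_le_mul_of_nonneg_left (by linarith) (by positivity)
end blm

/-- Truncation derivative and truncation. -/
def eta (δ t : ℝ) : ℝ := min 1 (max 0 (|t| / δ - 1))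
def Fd (δ s : ℝ) : ℝ := ∫ t in (0:ℝ)..s, eta δ t

section trunc
variable {Ω : Set E3} {f : E3 → ℝ} {δ : ℝ}

theorem eta_cont (δ : ℝ) : Continuous (eta δ) := by unfold eta; fun_prop
theorem eta_nn (δ t : ℝ) : 0 ≤ eta δ t := le_min zero_le_one (le_max_left _ _)
theorem eta_le (δ t : ℝ) : eta δ t ≤ 1 := min_le_left _ _

theorem Fd_deriv (δ s : ℝ) : HasDerivAt (Fd δ) (eta δ s) s := (eta_cont δ).integral_hasStrictDerivAt 0 s |>.hasDerivAt

theorem Fd_zero (hδ : 0 < δ) {s : ℝ} (hs : |s| ≤ δ) : Fd δ s = 0 := by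
  unfold Fd
  rw [intervalIntegral.integral_congr (g := fun _ => 0) fun t ht => ?_]
  · simp
  · have h1 : |t| ≤ |s| := by
      rcases le_total 0 s with h | h
      · rw [uIcc_of_le h] at ht; rw [abs_of_nonneg h, abs_of_nonneg ht.1]; exact ht.2
      · rw [uIcc_of_ge h] at ht; rw [abs_of_nonpos h, abs_of_nonpos ht.2]; linarith [ht.1]
    have h2 : |t| / δ ≤ 1 := (div_le_one hδ).2 (h1.trans hs)
    simp only [eta]
    rw [max_eq_left (by linarith), min_eq_right zero_le_one]

theorem Fd_cd (δ : ℝ) : ContDiff ℝ 1 (Fd δ) := by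
  rw [contDiff_one_iff_deriv]
  refine ⟨fun s => (Fd_deriv δ s).differentiableAt, ?_⟩
  rw [show deriv (Fd δ) = eta δ from funext fun s => (Fd_deriv δ s).deriv]
  exact eta_cont δ

theorem Fd_lip (δ : ℝ) : LipschitzWith 1 (Fd δ) := by
  refine lipschitzWith_of_nnnorm_deriv_le (fun s => (Fd_deriv δ s).differentiableAt) fun s => ?_
  rw [(Fd_deriv δ s).deriv, ← NNReal.coe_le_coe, coe_nnnorm, Real.norm_of_nonneg (eta_nn δ s)]
  exact eta_le δ s

theorem Fd_ts (hδ : 0 < δ) (hf : Continuous f) (h0 : ∀ x, x ∉ Ω → f x = 0) : tsupport (fun x => Fd δ (f x)) ⊆ Ω := by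
  have hcl : IsClosed {x | δ ≤ |f x|} := isClosed_le continuous_const (by fun_prop)
  refine (closure_minimal (fun x hx => ?_) hcl).trans fun x hx => ?_
  · by_contra h
    exact hx (Fd_zero hδ (le_of_lt (not_le.1 h)))
  · by_contra h
    rw [mem_ofPred_eq, h0 x h, abs_zero] at hx
    linarith

theorem null_line (hf : Measurable f) (e : E3) :
    ∀ᵐ x, ¬ (DifferentiableAt ℝ f x ∧ f x = 0 ∧ ⟪gradient f x, e⟫ ≠ 0) := by
  have hm : MeasurableSet {x | ¬ (DifferentiableAt ℝ f x ∧ f x = 0 ∧ ⟪gradient f x, e⟫ ≠ 0)} := by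
    refine ((measurableSet_of_differentiableAt ℝ f).inter ((hf (measurableSet_singleton 0)).inter ?_)).compl
    exact (((measurable_gradient f).inner measurable_const) (measurableSet_singleton (0:ℝ))).compl
  refine ae_mem_of_ae_add_linearMap_mem (LinearMap.toSpanSingleton ℝ E3 e) volume volume hm fun y => ?_
  set S := {s : ℝ | DifferentiableAt ℝ f (y + s • e) ∧ f (y + s • e) = 0 ∧ ⟪gradient f (y + s • e), e⟫ ≠ 0} with hS
  have hSc : S.Countable := by
    have hd : DiscreteTopology S := by
      rw [discreteTopology_subtype_iff]
      rintro s ⟨h1, h2, h3⟩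
      have h4 : HasDerivAt (fun s : ℝ => f (y + s • e)) ⟪gradient f (y + s • e), e⟫ s := by
        have h5 := hasGradientAt_iff_hasFDerivAt.1 h1.hasGradientAt
        have h6 : HasDerivAt (fun s : ℝ => y + s • e) e s := by
          simpa using ((hasDerivAt_id s).smul_const e).const_add y
        exact (h5.comp_hasDerivAt s h6).congr_deriv (by simp)
      have h5 := h4.eventually_ne h3 (c := 0)
      refine disjoint_iff.1 (Filter.disjoint_principal_right.2 ?_)
      filter_upwards [h5] with t ht hts
      exact ht hts.2.1
    exact countable_coe_iff.1 (countable_of_Lindelof_of_discrete (X := S))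
  have := hSc.ae_notMem (volume : Measure ℝ)
  filter_upwards [this] with s hs
  exact hs

theorem null_grad (hf : Measurable f) : ∀ᵐ x, DifferentiableAt ℝ f x → f x = 0 → gradient f x = 0 := by
  have := (Filter.eventually_all (ι := Fin 3)).2 fun i => null_line hf (EuclideanSpace.single i (1:ℝ))
  filter_upwards [this] with x hx h1 h2
  ext i
  by_contra h
  exact hx i ⟨h1, h2, by rwa [inner_single]⟩

theorem trunc_grad {x : E3} (hx : DifferentiableAt ℝ f x) : gradient (fun x => Fd δ (f x)) x = eta δ (f x) • gradient f x :=
  (HasGradientAt.comp_real (Fd_deriv δ (f x)) hx.hasGradientAt).gradient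

theorem trunc_lim (hD : Dom Ω) (hf : Measurable f) (hd : ∀ᵐ x, x ∈ Ω → DifferentiableAt ℝ f x)
    (hi : IntegrableOn (fun x => ‖gradient f x‖ ^ 2) Ω) {ε : ℝ} (hε : 0 < ε) : ∃ δ, 0 < δ ∧
    ∫ x in Ω, ‖gradient (fun x => Fd δ (f x)) x - gradient f x‖ ^ 2 ≤ ε := by
  have hpt : ∀ᵐ x ∂(volume.restrict Ω), ∀ δ, ‖gradient (fun x => Fd δ (f x)) x - gradient f x‖ ^ 2 = (1 - eta δ (f x)) ^ 2 * ‖gradient f x‖ ^ 2 := by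
    rw [ae_restrict_iff' hD.meas]
    filter_upwards [hd] with x hx hxΩ δ
    rw [trunc_grad (hx hxΩ), show eta δ (f x) • gradient f x - gradient f x = (eta δ (f x) - 1) • gradient f x by module, norm_smul, mul_pow,
      Real.norm_eq_abs, sq_abs]
    ring
  have key := tendsto_integral_of_dominated_convergence (μ := volume.restrict Ω)
    (F := fun n : ℕ => fun x => ‖gradient (fun x => Fd (1 / ((n:ℝ) + 1)) (f x)) x - gradient f x‖ ^ 2) (f := fun _ => 0)
    (fun x => ‖gradient f x‖ ^ 2)
    (fun n => (((measurable_gradient _).sub (measurable_gradient f)).norm.pow_const 2).aestronglyMeasurable) hi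
    (fun n => by
      filter_upwards [hpt] with x hx
      rw [hx, Real.norm_of_nonneg (by positivity)]
      have := eta_nn (1 / ((n:ℝ) + 1)) (f x)
      have := eta_le (1 / ((n:ℝ) + 1)) (f x)
      exact mul_le_of_le_one_left (by positivity) (by nlinarith)) (by
      filter_upwards [hpt, ae_restrict_of_ae (s := Ω) (null_grad hf), (ae_restrict_iff' hD.meas).2 hd] with x hx hn hdx
      refine tendsto_const_nhds.congr' ?_
      by_cases h0 : f x = 0
      · refine Filter.Eventually.of_forall fun n => ?_
        beta_reduce
        rw [hx, hn hdx h0]; simp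
      · have h1 : ∀ᶠ n : ℕ in Filter.atTop, 1 / ((n:ℝ) + 1) < |f x| / 2 :=
          (tendsto_one_div_add_atTop_nhds_zero_nat (𝕜 := ℝ)).eventually_lt_const (by have := abs_pos.2 h0; positivity)
        filter_upwards [h1] with n hn
        beta_reduce
        rw [hx]
        have hp : (0:ℝ) < 1 / ((n:ℝ) + 1) := by positivity
        have h2 : 2 ≤ |f x| / (1 / ((n:ℝ) + 1)) := by rw [le_div_iff₀ hp]; linarith
        have : eta (1 / ((n:ℝ) + 1)) (f x) = 1 := min_eq_left (le_max_of_le_right (by linarith))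
        rw [this]; simp)
  rw [integral_zero] at key
  obtain ⟨n, hn⟩ := (key.eventually_le_const hε).exists
  exact ⟨_, by positivity, hn⟩

end trunc

/-- The continuous solution, extended by zero. -/
structure VS (Ω : Set E3) (v φ : E3 → ℝ) : Prop where
  ct : Continuous v
  z : ∀ x, x ∉ Ω → v x = 0
  cd : ContDiffOn ℝ 2 v Ω
  lp : ∀ x ∈ Ω, lap v x = -φ x
  gi : IntegrableOn (fun x => ‖gradient v x‖ ^ 2) Ω
  bm : BM Ω φ

section weak
variable {Ω : Set E3} {v φ ζ : E3 → ℝ}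

theorem l2_inner {A : Set E3} {F G : E3 → E3} (hF : Measurable F) (hG : Measurable G) (hFi : IntegrableOn (fun x => ‖F x‖ ^ 2) A)
    (hGi : IntegrableOn (fun x => ‖G x‖ ^ 2) A) : IntegrableOn (fun x => ⟪F x, G x⟫) A ∧ IntegrableOn (fun x => ‖F x‖ * ‖G x‖) A := by
  have hb : ∀ x, ‖F x‖ * ‖G x‖ ≤ ‖F x‖ ^ 2 + ‖G x‖ ^ 2 := fun x => by nlinarith [sq_nonneg (‖F x‖ - ‖G x‖), sq_nonneg ‖F x‖, sq_nonneg ‖G x‖]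
  refine ⟨Integrable.mono' (hFi.add hGi) (hF.inner hG).aestronglyMeasurable (Filter.Eventually.of_forall fun x => ?_),
    Integrable.mono' (hFi.add hGi) (hF.norm.mul hG.norm).aestronglyMeasurable (Filter.Eventually.of_forall fun x => ?_)⟩
  · exact (norm_inner_le_norm _ _).trans (hb x)
  · rw [Real.norm_of_nonneg (by positivity)]; exact hb x

theorem cs_vec {A : Set E3} {F G : E3 → E3} (hF : Measurable F) (hG : Measurable G) (hFi : IntegrableOn (fun x => ‖F x‖ ^ 2) A)
    (hGi : IntegrableOn (fun x => ‖G x‖ ^ 2) A) : (∫ x in A, ⟪F x, G x⟫) ^ 2 ≤ (∫ x in A, ‖F x‖ ^ 2) * ∫ x in A, ‖G x‖ ^ 2 := by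
  obtain ⟨_, h2⟩ := l2_inner hF hG hFi hGi
  refine le_trans ?_ (cs_int hFi hGi h2)
  rw [← sq_abs, ← Real.norm_eq_abs]
  refine pow_le_pow_left₀ (norm_nonneg _) (norm_integral_le_of_norm_le h2 (Filter.Eventually.of_forall fun x => norm_inner_le_norm _ _)) 2

theorem poinc (hD : Dom Ω) (hne : Ω.Nonempty) : ∃ P, 0 < P ∧ ∀ f, LO Ω f → ∫ x in Ω, f x ^ 2 ≤ P * ∫ x in Ω, ‖gradient f x‖ ^ 2 := by
  obtain ⟨p, n, κ, hp⟩ := hD.exists_pole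
  obtain ⟨R, hR, hRb⟩ := hD.bound p
  refine ⟨R ^ 2 * (4 / 9), by positivity, fun f hf => ?_⟩
  have h1 := hardy hD hp hf
  have h2 : ∫ x in Ω, f x ^ 2 ≤ ∫ x in Ω, R ^ 2 * (‖x - p‖ ^ (-2 : ℝ) * f x ^ 2) := by
    refine ae_le_set hD (hf.bm hD).sq (((hp.bm hD _).mul (hf.bm hD).sq).cmul _) (Filter.Eventually.of_forall fun x hx => ?_)
    have h3 := hp.rpos hx
    rw [show (-2 : ℝ) = -((2:ℕ):ℝ) by norm_num, Real.rpow_neg h3.le, Real.rpow_natCast, ← mul_assoc]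
    refine le_mul_of_one_le_left (by positivity) ?_
    rw [← div_eq_mul_inv, one_le_div (by positivity)]
    exact pow_le_pow_left₀ h3.le (hRb x hx) 2
  rw [integral_const_mul] at h2
  have := mul_le_mul_of_nonneg_left h1 (by positivity : 0 ≤ R ^ 2)
  linarith

theorem VS.da (hD : Dom Ω) (H : VS Ω v φ) {x : E3} (hx : x ∈ Ω) : DifferentiableAt ℝ v x :=
  (H.cd.contDiffAt (hD.op.mem_nhds hx)).differentiableAt two_ne_zero

open Manifold ContDiff in
theorem VS.weak0 (hD : Dom Ω) (H : VS Ω v φ) (hζ : LO Ω ζ) (hs : tsupport ζ ⊆ Ω) :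
    ∫ x in Ω, ⟪gradient v x, gradient ζ x⟫ = ∫ x in Ω, φ x * ζ x := by
  obtain ⟨θ, hθ0, hθ1, _⟩ := exists_contMDiffMap_zero_one_nhds_of_isClosed (n := ((2:ℕ):ℕ∞)) 𝓘(ℝ, E3) hD.op.isClosed_compl (isClosed_tsupport ζ)
    (by rw [disjoint_compl_left_iff_subset]; exact hs)
  have hθc : ContDiff ℝ 2 θ := by
    have := θ.contMDiff.contDiff
    exact_mod_cast this
  rw [eventually_nhdsSet_iff_forall] at hθ0 hθ1
  set ψ : E3 → ℝ := fun x => θ x * v x with hψ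
  have hψ0 : ∀ x, x ∉ Ω → ψ =ᶠ[nhds x] 0 := fun x hx => by
    filter_upwards [hθ0 x hx] with y hy
    simp [hψ, hy]
  have hψ1 : ∀ x ∈ tsupport ζ, ψ =ᶠ[nhds x] v := fun x hx => by
    filter_upwards [hθ1 x hx] with y hy
    simp [hψ, hy]
  have hψc : ContDiff ℝ 2 ψ := contDiff_iff_contDiffAt.2 fun x => by
    by_cases hx : x ∈ Ω
    · exact hθc.contDiffAt.mul (H.cd.contDiffAt (hD.op.mem_nhds hx))
    · exact contDiffAt_const.congr_of_eventuallyEq (hψ0 x hx)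
  have hψt : tsupport ψ ⊆ Ω := fun x hx => by
    by_contra h
    exact (notMem_tsupport_iff_eventuallyEq.2 (hψ0 x h)) hx
  set e : Fin 3 → E3 := fun i => EuclideanSpace.single i 1 with he
  set m : Fin 3 → E3 → ℝ := fun i y => fderiv ℝ ψ y (e i) with hm
  have hmC : ∀ i, CU Ω (m i) := fun i =>
    ⟨(hψc.fderiv_right (m := 1) (by norm_num)).clm_apply contDiff_const, (tsupport_fderiv_apply_subset ℝ (e i)).trans hψt⟩
  have key : ∀ i, ∫ x in Ω, (m i x * gradient ζ x i + ζ x * fderiv ℝ (m i) x (e i)) = 0 := fun i => by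
    have h1 := (hζ.mul hD ((hmC i).lo hD)).ibp hD (e i)
    rw [← h1]
    refine integral_congr_ae (ae_restrict_of_ae ?_)
    filter_upwards [hζ.ae] with x hx
    rw [(((hmC i).hg x).mul' hx.hasGradientAt).gradient, inner_add_left, real_inner_smul_left, real_inner_smul_left, he, inner_single]
    congr 2
    rw [gradient, InnerProductSpace.toDual_symm_apply]
  have hbi : ∀ i, BM Ω fun x => (m i x * gradient ζ x i + ζ x * fderiv ℝ (m i) x (e i)) := fun i => by
    have b1 := (hζ.gbm.inner (BM.const (e i)))
    have b2 := (((hmC i).lo hD).gbm.inner (BM.const (Ω := Ω) (e i)))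
    have := ((((hmC i).lo hD).bm hD).mul b1).add ((hζ.bm hD).mul b2)
    have hgi : ∀ x, ⟪gradient (m i) x, e i⟫ = fderiv ℝ (m i) x (e i) := fun x => by rw [gradient, InnerProductSpace.toDual_symm_apply]
    have hz : ∀ x, ⟪gradient ζ x, e i⟫ = gradient ζ x i := fun x => inner_single _ _
    simpa only [hgi, hz] using this
  have hsum : ∫ x in Ω, ∑ i, (m i x * gradient ζ x i + ζ x * fderiv ℝ (m i) x (e i)) = 0 := by
    rw [integral_finsetSum _ fun i _ => (hbi i).integrableOn hD]
    exact Finset.sum_eq_zero fun i _ => key i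
  have hpt : ∀ x ∈ Ω, ∑ i, (m i x * gradient ζ x i + ζ x * fderiv ℝ (m i) x (e i)) = ⟪gradient v x, gradient ζ x⟫ - φ x * ζ x := fun x hx => by
    by_cases hxs : x ∈ tsupport ζ
    · have h1 : gradient ψ x = gradient v x := (hψ1 x hxs).gradient_eq
      have h2 : ∀ i, fderiv ℝ (m i) x (e i) = fderiv ℝ (fun y => fderiv ℝ v y (e i)) x (e i) := fun i => by
        have : m i =ᶠ[nhds x] fun y => fderiv ℝ v y (e i) := by
          filter_upwards [(hψ1 x hxs).fderiv (𝕜 := ℝ)] with y hy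
          simp only [hm, hy]
        rw [this.fderiv_eq]
      have h3 := H.lp x hx
      rw [lap] at h3
      rw [Finset.sum_add_distrib, ← Finset.mul_sum, Finset.sum_congr rfl fun i _ => h2 i, h3, ← h1]
      have h4 : ∀ i, m i x = gradient ψ x i := fun i => by
        rw [← inner_single, gradient, InnerProductSpace.toDual_symm_apply]
      simp only [h4]
      rw [PiLp.inner_apply]
      simp only [RCLike.inner_apply, conj_trivial]
      rw [Finset.sum_congr rfl fun i _ => mul_comm _ _]
      ring
    · have h1 : gradient ζ x = 0 := by rw [gradient, fderiv_of_notMem_tsupport ℝ hxs, map_zero]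
      rw [h1, image_eq_zero_of_notMem_tsupport hxs]; simp
  rw [setIntegral_congr_fun hD.meas hpt, integral_sub
    (l2_inner (measurable_gradient v) (measurable_gradient ζ) H.gi (hζ.gbm.nsq.integrableOn hD)).1 ((H.bm.mul (hζ.bm hD)).integrableOn hD)] at hsum
  linarith

theorem VS.weak (hD : Dom Ω) (hne : Ω.Nonempty) (H : VS Ω v φ) (hζ : LO Ω ζ) :
    ∫ x in Ω, ⟪gradient v x, gradient ζ x⟫ = ∫ x in Ω, φ x * ζ x := by
  obtain ⟨P, hP, HP⟩ := poinc hD hne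
  set a := ∫ x in Ω, ‖gradient v x‖ ^ 2
  set b := ∫ x in Ω, φ x ^ 2
  have ha : 0 ≤ a := integral_nonneg fun _ => by positivity
  have hb : 0 ≤ b := integral_nonneg fun _ => by positivity
  set X := (∫ x in Ω, ⟪gradient v x, gradient ζ x⟫) - ∫ x in Ω, φ x * ζ x with hX
  have main : ∀ ε, 0 < ε → X ^ 2 ≤ 2 * (a + b * P) * ε := fun ε hε => by
    obtain ⟨δ, hδ, hlim⟩ := trunc_lim hD hζ.meas (by filter_upwards [hζ.ae] with x hx _ using hx) (hζ.gbm.nsq.integrableOn hD) hε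
    have hz : LO Ω (fun x => Fd δ (ζ x)) := by
      obtain ⟨⟨K, hK⟩, h0⟩ := hζ
      exact ⟨⟨_, (Fd_lip δ).comp hK⟩, fun x hx => by
        show Fd δ (ζ x) = 0
        rw [h0 x hx]; exact Fd_zero hδ (by simp [hδ.le])⟩
    have hw := H.weak0 hD hz (Fd_ts hδ hζ.cont hζ.2)
    have hsub := hz.sub hζ
    have hgs : ∀ᵐ x, gradient (fun x => Fd δ (ζ x) - ζ x) x = gradient (fun x => Fd δ (ζ x)) x - gradient ζ x := by
      filter_upwards [hz.ae, hζ.ae] with x h1 h2 using gradient_sub' h1 h2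
    have e1 : ∫ x in Ω, ‖gradient (fun x => Fd δ (ζ x) - ζ x) x‖ ^ 2 ≤ ε := by
      refine le_trans (le_of_eq (integral_congr_ae (ae_restrict_of_ae ?_))) hlim
      filter_upwards [hgs] with x hx
      rw [hx]
    have i1 := (l2_inner (measurable_gradient v) (measurable_gradient _) H.gi (hζ.gbm.nsq.integrableOn hD)).1
    have i2 := (l2_inner (measurable_gradient v) (measurable_gradient _) H.gi (hz.gbm.nsq.integrableOn hD)).1
    have e2 : X = (∫ x in Ω, φ x * (Fd δ (ζ x) - ζ x)) - ∫ x in Ω, ⟪gradient v x, gradient (fun x => Fd δ (ζ x) - ζ x) x⟫ := by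
      have h1 : ∫ x in Ω, ⟪gradient v x, gradient (fun x => Fd δ (ζ x) - ζ x) x⟫ =
          ∫ x in Ω, (⟪gradient v x, gradient (fun x => Fd δ (ζ x)) x⟫ - ⟪gradient v x, gradient ζ x⟫) := by
        refine integral_congr_ae (ae_restrict_of_ae ?_)
        filter_upwards [hgs] with x hx
        rw [hx, inner_sub_right]
      rw [h1, integral_sub i2 i1]
      simp only [mul_sub]
      rw [integral_sub ((H.bm.mul (hz.bm hD)).integrableOn hD) ((H.bm.mul (hζ.bm hD)).integrableOn hD), hw]
      ring
    have c1 := cs_vec (measurable_gradient v) (measurable_gradient _) H.gi (hsub.gbm.nsq.integrableOn hD)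
    have c2 := H.bm.cs hD (hsub.bm hD)
    have c3 := HP _ hsub
    have d1 := mul_le_mul_of_nonneg_left e1 ha
    have d2 := mul_le_mul_of_nonneg_left (c3.trans (mul_le_mul_of_nonneg_left e1 hP.le)) hb
    rw [e2]
    have h5 : ∀ p q : ℝ, (p - q) ^ 2 ≤ 2 * p ^ 2 + 2 * q ^ 2 := fun p q => by nlinarith [sq_nonneg (p + q)]
    refine (h5 _ _).trans ?_
    linarith
  by_contra hne'
  have hX0 : 0 < X ^ 2 := by
    have : X ≠ 0 := fun h => hne' (by linarith)
    positivity
  have h1 := main (X ^ 2 / (4 * (a + b * P + 1))) (by positivity)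
  have h2 : 2 * (a + b * P) * (X ^ 2 / (4 * (a + b * P + 1))) = X ^ 2 * ((a + b * P) / (2 * (a + b * P + 1))) := by
    have : 0 < a + b * P + 1 := by positivity
    field_simp; ring
  have h3 : (a + b * P) / (2 * (a + b * P + 1)) < 1 := by
    have : 0 ≤ b * P := by positivity
    rw [div_lt_one (by positivity)]; linarith
  have := mul_lt_mul_of_pos_left h3 hX0
  linarith

theorem VS.approx (hD : Dom Ω) (hne : Ω.Nonempty) (H : VS Ω v φ) {ε : ℝ} (hε : 0 < ε) : ∃ u, CU Ω u ∧ WS Ω u φ ε ∧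
    ∫ x in Ω, ‖gradient u x‖ ^ 2 ≤ ∫ x in Ω, ‖gradient v x‖ ^ 2 ∧ ∫ x in Ω, ‖gradient u x - gradient v x‖ ^ 2 ≤ ε ^ 2 := by
  obtain ⟨δ, hδ, hlim⟩ := trunc_lim hD H.ct.measurable (Filter.Eventually.of_forall fun x hx => H.da hD hx) H.gi (sq_pos_of_pos hε)
  have hts := Fd_ts (Ω := Ω) hδ H.ct H.z
  have hu : CU Ω (fun x => Fd δ (v x)) := by
    refine ⟨contDiff_iff_contDiffAt.2 fun x => ?_, hts⟩
    by_cases hx : x ∈ Ω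
    · exact (Fd_cd δ).contDiffAt.comp x ((H.cd.contDiffAt (hD.op.mem_nhds hx)).of_le (by norm_num))
    · exact contDiffAt_const.congr_of_eventuallyEq (notMem_tsupport_iff_eventuallyEq.1 fun h => hx (hts h))
  have hlo := hu.lo hD
  have hui := hlo.gbm.nsq.integrableOn hD
  have hgu := measurable_gradient (fun x => Fd δ (v x))
  have hgv := measurable_gradient v
  have hdi : IntegrableOn (fun x => ‖gradient (fun x => Fd δ (v x)) x - gradient v x‖ ^ 2) Ω := by
    refine Integrable.mono' ((hui.const_mul 2).add (H.gi.const_mul 2)) ((hgu.sub hgv).norm.pow_const 2).aestronglyMeasurable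
      (Filter.Eventually.of_forall fun x => ?_)
    rw [Real.norm_of_nonneg (by positivity)]
    have := pow_le_pow_left₀ (norm_nonneg _) (norm_sub_le (gradient (fun x => Fd δ (v x)) x) (gradient v x)) 2
    simp only [Pi.add_apply]
    nlinarith [sq_nonneg (‖gradient (fun x => Fd δ (v x)) x‖ - ‖gradient v x‖)]
  refine ⟨_, hu, fun ζ hζ => ?_, ?_, hlim⟩
  · have hζi := hζ.gbm.nsq.integrableOn hD
    rw [← H.weak hD hne hζ, ← integral_sub (l2_inner hgu (measurable_gradient _) hui hζi).1 (l2_inner hgv (measurable_gradient _) H.gi hζi).1]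
    simp only [← inner_sub_left]
    have h1 := cs_vec (hgu.sub hgv) (measurable_gradient ζ) hdi hζi
    refine abs_le_of_sq_le_sq (h1.trans ?_) (by positivity)
    rw [mul_pow, Real.sq_sqrt (integral_nonneg fun _ => by positivity)]
    exact mul_le_mul_of_nonneg_right hlim (integral_nonneg fun _ => by positivity)
  · refine setIntegral_mono_on hui H.gi hD.meas fun x hx => ?_
    rw [trunc_grad (H.da hD hx), norm_smul, mul_pow]
    refine mul_le_of_le_one_left (by positivity) ?_
    rw [Real.norm_of_nonneg (eta_nn _ _)]
    exact pow_le_one₀ (eta_nn _ _) (eta_le _ _)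

end weak

section inter
variable {Ω : Set E3} {T : Finset (Fin 4 → E3)} {h c : ℝ} {r : ℕ} {z0 x0 : E3} {r0 d ρ s S : ℝ} {u φ ζ : E3 → ℝ}

/-- The kernel gradient. -/
def Kg (s S : ℝ) (x : E3) : E3 := (3 * vb)⁻¹ • (Fk S x - Fk s x)

/-- Local potential of `φ`. -/
def Wp (s S : ℝ) (φ : E3 → ℝ) (x : E3) : ℝ := ∫ y, φ y * ((3 * vb)⁻¹ * kk s S (x - y))

theorem Kg_cont (hs : 0 < s) (hS : 0 < S) : Continuous (Kg s S) := by
  have h1 := Fk_cont hS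
  have h2 := Fk_cont hs
  unfold Kg
  fun_prop

theorem Kg_le (hs : 0 < s) (hS : 0 < S) : ∃ B, ∀ x, ‖Kg s S x‖ ≤ B := by
  refine ⟨‖(3 * vb)⁻¹‖ * ((S ^ 2)⁻¹ + (s ^ 2)⁻¹), fun x => ?_⟩
  rw [Kg, norm_smul]
  exact mul_le_mul_of_nonneg_left ((norm_sub_le _ _).trans (add_le_add (Fk_le hS x) (Fk_le hs x))) (norm_nonneg _)

theorem Wp_grad (hs : 0 < s) (hS : 0 < S) (hφ : Continuous φ) (hφs : HasCompactSupport φ) (x : E3) :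
    HasGradientAt (Wp s S φ) (∫ y, φ y • Kg s S (x - y)) x := by
  have hkc := Kg_cont hs hS
  obtain ⟨B, hB⟩ := Kg_le hs hS
  have hk : ∀ x, HasGradientAt (fun x => (3 * vb)⁻¹ * kk s S x) (Kg s S x) x := fun x => (kk_grad hs hS x).cmul _
  have hkk : Continuous fun x => (3 * vb)⁻¹ * kk s S x :=
    continuous_iff_continuousAt.2 fun x => (hk x).differentiableAt.continuousAt
  have hkk' : ∀ x, Continuous fun y => (3 * vb)⁻¹ * kk s S (x - y) := fun x => hkk.comp (by fun_prop : Continuous fun y => x - y)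
  rw [hasGradientAt_iff_hasFDerivAt]
  have e1 : (InnerProductSpace.toDual ℝ E3) (∫ y, φ y • Kg s S (x - y)) =
      ∫ y, (InnerProductSpace.toDual ℝ E3) (φ y • Kg s S (x - y)) :=
    ((InnerProductSpace.toDual ℝ E3).toContinuousLinearEquiv.toContinuousLinearMap.integral_comp_comm
      (Continuous.integrable_of_hasCompactSupport (by fun_prop) hφs.smul_right)).symm
  rw [e1]
  refine hasFDerivAt_integral_of_dominated_of_fderiv_le (F := fun x y => φ y * ((3 * vb)⁻¹ * kk s S (x - y)))
    (F' := fun x y => (InnerProductSpace.toDual ℝ E3) (φ y • Kg s S (x - y)))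
    (bound := fun y => ‖φ y‖ * B) (s := univ) Filter.univ_mem (Filter.Eventually.of_forall fun y => ?_) ?_ ?_ ?_ ?_ ?_
  · exact (hφ.mul (hkk' y)).aestronglyMeasurable
  · exact (hφ.mul (hkk' x)).integrable_of_hasCompactSupport hφs.mul_right
  · exact ((InnerProductSpace.toDual ℝ E3).continuous.comp (by fun_prop)).aestronglyMeasurable
  · refine Filter.Eventually.of_forall fun z y _ => ?_
    rw [LinearIsometryEquiv.norm_map, norm_smul]
    exact mul_le_mul_of_nonneg_left (hB _) (norm_nonneg _)
  · exact (hφ.integrable_of_hasCompactSupport hφs).norm.mul_const _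
  · refine Filter.Eventually.of_forall fun z y _ => ?_
    have h1 := hasGradientAt_iff_hasFDerivAt.1 (hk (y - z))
    have h2 : HasGradientAt (fun x => (3 * vb)⁻¹ * kk s S (x - z)) (Kg s S (y - z)) y := by
      rw [hasGradientAt_iff_hasFDerivAt]
      refine (h1.comp y ((hasFDerivAt_id y).sub_const z)).congr_fderiv ?_
      ext; simp
    have := h2.cmul (φ z)
    rwa [hasGradientAt_iff_hasFDerivAt] at this

theorem Wp_ts (hs : 0 < s) (hS : s ≤ S) (hb : tsupport φ ⊆ ball x0 ρ) : tsupport (Wp s S φ) ⊆ closedBall x0 (ρ + S) := by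
  refine closure_minimal (fun x hx => ?_) isClosed_closedBall
  by_contra hn
  refine hx ?_
  unfold Wp
  rw [integral_congr_ae (g := fun _ => 0) (Filter.Eventually.of_forall fun y => ?_), integral_zero]
  by_cases hy : y ∈ ball x0 ρ
  · rw [mem_closedBall, not_le] at hn
    rw [mem_ball] at hy
    have : S ≤ ‖x - y‖ := by
      rw [← dist_eq_norm]; linarith [dist_triangle x y x0]
    simp [kk_zero hs hS this]
  · have : φ y = 0 := image_eq_zero_of_notMem_tsupport fun h => hy (hb h)
    simp [this]

theorem Wp_cu (hs : 0 < s) (hS : s ≤ S) (hφ : Continuous φ) (hφs : HasCompactSupport φ) (hb : tsupport φ ⊆ ball x0 ρ)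
    (hB : closedBall x0 (ρ + S) ⊆ Ω) : CU Ω (Wp s S φ) := by
  have hS' := hs.trans_le hS
  have hg := Wp_grad hs hS' hφ hφs
  refine ⟨contDiff_one_iff_fderiv.2 ⟨fun x => (hg x).differentiableAt, ?_⟩, (Wp_ts hs hS hb).trans hB⟩
  obtain ⟨B, hBd⟩ := Kg_le hs hS'
  have hkc := Kg_cont hs hS'
  have : fderiv ℝ (Wp s S φ) = fun x => (InnerProductSpace.toDual ℝ E3) (∫ y, φ y • Kg s S (x - y)) := by
    ext1 x; exact (hasGradientAt_iff_hasFDerivAt.1 (hg x)).fderiv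
  rw [this]
  refine (LinearIsometryEquiv.continuous _).comp (continuous_of_dominated (bound := fun y => ‖φ y‖ * B) (fun x => ?_) (fun x => ?_) ?_ ?_)
  · exact Continuous.aestronglyMeasurable (by fun_prop)
  · refine Filter.Eventually.of_forall fun y => ?_
    rw [norm_smul]; exact mul_le_mul_of_nonneg_left (hBd _) (norm_nonneg _)
  · exact (hφ.integrable_of_hasCompactSupport hφs).norm.mul_const _
  · exact Filter.Eventually.of_forall fun y => by fun_prop

theorem Wp_weak (hD : Dom Ω) (hs : 0 < s) (hS : 0 < S) (hφ : CU Ω φ) (hζ : LO Ω ζ) :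
    ∫ x in Ω, ⟪gradient (Wp s S φ) x, gradient ζ x⟫ = ∫ x in Ω, φ x * (Av s ζ x - Av S ζ x) := by
  have hφc := hφ.cd.continuous
  have hφs := hφ.cs hD
  have hz := hζ.ae_zero hD
  rw [setIntegral_eq_full hD (by filter_upwards [hz] with x h hx; simp [(h hx).2]),
    setIntegral_eq_full hD (Filter.Eventually.of_forall fun x hx => by simp [(hφ.lo hD).2 x hx])]
  obtain ⟨B, hBd⟩ := Kg_le hs hS
  have hB0 : 0 ≤ B := (norm_nonneg _).trans (hBd 0)
  have hkc := Kg_cont hs hS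
  have hgi : Integrable (gradient ζ) := by
    have h1 : IntegrableOn (gradient ζ) Ω := hζ.gbm.integrableOn hD
    rw [← integrable_indicator_iff hD.meas] at h1
    refine h1.congr ?_
    filter_upwards [hz] with x h
    by_cases hx : x ∈ Ω
    · simp [hx]
    · simp [hx, (h hx).2]
  have hφi : Integrable φ := hφc.integrable_of_hasCompactSupport hφs
  have hki : ∀ x, Integrable fun y => φ y • Kg s S (x - y) := fun x =>
    Continuous.integrable_of_hasCompactSupport (by fun_prop) hφs.smul_right
  have hm : Measurable fun q : E3 × E3 => φ q.2 * ⟪Kg s S (q.1 - q.2), gradient ζ q.1⟫ := by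
    refine (hφc.measurable.comp measurable_snd).mul (Measurable.inner (hkc.measurable.comp (by fun_prop)) ((measurable_gradient ζ).comp measurable_fst))
  have hI : Integrable (fun q : E3 × E3 => φ q.2 * ⟪Kg s S (q.1 - q.2), gradient ζ q.1⟫) (volume.prod volume) := by
    refine Integrable.mono' (hgi.norm.mul_prod (hφi.norm.const_mul B)) hm.aestronglyMeasurable (Filter.Eventually.of_forall fun q => ?_)
    rw [norm_mul]
    have h1 := (norm_inner_le_norm (𝕜 := ℝ) (Kg s S (q.1 - q.2)) (gradient ζ q.1)).trans
      (mul_le_mul_of_nonneg_right (hBd (q.1 - q.2)) (norm_nonneg _))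
    have h2 := mul_le_mul_of_nonneg_left h1 (norm_nonneg (φ q.2))
    linarith
  have e1 : ∀ x, ⟪gradient (Wp s S φ) x, gradient ζ x⟫ = ∫ y, φ y * ⟪Kg s S (x - y), gradient ζ x⟫ := fun x => by
    rw [(Wp_grad hs hS hφc hφs x).gradient, real_inner_comm, ← integral_inner (hki x)]
    simp only [inner_smul_right, real_inner_comm]
  simp only [e1]
  rw [integral_integral_swap hI]
  congr 1; ext y
  rw [integral_const_mul]
  congr 1
  have hfi : ∀ t : ℝ, 0 < t → Integrable fun x => ⟪Fk t (x - y), gradient ζ x⟫ := fun t ht => by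
    have hc := Fk_cont ht
    refine Integrable.mono' (hgi.norm.const_mul (t ^ 2)⁻¹) (Measurable.inner (by fun_prop) (measurable_gradient ζ)).aestronglyMeasurable
      (Filter.Eventually.of_forall fun x => ?_)
    exact (norm_inner_le_norm _ _).trans (mul_le_mul_of_nonneg_right (Fk_le ht _) (norm_nonneg _))
  rw [hζ.av_eq hD hs, hζ.av_eq hD hS]
  simp only [Kg, real_inner_smul_left, inner_sub_left]
  rw [integral_const_mul, integral_sub (hfi S hS) (hfi s hs)]
  ring

theorem av_symm (hD : Dom Ω) (hφ : LO Ω φ) (hζ : LO Ω ζ) : ∫ x in Ω, Av S φ x * ζ x = ∫ x in Ω, φ x * Av S ζ x := by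
  rw [setIntegral_eq_full hD (Filter.Eventually.of_forall fun x hx => by simp [hζ.2 x hx]),
    setIntegral_eq_full hD (Filter.Eventually.of_forall fun x hx => by simp [hφ.2 x hx])]
  have hφi : Integrable φ := hφ.cont.integrable_of_hasCompactSupport (hφ.cs hD)
  have hζi : Integrable ζ := hζ.cont.integrable_of_hasCompactSupport (hζ.cs hD)
  have hmA : MeasurableSet {q : E3 × E3 | dist q.1 q.2 < S} := (isOpen_lt continuous_dist continuous_const).measurableSet
  have hI := (hφi.mul_prod hζi).indicator hmA
  have hf : ∀ (x y : E3), {q : E3 × E3 | dist q.1 q.2 < S}.indicator (fun q => φ q.1 * ζ q.2) (x, y) =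
      φ x * (ball x S).indicator ζ y := fun x y => by
    simp only [indicator, mem_ofPred_eq, mem_ball, dist_comm y x]
    split_ifs <;> simp
  have hf' : ∀ (x y : E3), {q : E3 × E3 | dist q.1 q.2 < S}.indicator (fun q => φ q.1 * ζ q.2) (x, y) =
      ζ y * (ball y S).indicator φ x := fun x y => by
    simp only [indicator, mem_ofPred_eq, mem_ball]
    split_ifs <;> simp [mul_comm]
  have hsw := integral_integral_swap (f := fun x y => {q : E3 × E3 | dist q.1 q.2 < S}.indicator (fun q => φ q.1 * ζ q.2) (x, y)) hI
  have h1 : ∀ x, ∫ y, {q : E3 × E3 | dist q.1 q.2 < S}.indicator (fun q => φ q.1 * ζ q.2) (x, y) = φ x * ∫ y in ball x S, ζ y := fun x => by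
    simp only [hf]; rw [integral_const_mul, integral_indicator measurableSet_ball]
  have h2 : ∀ y, ∫ x, {q : E3 × E3 | dist q.1 q.2 < S}.indicator (fun q => φ q.1 * ζ q.2) (x, y) = ζ y * ∫ x in ball y S, φ x := fun y => by
    simp only [hf']; rw [integral_const_mul, integral_indicator measurableSet_ball]
  simp only [h1, h2] at hsw
  unfold Av
  have g1 : ∀ x, (S ^ 3 * vb)⁻¹ * (∫ z in ball x S, φ z) * ζ x = (S ^ 3 * vb)⁻¹ * (ζ x * ∫ z in ball x S, φ z) := fun x => by ring
  have g2 : ∀ x, φ x * ((S ^ 3 * vb)⁻¹ * ∫ z in ball x S, ζ z) = (S ^ 3 * vb)⁻¹ * (φ x * ∫ z in ball x S, ζ z) := fun x => by ring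
  simp only [g1, g2]
  rw [integral_const_mul, integral_const_mul, hsw]

theorem phi_ball (hD : Dom Ω) (hφ : CU Ω φ) (hb : tsupport φ ⊆ ball x0 ρ) (h1 : ∫ x in Ω, φ x ^ 2 ≤ 1) {X : E3 → ℝ} (hX : Continuous X) :
    (∫ x in Ω, φ x * X x) ^ 2 ≤ ∫ x in ball x0 ρ, X x ^ 2 := by
  have hφc := hφ.cd.continuous
  have hz : ∀ x, x ∉ ball x0 ρ → φ x = 0 := fun x hx => image_eq_zero_of_notMem_tsupport fun h => hx (hb h)
  have e : ∀ F : E3 → ℝ, (∀ x, φ x = 0 → F x = 0) → ∫ x in Ω, F x = ∫ x in ball x0 ρ, F x := fun F hF => by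
    rw [setIntegral_eq_full hD (Filter.Eventually.of_forall fun x hx => hF x ((hφ.lo hD).2 x hx)),
      setIntegral_eq_integral_of_forall_compl_eq_zero fun x hx => hF x (hz x hx)]
  rw [e (fun x => φ x * X x) fun x hx => by simp [hx]]
  rw [e (fun x => φ x ^ 2) fun x hx => by simp [hx]] at h1
  have := cs_int (F := φ) (G := X) (ci_ball (hφc.pow 2) x0 ρ) (ci_ball (hX.pow 2) x0 ρ) (ci_ball (hφc.mul hX) x0 ρ)
  refine this.trans (mul_le_of_le_one_left (integral_nonneg fun _ => by positivity) h1)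

theorem avt (hD : Dom Ω) (hφ : CU Ω φ) (hb : tsupport φ ⊆ ball x0 ρ) (h1 : ∫ x in Ω, φ x ^ 2 ≤ 1) (hζ : LO Ω ζ) (hs : 0 < s) :
    (∫ x in Ω, φ x * (ζ x - Av s ζ x)) ^ 2 ≤ s ^ 2 * En ζ x0 (ρ + s) :=
  (phi_ball hD hφ hb h1 (hζ.cont.sub (hζ.av_cont hD s))).trans (hζ.av1 hD x0 ρ hs)

theorem LO.En_le' (hD : Dom Ω) (hζ : LO Ω ζ) (x : E3) (t : ℝ) : En ζ x t ≤ ∫ y in Ω, ‖gradient ζ y‖ ^ 2 := by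
  have := hζ.En_le hD (x := x) (t := t) (BM.const 1) (fun _ _ => zero_le_one) (fun _ _ _ => le_rfl)
  simpa using this

theorem avt' (hD : Dom Ω) (hφ : CU Ω φ) (hb : tsupport φ ⊆ ball x0 ρ) (h1 : ∫ x in Ω, φ x ^ 2 ≤ 1) (hζ : LO Ω ζ) (hs : 0 < s) :
    |∫ x in Ω, φ x * (ζ x - Av s ζ x)| ≤ s * √(∫ y in Ω, ‖gradient ζ y‖ ^ 2) := by
  refine abs_le_of_sq_le_sq ((avt hD hφ hb h1 hζ hs).trans ?_) (by positivity)
  rw [mul_pow, Real.sq_sqrt (integral_nonneg fun _ => by positivity)]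
  exact mul_le_mul_of_nonneg_left (hζ.En_le' hD _ _) (by positivity)

end inter

section far
variable {Ω : Set E3} {T : Finset (Fin 4 → E3)} {h c : ℝ} {r : ℕ} {z0 x0 : E3} {r0 d ρ s S ε : ℝ} {u φ ζ : E3 → ℝ}

theorem av_phi (hD : Dom Ω) (hφ : CU Ω φ) (hb : tsupport φ ⊆ ball x0 ρ) (h1 : ∫ x in Ω, φ x ^ 2 ≤ 1) (hρ : 0 ≤ ρ) (x : E3) :
    Av S φ x ^ 2 ≤ ((S ^ 3 * vb)⁻¹) ^ 2 * (ρ ^ 3 * vb) := by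
  have hφc := hφ.cd.continuous
  have hφs := hφ.cs hD
  have hz : ∀ x, x ∉ ball x0 ρ → φ x = 0 := fun x hx => image_eq_zero_of_notMem_tsupport fun h => hx (hb h)
  have hi : Integrable fun x => |φ x| := (hφc.integrable_of_hasCompactSupport hφs).norm
  have e1 : ∫ x, |φ x| = ∫ x in ball x0 ρ, |φ x| :=
    (setIntegral_eq_integral_of_forall_compl_eq_zero fun x hx => by simp [hz x hx]).symm
  have e2 : ∫ x in ball x0 ρ, φ x ^ 2 ≤ 1 := by
    rw [setIntegral_eq_integral_of_forall_compl_eq_zero fun x hx => by simp [hz x hx],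
      ← setIntegral_eq_full hD (Filter.Eventually.of_forall fun x hx => by simp [(hφ.lo hD).2 x hx])]
    exact h1
  have hcs := cs_int (F := fun x => |φ x|) (G := fun _ => (1:ℝ)) (ci_ball (by fun_prop) x0 ρ) (ci_ball (by fun_prop) x0 ρ) (ci_ball (by fun_prop) x0 ρ)
  simp only [mul_one, one_pow, sq_abs, ball_one x0 hρ] at hcs
  have hv := vb_pos
  rw [Av, mul_pow]
  refine mul_le_mul_of_nonneg_left ?_ (by positivity)
  have h2 : |∫ z in ball x S, φ z| ≤ ∫ x in ball x0 ρ, |φ x| := by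
    rw [← e1]
    refine (abs_integral_le_integral_abs).trans ?_
    exact setIntegral_le_integral hi (Filter.Eventually.of_forall fun _ => abs_nonneg _)
  rw [← sq_abs]
  refine (pow_le_pow_left₀ (abs_nonneg _) h2 2).trans (hcs.trans ?_)
  exact mul_le_of_le_one_left (by positivity) e2

theorem av_phi0 (hb : tsupport φ ⊆ ball x0 ρ) {x : E3} (hx : Av S φ x ≠ 0) : ‖x - x0‖ < ρ + S := by
  by_contra hn
  refine hx ?_
  rw [Av, setIntegral_eq_zero_of_forall_eq_zero fun z hz => ?_, mul_zero]
  refine image_eq_zero_of_notMem_tsupport fun h => ?_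
  have h1 := hb h
  rw [mem_ball] at h1 hz
  rw [← dist_eq_norm] at hn
  rw [dist_comm] at hz
  linarith [dist_triangle x z x0]

theorem av_phi_int (hD : Dom Ω) (hφ : CU Ω φ) (hb : tsupport φ ⊆ ball x0 ρ) (h1 : ∫ x in Ω, φ x ^ 2 ≤ 1) (hρ : 0 ≤ ρ) (hS : 0 < S)
    (hρS : ρ ≤ 3 * S) : ∫ x in Ω, Av S φ x ^ 2 ≤ 64 * ρ ^ 3 / S ^ 3 := by
  have hv := vb_pos
  have hac := (hφ.lo hD).av_cont hD S
  have hz : ∀ x, x ∉ ball x0 (4 * S) → Av S φ x ^ 2 = 0 := fun x hx => by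
    by_contra hn
    have h2 := av_phi0 (S := S) hb (x := x) fun h => hn (by rw [h]; norm_num)
    rw [mem_ball, dist_eq_norm] at hx
    exact hx (by linarith)
  have hi : Integrable fun x => Av S φ x ^ 2 := (hac.pow 2).integrable_of_hasCompactSupport (hcs_of_ball hz)
  refine (setIntegral_le_integral hi (Filter.Eventually.of_forall fun _ => by positivity)).trans ?_
  rw [← setIntegral_eq_integral_of_forall_compl_eq_zero hz]
  have h2 : ∫ x in ball x0 (4 * S), Av S φ x ^ 2 ≤ ∫ x in ball x0 (4 * S), ((S ^ 3 * vb)⁻¹) ^ 2 * (ρ ^ 3 * vb) * 1 := by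
    refine setIntegral_mono_on (ci_ball (hac.pow 2) _ _) (ci_ball continuous_const _ _) measurableSet_ball fun x _ => ?_
    rw [mul_one]; exact av_phi hD hφ hb h1 hρ x
  rw [integral_const_mul, ball_one x0 (by positivity)] at h2
  refine h2.trans (le_of_eq ?_)
  field_simp; norm_num

theorem CU.sub {f g : E3 → ℝ} (hf : CU Ω f) (hg : CU Ω g) : CU Ω (fun x => f x - g x) :=
  ⟨hf.cd.sub hg.cd, (tsupport_sub f g).trans (union_subset hf.ts hg.ts)⟩

theorem CU.gsub {f g : E3 → ℝ} (hf : CU Ω f) (hg : CU Ω g) (x : E3) : gradient (fun x => f x - g x) x = gradient f x - gradient g x :=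
  ((hf.hg x).sub' (hg.hg x)).gradient

theorem phi_split (hD : Dom Ω) (hφ : CU Ω φ) (hζ : LO Ω ζ) (s S : ℝ) : ∫ x in Ω, φ x * (Av s ζ x - Av S ζ x) =
    (∫ x in Ω, φ x * (ζ x - Av S ζ x)) - ∫ x in Ω, φ x * (ζ x - Av s ζ x) := by
  have hφc := hφ.cd.continuous
  have hi : ∀ X : E3 → ℝ, Continuous X → IntegrableOn (fun x => φ x * X x) Ω := fun X hX =>
    ((hφc.mul hX).integrable_of_hasCompactSupport (hφ.cs hD).mul_right).integrableOn
  have h1 := hζ.av_cont hD s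
  have h2 := hζ.av_cont hD S
  have h3 := hζ.cont
  rw [← integral_sub (hi _ (by fun_prop)) (hi _ (by fun_prop))]
  congr 1; ext x; ring

theorem Wp_en (hD : Dom Ω) (hφ : CU Ω φ) (hb : tsupport φ ⊆ ball x0 ρ) (h1 : ∫ x in Ω, φ x ^ 2 ≤ 1) (hs : 0 < s) (hS : s ≤ S)
    (hB : closedBall x0 (ρ + S) ⊆ Ω) : ∫ x in Ω, ‖gradient (Wp s S φ) x‖ ^ 2 ≤ (2 * S) ^ 2 := by
  have hS' := hs.trans_le hS
  have hW := (Wp_cu hs hS hφ.cd.continuous (hφ.cs hD) hb hB).lo hD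
  have h2 := Wp_weak hD hs hS' hφ hW
  rw [phi_split hD hφ hW] at h2
  simp only [real_inner_self_eq_norm_sq] at h2
  have h3 := avt' hD hφ hb h1 hW hs
  have h4 := avt' hD hφ hb h1 hW hS'
  set E := ∫ x in Ω, ‖gradient (Wp s S φ) x‖ ^ 2
  have hE : 0 ≤ E := integral_nonneg fun _ => by positivity
  have h5 := Real.sq_sqrt hE
  have h6 := Real.sqrt_nonneg E
  have h7 := (abs_le.1 h3).1
  have h8 := (abs_le.1 h4).2
  have h9 : s * √E ≤ S * √E := mul_le_mul_of_nonneg_right hS h6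
  have h10 : √E ^ 2 ≤ 2 * S * √E := by linarith
  have h11 : √E ≤ 2 * S := by
    by_contra hn
    push Not at hn
    nlinarith
  rw [← h5]
  exact pow_le_pow_left₀ h6 h11 2

theorem Wp_ws (hD : Dom Ω) (hφ : CU Ω φ) (hb : tsupport φ ⊆ ball x0 ρ) (h1 : ∫ x in Ω, φ x ^ 2 ≤ 1) (hs : 0 < s) (hS : s ≤ S)
    (hB : closedBall x0 (ρ + S) ⊆ Ω) (hu : CU Ω u) (H : WS Ω u φ ε) : WS Ω (fun x => u x - Wp s S φ x) (Av S φ) (ε + s) := fun ζ hζ => by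
  have hS' := hs.trans_le hS
  have hW := Wp_cu hs hS hφ.cd.continuous (hφ.cs hD) hb hB
  have hφc := hφ.cd.continuous
  have hi : ∀ X : E3 → ℝ, Continuous X → IntegrableOn (fun x => φ x * X x) Ω := fun X hX =>
    ((hφc.mul hX).integrable_of_hasCompactSupport (hφ.cs hD).mul_right).integrableOn
  have h2 := Wp_weak hD hs hS' hφ hζ
  have h3 := avt' hD hφ hb h1 hζ hs
  have h4 := H ζ hζ
  have c1 := hζ.av_cont hD s
  have c2 := hζ.av_cont hD S
  have c3 := hζ.cont
  simp only [CU.gsub hu hW, inner_sub_left]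
  rw [integral_sub (((hu.lo hD).gbm.inner hζ.gbm).integrableOn hD) (((hW.lo hD).gbm.inner hζ.gbm).integrableOn hD), h2,
    av_symm hD (hφ.lo hD) hζ]
  simp only [mul_sub] at h3 ⊢
  rw [integral_sub (hi _ c1) (hi _ c2)]
  rw [integral_sub (hi _ c3) (hi _ c1)] at h3
  rw [add_mul]
  refine le_trans (le_of_eq ?_) ((abs_add_le _ _).trans (add_le_add h4 h3))
  congr 1; ring

theorem sq_sum3 (a b e : ℝ) : (a + b + e) ^ 2 ≤ 3 * a ^ 2 + 3 * b ^ 2 + 3 * e ^ 2 := by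
  nlinarith [sq_nonneg (a - b), sq_nonneg (b - e), sq_nonneg (a - e)]

theorem Geo.wphi (G : Geo Ω z0 r0 d) (hc : 0 < c) (r : ℕ) : ∃ C : ℝ, 0 < C ∧
    ∀ {T : Finset (Fin 4 → E3)} {h : ℝ} {g : E3 → E3} {w φ : E3 → ℝ} {x0 : E3} {ρ s : ℝ} (J : ℕ), Msh Ω T h c r →
    Ritz Ω T r h g w → 4 * h ≤ r0 → x0 ∈ Ω → h ≤ ρ → ρ ≤ d → CU Ω φ → tsupport φ ⊆ ball x0 ρ → ∫ x in Ω, φ x ^ 2 ≤ 1 →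
    0 < s → s ≤ h → 16 * ρ ≤ infDist x0 (frontier Ω) → 16 * (2 ^ J * h) ≤ infDist x0 (frontier Ω) →
    (∫ x in Ω, φ x * (Av s w x - Av (2 ^ J * h) w x)) ^ 2 ≤ C * (h ^ 2 * ρ ^ 3) := by
  obtain ⟨C1, hC1, H1⟩ := G.int hc r (m := 6) (by norm_num)
  obtain ⟨C2, hC2, H2⟩ := tel hc r
  have hv := vb_pos
  refine ⟨24 * C1 + 27 * C1 * C2 ^ 2 * vb, by positivity, fun {T h g w φ x0 ρ s} J M W h4 hx0 hρ hρd hφ hb h1 hs hsh hDρ hDJ => ?_⟩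
  have hD := M.D
  have hh := M.h0
  have hwl := W.fe.LO M
  have hφc := hφ.cd.continuous
  have c1 := hwl.av_cont hD s
  have c2 := hwl.av_cont hD (2 ^ J * h)
  have c3 := hwl.cont
  have c4 := hwl.av_cont hD h
  have hρ0 : 0 < ρ := hh.trans_le hρ
  have hi : ∀ X : E3 → ℝ, Continuous X → IntegrableOn (fun x => φ x * X x) Ω := fun X hX =>
    ((hφc.mul hX).integrable_of_hasCompactSupport (hφ.cs hD).mul_right).integrableOn
  have e : ∫ x in Ω, φ x * (Av s w x - Av (2 ^ J * h) w x) = -(∫ x in Ω, φ x * (w x - Av s w x)) +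
      (∫ x in Ω, φ x * (w x - Av h w x)) + ∫ x in Ω, φ x * (Av h w x - Av (2 ^ J * h) w x) := by
    simp only [mul_sub]
    rw [integral_sub (hi _ c1) (hi _ c2), integral_sub (hi _ c3) (hi _ c1), integral_sub (hi _ c3) (hi _ c4), integral_sub (hi _ c4) (hi _ c2)]
    ring
  have hE : ∀ t, 0 < t → t ≤ h → (∫ x in Ω, φ x * (w x - Av t w x)) ^ 2 ≤ 4 * C1 * (h ^ 2 * ρ ^ 3) := fun t ht hth => by
    refine (avt hD hφ hb h1 hwl ht).trans ?_
    have a1 := hwl.En_mono hD (ball_subset_ball (x := x0) (by linarith : ρ + t ≤ 2 * ρ))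
    have a2 := a1.trans (H1 M W h4 hx0 (by linarith : h ≤ 2 * ρ) (by linarith))
    have a3 : t ^ 2 ≤ h ^ 2 := pow_le_pow_left₀ ht.le hth 2
    have a4 : h * ρ ^ 2 ≤ ρ ^ 3 := by
      rw [pow_succ' ρ 2]; exact mul_le_mul_of_nonneg_right hρ (by positivity)
    calc _ ≤ h ^ 2 * (C1 * h * (2 * ρ) ^ 2) := mul_le_mul a3 a2 (En_nonneg _ _ _) (by positivity)
      _ = 4 * C1 * h ^ 2 * (h * ρ ^ 2) := by ring
      _ ≤ 4 * C1 * h ^ 2 * ρ ^ 3 := mul_le_mul_of_nonneg_left a4 (by positivity)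
      _ = _ := by ring
  have b1 := hE s hs hsh
  have b2 := hE h hh le_rfl
  have b3 : (∫ x in Ω, φ x * (Av h w x - Av (2 ^ J * h) w x)) ^ 2 ≤ 9 * C1 * C2 ^ 2 * vb * (h ^ 2 * ρ ^ 3) := by
    refine (phi_ball hD hφ hb h1 (c4.sub c2)).trans ?_
    have hpt : ∀ y ∈ ball x0 ρ, (Av h w y - Av (2 ^ J * h) w y) ^ 2 ≤ 9 * C1 * C2 ^ 2 * h ^ 2 * 1 := fun y hy => by
      have hy' : dist x0 y < ρ := by rw [dist_comm]; exact hy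
      have hdy : infDist x0 (frontier Ω) ≤ infDist y (frontier Ω) + dist x0 y := infDist_le_infDist_add_dist
      have hyΩ : y ∈ Ω := ball_in hx0 le_rfl (ball_subset_ball (by linarith) hy)
      have hp : 0 < 2 ^ J * h := by positivity
      have h5 := H2 (y := y) (Q := 9 * C1 * h) M W hyΩ J le_rfl (by linarith) fun t ht htd => by
        have := H1 M W h4 hyΩ (by linarith : h ≤ 3 * t) (by linarith [G.int_le hyΩ])
        refine this.trans (le_of_eq (by ring))
      rw [mul_div_assoc, div_self hh.ne', mul_one] at h5
      rw [← sq_abs]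
      refine (pow_le_pow_left₀ (abs_nonneg _) h5 2).trans (le_of_eq ?_)
      rw [mul_pow, Real.sq_sqrt (by positivity)]; ring
    have := setIntegral_mono_on (ci_ball ((c4.sub c2).pow 2) x0 ρ) (ci_ball continuous_const x0 ρ) measurableSet_ball hpt
    rw [integral_const_mul, ball_one x0 hρ0.le] at this
    refine this.trans (le_of_eq (by ring))
  rw [e]
  refine (sq_sum3 _ _ _).trans ?_
  rw [neg_sq]
  linarith

end far

section fin
variable {Ω : Set E3} {T : Finset (Fin 4 → E3)} {h c : ℝ} {r : ℕ} {z0 x0 : E3} {r0 d ρ s S ε : ℝ} {u φ ζ : E3 → ℝ}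

theorem nsub2 (a b : E3) : ‖a - b‖ ^ 2 ≤ 2 * ‖a‖ ^ 2 + 2 * ‖b‖ ^ 2 := by
  have := pow_le_pow_left₀ (norm_nonneg _) (norm_sub_le a b) 2
  nlinarith [sq_nonneg (‖a‖ - ‖b‖)]

theorem sq_sub2 (p q : ℝ) : (p - q) ^ 2 ≤ 2 * p ^ 2 + 2 * q ^ 2 := by nlinarith [sq_nonneg (p + q)]

theorem Geo.far (G : Geo Ω z0 r0 d) (hc : 0 < c) (r : ℕ) : ∃ C : ℝ, 0 < C ∧
    ∀ {T : Finset (Fin 4 → E3)} {h : ℝ} {g : E3 → E3} {w u φ : E3 → ℝ} {x0 : E3} {ρ a ε : ℝ}, Msh Ω T h c r →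
    Ritz Ω T r h g w → 4 * h ≤ r0 → x0 ∈ closure Ω → h ≤ ρ → ρ ≤ d → CU Ω u → CU Ω φ → tsupport φ ⊆ ball x0 ρ → ∫ x in Ω, φ x ^ 2 ≤ 1 →
    WS Ω u φ ε → 0 < ε → ε ≤ 1 → 0 ≤ a → ∫ x in Ω, ‖gradient u x‖ ^ 2 ≤ a →
    (∫ x in Ω, ⟪gradient u x, g x - gradient w x⟫) ^ 2 ≤ C * (h ^ 2 * ρ ^ 3 + ε * ((1 + h) * √(2 * a + 8 * d ^ 2))) := by
  obtain ⟨C1, hC1, H1⟩ := G.BL hc r (m := 16) (by norm_num)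
  obtain ⟨C2, hC2, H2⟩ := G.wphi hc r
  have hd0 := G.dpos
  refine ⟨2 * (4096 * C1) + 2 * C2, by positivity, fun {T h g w u φ x0 ρ a ε} M W h4 hx0 hρ hρd hu hφ hb h1 hws hε hε1 ha hua => ?_⟩
  have hD := M.D
  have hh := M.h0
  have hwl := W.fe.LO M
  have hρ0 : 0 < ρ := hh.trans_le hρ
  set Q := √(2 * a + 8 * d ^ 2) with hQ
  have hQ0 : 0 ≤ Q := Real.sqrt_nonneg _
  have hQ2 : Q ^ 2 = 2 * a + 8 * d ^ 2 := Real.sq_sqrt (by positivity)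
  have hR0 : 0 ≤ h ^ 2 * ρ ^ 3 := by positivity
  have hR1 : 0 ≤ ε * ((1 + h) * Q) := by positivity
  by_cases hnear : infDist x0 (frontier Ω) ≤ 16 * ρ
  · have := H1 (u := u) (φ := φ) (x0 := x0) (t := ρ) (N := 1) (B := Q) (ε := ε) M W h4 hρ (by linarith) hx0 hnear hu ((hφ.lo hD).bm hD) (fun x _ hx => ?_) h1 hws hε.le hQ0
      (by rw [hQ2]; linarith [sq_nonneg d])
    · refine this.trans ?_
      have e1 : ε * Q ≤ ε * ((1 + h) * Q) := mul_le_mul_of_nonneg_left (le_mul_of_one_le_left hQ0 (by linarith)) hε.le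
      have e2 := mul_le_mul_of_nonneg_left e1 hC1.le
      have e3 := mul_nonneg hC1.le hR0
      have e4 := mul_nonneg hC1.le hR1
      have e5 := mul_nonneg hC2.le hR0
      have e6 := mul_nonneg hC2.le hR1
      linarith
    · have h2 := hb (subset_tsupport _ hx)
      rw [mem_ball, dist_eq_norm] at h2
      exact h2.le
  push Not at hnear
  set D := infDist x0 (frontier Ω) with hDd
  have hx0Ω : x0 ∈ Ω := by
    by_contra hn
    have : x0 ∈ frontier Ω := by rw [frontier, hD.op.interior_eq]; exact ⟨hx0, hn⟩
    have := infDist_zero_of_mem this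
    linarith
  have hDle : D ≤ d := G.int_le hx0Ω
  obtain ⟨J, hJ1, hJ2⟩ := exists_nat_pow_near (x := D / (16 * h)) (y := 2) (by rw [le_div_iff₀ (by positivity)]; linarith) (by norm_num)
  rw [le_div_iff₀ (by positivity)] at hJ1
  rw [div_lt_iff₀ (by positivity), pow_succ] at hJ2
  set S := 2 ^ J * h with hS
  have hS1 : 16 * S ≤ D := by rw [hS]; linarith
  have hS2 : D < 32 * S := by rw [hS]; linarith
  have hhS : h ≤ S := by rw [hS]; exact le_mul_of_one_le_left hh.le (one_le_pow₀ (by norm_num))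
  have hS0 : 0 < S := hh.trans_le hhS
  set s := ε * h with hs
  have hs0 : 0 < s := by positivity
  have hsh : s ≤ h := mul_le_of_le_one_left hh.le hε1
  have hsS := hsh.trans hhS
  have hB : closedBall x0 (ρ + S) ⊆ Ω := (closedBall_subset_ball (by linarith)).trans (ball_in hx0Ω le_rfl)
  have hW := Wp_cu hs0 hsS hφ.cd.continuous (hφ.cs hD) hb hB
  have hWe := Wp_en hD hφ hb h1 hs0 hsS hB
  have hWw := Wp_weak hD hs0 hS0 hφ hwl
  have hws' := Wp_ws hD hφ hb h1 hs0 hsS hB hu hws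
  have hut := hu.sub hW
  have k1 := H2 (s := s) J M W h4 hx0Ω hρ hρd hφ hb h1 hs0 hsh hnear.le hS1
  rw [← hWw] at k1
  have hub : ∫ x in Ω, ‖gradient (fun x => u x - Wp s S φ x) x‖ ^ 2 ≤ Q ^ 2 := by
    have h2 : ∫ x in Ω, ‖gradient (fun x => u x - Wp s S φ x) x‖ ^ 2 ≤ ∫ x in Ω, (2 * ‖gradient u x‖ ^ 2 + 2 * ‖gradient (Wp s S φ) x‖ ^ 2) := by
      refine ae_le_set hD (hut.lo hD).gbm.nsq (((hu.lo hD).gbm.nsq.cmul 2).add ((hW.lo hD).gbm.nsq.cmul 2)) (Filter.Eventually.of_forall fun x _ => ?_)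
      rw [hu.gsub hW]
      exact nsub2 _ _
    rw [integral_add (((hu.lo hD).gbm.nsq.cmul 2).integrableOn hD) (((hW.lo hD).gbm.nsq.cmul 2).integrableOn hD), integral_const_mul, integral_const_mul] at h2
    have h3 : (2 * S) ^ 2 ≤ d ^ 2 := pow_le_pow_left₀ (by positivity) (by linarith) 2
    have := sq_nonneg d
    linarith
  have k2 := H1 (t := 4 * S) (N := 64 * ρ ^ 3 / S ^ 3) (B := Q) M W h4 (by linarith) (by linarith) hx0 (by linarith) hut
    (BM.of_cont_le ((hφ.lo hD).av_cont hD S).measurable _ fun x _ =>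
      (show ‖Av S φ x‖ ≤ √(((S ^ 3 * vb)⁻¹) ^ 2 * (ρ ^ 3 * vb)) from Real.abs_le_sqrt (av_phi hD hφ hb h1 hρ0.le x)))
    (fun x _ hx => by linarith [av_phi0 hb hx]) (av_phi_int hD hφ hb h1 hρ0.le hS0 (by linarith)) hws' (by positivity) hQ0 hub
  have e0 : h ^ 2 * (4 * S) ^ 3 * (64 * ρ ^ 3 / S ^ 3) + (ε + s) * Q = 4096 * (h ^ 2 * ρ ^ 3) + ε * ((1 + h) * Q) := by
    rw [hs]; field_simp; ring
  rw [e0] at k2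
  have hgW : ∀ x, ⟪gradient (Wp s S φ) x, g x⟫ = 0 := fun x => by
    by_cases hx : x ∈ Lam Ω h
    · have h2 : x ∉ tsupport (Wp s S φ) := fun hn => by
        have h3 := Wp_ts hs0 hsS hb hn
        rw [mem_closedBall, dist_comm] at h3
        have h5 : infDist x0 (frontier Ω) ≤ infDist x (frontier Ω) + dist x0 x := infDist_le_infDist_add_dist
        have h6 := hx.2
        linarith
      rw [gradient, fderiv_of_notMem_tsupport ℝ h2, map_zero, inner_zero_left]
    · rw [W.gz x hx, inner_zero_right]
  have hbR := W.bm.sub hwl.gbm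
  have e1 : ∫ x in Ω, ⟪gradient u x, g x - gradient w x⟫ = (∫ x in Ω, ⟪gradient (fun x => u x - Wp s S φ x) x, g x - gradient w x⟫) -
      ∫ x in Ω, ⟪gradient (Wp s S φ) x, gradient w x⟫ := by
    rw [← integral_sub (((hut.lo hD).gbm.inner hbR).integrableOn hD) (((hW.lo hD).gbm.inner hwl.gbm).integrableOn hD)]
    congr 1; ext x
    have := hgW x
    rw [hu.gsub hW, inner_sub_left, inner_sub_right (gradient (Wp s S φ) x), this]; ring
  rw [e1]
  refine (sq_sub2 _ _).trans ?_
  have e4 := mul_nonneg hC1.le hR1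
  have e6 := mul_nonneg hC2.le hR1
  linarith

theorem eps_lim {X a b : ℝ} (H : ∀ ε, 0 < ε → ε ≤ 1 → X ≤ a + ε * b) : X ≤ a := by
  by_contra hn
  push Not at hn
  have hb : 0 < |b| + 1 := by positivity
  have h1 := H (min 1 ((X - a) / (2 * (|b| + 1)))) (lt_min one_pos (div_pos (by linarith) (by linarith))) (min_le_left _ _)
  have h2 : min 1 ((X - a) / (2 * (|b| + 1))) * b ≤ (X - a) / (2 * (|b| + 1)) * (|b| + 1) :=
    (mul_le_mul_of_nonneg_left (by linarith [le_abs_self b] : b ≤ |b| + 1) (le_min zero_le_one (div_nonneg (by linarith) (by linarith)))).trans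
      (mul_le_mul_of_nonneg_right (min_le_right _ _) hb.le)
  have h3 : (X - a) / (2 * (|b| + 1)) * (|b| + 1) = (X - a) / 2 := by field_simp
  linarith

theorem Geo.dual (G : Geo Ω z0 r0 d) (hc : 0 < c) (r : ℕ) : ∃ C : ℝ, 0 < C ∧
    ∀ {T : Finset (Fin 4 → E3)} {h : ℝ} {g : E3 → E3} {w v φ : E3 → ℝ} {x0 : E3} {ρ : ℝ}, Msh Ω T h c r →
    Ritz Ω T r h g w → 4 * h ≤ r0 → x0 ∈ closure Ω → h ≤ ρ → ρ ≤ d → VS Ω v φ → CU Ω φ → tsupport φ ⊆ ball x0 ρ → ∫ x in Ω, φ x ^ 2 ≤ 1 →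
    (∫ x in Ω, ⟪gradient v x, g x - gradient w x⟫) ^ 2 ≤ C * (h ^ 2 * ρ ^ 3) := by
  obtain ⟨C1, hC1, H1⟩ := G.far hc r
  refine ⟨2 * C1, by positivity, fun {T h g w v φ x0 ρ} M W h4 hx0 hρ hρd H hφ hb h1 => ?_⟩
  have hD := M.D
  have hh := M.h0
  have hwl := W.fe.LO M
  set a := ∫ x in Ω, ‖gradient v x‖ ^ 2 with ha
  have ha0 : 0 ≤ a := integral_nonneg fun _ => by positivity
  set Rr := ∫ x in Ω, ‖g x - gradient w x‖ ^ 2 with hRr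
  have hRr0 : 0 ≤ Rr := integral_nonneg fun _ => by positivity
  have hbR := W.bm.sub hwl.gbm
  have hRi := hbR.nsq.integrableOn hD
  refine eps_lim (b := 2 * C1 * ((1 + h) * √(2 * a + 8 * d ^ 2)) + 2 * Rr) fun ε hε hε1 => ?_
  obtain ⟨u, hu, hws, hua, hud⟩ := H.approx hD ⟨z0, G.z0m⟩ hε
  have k1 := H1 M W h4 hx0 hρ hρd hu hφ hb h1 hws hε hε1 ha0 hua
  have hgu := measurable_gradient u
  have hgv := measurable_gradient v
  have hgd : Measurable fun x => gradient u x - gradient v x := hgu.sub hgv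
  have hui := (hu.lo hD).gbm.nsq.integrableOn hD
  have hdi : IntegrableOn (fun x => ‖gradient u x - gradient v x‖ ^ 2) Ω := by
    refine Integrable.mono' ((hui.const_mul 2).add (H.gi.const_mul 2)) ((hgu.sub hgv).norm.pow_const 2).aestronglyMeasurable
      (Filter.Eventually.of_forall fun x => ?_)
    rw [Real.norm_of_nonneg (by positivity)]
    exact nsub2 _ _
  have k2 := cs_vec hgd hbR.1 hdi hRi
  have e1 : ∫ x in Ω, ⟪gradient v x, g x - gradient w x⟫ = (∫ x in Ω, ⟪gradient u x, g x - gradient w x⟫) -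
      ∫ x in Ω, ⟪gradient u x - gradient v x, g x - gradient w x⟫ := by
    rw [← integral_sub (l2_inner hgu hbR.1 hui hRi).1 (l2_inner hgd hbR.1 hdi hRi).1]
    congr 1; ext x
    rw [inner_sub_left]; ring
  rw [e1]
  refine (sq_sub2 _ _).trans ?_
  have k3 : ε ^ 2 ≤ ε := pow_le_of_le_one hε.le hε1 two_ne_zero
  have k4 := k2.trans (mul_le_mul_of_nonneg_right (hud.trans k3) hRr0)
  linarith

end fin


section final
variable {Ω : Set E3} {T : Finset (Fin 4 → E3)} {h c : ℝ} {r : ℕ}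

theorem VS.of (hD : Dom Ω) {v φ : E3 → ℝ} (hv : ContinuousOn v (closure Ω)) (h0 : ∀ x ∈ frontier Ω, v x = 0)
    (hcd : ContDiffOn ℝ (⊤ : ℕ∞) v Ω) (hl : ∀ x ∈ Ω, lap v x = -φ x)
    (hi : IntegrableOn (fun x => ‖gradient v x‖ ^ 2) Ω) (hb : BM Ω φ) : VS Ω (Ω.indicator v) φ := by
  have hE : ∀ x ∈ Ω, Ω.indicator v x = v x := fun x hx => indicator_of_mem hx v
  have hf : ∀ x ∈ Ω, fderiv ℝ (Ω.indicator v) x = fderiv ℝ v x := fun x hx =>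
    Filter.EventuallyEq.fderiv_eq (Filter.mem_of_superset (hD.op.mem_nhds hx) hE)
  refine ⟨continuous_indicator h0 hv, fun x hx => indicator_of_notMem hx v, ?_, fun x hx => ?_, ?_, hb⟩
  · exact (contDiffOn_infty.1 hcd 2).congr hE
  · rw [← hl x hx]
    unfold lap
    refine Finset.sum_congr rfl fun i _ => ?_
    have : (fun y => fderiv ℝ (Ω.indicator v) y (EuclideanSpace.single i 1)) =ᶠ[nhds x]
        fun y => fderiv ℝ v y (EuclideanSpace.single i 1) :=
      Filter.mem_of_superset (hD.op.mem_nhds hx) fun y hy => by simp only [mem_ofPred_eq]; rw [hf y hy]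
    rw [this.fderiv_eq]
  · refine hi.congr_fun (fun x hx => ?_) hD.meas
    simp only [gradient_congr hD.op hE hx]

theorem FE.of (M : Msh Ω T h c r) {u : E3 → ℝ} (hu : MemSh0 Ω T r u) : FE Ω T r (Ω.indicator u) := by
  have hE : ∀ x ∈ closure Ω, Ω.indicator u x = u x := fun x hx => by
    by_cases h : x ∈ Ω
    · simp [h]
    · have : x ∈ frontier Ω := ⟨hx, fun h' => h (interior_subset h')⟩
      simp [h, hu.2 x this]
  refine ⟨⟨⟨hu.1.1.congr hE, fun t ht => ?_⟩, fun x hx => ?_⟩, fun x hx => indicator_of_notMem hx u⟩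
  · obtain ⟨p, hp, h⟩ := hu.1.2 t ht
    refine ⟨p, hp, fun x hx => ?_⟩
    rw [hE x ?_, h x hx]
    rw [← M.P.2.1]
    exact mem_biUnion ht hx
  · rw [hE x hx.1, hu.2 x hx]

theorem dual_id (M : Msh Ω T h c r) {v φ u : E3 → ℝ} (H : VS Ω (Ω.indicator v) φ) (hu : MemSh0 Ω T r u)
    (ho : ∀ χ : E3 → ℝ, MemSh0 Ω T r χ → ∫ x in Ω, ⟪gradient (fun y => v y - u y) x, gradient χ x⟫ = 0) :
    ∃ g w, Ritz Ω T r h g w ∧ ∫ x in Lam Ω h, ‖gradient (fun y => v y - u y) x‖ =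
      ∫ x in Ω, ⟪gradient (Ω.indicator v) x, g x - gradient w x⟫ := by
  have hD := M.D
  set e : E3 → ℝ := fun y => v y - u y with he
  set g : E3 → E3 := (Lam Ω h).indicator fun x => ‖gradient e x‖⁻¹ • gradient e x with hg
  have gm : Measurable g := ((measurable_gradient e).norm.inv.smul (measurable_gradient e)).indicator (Lam_meas hD h)
  have gb : ∀ x, ‖g x‖ ≤ 1 := fun x => by
    by_cases hx : x ∈ Lam Ω h
    · rw [hg, indicator_of_mem hx, norm_smul, norm_inv, norm_norm]
      exact inv_mul_le_one
    · rw [hg, indicator_of_notMem hx]; simp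
  have gz : ∀ x, x ∉ Lam Ω h → g x = 0 := fun x hx => indicator_of_notMem hx _
  obtain ⟨w, hw, hwo⟩ := M.exists_ritz (G := g) ⟨gm, 1, fun x _ => gb x⟩
  have W : Ritz Ω T r h g w := ⟨gm, gb, gz, hw, hwo⟩
  refine ⟨g, w, W, ?_⟩
  have hF := FE.of M hu
  have hL := hF.LO M
  have hwL := hw.LO M
  have hd : ∀ᵐ x, x ∈ Ω → gradient e x = gradient (Ω.indicator v) x - gradient (Ω.indicator u) x := by
    filter_upwards [hL.ae] with x hx hxΩ
    rw [← gradient_sub' (H.da hD hxΩ) hx]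
    exact gradient_congr hD.op (fun y hy => by simp [he, hy]) hxΩ
  have hk : ∀ x, ⟪gradient e x, g x⟫ = (Lam Ω h).indicator (fun x => ‖gradient e x‖) x := fun x => by
    by_cases hx : x ∈ Lam Ω h
    · rw [hg, indicator_of_mem hx, indicator_of_mem hx, real_inner_smul_right, real_inner_self_eq_norm_sq]
      by_cases h0 : ‖gradient e x‖ = 0
      · rw [h0]; simp
      · field_simp
    · rw [hg, indicator_of_notMem hx, indicator_of_notMem hx, inner_zero_right]
  have mV := measurable_gradient (Ω.indicator v)
  have bU := hL.gbm
  have bg := W.bm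
  have bw := hwL.gbm
  have bgw : BM Ω (fun x => g x - gradient w x) := bg.sub bw
  have iV : ∀ {G : E3 → E3}, BM Ω G → IntegrableOn (fun x => ⟪gradient (Ω.indicator v) x, G x⟫) Ω :=
    fun hG => (l2_inner mV hG.1 H.gi (hG.nsq.integrableOn hD)).1
  have iU : ∀ {G : E3 → E3}, BM Ω G → IntegrableOn (fun x => ⟪gradient (Ω.indicator u) x, G x⟫) Ω :=
    fun hG => (bU.inner hG).integrableOn hD
  have key : ∀ {G : E3 → E3}, BM Ω G → ∫ x in Ω, ⟪gradient e x, G x⟫ =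
      (∫ x in Ω, ⟪gradient (Ω.indicator v) x, G x⟫) - ∫ x in Ω, ⟪gradient (Ω.indicator u) x, G x⟫ := by
    intro G hG
    rw [← integral_sub (iV hG) (iU hG)]
    refine setIntegral_congr_ae hD.meas ?_
    filter_upwards [hd] with x hx hxΩ
    rw [hx hxΩ, inner_sub_left]
  have e1 : ∫ x in Lam Ω h, ‖gradient e x‖ = ∫ x in Ω, ⟪gradient e x, g x⟫ := by
    simp only [hk]
    rw [setIntegral_indicator (Lam_meas hD h), inter_eq_self_of_subset_right (Lam_sub h)]
  have e2 := ho w hw.1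
  rw [key bw] at e2
  have e3 := W.orth _ hF
  have e4 : ∫ x in Ω, ⟪gradient (Ω.indicator u) x, g x⟫ = ∫ x in Ω, ⟪gradient (Ω.indicator u) x, gradient w x⟫ := by
    simp only [real_inner_comm _ (gradient (Ω.indicator u) _)]
    exact e3.symm
  have e5 : ∫ x in Ω, ⟪gradient (Ω.indicator v) x, g x - gradient w x⟫ =
      (∫ x in Ω, ⟪gradient (Ω.indicator v) x, g x⟫) - ∫ x in Ω, ⟪gradient (Ω.indicator v) x, gradient w x⟫ := by
    rw [← integral_sub (iV bg) (iV bw)]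
    simp only [inner_sub_right]
  rw [e1, key bg, e5]
  linarith

end final

/-- **Main technical estimate: the boundary-strip gradient bound (estimate (3.10)/(4.17)).** -/
theorem boundary_strip_gradient_bound
    (Ω : Set E3) (hΩ : IsConvexPolyhedron Ω)
    (c : ℝ) (hc : 0 < c) (r : ℕ) (hr : 1 ≤ r) :
    ∃ C h₀ : ℝ, 0 < C ∧ 0 < h₀ ∧
      ∀ h : ℝ, 0 < h → h ≤ h₀ → ∀ T : Finset (Fin 4 → E3), IsTetPartition Ω T h c →
      ∀ x₀ ∈ closure Ω, ∀ ρ : ℝ, h ≤ ρ → ρ ≤ Metric.diam Ω →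
      ∀ φ : E3 → ℝ, ContDiff ℝ (⊤ : ℕ∞) φ → HasCompactSupport φ →
        tsupport φ ⊆ Ω ∩ Metric.ball x₀ ρ →
        (∫ x in Ω, |φ x| ^ 2) ^ ((1 : ℝ) / 2) ≤ 1 →
      ∀ v : E3 → ℝ, ContinuousOn v (closure Ω) → (∀ x ∈ frontier Ω, v x = 0) →
        ContDiffOn ℝ (⊤ : ℕ∞) v Ω → (∀ x ∈ Ω, lap v x = -φ x) →
        IntegrableOn (fun x => ‖gradient v x‖ ^ 2) Ω volume →
      ∀ v_h : E3 → ℝ, MemSh0 Ω T r v_h →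
        (∀ χ : E3 → ℝ, MemSh0 Ω T r χ →
          ∫ x in Ω, ⟪gradient (fun y => v y - v_h y) x, gradient χ x⟫ = 0) →
        (∫ x in {x ∈ Ω | Metric.infDist x (frontier Ω) ≤ h},
            ‖gradient (fun y => v y - v_h y) x‖)
          ≤ C * ρ ^ ((3 : ℝ) / 2) * h := by
  have hD : Dom Ω := ⟨hΩ.1, hΩ.2.1, hΩ.2.2.1⟩
  rcases Ω.eq_empty_or_nonempty with h0 | ⟨z0, hz0⟩
  · refine ⟨1, 1, one_pos, one_pos, ?_⟩
    intro h _ _ T _ x₀ hx₀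
    rw [h0] at hx₀
    simp at hx₀
  obtain ⟨ε, hε, hb⟩ := Metric.isOpen_iff.1 hD.op z0 hz0
  have G : Geo Ω z0 (ε / 3) (Metric.diam Ω) := ⟨hD, by positivity, by
    rw [show 3 * (ε / 3) = ε by ring]; exact hb, fun x hx y hy => by
    rw [← dist_eq_norm]; exact dist_le_diam_of_mem hD.bd hx hy⟩
  obtain ⟨C, hC, HC⟩ := G.dual hc r
  refine ⟨√C, ε / 3 / 4, Real.sqrt_pos.2 hC, by positivity, ?_⟩
  intro h hh hh0 T hT x₀ hx₀ ρ hρ hρd φ hφ _ hφs hφ1 v hv hv0 hvd hvl hvi u hu ho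
  have M : Msh Ω T h c r := ⟨hD, hT, hh, hc, hr⟩
  have hφC : CU Ω φ := ⟨hφ.of_le (by exact_mod_cast le_top), hφs.trans inter_subset_left⟩
  have H := VS.of hD hv hv0 hvd hvl hvi ((hφC.lo hD).bm hD)
  have h1 : ∫ x in Ω, φ x ^ 2 ≤ 1 := by
    simp only [sq_abs] at hφ1
    rw [← Real.sqrt_eq_rpow, Real.sqrt_le_one] at hφ1
    exact hφ1
  obtain ⟨g, w, W, e⟩ := dual_id M H hu ho
  have := HC M W (by linarith) hx₀ hρ hρd H hφC (hφs.trans inter_subset_right) h1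
  rw [← e] at this
  have hρ0 : 0 ≤ ρ := by linarith
  change ∫ x in Lam Ω h, _ ≤ _
  refine abs_le_of_sq_le_sq' ?_ (by positivity) |>.2
  refine this.trans (le_of_eq ?_)
  have e1 : (ρ ^ ((3 : ℝ) / 2)) ^ 2 = ρ ^ 3 := by
    rw [← Real.rpow_natCast, ← Real.rpow_mul hρ0, ← Real.rpow_natCast]
    norm_num
  rw [mul_pow, mul_pow, e1, Real.sq_sqrt hC.le]
  ring
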